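/- Let k ≥ 1 and let S(X, k; 3, 4) = Σ 2^{k·rk₄ Cl⁺(8d)}, where the sum is over squarefree integers d with d ≡ 3 (mod 4), 1 < 2d ≤ X, and every prime p dividing d satisfying (2/p) = 1. Let A(X; 3, 4) denote the number of such d. Then for every ε > 0, S(X, k; 3, 4) = A(X; 3, 4)·2^{1 − 2^k}·Σ_U γ⁺(U, 1) + O_ε( X·(log X)^{−1/2 − 1/2^{k+1} + ε} ), where the sum is over all maximal unlinked subsets U of 𝔽₂^{2k} and γ⁺(U, 1) is defined as follows: with λ_k(u) = Σ_{j=0}^{k−1} u_{2j+1}·u_{2j+2} and Φ_k(u, v) = Σ_{j=0}^{k−1} (u_{2j+1} + v_{2j+1})·(u_{2j+1} + v_{2j+2}) in 𝔽₂, u and v are unlinked if Φ_k(u, v) = Φ_k(v, u), a maximal unlinked subset is a subset of 𝔽₂^{2k} that is pairwise unlinked and maximal with respect to inclusion, and γ⁺(U, 1) = Σ_{S ⊆ U, |S| odd} (−1)^{Σ_{u ∈ S} λ_k(u) + Σ_{{u,v} ⊆ S, u ≠ v} Φ_k(u, v)}. -/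

import Mathlib

open NumberField IntermediateField
open scoped nonZeroDivisors

/-- The subgroup of invertible fractional ideals generated by principal fractional ideals
with a totally positive generator. -/
def narrowPrincipals (F : Type*) [Field F] :
    Subgroup (FractionalIdeal (𝓞 F)⁰ F)ˣ :=
  Subgroup.closure {I | ∃ x : F, (∀ φ : F →+* ℝ, 0 < φ x) ∧
    ((I : FractionalIdeal (𝓞 F)⁰ F) : Submodule (𝓞 F) F) = Submodule.span (𝓞 F) {x}}

/-- The narrow class group: nonzero fractional ideals modulo principal fractional ideals
generated by totally positive elements. -/
abbrev NarrowClassGroup (F : Type*) [Field F] :=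
  (FractionalIdeal (𝓞 F)⁰ F)ˣ ⧸ narrowPrincipals F

/-- `ℚ(√n)` as a subfield of `ℂ`. -/
noncomputable def quadField (n : ℕ) : IntermediateField ℚ ℂ := ℚ⟮(Real.sqrt n : ℂ)⟯

open scoped Classical

/-- `|G²/G⁴|`, i.e. `2^{rk₄ G}` where `rk₄` is the 4-rank of `G`. -/
noncomputable def fourRankPow (G : Type*) [CommGroup G] : ℕ :=
  Nat.card ((powMonoidHom 2 : G →* G).range ⧸
    ((powMonoidHom 4 : G →* G).range.subgroupOf (powMonoidHom 2 : G →* G).range))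

/-- `λ_k(u) = Σ_{j=0}^{k-1} u_{2j+1}·u_{2j+2} ∈ 𝔽₂` (coordinates indexed by `Fin (2k)`). -/
def lambdaK {k : ℕ} (u : Fin (2 * k) → ZMod 2) : ZMod 2 :=
  ∑ j : Fin k,
    u ⟨2 * j.1, by have := j.2; omega⟩ * u ⟨2 * j.1 + 1, by have := j.2; omega⟩

/-- `Φ_k(u,v) = Σ_{j=0}^{k-1} (u_{2j+1} + v_{2j+1})·(u_{2j+1} + v_{2j+2}) ∈ 𝔽₂`. -/
def phiK {k : ℕ} (u v : Fin (2 * k) → ZMod 2) : ZMod 2 :=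
  ∑ j : Fin k,
    (u ⟨2 * j.1, by have := j.2; omega⟩ + v ⟨2 * j.1, by have := j.2; omega⟩) *
      (u ⟨2 * j.1, by have := j.2; omega⟩ + v ⟨2 * j.1 + 1, by have := j.2; omega⟩)

/-- `u` and `v` are unlinked if `Φ_k(u,v) = Φ_k(v,u)`. -/
def Unlinked {k : ℕ} (u v : Fin (2 * k) → ZMod 2) : Prop := phiK u v = phiK v u

/-- A maximal unlinked subset of `𝔽₂^{2k}`: pairwise unlinked and maximal with respect
to inclusion among unlinked subsets. -/
def IsMaxUnlinked {k : ℕ} (U : Finset (Fin (2 * k) → ZMod 2)) : Prop :=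
  (∀ u ∈ U, ∀ v ∈ U, Unlinked u v) ∧
    ∀ U' : Finset (Fin (2 * k) → ZMod 2),
      (∀ u ∈ U', ∀ v ∈ U', Unlinked u v) → U ⊆ U' → U' = U

/-- An explicit injective encoding of `𝔽₂^{2k}` into `ℕ`, used to enumerate each
unordered pair of distinct elements exactly once. -/
def encV {k : ℕ} (v : Fin (2 * k) → ZMod 2) : ℕ := ∑ i, (v i).val * 2 ^ (i : ℕ)

/-- `e⁺(S) = Σ_{u ∈ S} λ_k(u) + Σ_{{u,v} ⊆ S, u ≠ v} Φ_k(u,v) ∈ 𝔽₂`, the second sum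
over unordered pairs of distinct elements of `S`. -/
def ePlus {k : ℕ} (S : Finset (Fin (2 * k) → ZMod 2)) : ZMod 2 :=
  ∑ u ∈ S, lambdaK u +
    ∑ p ∈ (S ×ˢ S).filter (fun p => encV p.1 < encV p.2), phiK p.1 p.2

/-- `γ⁺(U, 1) = Σ_{S ⊆ U, |S| odd} (-1)^{e⁺(S)}`. -/
def gammaPlus {k : ℕ} (U : Finset (Fin (2 * k) → ZMod 2)) : ℤ :=
  ∑ S ∈ U.powerset.filter (fun S => Odd S.card), if ePlus S = 0 then 1 else -1

/-- The condition on `d`: squarefree, `d ≡ 3 (mod 4)`, `1 < 2d ≤ X`, and every prime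
`p ∣ d` satisfies `(2/p) = 1`. -/
def dCond (X : ℝ) (d : ℕ) : Prop :=
  Squarefree d ∧ d % 4 = 3 ∧ 1 < 2 * d ∧ (2 * d : ℝ) ≤ X ∧
    ∀ p : ℕ, p.Prime → p ∣ d → jacobiSym 2 p = 1

/-- `S(X, k; 3, 4) = Σ_d 2^{k·rk₄ Cl⁺(8d)}`, over squarefree `d ≡ 3 (mod 4)` with
`1 < 2d ≤ X` and `(2/p) = 1` for all primes `p ∣ d`. -/
noncomputable def Scount (k : ℕ) (X : ℝ) : ℝ :=
  ∑ d ∈ Finset.range (⌊X⌋₊ + 1),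
    if dCond X d then (fourRankPow (NarrowClassGroup (quadField (2 * d))) : ℝ) ^ k else 0

/-- `A(X; 3, 4)`: the number of `d` as above. -/
noncomputable def Acount34 (X : ℝ) : ℝ :=
  ∑ d ∈ Finset.range (⌊X⌋₊ + 1), if dCond X d then 1 else 0

/-- A completely multiplicative, periodic, nonprincipal real sign function. -/
structure NPC (q : ℕ) (ψ : ℕ → ℤ) : Prop where
  pos : 0 < q
  per : ∀ n, ψ (n + q) = ψ n
  mul : ∀ m n, ψ (m * n) = ψ m * ψ n
  one : ψ 1 = 1
  zero : ψ 0 = 0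
  bd : ∀ n, |ψ n| ≤ 1
  ex : ∃ a, a.Coprime q ∧ ψ a = -1

theorem NPC.mod {q : ℕ} {ψ : ℕ → ℤ} (h : NPC q ψ) (n : ℕ) : ψ (n % q) = ψ n := by
  have : ∀ j r, ψ (r + q * j) = ψ r := by
    intro j; induction j with
    | zero => simp
    | succ j ih => intro r; rw [Nat.mul_succ, ← add_assoc, h.per, ih]
  conv_rhs => rw [← Nat.mod_add_div n q]
  rw [this]

theorem NPC.sum_period {q : ℕ} {ψ : ℕ → ℤ} (h : NPC q ψ) :
    ∑ i ∈ Finset.range q, ψ i = 0 := by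
  obtain ⟨a, ha, hψ⟩ := h.ex
  have : NeZero q := ⟨h.pos.ne'⟩
  have h1 : ∑ i ∈ Finset.range q, ψ i = ∑ x : ZMod q, ψ x.val := by
    refine (Finset.sum_bij (fun (x : ZMod q) _ => x.val) ?_ ?_ ?_ ?_).symm
    · intro x _; simpa using ZMod.val_lt x
    · intro x _ y _ hxy; exact ZMod.val_injective q hxy
    · intro b hb; exact ⟨(b : ZMod q), Finset.mem_univ _, ZMod.val_cast_of_lt (by simpa using hb)⟩
    · intros; rfl
  have h2 : ∑ x : ZMod q, ψ x.val = ∑ x : ZMod q, ψ (((ZMod.unitOfCoprime a ha : (ZMod q)ˣ) : ZMod q) * x).val :=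
    (Equiv.sum_comp (Units.mulLeft (ZMod.unitOfCoprime a ha)) (fun x : ZMod q => ψ x.val)).symm
  have h3 : ∀ x : ZMod q, ψ (((ZMod.unitOfCoprime a ha : (ZMod q)ˣ) : ZMod q) * x).val = - ψ x.val := by
    intro x
    rw [ZMod.val_mul, h.mod, h.mul, ZMod.coe_unitOfCoprime, ZMod.val_natCast, h.mod, hψ]; ring
  rw [h1]
  have h4 := h2
  simp only [h3, Finset.sum_neg_distrib] at h4
  omega

theorem NPC.sum_range_le {q : ℕ} {ψ : ℕ → ℤ} (h : NPC q ψ) (L : ℕ) :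
    |∑ i ∈ Finset.range L, ψ i| ≤ q := by
  induction L using Nat.strong_induction_on with
  | _ L ih =>
    by_cases hL : L < q
    · calc |∑ i ∈ Finset.range L, ψ i| ≤ ∑ i ∈ Finset.range L, |ψ i| := Finset.abs_sum_le_sum_abs _ _
        _ ≤ ∑ i ∈ Finset.range L, 1 := Finset.sum_le_sum fun i _ => h.bd i
        _ ≤ q := by simp; omega
    · obtain ⟨t, rfl⟩ := Nat.exists_eq_add_of_le (not_lt.mp hL)
      rw [Finset.sum_range_add, h.sum_period, zero_add]
      have : ∀ i, ψ (q + i) = ψ i := fun i => by rw [add_comm, h.per]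
      simp only [this]
      exact ih t (by have := h.pos; omega)

theorem NPC.sum_Icc_le {q : ℕ} {ψ : ℕ → ℤ} (h : NPC q ψ) (L : ℕ) :
    |∑ i ∈ Finset.Icc 1 L, ψ i| ≤ q := by
  have h1 := h.sum_range_le (L + 1)
  rw [Finset.sum_range_succ'] at h1
  rw [h.zero, add_zero] at h1
  have : ∑ i ∈ Finset.Icc 1 L, ψ i = ∑ i ∈ Finset.range L, ψ (i + 1) := by
    rw [Finset.range_eq_Ico, Finset.sum_Ico_add' (fun i => ψ i) 0 L 1]
    rfl
  rw [this]; exact h1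

/-- Sign functions of period 8. -/
structure Sgn8 (θ : ℕ → ℤ) : Prop where
  per : ∀ n, θ (n + 8) = θ n
  mul : ∀ m n, θ (m * n) = θ m * θ n
  one : θ 1 = 1
  bd : ∀ n, |θ n| ≤ 1

theorem jac_abs_le (a : ℤ) (b : ℕ) : |jacobiSym a b| ≤ 1 := by
  rcases jacobiSym.trichotomy a b with h | h | h <;> rw [h] <;> norm_num

theorem npc_jac {p m' : ℕ} (hp : p.Prime) (hp2 : p ≠ 2) (hm' : Odd m') (hpm : ¬ p ∣ m')
    {θ : ℕ → ℤ} (hθ : Sgn8 θ) :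
    NPC (8 * (p * m')) (fun n => jacobiSym n (p * m') * θ n) := by
  have : Fact p.Prime := ⟨hp⟩
  have hm0 : m' ≠ 0 := by rintro rfl; simp at hm'
  have perθ : ∀ j r, θ (r + 8 * j) = θ r := by
    intro j; induction j with
    | zero => simp
    | succ j ih => intro r; rw [Nat.mul_succ, ← add_assoc, hθ.per, ih]
  have : NeZero m' := ⟨hm0⟩
  refine ⟨?_, ?_, ?_, ?_, ?_, ?_, ?_⟩
  · have := hp.pos; positivity
  · intro n
    simp only [perθ]
    congr 1
    rw [jacobiSym.mod_left, jacobiSym.mod_left (n : ℤ)]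
    congr 1
    push_cast
    rw [show (8 : ℤ) * (p * m') = (p * m' : ℤ) * 8 by ring]
    simp
  · intro a b
    simp only [hθ.mul]; push_cast; rw [jacobiSym.mul_left]; ring
  · simp [hθ.one]
  · have : jacobiSym ((0 : ℕ) : ℤ) (p * m') = 0 := by
      rw [Nat.cast_zero]
      apply jacobiSym.zero_left
      calc 1 < p := hp.one_lt
        _ = p * 1 := by ring
        _ ≤ p * m' := Nat.mul_le_mul_left _ (Nat.pos_of_ne_zero hm0)
    simp only [this, zero_mul]
  · intro n
    rw [abs_mul]
    calc _ ≤ (1 : ℤ) * 1 := mul_le_mul (jac_abs_le _ _) (hθ.bd _) (abs_nonneg _) (by norm_num)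
      _ = 1 := by norm_num
  · -- existence
    obtain ⟨c, hc⟩ := FiniteField.exists_nonsquare (F := ZMod p) (by rwa [ZMod.ringChar_zmod_n])
    have hcop : Nat.Coprime p (8 * m') := by
      rw [Nat.coprime_mul_iff_right]
      refine ⟨?_, (Nat.Prime.coprime_iff_not_dvd hp).2 hpm⟩
      rw [show 8 = 2 ^ 3 by norm_num]
      exact Nat.Coprime.pow_right 3 ((Nat.coprime_primes hp Nat.prime_two).2 hp2)
    obtain ⟨a, ha1, ha2⟩ := Nat.chineseRemainder hcop c.val 1
    have ha1' : (a : ZMod p) = c := by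
      have := (ZMod.natCast_eq_natCast_iff _ _ _).2 ha1
      rw [this, ZMod.natCast_val, ZMod.cast_id]
    have hac : a.Coprime (8 * m') := by
      have := ha2.gcd_eq
      simpa [Nat.Coprime] using this
    have hj1 : jacobiSym a p = -1 := by
      rw [← jacobiSym.legendreSym.to_jacobiSym, legendreSym.eq_neg_one_iff]
      push_cast; rw [ha1']; exact hc
    have hap : a.Coprime p := by
      rw [Nat.coprime_comm, Nat.Prime.coprime_iff_not_dvd hp]
      intro hd
      have : (a : ZMod p) = 0 := (ZMod.natCast_eq_zero_iff _ _).2 hd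
      rw [ha1'] at this
      exact hc (this ▸ IsSquare.zero)
    have hj2 : jacobiSym a m' = 1 := by
      rw [jacobiSym.mod_left]
      have h3 : a ≡ 1 [MOD m'] := ha2.of_dvd (Dvd.intro_left 8 rfl)
      have : (a : ℤ) % m' = 1 % m' := by exact_mod_cast h3
      rw [this, ← jacobiSym.mod_left]; simp
    have hθa : θ a = 1 := by
      have h3 : a % 8 = 1 := by
        have : a ≡ 1 [MOD 8] := ha2.of_dvd (Dvd.intro m' rfl)
        simpa [Nat.ModEq] using this
      rw [← Nat.mod_add_div a 8, perθ, h3, hθ.one]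
    refine ⟨a, ?_, ?_⟩
    · rw [show 8 * (p * m') = p * (8 * m') by ring]
      exact Nat.Coprime.mul_right hap hac
    · have : NeZero p := ⟨hp.ne_zero⟩
      rw [jacobiSym.mul_right, hj1, hj2, hθa]; norm_num

theorem Sgn8.const : Sgn8 (fun _ => 1) := ⟨by simp, by simp, rfl, by simp⟩

theorem npc_jac_pair {m₁ m₂ : ℕ} (h1 : Odd m₁) (h2 : Odd m₂) (s1 : Squarefree m₁)
    (s2 : Squarefree m₂) (hne : m₁ ≠ m₂) :
    NPC (8 * (m₁ * m₂)) (fun n => jacobiSym n m₁ * jacobiSym n m₂) := by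
  have : NeZero m₁ := ⟨s1.ne_zero⟩
  have : NeZero m₂ := ⟨s2.ne_zero⟩
  have key : ∀ a b p : ℕ, Odd a → Odd b → Squarefree a → p.Prime → p ∣ a → ¬ p ∣ b →
      NPC (8 * (a * b)) (fun n => jacobiSym n (a * b)) := by
    intro a b p ha hb sa hp hpa hpb
    obtain ⟨c, rfl⟩ := hpa
    have hpc : ¬ p ∣ c := fun h => by
      have := (Nat.squarefree_mul_iff.1 sa).1
      exact hp.one_lt.ne' (Nat.Coprime.eq_one_of_dvd this h)
    have hodd := Nat.odd_mul.1 ha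
    have := npc_jac (m' := c * b) hp (by rintro rfl; exact absurd hodd.1 (by decide)) (hodd.2.mul hb)
      (fun h => (hp.dvd_mul.1 h).elim hpc hpb) Sgn8.const
    simpa [mul_assoc] using this
  have hex : ∃ p, p.Prime ∧ ¬ (p ∣ m₁ ↔ p ∣ m₂) := by
    by_contra hcon
    push Not at hcon
    exact hne ((Nat.Squarefree.ext_iff s1 s2).2 hcon)
  obtain ⟨p, hp, hpp⟩ := hex
  have hfun : (fun n : ℕ => jacobiSym n m₁ * jacobiSym n m₂) = fun n : ℕ => jacobiSym n (m₁ * m₂) := by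
    funext n; rw [jacobiSym.mul_right]
  rw [hfun]
  by_cases hd : p ∣ m₁
  · exact key m₁ m₂ p h1 h2 s1 hp hd (by tauto)
  · have := key m₂ m₁ p h2 h1 s2 hp (by tauto) hd
    rwa [mul_comm m₁ m₂]

/-- Harmonic sum. -/
noncomputable def harm (L : ℕ) : ℝ := ∑ l ∈ Finset.Icc 1 L, (1 : ℝ) / l

theorem tau_submul (a b : ℕ) : (a * b).divisors.card ≤ a.divisors.card * b.divisors.card := by
  rw [Nat.divisors_mul]; exact Finset.card_mul_le

theorem tau_mom (j L : ℕ) :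
    ∑ l ∈ Finset.Icc 1 L, ((l.divisors.card : ℝ) ^ j / l) ≤ harm L ^ (2 ^ j) := by
  induction j with
  | zero => simp [harm]
  | succ j ih =>
    have h0 : 0 ≤ ∑ l ∈ Finset.Icc 1 L, ((l.divisors.card : ℝ) ^ j / l) :=
      Finset.sum_nonneg fun _ _ => by positivity
    calc ∑ l ∈ Finset.Icc 1 L, ((l.divisors.card : ℝ) ^ (j + 1) / l)
        = ∑ l ∈ Finset.Icc 1 L, ∑ x ∈ l.divisorsAntidiagonal,
            (((x.1 * x.2).divisors.card : ℝ) ^ j / ((x.1 : ℝ) * x.2)) := by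
          refine Finset.sum_congr rfl fun l _ => ?_
          have : ∀ x ∈ l.divisorsAntidiagonal,
              (((x.1 * x.2).divisors.card : ℝ) ^ j / ((x.1 : ℝ) * x.2)) = (l.divisors.card : ℝ) ^ j / l := by
            intro x hx
            have := (Nat.mem_divisorsAntidiagonal.1 hx).1
            rw [← Nat.cast_mul, this]
          rw [Finset.sum_congr rfl this, Finset.sum_const, nsmul_eq_mul,
            ← Nat.map_div_right_divisors, Finset.card_map]
          rw [pow_succ]; ring
      _ = ∑ y ∈ (Finset.Icc 1 L).sigma (fun l => l.divisorsAntidiagonal),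
            (((y.2.1 * y.2.2).divisors.card : ℝ) ^ j / ((y.2.1 : ℝ) * y.2.2)) := by
          rw [Finset.sum_sigma]
      _ = ∑ x ∈ ((Finset.Icc 1 L).sigma (fun l => l.divisorsAntidiagonal)).image (fun y => y.2),
            (((x.1 * x.2).divisors.card : ℝ) ^ j / ((x.1 : ℝ) * x.2)) := by
          rw [Finset.sum_image]
          rintro ⟨l, x⟩ hx ⟨l', x'⟩ hx' h
          simp only [Finset.mem_coe, Finset.mem_sigma, Nat.mem_divisorsAntidiagonal] at hx hx' h
          subst h
          have : l = l' := hx.2.1.symm.trans hx'.2.1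
          subst this; rfl
      _ ≤ ∑ x ∈ Finset.Icc 1 L ×ˢ Finset.Icc 1 L,
            (((x.1 * x.2).divisors.card : ℝ) ^ j / ((x.1 : ℝ) * x.2)) := by
          refine Finset.sum_le_sum_of_subset_of_nonneg ?_ fun _ _ _ => by positivity
          intro x hx
          simp only [Finset.mem_image, Finset.mem_sigma, Nat.mem_divisorsAntidiagonal, Finset.mem_Icc] at hx
          obtain ⟨⟨l, y⟩, ⟨⟨hl, hL⟩, hy, hne⟩, rfl⟩ := hx
          simp only at hy hL hl
          have h1 : y.1 ≠ 0 := by intro h; rw [h] at hy; omega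
          have h2 : y.2 ≠ 0 := by intro h; rw [h] at hy; omega
          have h3 : y.1 ≤ l := Nat.le_of_dvd (by omega) ⟨y.2, hy.symm⟩
          have h4 : y.2 ≤ l := Nat.le_of_dvd (by omega) ⟨y.1, by rw [mul_comm]; exact hy.symm⟩
          simp only [Finset.mem_product, Finset.mem_Icc]; omega
      _ ≤ ∑ x ∈ Finset.Icc 1 L ×ˢ Finset.Icc 1 L,
            ((x.1.divisors.card : ℝ) ^ j / x.1) * ((x.2.divisors.card : ℝ) ^ j / x.2) := by
          refine Finset.sum_le_sum fun x _ => ?_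
          rw [div_mul_div_comm, ← mul_pow]
          gcongr
          exact_mod_cast tau_submul _ _
      _ = (∑ l ∈ Finset.Icc 1 L, ((l.divisors.card : ℝ) ^ j / l)) ^ 2 := by
          rw [sq, Finset.sum_mul_sum, Finset.sum_product]
      _ ≤ (harm L ^ (2 ^ j)) ^ 2 := by gcongr
      _ = harm L ^ (2 ^ (j + 1)) := by rw [← pow_mul, pow_succ]

theorem tau_mom' (j L : ℕ) :
    ∑ l ∈ Finset.Icc 1 L, ((l.divisors.card : ℝ) ^ j) ≤ L * harm L ^ (2 ^ j) := by
  calc _ ≤ ∑ l ∈ Finset.Icc 1 L, (L : ℝ) * ((l.divisors.card : ℝ) ^ j / l) := by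
        refine Finset.sum_le_sum fun l hl => ?_
        have h := Finset.mem_Icc.1 hl
        have h1 : (0 : ℝ) < l := by exact_mod_cast h.1
        have h2 : (l : ℝ) ≤ L := by exact_mod_cast h.2
        rw [← mul_div_assoc, le_div_iff₀ h1, mul_comm]
        gcongr
    _ = L * ∑ l ∈ Finset.Icc 1 L, ((l.divisors.card : ℝ) ^ j / l) := by rw [Finset.mul_sum]
    _ ≤ _ := by gcongr; exact tau_mom j L

/-- the product of a quadruple -/
def qprod (q : (ℕ × ℕ) × (ℕ × ℕ)) : ℕ := q.1.1 * q.1.2 * (q.2.1 * q.2.2)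

/-- box of quadruples -/
def qbox (N : ℕ) : Finset ((ℕ × ℕ) × (ℕ × ℕ)) :=
  (Finset.Icc 1 N ×ˢ Finset.Icc 1 N) ×ˢ (Finset.Icc 1 N ×ˢ Finset.Icc 1 N)

theorem qbox_fiber_card (N l : ℕ) :
    ((qbox N).filter (fun q => qprod q = l)).card ≤ l.divisors.card ^ 3 := by
  have : ((qbox N).filter (fun q => qprod q = l)).card ≤
      (l.divisors ×ˢ (l.divisors ×ˢ l.divisors)).card := by
    refine Finset.card_le_card_of_injOn (fun q => (q.1.1, q.1.2, q.2.1)) ?_ ?_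
    · intro q hq
      simp only [Finset.coe_filter, qbox, Finset.mem_product, Finset.mem_Icc, Set.mem_setOf_eq] at hq
      obtain ⟨⟨⟨h1, h2⟩, ⟨h3, h4⟩⟩, h⟩ := hq
      have hl : l ≠ 0 := by
        rw [← h]; unfold qprod
        exact Nat.mul_ne_zero (Nat.mul_ne_zero (by omega) (by omega)) (Nat.mul_ne_zero (by omega) (by omega))
      simp only [Finset.coe_product, Set.mem_prod, Finset.mem_coe, Nat.mem_divisors]
      refine ⟨⟨?_, hl⟩, ⟨?_, hl⟩, ⟨?_, hl⟩⟩
      · rw [← h]; exact ⟨q.1.2 * (q.2.1 * q.2.2), by unfold qprod; ring⟩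
      · rw [← h]; exact ⟨q.1.1 * (q.2.1 * q.2.2), by unfold qprod; ring⟩
      · rw [← h]; exact ⟨q.1.1 * q.1.2 * q.2.2, by unfold qprod; ring⟩
    · rintro ⟨⟨a, b⟩, ⟨c, e⟩⟩ hq ⟨⟨a', b'⟩, ⟨c', e'⟩⟩ hq' heq
      rw [Finset.mem_coe, Finset.mem_filter] at hq hq'
      simp only [qbox, Finset.mem_product, Finset.mem_Icc, qprod] at hq hq'
      simp only [Prod.mk.injEq] at heq
      obtain ⟨rfl, rfl, rfl⟩ := heq
      have h := hq.2.trans hq'.2.symm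
      have hab : 0 < a * b := Nat.mul_pos (by omega) (by omega)
      have h2 := Nat.eq_of_mul_eq_mul_left hab h
      have h3 := Nat.eq_of_mul_eq_mul_left (by omega) h2
      rw [h3]
  calc _ ≤ _ := this
    _ = _ := by simp [Finset.card_product]; ring

theorem pow4_expand (N : ℕ) (x : ℕ → ℝ) :
    (∑ n ∈ Finset.Icc 1 N, x n) ^ 4 =
      ∑ q ∈ qbox N, (x q.1.1 * x q.1.2) * (x q.2.1 * x q.2.2) := by
  unfold qbox
  rw [Finset.sum_product]
  simp_rw [← Finset.mul_sum]
  rw [← Finset.sum_mul, Finset.sum_product]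
  simp_rw [← Finset.mul_sum]
  rw [← Finset.sum_mul]
  ring

/-- odd squarefree numbers up to `M` -/
noncomputable def osq (M : ℕ) : Finset ℕ := (Finset.Icc 1 M).filter (fun m => Odd m ∧ Squarefree m)

theorem large_dual (M L : ℕ) :
    ∑ l ∈ Finset.Icc 1 L, (∑ m ∈ osq M, (jacobiSym l m : ℝ)) ^ 2 ≤ M * L + 8 * (M : ℝ) ^ 4 := by
  have h1 : ∑ l ∈ Finset.Icc 1 L, (∑ m ∈ osq M, (jacobiSym l m : ℝ)) ^ 2 =
      ∑ x ∈ osq M ×ˢ osq M, ((∑ l ∈ Finset.Icc 1 L, jacobiSym l x.1 * jacobiSym l x.2 : ℤ) : ℝ) := by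
    simp_rw [sq, Finset.sum_mul_sum]
    rw [Finset.sum_comm, Finset.sum_product]
    refine Finset.sum_congr rfl fun a _ => ?_
    rw [Finset.sum_comm]
    push_cast; rfl
  have hcard : ((osq M).card : ℝ) ≤ M := by
    have : (osq M).card ≤ M := (Finset.card_filter_le _ _).trans (by simp)
    exact_mod_cast this
  rw [h1, ← Finset.sum_filter_add_sum_filter_not _ (fun x => x.1 = x.2)]
  refine add_le_add ?_ ?_
  · calc _ ≤ ∑ x ∈ (osq M ×ˢ osq M).filter (fun x => x.1 = x.2), (L : ℝ) := by
          refine Finset.sum_le_sum fun x _ => ?_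
          have : ∑ l ∈ Finset.Icc 1 L, jacobiSym l x.1 * jacobiSym l x.2 ≤ L := by
            calc _ ≤ ∑ l ∈ Finset.Icc 1 L, (1 : ℤ) := by
                  refine Finset.sum_le_sum fun l _ => ?_
                  refine (le_abs_self _).trans ?_
                  rw [abs_mul]
                  exact mul_le_one₀ (jac_abs_le _ _) (abs_nonneg _) (jac_abs_le _ _)
              _ = L := by simp
          exact_mod_cast this
      _ ≤ M * L := by
          rw [Finset.sum_const, nsmul_eq_mul]
          refine mul_le_mul_of_nonneg_right (le_trans ?_ hcard) (Nat.cast_nonneg _)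
          have : ((osq M ×ˢ osq M).filter (fun x => x.1 = x.2)).card ≤ (osq M).card := by
            refine Finset.card_le_card_of_injOn (fun x => x.1) ?_ ?_
            · intro x hx; simp only [Finset.coe_filter, Finset.mem_product, Set.mem_setOf_eq] at hx
              exact hx.1.1
            · rintro ⟨a, b⟩ hx ⟨c, e⟩ hy h
              simp only [Finset.coe_filter, Set.mem_setOf_eq] at hx hy h
              rw [Prod.mk.injEq]; exact ⟨h, hx.2.symm.trans (h.trans hy.2)⟩
          exact_mod_cast this
  · calc _ ≤ ∑ x ∈ (osq M ×ˢ osq M).filter (fun x => ¬ x.1 = x.2), (8 * (M : ℝ) ^ 2) := by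
          refine Finset.sum_le_sum fun x hx => ?_
          simp only [osq, Finset.mem_filter, Finset.mem_product, Finset.mem_Icc] at hx
          obtain ⟨⟨⟨⟨_, h1⟩, o1, s1⟩, ⟨⟨_, h2⟩, o2, s2⟩⟩, hne⟩ := hx
          have := (npc_jac_pair o1 o2 s1 s2 hne).sum_Icc_le L
          have h3 := (le_abs_self _).trans this
          calc ((∑ l ∈ Finset.Icc 1 L, jacobiSym l x.1 * jacobiSym l x.2 : ℤ) : ℝ)
              ≤ (8 * (x.1 * x.2) : ℝ) := by exact_mod_cast h3
            _ ≤ 8 * ((M : ℝ) * M) := by gcongr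
            _ = _ := by ring
      _ ≤ (M : ℝ) ^ 2 * (8 * (M : ℝ) ^ 2) := by
          rw [Finset.sum_const, nsmul_eq_mul]
          gcongr
          calc _ ≤ ((osq M ×ˢ osq M).card : ℝ) := by exact_mod_cast Finset.card_filter_le _ _
            _ = (osq M).card * (osq M).card := by rw [Finset.card_product]; push_cast; rfl
            _ ≤ (M : ℝ) * M := by gcongr
            _ = _ := by ring
      _ = _ := by ring

theorem box_core (M N : ℕ) (hMN : M ≤ N) (α β : ℕ → ℝ) (hα : ∀ m, |α m| ≤ 1)
    (hβ : ∀ n, |β n| ≤ 1) :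
    (∑ m ∈ osq M, α m * ∑ n ∈ Finset.Icc 1 N, β n * jacobiSym n m) ^ 8 ≤
      9 * (M : ℝ) ^ 7 * (N : ℝ) ^ 8 * harm (N ^ 4) ^ 64 := by
  set T := ∑ m ∈ osq M, α m * ∑ n ∈ Finset.Icc 1 N, β n * jacobiSym n m with hT
  have hcard : ((osq M).card : ℝ) ≤ M := by
    have : (osq M).card ≤ M := (Finset.card_filter_le _ _).trans (by simp)
    exact_mod_cast this
  set I : ℕ → ℝ := fun m => ∑ n ∈ Finset.Icc 1 N, β n * jacobiSym n m with hI
  have hT2 : T ^ 2 ≤ M * ∑ m ∈ osq M, (I m) ^ 2 := by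
    calc T ^ 2 ≤ (osq M).card * ∑ m ∈ osq M, (α m * I m) ^ 2 := sq_sum_le_card_mul_sum_sq
      _ ≤ M * ∑ m ∈ osq M, (I m) ^ 2 := by
        refine mul_le_mul hcard (Finset.sum_le_sum fun m _ => ?_)
          (Finset.sum_nonneg fun _ _ => sq_nonneg _) (Nat.cast_nonneg _)
        rw [mul_pow]
        have : (α m) ^ 2 ≤ 1 := by rw [sq_le_one_iff_abs_le_one]; exact hα m
        nlinarith [sq_nonneg (I m)]
  have hT4 : T ^ 4 ≤ M ^ 3 * ∑ m ∈ osq M, (I m) ^ 4 := by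
    calc T ^ 4 = (T ^ 2) ^ 2 := by ring
      _ ≤ (M * ∑ m ∈ osq M, (I m) ^ 2) ^ 2 := by gcongr
      _ = M ^ 2 * (∑ m ∈ osq M, (I m) ^ 2) ^ 2 := by ring
      _ ≤ M ^ 2 * ((osq M).card * ∑ m ∈ osq M, ((I m) ^ 2) ^ 2) := by
        gcongr; exact sq_sum_le_card_mul_sum_sq
      _ ≤ M ^ 2 * (M * ∑ m ∈ osq M, ((I m) ^ 2) ^ 2) := by gcongr
      _ = _ := by simp_rw [← pow_mul]; ring
  set b : ℕ → ℝ := fun l => ∑ q ∈ (qbox N).filter (fun q => qprod q = l),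
    (β q.1.1 * β q.1.2) * (β q.2.1 * β q.2.2) with hb
  have hbl : ∀ l, |b l| ≤ (l.divisors.card : ℝ) ^ 3 := by
    intro l
    calc |b l| ≤ ∑ q ∈ (qbox N).filter (fun q => qprod q = l), |(β q.1.1 * β q.1.2) * (β q.2.1 * β q.2.2)| :=
          Finset.abs_sum_le_sum_abs _ _
      _ ≤ ∑ q ∈ (qbox N).filter (fun q => qprod q = l), 1 := by
          refine Finset.sum_le_sum fun q _ => ?_
          rw [abs_mul, abs_mul, abs_mul]
          exact mul_le_one₀ (mul_le_one₀ (hβ _) (abs_nonneg _) (hβ _)) (by positivity)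
            (mul_le_one₀ (hβ _) (abs_nonneg _) (hβ _))
      _ ≤ _ := by
          rw [Finset.sum_const, nsmul_eq_mul, mul_one]
          exact_mod_cast qbox_fiber_card N l
  have hI4 : ∀ m, I m ^ 4 = ∑ l ∈ Finset.Icc 1 (N ^ 4), b l * jacobiSym l m := by
    intro m
    rw [hI, pow4_expand]
    rw [← Finset.sum_fiberwise_of_maps_to (s := qbox N) (t := Finset.Icc 1 (N ^ 4)) (g := qprod)]
    · refine Finset.sum_congr rfl fun l _ => ?_
      rw [hb, Finset.sum_mul]
      refine Finset.sum_congr rfl fun q hq => ?_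
      rw [← (Finset.mem_filter.1 hq).2]
      unfold qprod
      push_cast
      rw [jacobiSym.mul_left, jacobiSym.mul_left, jacobiSym.mul_left]
      push_cast; ring
    · intro q hq
      simp only [qbox, Finset.mem_product, Finset.mem_Icc] at hq
      obtain ⟨⟨⟨h1, h1'⟩, h2, h2'⟩, ⟨h3, h3'⟩, h4, h4'⟩ := hq
      rw [Finset.mem_Icc]
      unfold qprod
      refine ⟨Nat.succ_le_of_lt (by positivity), ?_⟩
      calc _ ≤ N * N * (N * N) := by gcongr
        _ = N ^ 4 := by ring
  have hsum : ∑ m ∈ osq M, (I m) ^ 4 =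
      ∑ l ∈ Finset.Icc 1 (N ^ 4), b l * ∑ m ∈ osq M, (jacobiSym l m : ℝ) := by
    simp_rw [hI4, Finset.mul_sum]
    rw [Finset.sum_comm]
  have hCS : (∑ m ∈ osq M, (I m) ^ 4) ^ 2 ≤
      ((N : ℝ) ^ 4 * harm (N ^ 4) ^ 64) * (9 * M * (N : ℝ) ^ 4) := by
    rw [hsum]
    refine (Finset.sum_mul_sq_le_sq_mul_sq _ _ _).trans ?_
    have hh : 0 ≤ harm (N ^ 4) := Finset.sum_nonneg fun _ _ => by positivity
    refine mul_le_mul ?_ ?_ (Finset.sum_nonneg fun _ _ => sq_nonneg _) (by positivity)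
    · calc _ ≤ ∑ l ∈ Finset.Icc 1 (N ^ 4), ((l.divisors.card : ℝ) ^ 6) := by
            refine Finset.sum_le_sum fun l _ => ?_
            rw [← sq_abs]
            calc |b l| ^ 2 ≤ ((l.divisors.card : ℝ) ^ 3) ^ 2 := by gcongr; exact hbl l
              _ = _ := by rw [← pow_mul]
        _ ≤ _ := by
            have := tau_mom' 6 (N ^ 4)
            norm_num at this ⊢; exact this
    · refine (large_dual M (N ^ 4)).trans ?_
      have h1 : (M : ℝ) ≤ N := by exact_mod_cast hMN
      have h2 : (M : ℝ) ^ 4 ≤ (M : ℝ) * (N : ℝ) ^ 4 := by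
        rcases Nat.eq_zero_or_pos M with h0 | h0
        · subst h0; simp
        · have hN : (1 : ℝ) ≤ N := by exact_mod_cast (h0.trans_le hMN)
          calc (M : ℝ) ^ 4 = (M : ℝ) * (M : ℝ) ^ 3 := by ring
            _ ≤ (M : ℝ) * (N : ℝ) ^ 3 := by gcongr
            _ ≤ (M : ℝ) * (N : ℝ) ^ 4 :=
              mul_le_mul_of_nonneg_left (pow_le_pow_right₀ hN (by norm_num)) (Nat.cast_nonneg _)
      push_cast; nlinarith
  calc T ^ 8 = (T ^ 4) ^ 2 := by ring
    _ ≤ (M ^ 3 * ∑ m ∈ osq M, (I m) ^ 4) ^ 2 := by gcongr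
    _ = M ^ 6 * (∑ m ∈ osq M, (I m) ^ 4) ^ 2 := by ring
    _ ≤ M ^ 6 * (((N : ℝ) ^ 4 * harm (N ^ 4) ^ 64) * (9 * M * (N : ℝ) ^ 4)) := by gcongr
    _ = _ := by ring

/-- The character mod 4 on naturals. -/
def c4 (n : ℕ) : ℤ := ZMod.χ₄ (n : ZMod 4)

theorem c4_eq (n : ℕ) : c4 n = if n % 2 = 0 then 0 else if n % 4 = 1 then 1 else -1 :=
  ZMod.χ₄_nat_eq_if_mod_four n

theorem c4_mul (m n : ℕ) : c4 (m * n) = c4 m * c4 n := by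
  unfold c4; push_cast; rw [map_mul]

theorem c4_abs (n : ℕ) : |c4 n| ≤ 1 := by
  rw [c4_eq]; split_ifs <;> simp

theorem qr_flip {m n : ℕ} (hm : Odd m) (hn : Odd n) :
    2 * jacobiSym m n = (1 + c4 m + c4 n - c4 m * c4 n) * jacobiSym n m := by
  have hm' := Nat.odd_iff.1 hm
  have hn' := Nat.odd_iff.1 hn
  have h1 : m % 4 = 1 ∨ m % 4 = 3 := by omega
  have h2 : n % 4 = 1 ∨ n % 4 = 3 := by omega
  rcases h1 with h1 | h1
  · rw [jacobiSym.quadratic_reciprocity_one_mod_four h1 hn, c4_eq, c4_eq]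
    rcases h2 with h2 | h2 <;> simp [h1, h2, hm', hn']
  · rcases h2 with h2 | h2
    · rw [← jacobiSym.quadratic_reciprocity_one_mod_four h2 hm, c4_eq, c4_eq]
      simp [h1, h2, hm', hn']
    · rw [jacobiSym.quadratic_reciprocity_three_mod_four h1 h2, c4_eq, c4_eq]
      simp [h1, h2, hm', hn']

theorem harm_mono {a b : ℕ} (h : a ≤ b) : harm a ≤ harm b := by
  unfold harm
  exact Finset.sum_le_sum_of_subset_of_nonneg (Finset.Icc_subset_Icc_right h) fun _ _ _ => by positivity

theorem harm_nonneg (a : ℕ) : 0 ≤ harm a := Finset.sum_nonneg fun _ _ => by positivity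

theorem harm_le_log (n : ℕ) : harm n ≤ 1 + Real.log n := by
  have := harmonic_le_one_add_log n
  rw [harmonic_eq_sum_Icc] at this
  push_cast at this
  simpa [harm] using this

/-- supported on odd squarefree numbers and bounded by one -/
def OSB (α : ℕ → ℝ) : Prop := (∀ m, |α m| ≤ 1) ∧ ∀ m, ¬ (Odd m ∧ Squarefree m) → α m = 0

theorem OSB.mul {α θ : ℕ → ℝ} (h : OSB α) (hθ : ∀ m, |θ m| ≤ 1) : OSB (fun m => α m * θ m) := by
  refine ⟨fun m => ?_, fun m hm => by simp [h.2 m hm]⟩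
  rw [abs_mul]; exact mul_le_one₀ (h.1 m) (abs_nonneg _) (hθ m)

theorem box_core' (M N L : ℕ) (hMN : M ≤ N) (hNL : N ≤ L) (α β : ℕ → ℝ) (hα : OSB α)
    (hβ : OSB β) :
    |∑ m ∈ Finset.Icc 1 M, ∑ n ∈ Finset.Icc 1 N, α m * β n * jacobiSym n m| ^ 8 ≤
      9 * (M : ℝ) ^ 7 * (N : ℝ) ^ 8 * harm (L ^ 4) ^ 64 := by
  have h := box_core M N hMN α β hα.1 hβ.1
  have h1 : ∑ m ∈ osq M, α m * ∑ n ∈ Finset.Icc 1 N, β n * (jacobiSym n m : ℝ) =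
      ∑ m ∈ Finset.Icc 1 M, ∑ n ∈ Finset.Icc 1 N, α m * β n * jacobiSym n m := by
    unfold osq
    rw [Finset.sum_filter]
    refine Finset.sum_congr rfl fun m _ => ?_
    split_ifs with hm
    · rw [Finset.mul_sum]; refine Finset.sum_congr rfl fun n _ => by ring
    · simp [hα.2 m hm]
  rw [h1] at h
  rw [pow_abs, abs_of_nonneg (by positivity)]
  refine h.trans ?_
  have := harm_mono (Nat.pow_le_pow_left hNL 4)
  have h0 := harm_nonneg (N ^ 4)
  gcongr

theorem box_sym (M N L B : ℕ) (hM : M ≤ L) (hN : N ≤ L) (hBM : B ≤ M) (hBN : B ≤ N)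
    (hB : 1 ≤ B) (α β : ℕ → ℝ) (hα : OSB α) (hβ : OSB β) :
    |∑ m ∈ Finset.Icc 1 M, ∑ n ∈ Finset.Icc 1 N, α m * β n * jacobiSym m n| ≤
      3 * ((M : ℝ) * N * (B : ℝ) ^ (-(1 / 8) : ℝ) * harm (L ^ 4) ^ 8) := by
  have h0 := harm_nonneg (L ^ 4)
  have hBpos : (0 : ℝ) < B := by exact_mod_cast hB
  -- eighth root
  have root : ∀ (T : ℝ) (M N : ℕ), B ≤ M → 0 ≤ T →
      T ^ 8 ≤ 9 * (M : ℝ) ^ 7 * (N : ℝ) ^ 8 * harm (L ^ 4) ^ 64 →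
      T ≤ (3 / 2) * ((M : ℝ) * N * (B : ℝ) ^ (-(1 / 8) : ℝ) * harm (L ^ 4) ^ 8) := by
    intro T M N hBM hT h
    refine le_of_pow_le_pow_left₀ (n := 8) (by norm_num) (by positivity) (h.trans ?_)
    have hb : ((B : ℝ) ^ (-(1 / 8) : ℝ)) ^ 8 = (B : ℝ)⁻¹ := by
      rw [← Real.rpow_natCast, ← Real.rpow_mul hBpos.le]; norm_num
      exact Real.rpow_neg_one _
    rw [mul_pow, mul_pow, mul_pow, mul_pow, hb, ← pow_mul]
    have hM' : (M : ℝ) ^ 7 ≤ (M : ℝ) ^ 8 * (B : ℝ)⁻¹ := by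
      rw [← div_eq_mul_inv, le_div_iff₀ hBpos, pow_succ]
      have : (B : ℝ) ≤ M := by exact_mod_cast hBM
      exact mul_le_mul_of_nonneg_left this (by positivity)
    have hE : 0 ≤ (N : ℝ) ^ 8 * harm (L ^ 4) ^ 64 := by positivity
    have : (9 : ℝ) ≤ (3 / 2) ^ 8 := by norm_num
    calc 9 * (M : ℝ) ^ 7 * (N : ℝ) ^ 8 * harm (L ^ 4) ^ 64
        ≤ (3 / 2) ^ 8 * ((M : ℝ) ^ 8 * (B : ℝ)⁻¹) * (N : ℝ) ^ 8 * harm (L ^ 4) ^ 64 := by gcongr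
      _ = _ := by ring
  have hc4 : ∀ m, |((c4 m : ℤ) : ℝ)| ≤ 1 := fun m => by exact_mod_cast c4_abs m
  rcases le_total N M with hle | hle
  · have h := root _ N M hBN (abs_nonneg _) (box_core' N M L hle hM β α hβ hα)
    rw [Finset.sum_comm] at h
    have h2 : ∑ y ∈ Finset.Icc 1 M, ∑ x ∈ Finset.Icc 1 N, β x * α y * (jacobiSym y x : ℝ) =
      ∑ m ∈ Finset.Icc 1 M, ∑ n ∈ Finset.Icc 1 N, α m * β n * jacobiSym m n :=
      Finset.sum_congr rfl fun _ _ => Finset.sum_congr rfl fun _ _ => by ring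
    rw [h2] at h
    refine h.trans ?_
    have : 0 ≤ (M : ℝ) * N * (B : ℝ) ^ (-(1 / 8) : ℝ) * harm (L ^ 4) ^ 8 := by positivity
    nlinarith
  · have hb : ∀ (α β : ℕ → ℝ), OSB α → OSB β →
        |∑ m ∈ Finset.Icc 1 M, ∑ n ∈ Finset.Icc 1 N, α m * β n * jacobiSym n m| ≤
        (3 / 2) * ((M : ℝ) * N * (B : ℝ) ^ (-(1 / 8) : ℝ) * harm (L ^ 4) ^ 8) :=
      fun α β hα hβ => root _ M N hBM (abs_nonneg _) (box_core' M N L hle hN α β hα hβ)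
    have e1 := hb α β hα hβ
    have e2 := hb _ β (hα.mul hc4) hβ
    have e3 := hb α _ hα (hβ.mul hc4)
    have e4 := hb _ _ (hα.mul hc4) (hβ.mul hc4)
    have hsum : 2 * ∑ m ∈ Finset.Icc 1 M, ∑ n ∈ Finset.Icc 1 N, α m * β n * (jacobiSym m n : ℝ) =
        ∑ m ∈ Finset.Icc 1 M, ∑ n ∈ Finset.Icc 1 N, α m * β n * (jacobiSym n m : ℝ) +
        ∑ m ∈ Finset.Icc 1 M, ∑ n ∈ Finset.Icc 1 N, α m * c4 m * β n * (jacobiSym n m : ℝ) +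
        ∑ m ∈ Finset.Icc 1 M, ∑ n ∈ Finset.Icc 1 N, α m * (β n * c4 n) * (jacobiSym n m : ℝ) -
        ∑ m ∈ Finset.Icc 1 M, ∑ n ∈ Finset.Icc 1 N, α m * c4 m * (β n * c4 n) * (jacobiSym n m : ℝ) := by
      simp only [Finset.mul_sum, ← Finset.sum_add_distrib, ← Finset.sum_sub_distrib]
      refine Finset.sum_congr rfl fun m _ => Finset.sum_congr rfl fun n _ => ?_
      by_cases hm : Odd m ∧ Squarefree m
      · by_cases hn : Odd n ∧ Squarefree n
        · have := qr_flip hm.1 hn.1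
          have h : 2 * (jacobiSym m n : ℝ) = (1 + c4 m + c4 n - c4 m * c4 n) * jacobiSym n m := by
            exact_mod_cast this
          linear_combination α m * β n * h
        · simp [hβ.2 n hn]
      · simp [hα.2 m hm]
    rw [abs_le] at *
    constructor <;> linarith [e1.1, e1.2, e2.1, e2.2, e3.1, e3.2, e4.1, e4.2]

/-- logarithmic slice index -/
noncomputable def lidx (J m : ℕ) : ℕ := ⌊(J : ℝ) * Real.log m⌋₊

theorem lidx_lower {J m : ℕ} (hJ : 1 ≤ J) (hm : 1 ≤ m) : Real.exp ((lidx J m : ℝ) / J) ≤ m := by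
  have hm' : (0 : ℝ) < m := by exact_mod_cast hm
  have hJ' : (0 : ℝ) < J := by exact_mod_cast hJ
  rw [← Real.le_log_iff_exp_le hm', div_le_iff₀ hJ', mul_comm]
  exact Nat.floor_le (mul_nonneg hJ'.le (Real.log_natCast_nonneg m))

theorem lidx_upper {J m : ℕ} (hJ : 1 ≤ J) (hm : 1 ≤ m) :
    (m : ℝ) < Real.exp (((lidx J m : ℝ) + 1) / J) := by
  have hm' : (0 : ℝ) < m := by exact_mod_cast hm
  have hJ' : (0 : ℝ) < J := by exact_mod_cast hJ
  rw [← Real.log_lt_iff_lt_exp hm', lt_div_iff₀ hJ', mul_comm]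
  exact Nat.lt_floor_add_one _

/-- the hyperbola region -/
def hyp (Y B : ℕ) : Finset (ℕ × ℕ) :=
  (Finset.Icc 1 Y ×ˢ Finset.Icc 1 Y).filter fun p => B ≤ p.1 ∧ B ≤ p.2 ∧ p.1 * p.2 ≤ Y

theorem mem_hyp {Y B : ℕ} {p : ℕ × ℕ} : p ∈ hyp Y B ↔
    (1 ≤ p.1 ∧ p.1 ≤ Y) ∧ (1 ≤ p.2 ∧ p.2 ≤ Y) ∧ B ≤ p.1 ∧ B ≤ p.2 ∧ p.1 * p.2 ≤ Y := by
  simp [hyp, and_assoc]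

/-- one complete box -/
theorem hyp_box (Y B J i j : ℕ) (hB : 1 ≤ B) (hJ : 1 ≤ J)
    (hij : Real.exp (((i : ℝ) + j + 2) / J) ≤ Y)
    (α β : ℕ → ℝ) (hα : OSB α) (hβ : OSB β) :
    |∑ p ∈ (hyp Y B).filter (fun p => lidx J p.1 = i ∧ lidx J p.2 = j),
      α p.1 * β p.2 * jacobiSym p.1 p.2| ≤
      3 * (Y * (B : ℝ) ^ (-(1 / 8) : ℝ) * harm (Y ^ 4) ^ 8) := by
  have h0 := harm_nonneg (Y ^ 4)
  have hJ' : (0 : ℝ) < J := by exact_mod_cast hJ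
  set M := ⌊Real.exp (((i : ℝ) + 1) / J)⌋₊ with hM
  set N := ⌊Real.exp (((j : ℝ) + 1) / J)⌋₊ with hN
  have hMr : (M : ℝ) ≤ Real.exp (((i : ℝ) + 1) / J) := Nat.floor_le (Real.exp_pos _).le
  have hNr : (N : ℝ) ≤ Real.exp (((j : ℝ) + 1) / J) := Nat.floor_le (Real.exp_pos _).le
  have hMN : (M : ℝ) * N ≤ Y := by
    refine le_trans (mul_le_mul hMr hNr (by positivity) (Real.exp_pos _).le) ?_
    rw [← Real.exp_add]
    refine le_trans (le_of_eq ?_) hij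
    congr 1; ring
  have hMN' : M * N ≤ Y := by exact_mod_cast hMN
  by_cases hne : ((hyp Y B).filter (fun p => lidx J p.1 = i ∧ lidx J p.2 = j)).Nonempty
  swap
  · rw [Finset.not_nonempty_iff_eq_empty] at hne
    rw [hne]; simp only [Finset.sum_empty, abs_zero]; positivity
  have key : ∀ {m i : ℕ}, 1 ≤ m → lidx J m = i → m ≤ ⌊Real.exp (((i : ℝ) + 1) / J)⌋₊ := by
    intro m i hm hi
    refine Nat.le_floor ?_
    rw [← hi]; exact (lidx_upper hJ hm).le
  obtain ⟨q, hq⟩ := hne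
  rw [Finset.mem_filter, mem_hyp] at hq
  have hBM : B ≤ M := hq.1.2.2.1.trans (key hq.1.1.1 hq.2.1)
  have hBN : B ≤ N := hq.1.2.2.2.1.trans (key hq.1.2.1.1 hq.2.2)
  have hMY : M ≤ Y := le_trans (Nat.le_mul_of_pos_right M (by omega)) hMN'
  have hNY : N ≤ Y := le_trans (Nat.le_mul_of_pos_left N (by omega)) hMN'
  have ind : ∀ (i m : ℕ), |(if lidx J m = i ∧ B ≤ m then (1 : ℝ) else 0)| ≤ 1 := by
    intro i m; split_ifs <;> simp
  have hb := box_sym M N Y B hMY hNY hBM hBN hB _ _ (hα.mul (ind i)) (hβ.mul (ind j))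
  have heq : ∑ p ∈ (hyp Y B).filter (fun p => lidx J p.1 = i ∧ lidx J p.2 = j),
      α p.1 * β p.2 * (jacobiSym p.1 p.2 : ℝ) =
      ∑ m ∈ Finset.Icc 1 M, ∑ n ∈ Finset.Icc 1 N,
        α m * (if lidx J m = i ∧ B ≤ m then (1 : ℝ) else 0) *
        (β n * (if lidx J n = j ∧ B ≤ n then (1 : ℝ) else 0)) * jacobiSym m n := by
    rw [← Finset.sum_product', ← Finset.sum_filter_of_ne (s := Finset.Icc 1 M ×ˢ Finset.Icc 1 N)
      (p := fun p : ℕ × ℕ => (lidx J p.1 = i ∧ B ≤ p.1) ∧ (lidx J p.2 = j ∧ B ≤ p.2))]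
    · refine Finset.sum_congr ?_ ?_
      · ext p
        simp only [Finset.mem_filter, mem_hyp, Finset.mem_product, Finset.mem_Icc]
        constructor
        · rintro ⟨⟨⟨a1, a2⟩, ⟨b1, b2⟩, c1, c2, c3⟩, h1, h2⟩
          exact ⟨⟨⟨a1, key a1 h1⟩, ⟨b1, key b1 h2⟩⟩, ⟨h1, c1⟩, h2, c2⟩
        · rintro ⟨⟨⟨a1, a2⟩, ⟨b1, b2⟩⟩, ⟨h1, c1⟩, h2, c2⟩
          exact ⟨⟨⟨a1, a2.trans hMY⟩, ⟨b1, b2.trans hNY⟩, c1, c2,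
            (Nat.mul_le_mul a2 b2).trans hMN'⟩, h1, h2⟩
      · intro p hp
        rw [Finset.mem_filter] at hp
        rw [if_pos hp.2.1, if_pos hp.2.2]; ring
    · intro p _ hp
      constructor
      · by_contra h; simp [h] at hp
      · by_contra h; simp [h] at hp
  rw [heq]
  refine hb.trans ?_
  gcongr

theorem hyp_boundary (Y B J : ℕ) (hB : 1 ≤ B) (hJ : 1 ≤ J) :
    (((hyp Y B).filter (fun p => ¬ Real.exp (((lidx J p.1 : ℝ) + lidx J p.2 + 2) / J) ≤ Y)).card : ℝ)
      ≤ 2 * Y / J * harm Y + Y / B := by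
  have hJ' : (0 : ℝ) < J := by exact_mod_cast hJ
  have hB' : (0 : ℝ) < B := by exact_mod_cast hB
  set c := Real.exp (-2 / J) with hc
  have hc0 : 0 < c := Real.exp_pos _
  have hc1 : 1 - c ≤ 2 / J := by
    have := Real.add_one_le_exp (-2 / (J : ℝ))
    rw [neg_div] at this; rw [hc, neg_div]; linarith
  have hc2 : c ≤ 1 := by rw [hc]; exact Real.exp_le_one_iff.2 (by rw [neg_div]; exact neg_nonpos.2 (by positivity))
  have hsub : (hyp Y B).filter (fun p => ¬ Real.exp (((lidx J p.1 : ℝ) + lidx J p.2 + 2) / J) ≤ Y) ⊆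
      (Finset.Icc 1 (Y / B)).biUnion fun m => (Finset.Ioc ⌊(Y : ℝ) * c / m⌋₊ ⌊(Y : ℝ) / m⌋₊).image
        fun n => (m, n) := by
    intro p hp
    rw [Finset.mem_filter, mem_hyp] at hp
    obtain ⟨⟨⟨a1, a2⟩, ⟨b1, b2⟩, c1, c2, c3⟩, h⟩ := hp
    simp only [Finset.mem_biUnion, Finset.mem_image, Finset.mem_Icc, Finset.mem_Ioc]
    have hp1 : (0 : ℝ) < p.1 := by exact_mod_cast a1
    refine ⟨p.1, ⟨a1, ?_⟩, p.2, ⟨?_, ?_⟩, rfl⟩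
    · rw [Nat.le_div_iff_mul_le (by omega)]
      exact (Nat.mul_le_mul_left _ c2).trans c3
    · rw [Nat.floor_lt (by positivity), div_lt_iff₀ hp1]
      push Not at h
      have h1 := lidx_lower hJ a1
      have h2 := lidx_lower hJ b1
      have h3 : Real.exp (((lidx J p.1 : ℝ) + lidx J p.2) / J) ≤ p.2 * p.1 := by
        rw [add_div, Real.exp_add, mul_comm]
        exact mul_le_mul h2 h1 (Real.exp_pos _).le (by positivity)
      refine lt_of_lt_of_le ?_ h3
      have h4 : Real.exp (((lidx J p.1 : ℝ) + lidx J p.2) / J) =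
        Real.exp (((lidx J p.1 : ℝ) + lidx J p.2 + 2) / J) * c := by
        rw [hc, ← Real.exp_add]; congr 1; ring
      rw [h4]
      exact mul_lt_mul_of_pos_right h hc0
    · refine Nat.le_floor ?_
      rw [le_div_iff₀ hp1]
      exact_mod_cast (by rw [mul_comm]; exact c3)
  have h1 := (Finset.card_le_card hsub).trans Finset.card_biUnion_le
  have h2 : ∀ m ∈ Finset.Icc 1 (Y / B),
      (((Finset.Ioc ⌊(Y : ℝ) * c / m⌋₊ ⌊(Y : ℝ) / m⌋₊).image fun n => (m, n)).card : ℝ) ≤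
        2 * Y / J * (1 / m) + 1 := by
    intro m hm
    have hm0 : (0 : ℝ) < m := by exact_mod_cast (Finset.mem_Icc.1 hm).1
    refine le_trans (Nat.cast_le.2 Finset.card_image_le) ?_
    rw [Nat.card_Ioc]
    have hle : ⌊(Y : ℝ) * c / m⌋₊ ≤ ⌊(Y : ℝ) / m⌋₊ := by
      refine Nat.floor_le_floor ?_
      gcongr; exact mul_le_of_le_one_right (by positivity) hc2
    rw [Nat.cast_sub hle]
    have e1 : ((⌊(Y : ℝ) / m⌋₊ : ℕ) : ℝ) ≤ Y / m := Nat.floor_le (by positivity)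
    have e2 : (Y : ℝ) * c / m < (⌊(Y : ℝ) * c / m⌋₊ : ℕ) + 1 := Nat.lt_floor_add_one _
    have e3 : (Y : ℝ) / m - Y * c / m ≤ 2 * Y / J * (1 / m) := by
      have : (Y : ℝ) / m - Y * c / m = (Y / m) * (1 - c) := by ring
      rw [this]
      have : 2 * (Y : ℝ) / J * (1 / m) = Y / m * (2 / J) := by ring
      rw [this]
      gcongr
    linarith
  have h3 : ((∑ m ∈ Finset.Icc 1 (Y / B),
      ((Finset.Ioc ⌊(Y : ℝ) * c / m⌋₊ ⌊(Y : ℝ) / m⌋₊).image fun n => (m, n)).card : ℕ) : ℝ) ≤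
      2 * Y / J * harm (Y / B) + ((Y / B : ℕ) : ℝ) := by
    push_cast
    refine (Finset.sum_le_sum h2).trans (le_of_eq ?_)
    rw [Finset.sum_add_distrib, ← Finset.mul_sum]; simp [harm]
  refine (Nat.cast_le.2 h1).trans (h3.trans ?_)
  have h4 := harm_mono (Nat.div_le_self Y B)
  have h5 : ((Y / B : ℕ) : ℝ) ≤ (Y : ℝ) / B := Nat.cast_div_le
  gcongr

theorem hyp_bilinear0 (Y B J : ℕ) (hB : 1 ≤ B) (hJ : 1 ≤ J)
    (α β : ℕ → ℝ) (hα : OSB α) (hβ : OSB β) :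
    |∑ p ∈ hyp Y B, α p.1 * β p.2 * jacobiSym p.1 p.2| ≤
      ((J : ℝ) * Real.log Y + 1) ^ 2 * (3 * (Y * (B : ℝ) ^ (-(1 / 8) : ℝ) * harm (Y ^ 4) ^ 8)) +
      (2 * Y / J * harm Y + Y / B) := by
  have h0 := harm_nonneg (Y ^ 4)
  rw [← Finset.sum_filter_add_sum_filter_not (hyp Y B)
    (fun p => Real.exp (((lidx J p.1 : ℝ) + lidx J p.2 + 2) / J) ≤ Y)]
  refine (abs_add_le _ _).trans (add_le_add ?_ ?_)
  · set K := ⌊(J : ℝ) * Real.log Y⌋₊ + 1 with hK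
    have hKr : (K : ℝ) ≤ (J : ℝ) * Real.log Y + 1 := by
      rw [hK]; push_cast
      have := Nat.floor_le (mul_nonneg (Nat.cast_nonneg J) (Real.log_natCast_nonneg Y))
      linarith
    rw [← Finset.sum_fiberwise_of_maps_to (t := Finset.range K ×ˢ Finset.range K)
      (g := fun p : ℕ × ℕ => (lidx J p.1, lidx J p.2))]
    · refine (Finset.abs_sum_le_sum_abs _ _).trans ?_
      have : ∀ q ∈ Finset.range K ×ˢ Finset.range K,
        |∑ p ∈ (hyp Y B).filter (fun p => Real.exp (((lidx J p.1 : ℝ) + lidx J p.2 + 2) / J) ≤ Y)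
          with (lidx J p.1, lidx J p.2) = q, α p.1 * β p.2 * (jacobiSym p.1 p.2 : ℝ)| ≤
          3 * (Y * (B : ℝ) ^ (-(1 / 8) : ℝ) * harm (Y ^ 4) ^ 8) := by
        rintro ⟨i, j⟩ _
        rw [Finset.filter_filter]
        by_cases hij : Real.exp (((i : ℝ) + j + 2) / J) ≤ Y
        · refine le_trans (le_of_eq ?_) (hyp_box Y B J i j hB hJ hij α β hα hβ)
          congr 1
          refine Finset.sum_congr (Finset.filter_congr fun p _ => ?_) fun _ _ => rfl
          simp only [Prod.mk.injEq]
          constructor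
          · exact fun h => h.2
          · rintro ⟨rfl, rfl⟩; exact ⟨hij, rfl, rfl⟩
        · rw [Finset.filter_false_of_mem]
          · simp only [Finset.sum_empty, abs_zero]; positivity
          · rintro p _ ⟨h1, h2⟩
            rw [Prod.mk.injEq] at h2
            rw [← h2.1, ← h2.2] at hij; exact hij h1
      refine (Finset.sum_le_sum this).trans ?_
      rw [Finset.sum_const, Finset.card_product, Finset.card_range, nsmul_eq_mul]
      push_cast
      rw [← pow_two]
      gcongr
    · intro p hp
      rw [Finset.mem_filter, mem_hyp] at hp
      have : ∀ m, 1 ≤ m → m ≤ Y → lidx J m ∈ Finset.range K := by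
        intro m h1 h2
        rw [Finset.mem_range, hK, Nat.lt_succ_iff]
        refine Nat.floor_le_floor ?_
        have : (0 : ℝ) < m := by exact_mod_cast h1
        gcongr
      rw [Finset.mem_product]
      exact ⟨this _ hp.1.1.1 hp.1.1.2, this _ hp.1.2.1.1 hp.1.2.1.2⟩
  · refine (Finset.abs_sum_le_sum_abs _ _).trans ?_
    refine le_trans ?_ (hyp_boundary Y B J hB hJ)
    rw [Finset.card_eq_sum_ones]; push_cast
    refine Finset.sum_le_sum fun p _ => ?_
    rw [abs_mul, abs_mul]
    have hj : |(jacobiSym p.1 p.2 : ℝ)| ≤ 1 := by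
      exact_mod_cast jac_abs_le _ _
    exact mul_le_one₀ (mul_le_one₀ (hα.1 _) (abs_nonneg _) (hβ.1 _)) (abs_nonneg _) hj

theorem hyp_bilinear (Y B : ℕ) (hY : 1 ≤ Y) (hB : 1 ≤ B)
    (α β : ℕ → ℝ) (hα : OSB α) (hβ : OSB β) :
    |∑ p ∈ hyp Y B, α p.1 * β p.2 * jacobiSym p.1 p.2| ≤
      2000000 * (Y * (B : ℝ) ^ (-(1 / 32) : ℝ) * (1 + Real.log Y) ^ 10) := by
  have hB1 : (1 : ℝ) ≤ B := by exact_mod_cast hB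
  have hB0 : (0 : ℝ) < B := by linarith
  set b := (B : ℝ) ^ ((1 / 32) : ℝ) with hb
  have hb1 : 1 ≤ b := Real.one_le_rpow hB1 (by norm_num)
  have hb0 : 0 < b := by linarith
  set J := ⌈b⌉₊ with hJdef
  have hJ : 1 ≤ J := Nat.one_le_iff_ne_zero.2 (by rw [hJdef]; exact (Nat.ceil_pos.2 hb0).ne')
  have hJ1 : b ≤ J := Nat.le_ceil b
  have hJ2 : (J : ℝ) ≤ 2 * b := by
    have := (Nat.ceil_lt_add_one hb0.le).le
    rw [← hJdef] at this; linarith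
  refine (hyp_bilinear0 Y B J hB hJ α β hα hβ).trans ?_
  set l := 1 + Real.log Y with hl
  have hlog : 0 ≤ Real.log Y := Real.log_natCast_nonneg Y
  have hl1 : 1 ≤ l := by linarith
  have e1 : (B : ℝ) ^ (-(1 / 32) : ℝ) = b⁻¹ := by rw [hb, ← Real.rpow_neg hB0.le]
  have e2 : (B : ℝ) ^ (-(1 / 8) : ℝ) = b⁻¹ ^ 4 := by
    rw [← e1, ← Real.rpow_natCast, ← Real.rpow_mul hB0.le]; norm_num
  have e3 : (B : ℝ)⁻¹ ≤ b⁻¹ := by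
    rw [← e1, ← Real.rpow_neg_one]
    exact Real.rpow_le_rpow_of_exponent_le hB1 (by norm_num)
  have hbi : b⁻¹ ≤ 1 := inv_le_one_of_one_le₀ hb1
  have hbi0 : 0 < b⁻¹ := by positivity
  have hH : harm Y ≤ l := harm_le_log Y
  have hH4 : harm (Y ^ 4) ≤ 4 * l := by
    refine (harm_le_log _).trans ?_
    push_cast; rw [Real.log_pow]; push_cast; linarith
  have h0 := harm_nonneg Y
  have h04 := harm_nonneg (Y ^ 4)
  have hY0 : (0 : ℝ) < Y := by exact_mod_cast hY
  rw [e1, e2]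
  have t1 : ((J : ℝ) * Real.log Y + 1) ^ 2 ≤ (2 * b * l) ^ 2 := by
    gcongr
    have : (J : ℝ) * Real.log Y ≤ 2 * b * Real.log Y := by gcongr
    rw [hl]; nlinarith
  have t2 : ((J : ℝ) * Real.log Y + 1) ^ 2 * (3 * (Y * b⁻¹ ^ 4 * harm (Y ^ 4) ^ 8)) ≤
      (2 * b * l) ^ 2 * (3 * (Y * b⁻¹ ^ 4 * (4 * l) ^ 8)) := by gcongr
  have t3 : (2 * b * l) ^ 2 * (3 * (Y * b⁻¹ ^ 4 * (4 * l) ^ 8)) =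
      786432 * (Y * (b⁻¹ * b⁻¹) * l ^ 10) := by
    field_simp; ring
  have t4 : (Y : ℝ) * (b⁻¹ * b⁻¹) * l ^ 10 ≤ Y * b⁻¹ * l ^ 10 := by
    have : b⁻¹ * b⁻¹ ≤ b⁻¹ := by nlinarith
    gcongr
  have hl10 : l ≤ l ^ 10 := le_self_pow₀ hl1 (by norm_num)
  have t5 : 2 * (Y : ℝ) / J * harm Y ≤ 2 * (Y * b⁻¹ * l ^ 10) := by
    have : 2 * (Y : ℝ) / J ≤ 2 * Y * b⁻¹ := by
      rw [div_eq_mul_inv]; gcongr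
    calc 2 * (Y : ℝ) / J * harm Y ≤ 2 * Y * b⁻¹ * l ^ 10 := by gcongr; exact hH.trans hl10
      _ = _ := by ring
  have t6 : (Y : ℝ) / B ≤ Y * b⁻¹ * l ^ 10 := by
    rw [div_eq_mul_inv]
    have : (1 : ℝ) ≤ l ^ 10 := one_le_pow₀ hl1
    calc (Y : ℝ) * (B : ℝ)⁻¹ ≤ Y * b⁻¹ * 1 := by rw [mul_one]; gcongr
      _ ≤ _ := by gcongr
  have : 0 ≤ (Y : ℝ) * b⁻¹ * l ^ 10 := by positivity
  linarith

/-- squarefree-supported multiplicative function with prescribed prime values -/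
noncomputable def gm (h : ℕ → ℝ) (n : ℕ) : ℝ :=
  if Squarefree n then ∏ p ∈ n.primeFactors, h p else 0

theorem gm_nonneg {h : ℕ → ℝ} (h0 : ∀ p, 0 ≤ h p) (n : ℕ) : 0 ≤ gm h n := by
  unfold gm; split_ifs
  · exact Finset.prod_nonneg fun p _ => h0 p
  · exact le_rfl

theorem gm_prime_mul {h : ℕ → ℝ} (h0 : ∀ p, 0 ≤ h p) (h1 : ∀ p, h p ≤ 1) {p m : ℕ}
    (hp : p.Prime) : gm h (p * m) ≤ gm h m := by
  by_cases hs : Squarefree (p * m)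
  · have hm := Squarefree.of_mul_right hs
    have hpm : ¬ p ∣ m := fun hd => by
      have := hs p (Nat.mul_dvd_mul_left p hd)
      exact hp.one_lt.ne' (Nat.isUnit_iff.1 this)
    have hm0 : m ≠ 0 := hm.ne_zero
    unfold gm
    rw [if_pos hs, if_pos hm, Nat.primeFactors_mul hp.ne_zero hm0, hp.primeFactors,
      Finset.prod_union (by simp [hpm]), Finset.prod_singleton]
    exact mul_le_of_le_one_left (Finset.prod_nonneg fun p _ => h0 p) (h1 p)
  · conv_lhs => unfold gm
    rw [if_neg hs]; exact gm_nonneg h0 m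

theorem sqf_log {n : ℕ} (hn : Squarefree n) : Real.log n = ∑ p ∈ n.primeFactors, Real.log p := by
  conv_lhs => rw [← Nat.prod_primeFactors_of_squarefree hn]
  push_cast
  rw [Real.log_prod]
  intro p hp; exact_mod_cast (Nat.prime_of_mem_primeFactors hp).ne_zero

theorem ub_log {h : ℕ → ℝ} (h0 : ∀ p, 0 ≤ h p) (h1 : ∀ p, h p ≤ 1) (y : ℕ) :
    ∑ n ∈ Finset.Icc 1 y, gm h n * Real.log n ≤
      Real.log 4 * (y * ∑ n ∈ Finset.Icc 1 y, gm h n / n) := by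
  have A : ∀ n ∈ Finset.Icc 1 y, gm h n * Real.log n =
      ∑ p ∈ (Finset.Icc 1 y).filter Nat.Prime, if p ∣ n then Real.log p * gm h n else 0 := by
    intro n hn
    rw [Finset.mem_Icc] at hn
    by_cases hs : Squarefree n
    · rw [sqf_log hs, Finset.mul_sum, ← Finset.sum_filter]
      refine Finset.sum_congr ?_ fun _ _ => by ring
      ext p
      simp only [Nat.mem_primeFactors, Finset.mem_filter, Finset.mem_Icc]
      constructor
      · rintro ⟨a, b, c⟩
        exact ⟨⟨⟨a.one_le, (Nat.le_of_dvd (by omega) b).trans hn.2⟩, a⟩, b⟩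
      · rintro ⟨⟨⟨_, _⟩, a⟩, b⟩; exact ⟨a, b, by omega⟩
    · have : gm h n = 0 := by unfold gm; rw [if_neg hs]
      simp [this]
  rw [Finset.sum_congr rfl A, Finset.sum_comm]
  have C : ∀ p ∈ (Finset.Icc 1 y).filter Nat.Prime,
      ∑ n ∈ Finset.Icc 1 y, (if p ∣ n then Real.log p * gm h n else 0) ≤
      ∑ m ∈ Finset.Icc 1 y, if p * m ≤ y then Real.log p * gm h m else 0 := by
    intro p hp
    have hp' := (Finset.mem_filter.1 hp).2
    rw [← Finset.sum_filter, ← Finset.sum_filter]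
    have : (Finset.Icc 1 y).filter (fun n => p ∣ n) =
        ((Finset.Icc 1 y).filter (fun m => p * m ≤ y)).image (fun m => p * m) := by
      ext n
      simp only [Finset.mem_filter, Finset.mem_image, Finset.mem_Icc]
      constructor
      · rintro ⟨⟨a, b⟩, m, rfl⟩
        have hm : 1 ≤ m := Nat.pos_of_ne_zero (by rintro rfl; simp at a)
        exact ⟨m, ⟨⟨hm, (Nat.le_mul_of_pos_left m hp'.pos).trans b⟩, b⟩, rfl⟩
      · rintro ⟨m, ⟨⟨a, b⟩, c⟩, rfl⟩
        exact ⟨⟨Nat.mul_pos hp'.pos a, c⟩, dvd_mul_right _ _⟩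
    rw [this, Finset.sum_image fun a _ b _ hab => Nat.eq_of_mul_eq_mul_left hp'.pos hab]
    refine Finset.sum_le_sum fun m _ => ?_
    exact mul_le_mul_of_nonneg_left (gm_prime_mul h0 h1 hp') (Real.log_natCast_nonneg p)
  refine (Finset.sum_le_sum C).trans ?_
  rw [Finset.sum_comm, Finset.mul_sum, Finset.mul_sum]
  refine Finset.sum_le_sum fun m hm => ?_
  have hm1 := (Finset.mem_Icc.1 hm).1
  have hm0 : (0 : ℝ) < m := by exact_mod_cast hm1
  have hth := Chebyshev.theta_le_log4_mul_x (x := (y : ℝ) / m) (by positivity)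
  have : ∑ p ∈ (Finset.Icc 1 y).filter Nat.Prime, (if p * m ≤ y then Real.log p * gm h m else 0) ≤
      Chebyshev.theta ((y : ℝ) / m) * gm h m := by
    rw [← Finset.sum_filter, ← Finset.sum_mul, Finset.filter_filter, Chebyshev.theta]
    refine mul_le_mul_of_nonneg_right (le_of_eq (Finset.sum_congr ?_ fun _ _ => rfl)) (gm_nonneg h0 m)
    ext p
    simp only [Finset.mem_filter, Finset.mem_Icc, Finset.mem_Ioc]
    have e : p ≤ ⌊(y : ℝ) / m⌋₊ ↔ p * m ≤ y := by
      rw [Nat.le_floor_iff (by positivity), le_div_iff₀ hm0]; exact_mod_cast Iff.rfl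
    rw [e]
    constructor
    · rintro ⟨⟨a, b⟩, c, d⟩; exact ⟨⟨a, d⟩, c⟩
    · rintro ⟨⟨a, d⟩, c⟩; exact ⟨⟨a, (Nat.le_mul_of_pos_right p hm1).trans d⟩, c, d⟩
  refine this.trans ((mul_le_mul_of_nonneg_right hth (gm_nonneg h0 m)).trans (le_of_eq ?_))
  ring

theorem ub1 {h : ℕ → ℝ} (h0 : ∀ p, 0 ≤ h p) (h1 : ∀ p, h p ≤ 1) (y : ℕ) :
    (∑ n ∈ Finset.Icc 1 y, gm h n) * Real.log y ≤
      3 * (y * ∑ n ∈ Finset.Icc 1 y, gm h n / n) := by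
  have h2 := ub_log h0 h1 y
  have h3 : ∑ n ∈ Finset.Icc 1 y, gm h n * (Real.log y - Real.log n) ≤
      y * ∑ n ∈ Finset.Icc 1 y, gm h n / n := by
    rw [Finset.mul_sum]
    refine Finset.sum_le_sum fun n hn => ?_
    have hn' := Finset.mem_Icc.1 hn
    have hn0 : (0 : ℝ) < n := by exact_mod_cast hn'.1
    have hy0 : (0 : ℝ) < y := by exact_mod_cast (by omega : 0 < y)
    rw [← Real.log_div hy0.ne' hn0.ne']
    have := Real.log_le_sub_one_of_pos (div_pos hy0 hn0)
    have hg := gm_nonneg h0 n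
    calc gm h n * Real.log (y / n) ≤ gm h n * (y / n) := by gcongr; linarith
      _ = _ := by ring
  have h4 : 0 ≤ y * ∑ n ∈ Finset.Icc 1 y, gm h n / n :=
    mul_nonneg (Nat.cast_nonneg _) (Finset.sum_nonneg fun n _ => div_nonneg (gm_nonneg h0 n) (Nat.cast_nonneg _))
  have h5 : Real.log 4 ≤ 2 := by
    have : Real.log 4 = 2 * Real.log 2 := by
      rw [show (4 : ℝ) = 2 ^ 2 by norm_num, Real.log_pow]; norm_num
    rw [this]; linarith [Real.log_two_lt_d9]
  simp only [mul_sub, Finset.sum_sub_distrib] at h3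
  rw [← Finset.sum_mul] at h3
  nlinarith

theorem ub2 {h : ℕ → ℝ} (h0 : ∀ p, 0 ≤ h p) (y : ℕ) (σ : ℝ) :
    ∑ n ∈ Finset.Icc 1 y, gm h n * (n : ℝ) ^ (-σ) ≤
      Real.exp (∑ p ∈ Nat.primesBelow (y + 1), h p * (p : ℝ) ^ (-σ)) := by
  have hf : ∀ p : ℕ, 0 ≤ h p * (p : ℝ) ^ (-σ) := fun p =>
    mul_nonneg (h0 p) (Real.rpow_nonneg (Nat.cast_nonneg _) _)
  have e1 : ∏ p ∈ Nat.primesBelow (y + 1), (1 + h p * (p : ℝ) ^ (-σ)) ≤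
      Real.exp (∑ p ∈ Nat.primesBelow (y + 1), h p * (p : ℝ) ^ (-σ)) := by
    rw [Real.exp_sum]
    refine Finset.prod_le_prod (fun p _ => by linarith [hf p]) fun p _ => ?_
    linarith [Real.add_one_le_exp (h p * (p : ℝ) ^ (-σ))]
  refine le_trans ?_ e1
  rw [Finset.prod_one_add]
  have e2 : ∑ n ∈ Finset.Icc 1 y, gm h n * (n : ℝ) ^ (-σ) =
      ∑ n ∈ (Finset.Icc 1 y).filter Squarefree, ∏ p ∈ n.primeFactors, h p * (p : ℝ) ^ (-σ) := by
    rw [Finset.sum_filter]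
    refine Finset.sum_congr rfl fun n _ => ?_
    unfold gm
    split_ifs with hs
    · rw [Finset.prod_mul_distrib, Real.finsetProd_rpow _ _ fun _ _ => Nat.cast_nonneg _]
      congr 2
      conv_lhs => rw [← Nat.prod_primeFactors_of_squarefree hs]
      push_cast; rfl
    · simp
  rw [e2, ← Finset.sum_image (g := fun n : ℕ => n.primeFactors)
    (f := fun T => ∏ p ∈ T, h p * (p : ℝ) ^ (-σ))]
  · refine Finset.sum_le_sum_of_subset_of_nonneg ?_ fun T _ _ => Finset.prod_nonneg fun p _ => hf p
    intro T hT
    rw [Finset.mem_image] at hT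
    obtain ⟨n, hn, rfl⟩ := hT
    rw [Finset.mem_filter, Finset.mem_Icc] at hn
    rw [Finset.mem_powerset]
    intro p hp
    rw [Nat.mem_primesBelow]
    exact ⟨Nat.lt_succ_of_le ((Nat.le_of_mem_primeFactors hp).trans hn.1.2),
      Nat.prime_of_mem_primeFactors hp⟩
  · intro a ha b hb hab
    simp only [Finset.coe_filter, Set.mem_setOf_eq] at ha hb
    rw [← Nat.prod_primeFactors_of_squarefree ha.2, ← Nat.prod_primeFactors_of_squarefree hb.2]
    simp only at hab
    rw [hab]

/-- prime sums of ψ are eventually bounded by `log K` -/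
def PB (ψ : ℕ → ℤ) (σ K : ℝ) : Prop :=
  ∀ᶠ n in Filter.atTop, ∑ p ∈ Nat.primesBelow n, (ψ p : ℝ) * (p : ℝ) ^ (-σ) ≤ Real.log K

theorem PB_zero (σ : ℝ) : PB (fun _ => 0) σ 1 := by
  unfold PB; simp

theorem PB_of_partial {ψ : ℕ → ℤ} {σ K : ℝ} (hσ : 1 < σ) (hmul : ∀ m n, ψ (m * n) = ψ m * ψ n)
    (hone : ψ 1 = 1) (hbd : ∀ n, |ψ n| ≤ 1)
    (hK : ∀ L : ℕ, ∑ n ∈ Finset.Icc 1 L, (ψ n : ℝ) * (n : ℝ) ^ (-σ) ≤ K) : PB ψ σ (K + 1) := by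
  let f : ℕ →*₀ ℝ :=
    { toFun := fun n => (ψ n : ℝ) * (n : ℝ) ^ (-σ)
      map_zero' := by rw [Nat.cast_zero, Real.zero_rpow (by linarith)]; simp
      map_one' := by simp [hone]
      map_mul' := fun m n => by
        rw [hmul]; push_cast
        rw [Real.mul_rpow (Nat.cast_nonneg _) (Nat.cast_nonneg _)]; ring }
  have hfv : ∀ n, f n = (ψ n : ℝ) * (n : ℝ) ^ (-σ) := fun _ => rfl
  have hnorm : ∀ n, ‖f n‖ ≤ (n : ℝ) ^ (-σ) := by
    intro n
    rw [hfv, norm_mul, Real.norm_eq_abs, Real.norm_of_nonneg (Real.rpow_nonneg (Nat.cast_nonneg _) _)]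
    have : |(ψ n : ℝ)| ≤ 1 := by exact_mod_cast hbd n
    exact mul_le_of_le_one_left (Real.rpow_nonneg (Nat.cast_nonneg _) _) this
  have hs0 : Summable fun n : ℕ => (n : ℝ) ^ (-σ) := Real.summable_nat_rpow.2 (by linarith)
  have hsum : Summable (‖f ·‖) := Summable.of_nonneg_of_le (fun _ => norm_nonneg _) hnorm hs0
  have hE := EulerProduct.eulerProduct_completely_multiplicative hsum
  have hlim : ∑' n, f n ≤ K := by
    have ht := (hsum.of_norm.hasSum.tendsto_sum_nat)
    refine le_of_tendsto ht (Filter.Eventually.of_forall fun n => ?_)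
    refine le_trans (le_of_eq ?_) (hK (n - 1))
    rcases n with _ | n
    · simp
    · rw [Finset.sum_range_succ', map_zero, add_zero, Nat.add_sub_cancel,
        Finset.range_eq_Ico, Finset.sum_Ico_add' (fun i => f i) 0 n 1]
      rfl
  have hev := hE.eventually (gt_mem_nhds (lt_of_le_of_lt hlim (lt_add_one K)))
  filter_upwards [hev] with n hn
  have hpos : ∀ p ∈ Nat.primesBelow n, f p < 1 := by
    intro p hp
    have hpp := Nat.prime_of_mem_primesBelow hp
    refine lt_of_le_of_lt (le_abs_self _) (lt_of_le_of_lt (hnorm p) ?_)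
    exact Real.rpow_lt_one_of_one_lt_of_neg (by exact_mod_cast hpp.one_lt) (by linarith)
  have h1 : Real.exp (∑ p ∈ Nat.primesBelow n, (ψ p : ℝ) * (p : ℝ) ^ (-σ)) ≤
      ∏ p ∈ Nat.primesBelow n, (1 - f p)⁻¹ := by
    rw [Real.exp_sum]
    refine Finset.prod_le_prod (fun p _ => (Real.exp_pos _).le) fun p hp => ?_
    have hlt := hpos p hp
    rw [le_inv_comm₀ (Real.exp_pos _) (by linarith), ← Real.exp_neg, ← hfv]
    linarith [Real.add_one_le_exp (-f p)]
  have h2 := h1.trans hn.le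
  rw [Real.le_log_iff_exp_le (lt_of_lt_of_le (Real.exp_pos _) h2)]
  exact h2

theorem abel_le {ψ : ℕ → ℤ} {q : ℕ} (hψ : NPC q ψ) {a : ℕ → ℝ} (ha : ∀ n, 1 ≤ n → a (n + 1) ≤ a n)
    (ha0 : ∀ n, 0 ≤ a n) (L : ℕ) :
    ∑ n ∈ Finset.Icc 1 L, (ψ n : ℝ) * a n ≤ ∑ n ∈ Finset.Icc 1 q, a n := by
  have hΦ : ∀ L : ℕ, 0 ≤ ∑ n ∈ Finset.Icc 1 L, (((if n ≤ q then 1 else 0 : ℤ) - ψ n : ℤ) : ℝ) := by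
    intro L
    rw [← Int.cast_sum]
    refine Int.cast_nonneg ?_
    rw [Finset.sum_sub_distrib, ← Finset.sum_filter]
    rcases le_total L q with hL | hL
    · rw [Finset.filter_true_of_mem fun n hn => (Finset.mem_Icc.1 hn).2.trans hL]
      rw [sub_nonneg]
      exact Finset.sum_le_sum fun n _ => (abs_le.1 (hψ.bd n)).2
    · have := (abs_le.1 (hψ.sum_Icc_le L)).2
      have e : (Finset.Icc 1 L).filter (fun n => n ≤ q) = Finset.Icc 1 q := by
        ext n; simp; omega
      rw [e]; simp; linarith
  have key : ∀ L, (∑ n ∈ Finset.Icc 1 L, (((if n ≤ q then 1 else 0 : ℤ) - ψ n : ℤ) : ℝ)) * a L ≤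
      ∑ n ∈ Finset.Icc 1 L, (((if n ≤ q then 1 else 0 : ℤ) - ψ n : ℤ) : ℝ) * a n := by
    intro L
    induction L with
    | zero => simp
    | succ L ih =>
      rw [Finset.sum_Icc_succ_top (by omega), Finset.sum_Icc_succ_top (by omega), add_mul]
      refine add_le_add (le_trans ?_ ih) le_rfl
      rcases Nat.eq_zero_or_pos L with rfl | hL
      · simp
      · exact mul_le_mul_of_nonneg_left (ha L hL) (hΦ L)
  have h1 := (mul_nonneg (hΦ L) (ha0 L)).trans (key L)
  have h2 : ∑ n ∈ Finset.Icc 1 L, (((if n ≤ q then 1 else 0 : ℤ) - ψ n : ℤ) : ℝ) * a n =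
      ∑ n ∈ (Finset.Icc 1 L).filter (fun n => n ≤ q), a n - ∑ n ∈ Finset.Icc 1 L, (ψ n : ℝ) * a n := by
    rw [Finset.sum_filter, ← Finset.sum_sub_distrib]
    refine Finset.sum_congr rfl fun n _ => ?_
    split_ifs <;> push_cast <;> ring
  have h3 : ∑ n ∈ (Finset.Icc 1 L).filter (fun n => n ≤ q), a n ≤ ∑ n ∈ Finset.Icc 1 q, a n := by
    refine Finset.sum_le_sum_of_subset_of_nonneg ?_ fun n _ _ => ha0 n
    intro n; simp; omega
  linarith

theorem NPC.PB {ψ : ℕ → ℤ} {q : ℕ} (hψ : NPC q ψ) {σ : ℝ} (hσ : 1 < σ) : PB ψ σ (harm q + 1) := by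
  refine PB_of_partial hσ hψ.mul hψ.one hψ.bd fun L => ?_
  refine (abel_le hψ (a := fun n => (n : ℝ) ^ (-σ)) ?_ (fun n => by positivity) L).trans ?_
  · intro n hn
    have : (0 : ℝ) < n := by exact_mod_cast hn
    exact Real.rpow_le_rpow_of_nonpos this (by push_cast; linarith) (by linarith)
  · unfold harm
    refine Finset.sum_le_sum fun n hn => ?_
    have : (1 : ℝ) ≤ n := by exact_mod_cast (Finset.mem_Icc.1 hn).1
    rw [one_div, ← Real.rpow_neg_one]
    exact Real.rpow_le_rpow_of_exponent_le this (by linarith)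

theorem PB_one {σ : ℝ} (hσ : 1 < σ) : PB (fun _ => 1) σ (1 / (σ - 1) + 1 + 1) := by
  refine PB_of_partial hσ (by simp) rfl (by simp) fun L => ?_
  have hs : 0 < σ - 1 := by linarith
  have key : ∀ L : ℕ, 1 ≤ L → ∑ n ∈ Finset.Icc 1 L, (n : ℝ) ^ (-σ) ≤
      1 / (σ - 1) + 1 - (L : ℝ) ^ (-(σ - 1)) / (σ - 1) := by
    intro L hL
    induction L, hL using Nat.le_induction with
    | base => simp
    | succ L hL ih =>
      rw [Finset.sum_Icc_succ_top (by omega)]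
      have hL0 : (0 : ℝ) < L := by exact_mod_cast hL
      have h1 : ((L + 1 : ℕ) : ℝ) ^ (-σ) ≤ (L : ℝ) ^ (-(σ - 1)) / (σ - 1) -
          ((L + 1 : ℕ) : ℝ) ^ (-(σ - 1)) / (σ - 1) := by
        set n : ℝ := ((L + 1 : ℕ) : ℝ) with hn
        have hn0 : 0 < n := by positivity
        have hLn : (L : ℝ) = n * (1 - 1 / n) := by
          rw [mul_sub, mul_one, mul_one_div_cancel hn0.ne', hn]; push_cast; ring
        have hx : 0 < 1 - 1 / n := by
          by_contra hc; push Not at hc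
          nlinarith [mul_nonpos_of_nonneg_of_nonpos hn0.le hc]
        rw [hLn, Real.mul_rpow hn0.le hx.le]
        have h2 : 1 + (σ - 1) / n ≤ (1 - 1 / n) ^ (-(σ - 1)) := by
          rw [Real.rpow_def_of_pos hx]
          have h3 := Real.log_le_sub_one_of_pos hx
          have h4 := Real.add_one_le_exp (Real.log (1 - 1 / n) * -(σ - 1))
          have h5 : (σ - 1) / n = (σ - 1) * (1 / n) := by ring
          rw [h5]
          nlinarith
        have h6 : n ^ (-σ) = n ^ (-(σ - 1)) * n⁻¹ := by
          rw [← Real.rpow_neg_one, ← Real.rpow_add hn0]; congr 1; ring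
        rw [h6, ← sub_div, le_div_iff₀ hs]
        have h7 : 0 < n ^ (-(σ - 1)) := Real.rpow_pos_of_pos hn0 _
        have h8 := mul_le_mul_of_nonneg_left h2 h7.le
        calc n ^ (-(σ - 1)) * n⁻¹ * (σ - 1) = n ^ (-(σ - 1)) * (1 + (σ - 1) / n) - n ^ (-(σ - 1)) := by ring
          _ ≤ _ := by linarith
      linarith
  rcases Nat.eq_zero_or_pos L with rfl | hL
  · simp; positivity
  · have := key L hL
    have h2 : 0 ≤ (L : ℝ) ^ (-(σ - 1)) / (σ - 1) := by positivity
    simp only [Int.cast_one, one_mul]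
    linarith

/-- The character mod 8 with `(2/p)`. -/
def c8 (n : ℕ) : ℤ := ZMod.χ₈ (n : ZMod 8)

theorem c8_mul (m n : ℕ) : c8 (m * n) = c8 m * c8 n := by
  unfold c8; push_cast; rw [map_mul]

theorem c8_eq (n : ℕ) : c8 n = if n % 2 = 0 then 0 else if n % 8 = 1 ∨ n % 8 = 7 then 1 else -1 :=
  ZMod.χ₈_nat_eq_if_mod_eight n

theorem c8_abs (n : ℕ) : |c8 n| ≤ 1 := by
  rw [c8_eq]; split_ifs <;> simp

theorem npc_c8 : NPC 8 c8 :=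
  ⟨by norm_num, fun n => by unfold c8; push_cast; congr 1; reduce_mod_char, c8_mul, by rw [c8_eq]; simp, by rw [c8_eq]; simp, c8_abs,
    3, by decide, by rw [c8_eq]; simp⟩

theorem npc_c4 : NPC 8 c4 :=
  ⟨by norm_num, fun n => by rw [c4_eq, c4_eq]; congr 1 <;> [skip; congr 1] <;> simp <;> omega, c4_mul, by rw [c4_eq]; simp, by rw [c4_eq]; simp, c4_abs,
    3, by decide, by rw [c4_eq]; simp⟩

theorem npc_c48 : NPC 8 (fun n => c4 n * c8 n) where
  pos := by norm_num
  per := fun n => by rw [npc_c4.per, npc_c8.per]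
  mul := fun m n => by rw [c4_mul, c8_mul]; ring
  one := by rw [npc_c4.one, npc_c8.one]; rfl
  zero := by rw [npc_c4.zero]; rfl
  bd := fun n => by rw [abs_mul]; exact mul_le_one₀ (c4_abs n) (abs_nonneg _) (c8_abs n)
  ex := ⟨5, by decide, by rw [c4_eq, c8_eq]; simp⟩

theorem UB {N : ℕ} (hN : 1 ≤ N) {q : ℕ} (hq : 8 ≤ q) {h : ℕ → ℝ} (h0 : ∀ p, 0 ≤ h p)
    (h1 : ∀ p, h p ≤ 1) {ψ : ℕ → ℤ}
    (hψ : (ψ = fun _ => 0) ∨ (NPC q ψ ∧ NPC q (fun n => ψ n * c8 n)))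
    (hh : ∀ p : ℕ, p.Prime → h p ≤ 1 / 2 * (1 + c8 p) * (1 - 1 / N + ψ p / N))
    {y : ℕ} (hy : 3 ≤ y) :
    ∑ n ∈ Finset.Icc 1 y, gm h n ≤
      27 * (y * Real.log y ^ (-(1 / 2) - 1 / (2 * N) : ℝ) * (1 + harm q)) := by
  have hN0 : (0 : ℝ) < N := by exact_mod_cast hN
  have hN1 : (1 : ℝ) ≤ N := by exact_mod_cast hN
  have hy0 : (0 : ℝ) < y := by exact_mod_cast (by omega : 0 < y)
  have hl1 : 1 ≤ Real.log y := by
    rw [Real.le_log_iff_exp_le hy0]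
    have : (3 : ℝ) ≤ y := by exact_mod_cast hy
    linarith [Real.exp_one_lt_d9]
  set l := Real.log y with hl
  have hl0 : 0 < l := by linarith
  set σ := 1 + 1 / l with hσd
  have hσ : 1 < σ := by rw [hσd]; have : 0 < 1 / l := by positivity
                        linarith
  have hσ1 : 1 / (σ - 1) = l := by rw [hσd]; field_simp; simp
  set H := harm q with hH
  have hH0 : 0 ≤ H := harm_nonneg q
  have p1 := PB_one hσ
  rw [hσ1] at p1
  have p2 : PB c8 σ (H + 1) := by
    have h8 := npc_c8.PB hσ
    filter_upwards [h8] with n hn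
    refine hn.trans (Real.log_le_log (by linarith [harm_nonneg 8]) ?_)
    linarith [harm_mono hq]
  have p3 : PB ψ σ (H + 1) ∧ PB (fun n => ψ n * c8 n) σ (H + 1) := by
    rcases hψ with rfl | ⟨a, b⟩
    · have : 0 ≤ Real.log (H + 1) := Real.log_nonneg (by linarith)
      constructor <;> (unfold PB; simp [this])
    · exact ⟨a.PB hσ, b.PB hσ⟩
  set G := ∑ p ∈ Nat.primesBelow (y + 1), h p * (p : ℝ) ^ (-σ) with hG
  have hGle : G ≤ (1 / 2 * (1 - 1 / N)) * (Real.log (l + 1 + 1) + Real.log (H + 1)) +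
      (1 / (2 * N)) * (Real.log (H + 1) + Real.log (H + 1)) := by
    obtain ⟨n, ⟨⟨⟨e1, e2⟩, e3⟩, e4⟩, e5⟩ :=
      ((((p1.and p2).and p3.1).and p3.2).and (Filter.eventually_ge_atTop (y + 1))).exists
    have hmono : G ≤ ∑ p ∈ Nat.primesBelow n, h p * (p : ℝ) ^ (-σ) := by
      refine Finset.sum_le_sum_of_subset_of_nonneg ?_ fun p _ _ => mul_nonneg (h0 p) (by positivity)
      intro p hp
      rw [Nat.mem_primesBelow] at hp ⊢
      exact ⟨by omega, hp.2⟩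
    refine hmono.trans ?_
    have hb : ∑ p ∈ Nat.primesBelow n, h p * (p : ℝ) ^ (-σ) ≤
        (1 / 2 * (1 - 1 / N)) * (∑ p ∈ Nat.primesBelow n, ((1 : ℤ) : ℝ) * (p : ℝ) ^ (-σ) +
          ∑ p ∈ Nat.primesBelow n, (c8 p : ℝ) * (p : ℝ) ^ (-σ)) +
        (1 / (2 * N)) * (∑ p ∈ Nat.primesBelow n, (ψ p : ℝ) * (p : ℝ) ^ (-σ) +
          ∑ p ∈ Nat.primesBelow n, ((ψ p * c8 p : ℤ) : ℝ) * (p : ℝ) ^ (-σ)) := by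
      rw [← Finset.sum_add_distrib, ← Finset.sum_add_distrib, Finset.mul_sum, Finset.mul_sum,
        ← Finset.sum_add_distrib]
      refine Finset.sum_le_sum fun p hp => ?_
      have := mul_le_mul_of_nonneg_right (hh p (Nat.prime_of_mem_primesBelow hp))
        (Real.rpow_nonneg (Nat.cast_nonneg p) (-σ))
      refine this.trans (le_of_eq ?_)
      push_cast; field_simp
    refine hb.trans ?_
    have c1 : 0 ≤ 1 / 2 * (1 - 1 / (N : ℝ)) := by
      have : 1 / (N : ℝ) ≤ 1 := by rw [div_le_one hN0]; exact hN1
      linarith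
    have c2 : 0 ≤ 1 / (2 * (N : ℝ)) := by positivity
    exact add_le_add (mul_le_mul_of_nonneg_left (add_le_add e1 e2) c1)
      (mul_le_mul_of_nonneg_left (add_le_add e3 e4) c2)
  have hexp : Real.exp G ≤ 3 * l ^ (1 / 2 - 1 / (2 * N) : ℝ) * (1 + H) := by
    have hi : 1 / (N : ℝ) ≤ 1 := by rw [div_le_one hN0]; exact hN1
    have hi0 : 0 < 1 / (N : ℝ) := by positivity
    have hi2 : 1 / (2 * (N : ℝ)) = 1 / 2 * (1 / N) := by ring
    rw [hi2] at hGle ⊢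
    set t := 1 / (N : ℝ) with ht
    have hlog1 : 0 ≤ Real.log (H + 1) := Real.log_nonneg (by linarith)
    have hlog2 : Real.log (l + 1 + 1) ≤ Real.log 3 + Real.log l := by
      rw [← Real.log_mul (by norm_num) hl0.ne']
      exact Real.log_le_log (by linarith) (by linarith)
    have hlog3 : 0 ≤ Real.log 3 := Real.log_nonneg (by norm_num)
    have hbd : G ≤ Real.log 3 + Real.log l * (1 / 2 - 1 / 2 * t) + Real.log (H + 1) := by
      refine hGle.trans ?_
      nlinarith [mul_le_mul_of_nonneg_left hlog2 (show 0 ≤ 1 / 2 * (1 - t) by linarith)]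
    refine (Real.exp_le_exp.2 hbd).trans (le_of_eq ?_)
    rw [Real.exp_add, Real.exp_add, Real.exp_log (by norm_num), Real.exp_log (by linarith),
      Real.rpow_def_of_pos hl0, add_comm H 1]
  have hS : ∑ n ∈ Finset.Icc 1 y, gm h n / n ≤ 3 * Real.exp G := by
    have e2 := ub2 h0 y σ
    have : ∑ n ∈ Finset.Icc 1 y, gm h n / n ≤ 3 * ∑ n ∈ Finset.Icc 1 y, gm h n * (n : ℝ) ^ (-σ) := by
      rw [Finset.mul_sum]
      refine Finset.sum_le_sum fun n hn => ?_
      have hn' := Finset.mem_Icc.1 hn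
      have hn0 : (0 : ℝ) < n := by exact_mod_cast hn'.1
      have hny : (n : ℝ) ≤ y := by exact_mod_cast hn'.2
      have e3 : (n : ℝ)⁻¹ ≤ 3 * (n : ℝ) ^ (-σ) := by
        have e4 : (n : ℝ) ^ (-σ) = (n : ℝ)⁻¹ * Real.exp (-(Real.log n / l)) := by
          rw [hσd, neg_add, Real.rpow_add hn0, Real.rpow_neg_one, Real.rpow_def_of_pos hn0]
          congr 2; ring
        have e5 : 1 ≤ 3 * Real.exp (-(Real.log n / l)) := by
          rw [Real.exp_neg, ← div_eq_mul_inv, le_div_iff₀ (Real.exp_pos _), one_mul]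
          have : Real.log n / l ≤ 1 := by
            rw [div_le_one hl0]; exact Real.log_le_log hn0 hny
          linarith [Real.exp_le_exp.2 this, Real.exp_one_lt_d9]
        rw [e4]
        calc (n : ℝ)⁻¹ = (n : ℝ)⁻¹ * 1 := by ring
          _ ≤ (n : ℝ)⁻¹ * (3 * Real.exp (-(Real.log n / l))) := by gcongr
          _ = _ := by ring
      rw [div_eq_mul_inv]
      calc gm h n * (n : ℝ)⁻¹ ≤ gm h n * (3 * (n : ℝ) ^ (-σ)) :=
            mul_le_mul_of_nonneg_left e3 (gm_nonneg h0 n)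
        _ = _ := by ring
    linarith
  have hu := ub1 h0 h1 y
  rw [← hl] at hu
  have hfin : (∑ n ∈ Finset.Icc 1 y, gm h n) * l ≤ 27 * (y * l ^ (1 / 2 - 1 / (2 * N) : ℝ) * (1 + H)) := by
    refine hu.trans ?_
    calc 3 * (y * ∑ n ∈ Finset.Icc 1 y, gm h n / n)
        ≤ 3 * (y * (3 * (3 * l ^ (1 / 2 - 1 / (2 * N) : ℝ) * (1 + H)))) := by
          gcongr; exact hS.trans (by linarith)
      _ = _ := by ring
  rw [← le_div_iff₀ hl0] at hfin
  refine hfin.trans (le_of_eq ?_)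
  have : l ^ (-(1 / 2) - 1 / (2 * N) : ℝ) = l ^ (1 / 2 - 1 / (2 * N) : ℝ) / l := by
    rw [← Real.rpow_sub_one hl0.ne']; congr 1; ring
  rw [this]; ring

/-- splitting coordinates into pairs -/
def pairEquiv (k : ℕ) : (Fin (2 * k) → ZMod 2) ≃ (Fin k → ZMod 2 × ZMod 2) where
  toFun v j := (v ⟨2 * j.1, by have := j.2; omega⟩, v ⟨2 * j.1 + 1, by have := j.2; omega⟩)
  invFun w i := if i.1 % 2 = 0 then (w ⟨i.1 / 2, by have := i.2; omega⟩).1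
    else (w ⟨i.1 / 2, by have := i.2; omega⟩).2
  left_inv v := by
    funext i
    by_cases h : i.1 % 2 = 0
    · simp only [h, if_true]; congr 1; ext; simp only; omega
    · simp only [h, if_false]; congr 1; ext; simp only; omega
  right_inv w := by
    funext j
    have h1 : (2 * j.1) % 2 = 0 := by omega
    have h2 : ¬ (2 * j.1 + 1) % 2 = 0 := by omega
    have h3 : (2 * j.1 + 1) / 2 = j.1 := by omega
    have h4 : (2 * j.1) / 2 = j.1 := by omega
    ext <;> simp only [h1, h2, if_true, if_false, h3, h4]

/-- the difference quadratic form -/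
def Qk {k : ℕ} (w : Fin (2 * k) → ZMod 2) : ZMod 2 :=
  ∑ j : Fin k, (pairEquiv k w j).1 * ((pairEquiv k w j).1 + (pairEquiv k w j).2)

theorem phi_add {k : ℕ} (u v : Fin (2 * k) → ZMod 2) : phiK u v + phiK v u = Qk (u + v) := by
  unfold phiK Qk pairEquiv
  rw [← Finset.sum_add_distrib]
  refine Finset.sum_congr rfl fun j _ => ?_
  simp only [Equiv.coe_fn_mk, Pi.add_apply]
  generalize u _ = a; generalize u _ = b; generalize v _ = c; generalize v _ = d
  revert a b c d; decide

theorem unl_iff {k : ℕ} (u v : Fin (2 * k) → ZMod 2) : Unlinked u v ↔ Qk (u + v) = 0 := by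
  unfold Unlinked
  rw [← phi_add]
  generalize phiK u v = a; generalize phiK v u = b
  revert a b; decide

theorem Q4 {k : ℕ} (a b c d : Fin (2 * k) → ZMod 2) :
    Qk (a + b + c + d) = Qk (a + b) + Qk (a + c) + Qk (a + d) + Qk (b + c) + Qk (b + d) + Qk (c + d) := by
  unfold Qk pairEquiv
  simp only [← Finset.sum_add_distrib]
  refine Finset.sum_congr rfl fun j _ => ?_
  simp only [Equiv.coe_fn_mk, Pi.add_apply]
  generalize a _ = a1; generalize a _ = a2; generalize b _ = b1; generalize b _ = b2
  generalize c _ = c1; generalize c _ = c2; generalize d _ = d1; generalize d _ = d2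
  have : (2 : ZMod 2) = 0 := rfl
  linear_combination (-(a1*a1) - a1*a2-b1*b1-b1*b2-c1*c1-c1*c2-d1*d1-d1*d2) * this

/-- additive sign -/
def sg (x : ZMod 2) : ℤ := if x = 0 then 1 else -1

theorem sg_add (x y : ZMod 2) : sg (x + y) = sg x * sg y := by revert x y; decide
theorem sg_sq (x : ZMod 2) : sg x * sg x = 1 := by revert x; decide
theorem sg_zero : sg 0 = 1 := rfl

theorem sg_sum {ι : Type*} (s : Finset ι) (f : ι → ZMod 2) : sg (∑ i ∈ s, f i) = ∏ i ∈ s, sg (f i) := by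
  induction s using Finset.induction_on with
  | empty => simp [sg_zero]
  | insert a s ha ih => rw [Finset.sum_insert ha, Finset.prod_insert ha, sg_add, ih]

theorem Qk_zero {k : ℕ} : Qk (0 : Fin (2 * k) → ZMod 2) = 0 := by
  unfold Qk pairEquiv; simp

theorem addself {k : ℕ} (a : Fin (2 * k) → ZMod 2) : a + a = 0 := by
  funext i; simp only [Pi.add_apply, Pi.zero_apply]; generalize a i = x; revert x; decide

theorem gauss_sum {k : ℕ} : ∑ v : Fin (2 * k) → ZMod 2, sg (Qk v) = 2 ^ k := by
  rw [← Equiv.sum_comp (pairEquiv k).symm]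
  unfold Qk
  simp only [Equiv.apply_symm_apply, sg_sum]
  rw [← Fintype.piFinset_univ, ← Finset.prod_univ_sum (fun _ => Finset.univ)
    (fun (_ : Fin k) (x : ZMod 2 × ZMod 2) => sg (x.1 * (x.1 + x.2)))]
  rw [Finset.prod_const, Finset.card_univ, Fintype.card_fin]
  congr 1

theorem bent {k : ℕ} (a : Fin (2 * k) → ZMod 2) :
    ∑ v, sg (Qk (a + v)) * sg (Qk v) = if a = 0 then 4 ^ k else 0 := by
  split_ifs with h
  · subst h
    simp only [zero_add, sg_sq]
    rw [Finset.sum_const, Finset.card_univ]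
    simp [pow_mul]
  · -- find b with polar form one
    have hb : ∃ b : Fin (2 * k) → ZMod 2, Qk (a + b) + Qk a + Qk b = 1 := by
      have hne : ∃ j : Fin k, pairEquiv k a j ≠ 0 := by
        by_contra hc; push Not at hc
        apply h
        apply (pairEquiv k).injective
        funext j; rw [hc j]; rfl
      obtain ⟨j, hj⟩ := hne
      have hpt : ∀ x : ZMod 2 × ZMod 2, x ≠ 0 → ∃ y : ZMod 2 × ZMod 2,
        (x.1 + y.1) * ((x.1 + y.1) + (x.2 + y.2)) + x.1 * (x.1 + x.2) + y.1 * (y.1 + y.2) = 1 := by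
        decide
      obtain ⟨y, hy⟩ := hpt _ hj
      refine ⟨(pairEquiv k).symm (Function.update 0 j y), ?_⟩
      set b := (pairEquiv k).symm (Function.update 0 j y) with hbdef
      have hpb : pairEquiv k b = Function.update (0 : Fin k → ZMod 2 × ZMod 2) j y := by simp [hbdef]
      have hpab : ∀ i, pairEquiv k (a + b) i = pairEquiv k a i + pairEquiv k b i := fun i => rfl
      unfold Qk
      rw [← Finset.sum_add_distrib, ← Finset.sum_add_distrib, Finset.sum_eq_single j]
      · rw [hpab, hpb, Function.update_self]
        exact hy
      · intro i _ hij
        rw [hpab, hpb, Function.update_of_ne hij]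
        simp only [Pi.zero_apply, add_zero, Prod.fst_zero, Prod.snd_zero, zero_mul]
        generalize pairEquiv k a i = x; revert x; decide
      · simp
    obtain ⟨b, hb⟩ := hb
    have hflip : ∀ v, sg (Qk (a + (v + b))) * sg (Qk (v + b)) = -(sg (Qk (a + v)) * sg (Qk v)) := by
      intro v
      rw [← sg_add, ← sg_add]
      have h4 := Q4 a v b 0
      simp only [add_zero] at h4
      have e : Qk (a + (v + b)) + Qk (v + b) = Qk (a + v) + Qk v + 1 := by
        rw [← add_assoc, h4, ← hb]
        generalize Qk (a + v) = x1; generalize Qk (a + b) = x2; generalize Qk a = x3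
        generalize Qk (v + b) = x4; generalize Qk v = x5; generalize Qk b = x6
        revert x1 x2 x3 x4 x5 x6; decide
      rw [e, sg_add _ 1]
      have : sg 1 = -1 := rfl
      rw [this]; ring
    have h5 := Equiv.sum_comp (Equiv.addRight b) (fun v => sg (Qk (a + v)) * sg (Qk v))
    simp only [Equiv.coe_addRight, hflip, Finset.sum_neg_distrib] at h5
    omega

/-- correlation with a set -/
def fU {k : ℕ} (U : Finset (Fin (2 * k) → ZMod 2)) (v : Fin (2 * k) → ZMod 2) : ℤ :=
  ∑ u ∈ U, sg (Qk (u + v))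

theorem fU_sq {k : ℕ} (U : Finset (Fin (2 * k) → ZMod 2)) :
    ∑ v, fU U v ^ 2 = 4 ^ k * U.card := by
  unfold fU
  simp only [pow_two, Finset.sum_mul_sum]
  rw [Finset.sum_comm]
  have : ∀ u ∈ U, ∑ v, ∑ u' ∈ U, sg (Qk (u + v)) * sg (Qk (u' + v)) = 4 ^ k := by
    intro u hu
    rw [Finset.sum_comm]
    have h1 : ∀ u', ∑ v, sg (Qk (u + v)) * sg (Qk (u' + v)) = if u = u' then 4 ^ k else 0 := by
      intro u'
      have := Equiv.sum_comp (Equiv.addLeft u') (fun v => sg (Qk ((u + u') + v)) * sg (Qk v))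
      rw [bent] at this
      simp only [Equiv.coe_addLeft] at this
      have h2 : ∀ v, u + u' + (u' + v) = u + v := fun v => by
        rw [add_assoc, ← add_assoc u', addself, zero_add]
      simp only [h2] at this
      rw [this]
      congr 1
      rw [eq_iff_iff]
      constructor
      · intro h
        have : u + u' + u' = u' := by rw [h, zero_add]
        rwa [add_assoc, addself, add_zero] at this
      · rintro rfl; exact addself u
    simp only [h1, Finset.sum_ite_eq, hu, if_true]
  rw [Finset.sum_congr rfl this]
  simp [mul_comm]

theorem fU_sum {k : ℕ} (U : Finset (Fin (2 * k) → ZMod 2)) :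
    ∑ v, fU U v = 2 ^ k * U.card := by
  unfold fU
  rw [Finset.sum_comm]
  have : ∀ u ∈ U, ∑ v, sg (Qk (u + v)) = 2 ^ k := by
    intro u _
    rw [← gauss_sum]
    exact Equiv.sum_comp (Equiv.addLeft u) (fun v => sg (Qk v))
  rw [Finset.sum_congr rfl this]; simp [mul_comm]

theorem fU_mem {k : ℕ} {U : Finset (Fin (2 * k) → ZMod 2)}
    (hU : ∀ u ∈ U, ∀ v ∈ U, Unlinked u v) {v} (hv : v ∈ U) : fU U v = U.card := by
  unfold fU
  have : ∀ u ∈ U, sg (Qk (u + v)) = 1 := fun u hu => by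
    rw [(unl_iff u v).1 (hU u hu v hv)]; rfl
  rw [Finset.sum_congr rfl this]; simp

theorem unl_card_le {k : ℕ} {U : Finset (Fin (2 * k) → ZMod 2)}
    (hU : ∀ u ∈ U, ∀ v ∈ U, Unlinked u v) : U.card ≤ 2 ^ k := by
  have h1 : ∑ v ∈ U, fU U v ^ 2 ≤ ∑ v, fU U v ^ 2 :=
    Finset.sum_le_sum_of_subset_of_nonneg (Finset.subset_univ _) fun _ _ _ => sq_nonneg _
  rw [fU_sq, Finset.sum_congr rfl fun v hv => by rw [fU_mem hU hv]] at h1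
  simp only [Finset.sum_const, nsmul_eq_mul] at h1
  by_contra hc
  push Not at hc
  have h2 : (2 : ℤ) ^ k < U.card := by exact_mod_cast hc
  have h3 : (4 : ℤ) ^ k = 2 ^ k * 2 ^ k := by rw [← mul_pow]; norm_num
  have h4 : (0 : ℤ) < 2 ^ k := by positivity
  rw [h3] at h1
  have h5 : (0 : ℤ) < U.card := by linarith
  nlinarith [mul_pos h5 (mul_pos h4 h5), mul_pos h5 (sub_pos.2 h2)]

theorem unl_symm {k : ℕ} {u v : Fin (2 * k) → ZMod 2} (h : Unlinked u v) : Unlinked v u := Eq.symm h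

theorem max_mem {k : ℕ} {U : Finset (Fin (2 * k) → ZMod 2)} (hU : IsMaxUnlinked U) {v}
    (hv : ∀ u ∈ U, Unlinked u v) : v ∈ U := by
  have := hU.2 (insert v U) ?_ (Finset.subset_insert _ _)
  · rw [← this]; exact Finset.mem_insert_self _ _
  · intro x hx y hy
    rw [Finset.mem_insert] at hx hy
    rcases hx with rfl | hx <;> rcases hy with rfl | hy
    · exact rfl
    · exact unl_symm (hv y hy)
    · exact hv x hx
    · exact hU.1 x hx y hy

theorem fU_max {k : ℕ} {U : Finset (Fin (2 * k) → ZMod 2)} (hU : IsMaxUnlinked U) {v u1 u2}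
    (h1 : u1 ∈ U) (h2 : u2 ∈ U) (hl1 : ¬ Unlinked u1 v) (hl2 : Unlinked u2 v) : fU U v = 0 := by
  have tri : ∀ u ∈ U, u + u1 + u2 ∈ U := by
    intro u hu
    refine max_mem hU fun w hw => ?_
    rw [unl_iff, add_comm, Q4, (unl_iff _ _).1 (hU.1 u hu u1 h1), (unl_iff _ _).1 (hU.1 u hu u2 h2),
      (unl_iff _ _).1 (hU.1 u hu w hw), (unl_iff _ _).1 (hU.1 u1 h1 u2 h2),
      (unl_iff _ _).1 (hU.1 u1 h1 w hw), (unl_iff _ _).1 (hU.1 u2 h2 w hw)]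
    rfl
  have hq1 : Qk (u1 + v) = 1 := by
    rw [unl_iff] at hl1
    generalize Qk (u1 + v) = x at *; revert x; decide
  have hflip : ∀ u ∈ U, sg (Qk (u + u1 + u2 + v)) = - sg (Qk (u + v)) := by
    intro u hu
    rw [Q4, (unl_iff _ _).1 (hU.1 u hu u1 h1), (unl_iff _ _).1 (hU.1 u hu u2 h2),
      (unl_iff _ _).1 (hU.1 u1 h1 u2 h2), hq1, (unl_iff _ _).1 hl2]
    generalize Qk (u + v) = x; revert x; decide
  have hinv : ∀ u : Fin (2 * k) → ZMod 2, u + u1 + u2 + u1 + u2 = u := by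
    intro u
    have : u + u1 + u2 + u1 + u2 = u + (u1 + u1) + (u2 + u2) := by abel
    rw [this, addself, addself, add_zero, add_zero]
  have h3 : fU U v = ∑ u ∈ U, sg (Qk (u + u1 + u2 + v)) := by
    unfold fU
    refine Finset.sum_nbij' (fun u => u + u1 + u2) (fun u => u + u1 + u2) tri tri
      (fun u _ => hinv u) (fun u _ => hinv u) ?_
    intro u _; rw [hinv]
  rw [Finset.sum_congr rfl hflip, Finset.sum_neg_distrib] at h3
  have : fU U v = - fU U v := h3
  omega

theorem max_card {k : ℕ} {U : Finset (Fin (2 * k) → ZMod 2)} (hU : IsMaxUnlinked U) :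
    U.card = 2 ^ k := by
  have hne : 0 < U.card := by
    rw [Finset.card_pos]
    by_contra hc
    rw [Finset.not_nonempty_iff_eq_empty] at hc
    have := max_mem hU (v := 0) (by rw [hc]; simp)
    rw [hc] at this; simp at this
  set c : ℤ := (U.card : ℤ) with hc
  have hc0 : 0 < c := by rw [hc]; exact_mod_cast hne
  -- pointwise identity f^2 + c f = 2 c^2 on U and 0 off U
  have hpt : ∀ v, fU U v ^ 2 + c * fU U v = if v ∈ U then 2 * c ^ 2 else 0 := by
    intro v
    split_ifs with hv
    · rw [fU_mem hU.1 hv]; ring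
    · by_cases hex : ∃ u ∈ U, Unlinked u v
      · obtain ⟨u2, h2, hl2⟩ := hex
        have : ∃ u1 ∈ U, ¬ Unlinked u1 v := by
          by_contra hcon; push Not at hcon; exact hv (max_mem hU hcon)
        obtain ⟨u1, h1, hl1⟩ := this
        rw [fU_max hU h1 h2 hl1 hl2]; ring
      · push Not at hex
        have : fU U v = -c := by
          unfold fU
          rw [Finset.sum_congr rfl (g := fun _ => (-1 : ℤ))]
          · simp [hc]
          · intro u hu
            have := hex u hu
            rw [unl_iff] at this
            simp [sg, this]
        rw [this]; ring
  have hs := Finset.sum_congr (rfl : (Finset.univ : Finset (Fin (2 * k) → ZMod 2)) = Finset.univ)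
    fun v _ => hpt v
  rw [Finset.sum_add_distrib, ← Finset.mul_sum, fU_sq, fU_sum, ← Finset.sum_filter] at hs
  simp only [Finset.filter_univ_mem, Finset.sum_const, nsmul_eq_mul] at hs
  rw [← hc] at hs
  have h3 : (4 : ℤ) ^ k = 2 ^ k * 2 ^ k := by rw [← mul_pow]; norm_num
  rw [h3] at hs
  have h4 : (0 : ℤ) < 2 ^ k := by positivity
  have h5 : c * ((c - 2 ^ k) * (2 * c + 2 ^ k)) = 0 := by linarith
  have h6 : c - 2 ^ k = 0 := by
    rcases mul_eq_zero.1 h5 with h | h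
    · omega
    · rcases mul_eq_zero.1 h with h | h
      · exact h
      · omega
  have : (U.card : ℤ) = ((2 ^ k : ℕ) : ℤ) := by push_cast; omega
  exact_mod_cast this

theorem max_of_card {k : ℕ} {U : Finset (Fin (2 * k) → ZMod 2)}
    (hU : ∀ u ∈ U, ∀ v ∈ U, Unlinked u v) (hc : U.card = 2 ^ k) : IsMaxUnlinked U :=
  ⟨hU, fun U' hU' hs => (Finset.eq_of_subset_of_card_le hs (by rw [hc]; exact unl_card_le hU')).symm⟩

theorem max_mixed {k : ℕ} {U : Finset (Fin (2 * k) → ZMod 2)} (hU : IsMaxUnlinked U) {v} (hv : v ∉ U) :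
    (∃ u ∈ U, ¬ Unlinked u v) ∧ ∃ u ∈ U, Unlinked u v := by
  have hc := max_card hU
  have h1 : ∃ u ∈ U, ¬ Unlinked u v := by
    by_contra hcon; push Not at hcon; exact hv (max_mem hU hcon)
  refine ⟨h1, ?_⟩
  have h2 := fU_sq U
  have h3 : ∑ w ∈ U, fU U w ^ 2 + fU U v ^ 2 ≤ ∑ w, fU U w ^ 2 := by
    rw [add_comm, ← Finset.sum_insert (f := fun w => fU U w ^ 2) hv]
    exact Finset.sum_le_sum_of_subset_of_nonneg (Finset.subset_univ _) fun _ _ _ => sq_nonneg _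
  rw [h2, Finset.sum_congr rfl fun v hv => by rw [fU_mem hU.1 hv], hc] at h3
  simp only [Finset.sum_const, nsmul_eq_mul, hc] at h3
  push_cast at h3
  have h4 : (4 : ℤ) ^ k = 2 ^ k * 2 ^ k := by rw [← mul_pow]; norm_num
  rw [h4] at h3
  have h5 : fU U v = 0 := by
    have : fU U v ^ 2 ≤ 0 := by nlinarith
    exact pow_eq_zero_iff (two_ne_zero) |>.1 (le_antisymm this (sq_nonneg _))
  by_contra hcon; push Not at hcon
  have : fU U v = -(U.card : ℤ) := by
    unfold fU
    rw [Finset.sum_congr rfl (g := fun _ => (-1 : ℤ))]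
    · simp
    · intro u hu
      have := hcon u hu
      rw [unl_iff] at this
      simp [sg, this]
  rw [h5, hc] at this
  have : (0 : ℤ) < 2 ^ k := by positivity
  push_cast at *
  omega

/-- the data of a real quadratic field `ℚ(s)`, `s² = n`, `n ≡ 2 mod 4` squarefree -/
structure QF (K : Type*) [Field K] [NumberField K] (n : ℕ) (s : K) : Prop where
  sq : s ^ 2 = n
  rep : ∀ x : K, ∃ a b : ℚ, x = a + b * s
  sqf : Squarefree n
  n4 : n % 4 = 2
  p1 : ∃ φ : K →+* ℝ, φ s = √n
  p2 : ∃ φ : K →+* ℝ, φ s = -√n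

lemma nat_not_sq_of {n : ℕ} (h4 : n % 4 = 2) : ¬ IsSquare n := by
  rintro ⟨m, rfl⟩
  have : m % 4 = 0 ∨ m % 4 = 1 ∨ m % 4 = 2 ∨ m % 4 = 3 := by omega
  rcases this with h | h | h | h <;> simp [Nat.mul_mod, h] at h4

lemma rat_sq_ne {n : ℕ} (h4 : n % 4 = 2) (r : ℚ) : r ^ 2 ≠ n := by
  intro h
  apply nat_not_sq_of h4
  have h1 : IsSquare (n : ℚ) := ⟨r, by rw [← h]; ring⟩
  exact_mod_cast h1

lemma quadField_QF {n : ℕ} (hs : Squarefree n) (h4 : n % 4 = 2) :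
    ∃ _ : NumberField (quadField n), ∃ s : quadField n, QF (quadField n) n s := by
  unfold quadField
  have hsq : ((Real.sqrt n : ℂ)) ^ 2 = n := by
    rw [← Complex.ofReal_pow, Real.sq_sqrt (by positivity)]; simp
  have hintg : IsIntegral ℚ (Real.sqrt n : ℂ) := by
    refine ⟨Polynomial.X ^ 2 - Polynomial.C (n : ℚ), Polynomial.monic_X_pow_sub_C _ (by norm_num), ?_⟩
    simp [hsq]
  have hmin : minpoly ℚ (Real.sqrt n : ℂ) = Polynomial.X ^ 2 - Polynomial.C (n : ℚ) := by
    symm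
    apply minpoly.eq_of_irreducible_of_monic
    · rw [Polynomial.irreducible_iff_roots_eq_zero_of_degree_le_three]
      · rw [Multiset.eq_zero_iff_forall_notMem]
        intro a ha
        have := Polynomial.isRoot_of_mem_roots ha
        simp [sub_eq_zero] at this
        exact rat_sq_ne h4 a this
      · rw [Polynomial.natDegree_X_pow_sub_C]
      · rw [Polynomial.natDegree_X_pow_sub_C]; norm_num
    · simp [hsq]
    · exact Polynomial.monic_X_pow_sub_C _ (by norm_num)
  have hfd : FiniteDimensional ℚ ℚ⟮(Real.sqrt n : ℂ)⟯ := IntermediateField.adjoin.finiteDimensional hintg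
  let e := algHomAdjoinIntegralEquiv (K := ℝ) ℚ hintg
  have hnf : NumberField ℚ⟮(Real.sqrt n : ℂ)⟯ := { to_charZero := inferInstance, to_finiteDimensional := hfd }
  refine ⟨hnf, AdjoinSimple.gen ℚ (Real.sqrt n : ℂ), ?_, ?_, hs, h4, ?_, ?_⟩
  · apply Subtype.ext
    simpa using hsq
  · intro x
    let pb := IntermediateField.adjoin.powerBasis hintg
    have hd : pb.dim = 2 := by
      rw [IntermediateField.adjoin.powerBasis_dim, hmin, Polynomial.natDegree_X_pow_sub_C]
    have : ∃ f : Polynomial ℚ, f.natDegree < 2 ∧ x = Polynomial.aeval pb.gen f := by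
      obtain ⟨f, h1, h2⟩ := pb.exists_eq_aeval x
      exact ⟨f, by rwa [hd] at h1, h2⟩
    obtain ⟨f, h1, h2⟩ := this
    refine ⟨f.coeff 0, f.coeff 1, ?_⟩
    rw [h2, Polynomial.aeval_eq_sum_range' h1]
    simp [Finset.sum_range_succ, Algebra.smul_def]
    left; exact IntermediateField.adjoin.powerBasis_gen hintg
  · refine ⟨(e.symm ⟨√n, ?_⟩ : ℚ⟮(Real.sqrt n : ℂ)⟯ →ₐ[ℚ] ℝ).toRingHom, ?_⟩
    · rw [hmin, Polynomial.mem_aroots]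
      refine ⟨Polynomial.X_pow_sub_C_ne_zero (by norm_num) _, ?_⟩
      simp
    · exact algHomAdjoinIntegralEquiv_symm_apply_gen ℚ hintg _
  · refine ⟨(e.symm ⟨-√n, ?_⟩ : ℚ⟮(Real.sqrt n : ℂ)⟯ →ₐ[ℚ] ℝ).toRingHom, ?_⟩
    · rw [hmin, Polynomial.mem_aroots]
      refine ⟨Polynomial.X_pow_sub_C_ne_zero (by norm_num) _, ?_⟩
      simp
    · exact algHomAdjoinIntegralEquiv_symm_apply_gen ℚ hintg _

section
variable {K : Type*} [Field K] [NumberField K] {n : ℕ} {s : K}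

namespace QF

lemma npos (h : QF K n s) : 0 < n := by have := h.n4; omega

lemma s_ne (h : QF K n s) : s ≠ 0 := by
  intro h0
  have := h.sq
  rw [h0] at this
  have h1 : (n : K) = 0 := by rw [← this]; ring
  have := h.npos
  simp at h1; omega

lemma ext0 (h : QF K n s) {a b : ℚ} (hab : (a : K) + b * s = 0) : a = 0 ∧ b = 0 := by
  have hb : b = 0 := by
    by_contra hb
    have h1 : s = ((-a / b : ℚ) : K) := by
      have : (b : K) ≠ 0 := by exact_mod_cast hb
      push_cast
      field_simp
      linear_combination hab
    have h2 := h.sq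
    rw [h1] at h2
    have h3 : (-a / b) ^ 2 = (n : ℚ) := by exact_mod_cast h2
    exact rat_sq_ne h.n4 _ h3
  subst hb
  simpa using hab

lemma ext' (h : QF K n s) {a b c d : ℚ} (hab : (a : K) + b * s = c + d * s) : a = c ∧ b = d := by
  have := h.ext0 (a := a - c) (b := b - d) (by push_cast; linear_combination hab)
  constructor <;> linarith [this.1, this.2]

lemma norm_eq (h : QF K n s) (a b : ℚ) : Algebra.norm ℚ ((a : K) + b * s) = a ^ 2 - n * b ^ 2 := by
  have hli : LinearIndependent ℚ ![(1 : K), s] := by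
    rw [LinearIndependent.pair_iff]
    intro a b hab
    apply h.ext0
    simpa [Algebra.smul_def] using hab
  have hsp : ⊤ ≤ Submodule.span ℚ (Set.range ![(1 : K), s]) := by
    intro x _
    obtain ⟨a, b, rfl⟩ := h.rep x
    simp only [Matrix.range_cons, Matrix.range_empty, Set.union_empty, Set.singleton_union]
    rw [Submodule.mem_span_pair]
    exact ⟨a, b, by simp [Algebra.smul_def]⟩
  let B := Module.Basis.mk hli hsp
  have hB0 : B 0 = 1 := by simp [B]
  have hB1 : B 1 = s := by simp [B]
  rw [Algebra.norm_eq_matrix_det B, Matrix.det_fin_two]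
  have hr : ∀ c d : ℚ, B.repr ((c : K) + d * s) 0 = c ∧ B.repr ((c : K) + d * s) 1 = d := by
    intro c d
    have : (c : K) + d * s = c • B 0 + d • B 1 := by rw [hB0, hB1]; simp [Algebra.smul_def]
    rw [this]
    simp [Finsupp.single_apply]
  have e1 : ((a : K) + b * s) * B 1 = ((n * b : ℚ) : K) + (a : ℚ) * s := by
    rw [hB1]; push_cast; linear_combination (b : K) * h.sq
  simp only [Algebra.leftMulMatrix_eq_repr_mul]
  rw [e1, hB0, mul_one, (hr _ _).1, (hr _ _).2, (hr _ _).1, (hr _ _).2]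
  ring

end QF
end

lemma rat_int_of_sq_mul {n : ℕ} (hn : Squarefree n) {r : ℚ} {N : ℤ} (h : n * r ^ 2 = N) :
    ∃ B : ℤ, r = B := by
  have hd : (r.den : ℤ) * r.den ∣ n := by
    have h1 : (n : ℤ) * r.num ^ 2 = N * r.den ^ 2 := by
      have hr := Rat.num_div_den r
      rw [← hr] at h
      have : (r.den : ℚ) ≠ 0 := by exact_mod_cast r.den_ne_zero
      field_simp at h
      rw [mul_comm] at h ⊢
      have h' : (r.num : ℚ) ^ 2 * n = N * r.den ^ 2 := by linarith
      exact_mod_cast h'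
    have h2 : IsCoprime ((r.den : ℤ) * r.den) (r.num ^ 2) := by
      have : IsCoprime (r.den : ℤ) r.num := by
        rw [Int.isCoprime_iff_gcd_eq_one]
        have := r.reduced
        rw [Int.gcd_comm]; exact this
      rw [← sq]
      exact IsCoprime.pow this
    exact h2.dvd_of_dvd_mul_right ⟨N, by rw [h1]; ring⟩
  have hd' : r.den * r.den ∣ n := by exact_mod_cast hd
  have := Nat.isUnit_iff.1 (hn _ hd')
  refine ⟨r.num, ?_⟩
  have hr := Rat.num_div_den r
  rw [this] at hr
  simpa using hr.symm

section
variable {K : Type*} [Field K] [NumberField K] {n : ℕ} {s : K}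

namespace QF

lemma phi_s (h : QF K n s) (φ : K →+* ℝ) : φ s = √n ∨ φ s = -√n := by
  have h1 : φ s ^ 2 = √n ^ 2 := by
    rw [← map_pow, h.sq, Real.sq_sqrt (by positivity)]; simp
  exact sq_eq_sq_iff_eq_or_eq_neg.1 h1

lemma totpos_iff (h : QF K n s) (a b : ℚ) :
    (∀ φ : K →+* ℝ, 0 < φ ((a : K) + b * s)) ↔ 0 < a ∧ 0 < a ^ 2 - n * b ^ 2 := by
  have hs2 : (√n) ^ 2 = n := Real.sq_sqrt (by positivity)
  have key : ((a : ℝ) + b * √n) * (a - b * √n) = ((a ^ 2 - n * b ^ 2 : ℚ) : ℝ) := by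
    push_cast; linear_combination - (b : ℝ) ^ 2 * hs2
  constructor
  · intro H
    obtain ⟨φ, hφ⟩ := h.p1
    obtain ⟨ψ, hψ⟩ := h.p2
    have h1 := H φ
    have h2 := H ψ
    simp [hφ, hψ] at h1 h2
    have h3 : (0 : ℝ) < a := by linarith
    have h4 : (0 : ℝ) < ((a ^ 2 - n * b ^ 2 : ℚ) : ℝ) := by
      rw [← key]; exact mul_pos h1 (by linarith)
    exact ⟨by exact_mod_cast h3, by exact_mod_cast h4⟩
  · rintro ⟨ha, hN⟩ φ
    have ha' : (0 : ℝ) < a := by exact_mod_cast ha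
    have hN' : (0 : ℝ) < ((a ^ 2 - n * b ^ 2 : ℚ) : ℝ) := by exact_mod_cast hN
    rw [← key] at hN'
    have : 0 < (a : ℝ) + b * √n ∧ 0 < (a : ℝ) - b * √n := by
      rcases pos_and_pos_or_neg_and_neg_of_mul_pos hN' with h | h
      · exact h
      · exfalso; linarith [h.1, h.2]
    rcases h.phi_s φ with h1 | h1 <;> simp [h1] <;> linarith [this.1, this.2]

lemma int_iff (h : QF K n s) (a b : ℚ) :
    IsIntegral ℤ ((a : K) + b * s) ↔ ∃ A B : ℤ, a = A ∧ b = B := by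
  constructor
  · intro H
    have hN : ∀ y : K, IsIntegral ℤ y → ∃ N : ℤ, Algebra.norm ℚ y = N := by
      intro y hy
      have := Algebra.isIntegral_norm ℚ hy
      obtain ⟨N, hN⟩ := IsIntegrallyClosed.isIntegral_iff.1 this
      exact ⟨N, by simpa using hN.symm⟩
    obtain ⟨N, hN1⟩ := hN _ H
    obtain ⟨N', hN2⟩ := hN _ (H.add isIntegral_one)
    have e : (a : K) + b * s + 1 = ((a + 1 : ℚ) : K) + b * s := by push_cast; ring
    rw [e, h.norm_eq] at hN2
    rw [h.norm_eq] at hN1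
    set A' : ℤ := N' - N - 1 with hA'
    have ha : 2 * a = A' := by rw [hA']; push_cast; linarith
    have hb : n * (2 * b) ^ 2 = ((A' ^ 2 - 4 * N : ℤ) : ℚ) := by
      push_cast; rw [← ha, ← hN1]; ring
    obtain ⟨B', hB'⟩ := rat_int_of_sq_mul h.sqf hb
    rw [hB'] at hb
    have hz : (n : ℤ) * B' ^ 2 = A' ^ 2 - 4 * N := by exact_mod_cast hb
    have hn4 : (n : ℤ) % 4 = 2 := by have := h.n4; omega
    obtain ⟨q, hq⟩ : ∃ q : ℤ, (n : ℤ) = 4 * q + 2 := ⟨n / 4, by omega⟩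
    rw [hq] at hz
    have hA2 : Even A' := by
      rcases Int.even_or_odd A' with h | ⟨c, hc⟩
      · exact h
      · exfalso; rw [hc] at hz; ring_nf at hz; omega
    obtain ⟨c, hc⟩ := hA2
    have hB2 : Even B' := by
      rcases Int.even_or_odd B' with h | ⟨e, he⟩
      · exact h
      · exfalso; rw [hc, he] at hz; ring_nf at hz; omega
    obtain ⟨e, he⟩ := hB2
    refine ⟨c, e, ?_, ?_⟩
    · rw [hc] at ha; push_cast at ha; linarith
    · rw [he] at hB'; push_cast at hB'; linarith
  · rintro ⟨A, B, rfl, rfl⟩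
    have hs : IsIntegral ℤ s := by
      refine IsIntegral.of_pow (n := 2) (by norm_num) ?_
      rw [h.sq]
      exact_mod_cast isIntegral_algebraMap (R := ℤ) (x := (n : ℤ))
    have hA : ∀ A : ℤ, IsIntegral ℤ (((A : ℚ) : K)) := fun A => by
      have := isIntegral_algebraMap (R := ℤ) (A := K) (x := A)
      simpa using this
    exact (hA A).add ((hA B).mul hs)

/-- integers of K -/
lemma s_int (h : QF K n s) : IsIntegral ℤ s := by
  have := (h.int_iff 0 1).2 ⟨0, 1, by simp, by simp⟩
  simpa using this

lemma norm_pos_tp (h : QF K n s) {x : K} (hx : ∀ φ : K →+* ℝ, 0 < φ x) :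
    0 < Algebra.norm ℚ x := by
  obtain ⟨a, b, rfl⟩ := h.rep x
  rw [h.norm_eq]
  exact ((h.totpos_iff a b).1 hx).2

lemma tp_of_norm_pos (h : QF K n s) {x : K} (hx : 0 < Algebra.norm ℚ x) :
    (∀ φ : K →+* ℝ, 0 < φ x) ∨ (∀ φ : K →+* ℝ, 0 < φ (-x)) := by
  obtain ⟨a, b, rfl⟩ := h.rep x
  rw [h.norm_eq] at hx
  have hn : (0 : ℚ) ≤ n * b ^ 2 := by positivity
  rcases lt_trichotomy a 0 with h1 | h1 | h1
  · right
    have := (h.totpos_iff (-a) (-b)).2 ⟨by linarith, by linarith⟩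
    intro φ
    have := this φ
    convert this using 2
    push_cast; ring
  · exfalso; rw [h1] at hx; nlinarith
  · left; exact (h.totpos_iff a b).2 ⟨h1, hx⟩

lemma tp_ne (h : QF K n s) {x : K} (hx : ∀ φ : K →+* ℝ, 0 < φ x) : x ≠ 0 := by
  rintro rfl
  obtain ⟨φ, _⟩ := h.p1
  simpa using hx φ

lemma tp_rat (h : QF K n s) {r : ℚ} (hr : 0 < r) : ∀ φ : K →+* ℝ, 0 < φ (r : K) := by
  intro φ; simpa using hr

end QF

lemma tp_inv {x : K} (hx : ∀ φ : K →+* ℝ, 0 < φ x) : ∀ φ : K →+* ℝ, 0 < φ x⁻¹ := by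
  intro φ; rw [map_inv₀]; exact inv_pos.2 (hx φ)

lemma tp_mul {x y : K} (hx : ∀ φ : K →+* ℝ, 0 < φ x) (hy : ∀ φ : K →+* ℝ, 0 < φ y) :
    ∀ φ : K →+* ℝ, 0 < φ (x * y) := by
  intro φ; rw [map_mul]; exact mul_pos (hx φ) (hy φ)

/-- principal fractional ideal as a unit -/
noncomputable def pr (x : K) (hx : x ≠ 0) : (FractionalIdeal (𝓞 K)⁰ K)ˣ :=
  Units.mk0 (FractionalIdeal.spanSingleton (𝓞 K)⁰ x) (FractionalIdeal.spanSingleton_ne_zero_iff.2 hx)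

lemma pr_val (x : K) (hx : x ≠ 0) :
    ((pr x hx : (FractionalIdeal (𝓞 K)⁰ K)ˣ) : FractionalIdeal (𝓞 K)⁰ K) =
      FractionalIdeal.spanSingleton (𝓞 K)⁰ x := rfl

lemma pr_mul (x y : K) (hx : x ≠ 0) (hy : y ≠ 0) :
    pr x hx * pr y hy = pr (x * y) (mul_ne_zero hx hy) := by
  apply Units.ext
  simp [pr_val]

lemma pr_congr {x y : K} (hx : x ≠ 0) (h : x = y) : pr x hx = pr y (h ▸ hx) := by
  subst h; rfl

lemma pr_neg (x : K) (hx : x ≠ 0) : pr (-x) (neg_ne_zero.2 hx) = pr x hx := by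
  apply Units.ext
  rw [pr_val, pr_val]
  apply le_antisymm <;> rw [FractionalIdeal.spanSingleton_le_iff_mem, FractionalIdeal.mem_spanSingleton]
  · exact ⟨-1, by simp⟩
  · exact ⟨-1, by simp⟩

lemma mem_sp_iff (x y : K) : y ∈ FractionalIdeal.spanSingleton (𝓞 K)⁰ x ↔
    ∃ z : K, IsIntegral ℤ z ∧ y = z * x := by
  rw [FractionalIdeal.mem_spanSingleton]
  constructor
  · rintro ⟨z, rfl⟩
    exact ⟨z, z.isIntegral_coe, by rw [Algebra.smul_def]⟩
  · rintro ⟨z, hz, rfl⟩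
    exact ⟨(⟨z, hz⟩ : integralClosure ℤ K), rfl⟩

lemma mem_one_iff' (y : K) : y ∈ (1 : FractionalIdeal (𝓞 K)⁰ K) ↔ IsIntegral ℤ y := by
  rw [← FractionalIdeal.spanSingleton_one, mem_sp_iff]
  simp

lemma narrow_mem (I : (FractionalIdeal (𝓞 K)⁰ K)ˣ) :
    I ∈ narrowPrincipals K ↔ ∃ (x : K) (hx : x ≠ 0), (∀ φ : K →+* ℝ, 0 < φ x) ∧ I = pr x hx := by
  constructor
  · intro h
    refine Subgroup.closure_induction (p := fun I _ => ∃ (x : K) (hx : x ≠ 0), (∀ φ : K →+* ℝ, 0 < φ x) ∧ I = pr x hx) ?_ ?_ ?_ ?_ h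
    · rintro J ⟨x, hx, hJ⟩
      have h0 : x ≠ 0 := by
        rintro rfl
        have h1 : (J : FractionalIdeal (𝓞 K)⁰ K) = 0 := by
          apply FractionalIdeal.coeToSubmodule_injective
          beta_reduce; rw [hJ]; simp
        exact J.ne_zero h1
      refine ⟨x, h0, hx, ?_⟩
      apply Units.ext
      apply FractionalIdeal.coeToSubmodule_injective
      simp only [hJ, pr_val, FractionalIdeal.coe_spanSingleton]
    · refine ⟨1, one_ne_zero, by simp, ?_⟩
      apply Units.ext
      simp [pr_val]
    · rintro _ _ _ _ ⟨x, hx, hx1, rfl⟩ ⟨y, hy, hy1, rfl⟩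
      exact ⟨x * y, mul_ne_zero hx hy, tp_mul hx1 hy1, pr_mul _ _ _ _⟩
    · rintro _ _ ⟨x, hx, hx1, rfl⟩
      refine ⟨x⁻¹, inv_ne_zero hx, tp_inv hx1, ?_⟩
      rw [inv_eq_iff_mul_eq_one, pr_mul]
      apply Units.ext
      simp [pr_val, hx]
  · rintro ⟨x, hx, h1, rfl⟩
    apply Subgroup.subset_closure
    exact ⟨x, h1, by rw [pr_val, FractionalIdeal.coe_spanSingleton]⟩

lemma le_one_of_sq_le (z : FractionalIdeal (𝓞 K)⁰ K) (hz : z ^ 2 ≤ 1) : z ≤ 1 := by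
  intro x hx
  rw [mem_one_iff']
  have h1 : x * x ∈ z ^ 2 := by rw [sq]; exact FractionalIdeal.mul_mem_mul hx hx
  have h2 := (mem_one_iff' _).1 (hz h1)
  exact IsIntegral.of_pow (n := 2) (by norm_num) (by rwa [sq])

lemma tf1 (z : (FractionalIdeal (𝓞 K)⁰ K)ˣ) (hz : z ^ 2 = 1) : z = 1 := by
  have h1 : ∀ w : (FractionalIdeal (𝓞 K)⁰ K)ˣ, w ^ 2 = 1 → (w : FractionalIdeal (𝓞 K)⁰ K) ≤ 1 := by
    intro w hw
    apply le_one_of_sq_le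
    have := congrArg Units.val hw
    push_cast at this
    exact this.le
  apply Units.ext
  apply le_antisymm
  · simpa using h1 z hz
  · have := h1 z⁻¹ (by rw [inv_pow, hz, inv_one])
    calc ((1 : (FractionalIdeal (𝓞 K)⁰ K)ˣ) : FractionalIdeal (𝓞 K)⁰ K) = (z : FractionalIdeal (𝓞 K)⁰ K) * ((z⁻¹ : (FractionalIdeal (𝓞 K)⁰ K)ˣ) : FractionalIdeal (𝓞 K)⁰ K) := by
          rw [← Units.val_mul]; simp
      _ ≤ z * 1 := by gcongr
      _ = z := mul_one _

lemma tf (y z : (FractionalIdeal (𝓞 K)⁰ K)ˣ) (hz : y ^ 2 = z ^ 2) : y = z := by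
  have := tf1 (y * z⁻¹) (by rw [mul_pow, hz, inv_pow, mul_inv_cancel])
  exact mul_inv_eq_one.1 this

end

section
variable {K : Type*} [Field K] [NumberField K] {n : ℕ} {s : K}

lemma int_natCast (D : ℕ) : IsIntegral ℤ (D : K) := by
  simpa using isIntegral_algebraMap (R := ℤ) (A := K) (x := (D : ℤ))

lemma int_intCast (D : ℤ) : IsIntegral ℤ (D : K) := by
  simpa using isIntegral_algebraMap (R := ℤ) (A := K) (x := D)

lemma fi_mem_smul {I : FractionalIdeal (𝓞 K)⁰ K} {x z : K} (hz : IsIntegral ℤ z) (hx : x ∈ I) :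
    z * x ∈ I := by
  have : (FractionalIdeal.spanSingleton (𝓞 K)⁰ x) ≤ I := FractionalIdeal.spanSingleton_le_iff_mem.2 hx
  exact this ((mem_sp_iff _ _).2 ⟨z, hz, rfl⟩)

lemma fi_mem_add {I : FractionalIdeal (𝓞 K)⁰ K} {x z : K} (hz : z ∈ I) (hx : x ∈ I) :
    z + x ∈ I := Submodule.add_mem _ hz hx

lemma fi_mem_sub {I : FractionalIdeal (𝓞 K)⁰ K} {x z : K} (hz : z ∈ I) (hx : x ∈ I) :
    z - x ∈ I := Submodule.sub_mem _ hz hx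

/-- the ideal `(D, s)` -/
noncomputable def dI (s : K) (D : ℕ) : FractionalIdeal (𝓞 K)⁰ K :=
  FractionalIdeal.spanSingleton (𝓞 K)⁰ (D : K) + FractionalIdeal.spanSingleton (𝓞 K)⁰ s

lemma mem_dI (s : K) (D : ℕ) : (D : K) ∈ dI s D ∧ s ∈ dI s D := by
  constructor
  · exact (le_sup_left : FractionalIdeal.spanSingleton (𝓞 K)⁰ (D : K) ≤ FractionalIdeal.spanSingleton (𝓞 K)⁰ (D : K) ⊔ FractionalIdeal.spanSingleton (𝓞 K)⁰ s) (FractionalIdeal.mem_spanSingleton_self _ _)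
  · exact (le_sup_right : FractionalIdeal.spanSingleton (𝓞 K)⁰ s ≤ FractionalIdeal.spanSingleton (𝓞 K)⁰ (D : K) ⊔ FractionalIdeal.spanSingleton (𝓞 K)⁰ s) (FractionalIdeal.mem_spanSingleton_self _ _)

lemma add_le_fi {I J L : FractionalIdeal (𝓞 K)⁰ K} (h1 : I ≤ L) (h2 : J ≤ L) : I + J ≤ L :=
  (sup_le h1 h2 : I ⊔ J ≤ L)

lemma QF.cop (h : QF K n s) {D m : ℕ} (hDm : D * m = n) : Nat.Coprime D m := by
  have := h.sqf
  rw [← hDm] at this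
  exact (Nat.squarefree_mul_iff.1 this).1

lemma dI_sq (h : QF K n s) {D m : ℕ} (hDm : D * m = n) :
    dI s D ^ 2 = FractionalIdeal.spanSingleton (𝓞 K)⁰ (D : K) := by
  have hn : (D : K) * m = n := by exact_mod_cast congrArg (Nat.cast (R := K)) hDm
  obtain ⟨hD, hs⟩ := mem_dI s D
  apply le_antisymm
  · rw [sq, dI, add_mul, mul_add, mul_add]
    simp only [FractionalIdeal.spanSingleton_mul_spanSingleton]
    refine add_le_fi (add_le_fi ?_ ?_) (add_le_fi ?_ ?_) <;>
      rw [FractionalIdeal.spanSingleton_le_iff_mem, mem_sp_iff]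
    · exact ⟨D, int_natCast D, rfl⟩
    · exact ⟨s, h.s_int, by ring⟩
    · exact ⟨s, h.s_int, by ring⟩
    · exact ⟨m, int_natCast m, by rw [← sq, h.sq, ← hn]; ring⟩
  · rw [FractionalIdeal.spanSingleton_le_iff_mem, sq]
    have hc : IsCoprime (D : ℤ) (m : ℤ) := Nat.isCoprime_iff_coprime.2 (h.cop hDm)
    obtain ⟨a, b, hab⟩ := hc
    have e : (D : K) = a * (D * D) + b * (s * s) := by
      have : ((a * D + b * m : ℤ) : K) = 1 := by rw [hab]; simp
      push_cast at this
      rw [← sq s, h.sq, ← hn]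
      linear_combination (-(D : K)) * this
    rw [e]
    exact fi_mem_add (fi_mem_smul (int_intCast a) (FractionalIdeal.mul_mem_mul hD hD))
      (fi_mem_smul (int_intCast b) (FractionalIdeal.mul_mem_mul hs hs))

lemma dI_ne (s : K) {D : ℕ} (hD : 0 < D) : dI s D ≠ 0 := by
  intro h0
  have := (mem_dI s D).1
  rw [h0] at this
  have h1 := FractionalIdeal.mem_zero_iff (S := (𝓞 K)⁰) (P := K) |>.1 this
  simp at h1; omega

/-- `(D, s)` as a unit (junk if `D = 0`). -/
noncomputable def dU (s : K) (D : ℕ) : (FractionalIdeal (𝓞 K)⁰ K)ˣ :=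
  if hD : 0 < D then Units.mk0 (dI s D) (dI_ne s hD) else 1

lemma dU_val (s : K) {D : ℕ} (hD : 0 < D) : (dU s D : FractionalIdeal (𝓞 K)⁰ K) = dI s D := by
  simp [dU, hD]

lemma QF.Dpos (h : QF K n s) {D m : ℕ} (hDm : D * m = n) : 0 < D := by
  rcases Nat.eq_zero_or_pos D with h0 | h0
  · subst h0; have := h.npos; omega
  · exact h0

lemma ncast_ne {D : ℕ} (hD : 0 < D) : (D : K) ≠ 0 := by
  exact_mod_cast hD.ne'

lemma dU_sq (h : QF K n s) {D m : ℕ} (hDm : D * m = n) :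
    dU s D ^ 2 = pr (D : K) (ncast_ne (h.Dpos hDm)) := by
  apply Units.ext
  rw [Units.val_pow_eq_pow_val, dU_val s (h.Dpos hDm), pr_val, dI_sq h hDm]

lemma F3 (h : QF K n s) {D : ℕ} (hD : Squarefree D) (c : (FractionalIdeal (𝓞 K)⁰ K)ˣ)
    (hc : c ^ 2 = pr (D : K) (ncast_ne (Nat.pos_of_ne_zero hD.ne_zero))) : D ∣ n := by
  have hc' : (c : FractionalIdeal (𝓞 K)⁰ K) ^ 2 = FractionalIdeal.spanSingleton (𝓞 K)⁰ (D : K) := by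
    rw [← Units.val_pow_eq_pow_val, hc, pr_val]
  have hc1 : (c : FractionalIdeal (𝓞 K)⁰ K) ≤ 1 := by
    apply le_one_of_sq_le
    rw [hc', FractionalIdeal.spanSingleton_le_iff_mem, mem_one_iff']
    exact int_natCast D
  rw [← Nat.prod_primeFactors_of_squarefree hD]
  apply Finset.prod_primes_dvd
  · intro p hp; exact (Nat.prime_of_mem_primeFactors hp).prime
  intro p hp
  have hpp := Nat.prime_of_mem_primeFactors hp
  have hpD := Nat.dvd_of_mem_primeFactors hp
  by_contra hpn
  have hp2 : p ≠ 2 := by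
    rintro rfl
    have := h.n4; omega
  have hpZ : Prime (p : ℤ) := Nat.prime_iff_prime_int.1 hpp
  have hcp : (c : FractionalIdeal (𝓞 K)⁰ K) ≤ FractionalIdeal.spanSingleton (𝓞 K)⁰ (p : K) := by
    intro x hx
    have hxi := (mem_one_iff' _).1 (hc1 hx)
    obtain ⟨a, b, rfl⟩ := h.rep x
    obtain ⟨A, B, rfl, rfl⟩ := (h.int_iff a b).1 hxi
    have h2 := FractionalIdeal.mul_mem_mul hx hx
    rw [← sq (c : FractionalIdeal (𝓞 K)⁰ K), hc', mem_sp_iff] at h2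
    obtain ⟨z, hz, hz2⟩ := h2
    obtain ⟨e, f, rfl⟩ := h.rep z
    obtain ⟨E, F, rfl, rfl⟩ := (h.int_iff e f).1 hz
    have h3 := h.ext' (a := A ^ 2 + n * B ^ 2) (b := 2 * A * B) (c := E * D) (d := F * D) (by
      have := h.sq
      push_cast at hz2 ⊢
      linear_combination hz2 - (B : K) ^ 2 * this)
    have h4 : A ^ 2 + n * B ^ 2 = E * D := by exact_mod_cast h3.1
    have h5 : 2 * A * B = F * D := by exact_mod_cast h3.2
    have hpD' : (p : ℤ) ∣ D := by exact_mod_cast hpD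
    have d1 : (p : ℤ) ∣ A ^ 2 + n * B ^ 2 := h4 ▸ hpD'.mul_left E
    have d2 : (p : ℤ) ∣ 2 * A * B := h5 ▸ hpD'.mul_left F
    have hpn' : ¬ (p : ℤ) ∣ n := by exact_mod_cast hpn
    have hp2' : ¬ (p : ℤ) ∣ 2 := by
      intro hh
      have : p ∣ 2 := by exact_mod_cast hh
      exact hp2 ((Nat.prime_dvd_prime_iff_eq hpp Nat.prime_two).1 this)
    have hAB : (p : ℤ) ∣ A ∧ (p : ℤ) ∣ B := by
      rcases hpZ.dvd_or_dvd d2 with hh | hh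
      · have hA := (hpZ.dvd_or_dvd hh).resolve_left hp2'
        refine ⟨hA, ?_⟩
        have : (p : ℤ) ∣ n * B ^ 2 := (Int.dvd_add_right (dvd_pow hA (by norm_num))).1 d1
        exact hpZ.dvd_of_dvd_pow ((hpZ.dvd_or_dvd this).resolve_left hpn')
      · refine ⟨?_, hh⟩
        have : (p : ℤ) ∣ A ^ 2 := (Int.dvd_add_left ((dvd_pow hh (by norm_num)).mul_left _)).1 d1
        exact hpZ.dvd_of_dvd_pow this
    obtain ⟨⟨A', rfl⟩, ⟨B', rfl⟩⟩ := hAB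
    rw [mem_sp_iff]
    exact ⟨((A' : ℚ) : K) + ((B' : ℚ) : K) * s, (h.int_iff _ _).2 ⟨A', B', rfl, rfl⟩, by push_cast; ring⟩
  have h6 : (D : K) ∈ FractionalIdeal.spanSingleton (𝓞 K)⁰ ((p : K) * p) := by
    rw [← FractionalIdeal.spanSingleton_mul_spanSingleton]
    have : FractionalIdeal.spanSingleton (𝓞 K)⁰ (D : K) ≤ FractionalIdeal.spanSingleton (𝓞 K)⁰ (p : K) * FractionalIdeal.spanSingleton (𝓞 K)⁰ (p : K) := by
      rw [← hc', sq]; exact mul_le_mul' hcp hcp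
    exact this (FractionalIdeal.mem_spanSingleton_self _ _)
  rw [mem_sp_iff] at h6
  obtain ⟨z, hz, hz2⟩ := h6
  obtain ⟨e, f, rfl⟩ := h.rep z
  obtain ⟨E, F, rfl, rfl⟩ := (h.int_iff e f).1 hz
  have h3 := h.ext' (a := D) (b := 0) (c := E * (p * p)) (d := F * (p * p)) (by
      push_cast at hz2 ⊢
      linear_combination hz2)
  have h4 : (D : ℤ) = E * (p * p) := by exact_mod_cast h3.1
  have h5 : p * p ∣ D := by
    have : ((p * p : ℕ) : ℤ) ∣ D := ⟨E, by rw [h4]; push_cast; ring⟩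
    exact_mod_cast this
  exact hpp.one_lt.ne' (Nat.isUnit_iff.1 (hD p h5))

lemma pr_pow_two (x : K) (hx : x ≠ 0) : pr x hx ^ 2 = pr (x ^ 2) (pow_ne_zero 2 hx) := by
  rw [sq, pr_mul]; exact pr_congr _ (sq x).symm

lemma pr_inv (x : K) (hx : x ≠ 0) : (pr x hx)⁻¹ = pr x⁻¹ (inv_ne_zero hx) := by
  rw [inv_eq_iff_mul_eq_one, pr_mul]
  apply Units.ext
  simp [pr_val, hx]

lemma pr_eq_iff_mem {x y : K} (hx : x ≠ 0) (hy : y ≠ 0) (h : pr x hx = pr y hy) :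
    ∃ z : K, IsIntegral ℤ z ∧ x = z * y := by
  have h1 := congrArg Units.val h
  rw [pr_val, pr_val] at h1
  exact (mem_sp_iff _ _).1 (h1 ▸ FractionalIdeal.mem_spanSingleton_self _ _)

/-- rational numbers up to squares -/
lemma rat_sqfree {r : ℚ} (hr : 0 < r) : ∃ D : ℕ, ∃ t : ℚ, Squarefree D ∧ 0 < t ∧ r = D * t ^ 2 := by
  have h0 : r.num.toNat * r.den ≠ 0 := by
    have := r.num_pos.2 hr
    have := r.den_ne_zero
    simp; omega
  obtain ⟨a, b, hab, ha⟩ := Nat.sq_mul_squarefree (r.num.toNat * r.den)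
  have hb : b ≠ 0 := by rintro rfl; simp at hab; linarith
  refine ⟨a, b / r.den, ha, ?_, ?_⟩
  · have := r.den_ne_zero
    positivity
  · have h1 : ((b ^ 2 * a : ℕ) : ℚ) = r.num * r.den := by
      rw [hab]; push_cast
      congr 1
      have : ((r.num.toNat : ℤ) : ℚ) = r.num := by rw [Int.toNat_of_nonneg (r.num_pos.2 hr).le]
      exact_mod_cast this
    have h2 := Rat.num_div_den r
    have h3 : (r.den : ℚ) ≠ 0 := by exact_mod_cast r.den_ne_zero
    push_cast at h1
    rw [div_pow, mul_div_assoc', mul_comm (a : ℚ), h1]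
    rw [eq_div_iff (pow_ne_zero 2 h3)]
    linear_combination (r.den : ℚ) * Rat.mul_den_eq_num r

end

/-- nontrivial solvability of `t² + m y² = D z²` -/
def TSol (D m : ℕ) : Prop :=
  ∃ z y t : ℤ, (z ≠ 0 ∨ y ≠ 0 ∨ t ≠ 0) ∧ t ^ 2 + m * y ^ 2 = D * z ^ 2

lemma TSol.prim {D m : ℕ} (h : TSol D m) : ∃ z y t : ℤ, t ^ 2 + m * y ^ 2 = D * z ^ 2 ∧
    ∀ p : ℕ, p.Prime → ¬ ((p : ℤ) ∣ z ∧ (p : ℤ) ∣ y ∧ (p : ℤ) ∣ t) := by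
  obtain ⟨z, y, t, h0, h1⟩ := h
  induction hN : z.natAbs + y.natAbs + t.natAbs using Nat.strong_induction_on generalizing z y t with
  | _ N ih =>
    by_cases hp : ∀ p : ℕ, p.Prime → ¬ ((p : ℤ) ∣ z ∧ (p : ℤ) ∣ y ∧ (p : ℤ) ∣ t)
    · exact ⟨z, y, t, h1, hp⟩
    · push Not at hp
      obtain ⟨p, hp, ⟨z', rfl⟩, ⟨y', rfl⟩, ⟨t', rfl⟩⟩ := hp
      have hp0 : (p : ℤ) ≠ 0 := by exact_mod_cast hp.ne_zero
      refine ih _ ?_ z' y' t' ?_ ?_ rfl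
      · rw [← hN]
        simp only [Int.natAbs_mul, Int.natAbs_natCast]
        rw [← mul_add, ← mul_add]
        have : 0 < z'.natAbs + y'.natAbs + t'.natAbs := by
          rcases h0 with h | h | h <;> simp [hp0] at h <;> omega
        nlinarith [hp.two_le]
      · simpa [hp.ne_zero] using h0
      · have : (p : ℤ) ^ 2 * (t' ^ 2 + m * y' ^ 2) = p ^ 2 * (D * z' ^ 2) := by linear_combination h1
        exact mul_left_cancel₀ (pow_ne_zero 2 hp0) this

lemma prime_sq_dvd {p : ℕ} (hp : p.Prime) {D : ℕ} (hD : Squarefree D) {z : ℤ}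
    (h : (p : ℤ) ^ 2 ∣ D * z ^ 2) : (p : ℤ) ∣ z := by
  have hpZ : Prime (p : ℤ) := Nat.prime_iff_prime_int.1 hp
  by_contra hz
  have hc : IsCoprime ((p : ℤ) ^ 2) (z ^ 2) := by
    apply IsCoprime.pow
    exact (Irreducible.coprime_iff_not_dvd hpZ.irreducible).2 hz
  have := hc.dvd_of_dvd_mul_right h
  have h2 : p * p ∣ D := by rw [← sq]; exact_mod_cast this
  exact hp.one_lt.ne' (Nat.isUnit_iff.1 (hD p h2))

/-- consequences of primitivity -/
lemma TSol.prim' {D m n : ℕ} (hn : Squarefree n) (hDm : D * m = n) {z y t : ℤ}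
    (h : t ^ 2 + m * y ^ 2 = D * z ^ 2)
    (hp : ∀ p : ℕ, p.Prime → ¬ ((p : ℤ) ∣ z ∧ (p : ℤ) ∣ y ∧ (p : ℤ) ∣ t)) :
    (∀ p : ℕ, p.Prime → ¬ ((p : ℤ) ∣ t ∧ (p : ℤ) ∣ y)) ∧
    (∀ p : ℕ, p.Prime → p ∣ n → ¬ (p : ℤ) ∣ t) ∧
    (∀ p : ℕ, p.Prime → p ∣ m → ¬ (p : ℤ) ∣ z) ∧
    (∀ p : ℕ, p.Prime → p ∣ D → ¬ (p : ℤ) ∣ y) := by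
  have hDm' := hn
  rw [← hDm] at hDm'
  obtain ⟨hc, hD, hm⟩ := Nat.squarefree_mul_iff.1 hDm'
  have A1 : ∀ p : ℕ, p.Prime → ¬ ((p : ℤ) ∣ t ∧ (p : ℤ) ∣ y) := by
    rintro p hpp ⟨⟨t', ht⟩, ⟨y', hy⟩⟩
    refine hp p hpp ⟨?_, ⟨y', hy⟩, ⟨t', ht⟩⟩
    apply prime_sq_dvd hpp hD
    rw [← h, ht, hy]
    exact ⟨t' ^ 2 + m * y' ^ 2, by ring⟩
  have A2 : ∀ p : ℕ, p.Prime → (p : ℤ) ∣ t → (p : ℤ) ∣ z → False := by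
    rintro p hpp ⟨t', ht⟩ ⟨z', hz⟩
    apply A1 p hpp ⟨⟨t', ht⟩, ?_⟩
    apply prime_sq_dvd hpp hm
    have : m * y ^ 2 = D * z ^ 2 - t ^ 2 := by linarith
    rw [this, ht, hz]
    exact ⟨D * z' ^ 2 - t' ^ 2, by ring⟩
  have A3 : ∀ p : ℕ, p.Prime → p ∣ m → ¬ (p : ℤ) ∣ z := by
    intro p hpp hpm hz
    have hpZ : Prime (p : ℤ) := Nat.prime_iff_prime_int.1 hpp
    refine A2 p hpp ?_ hz
    apply hpZ.dvd_of_dvd_pow (n := 2)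
    have : t ^ 2 = D * z ^ 2 - m * y ^ 2 := by linarith
    rw [this]
    have hpm' : (p : ℤ) ∣ m := by exact_mod_cast hpm
    exact dvd_sub ((dvd_pow hz (by norm_num)).mul_left _) (hpm'.mul_right _)
  have A4 : ∀ p : ℕ, p.Prime → p ∣ D → ¬ (p : ℤ) ∣ y := by
    intro p hpp hpm hz
    have hpZ : Prime (p : ℤ) := Nat.prime_iff_prime_int.1 hpp
    refine A1 p hpp ⟨?_, hz⟩
    apply hpZ.dvd_of_dvd_pow (n := 2)
    have : t ^ 2 = D * z ^ 2 - m * y ^ 2 := by linarith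
    rw [this]
    have hpm' : (p : ℤ) ∣ D := by exact_mod_cast hpm
    exact dvd_sub (hpm'.mul_right _) ((dvd_pow hz (by norm_num)).mul_left _)
  refine ⟨A1, ?_, A3, A4⟩
  intro p hpp hpn ht
  have hpZ : Prime (p : ℤ) := Nat.prime_iff_prime_int.1 hpp
  rw [← hDm] at hpn
  have ht2 : (p : ℤ) ∣ t ^ 2 := dvd_pow ht (by norm_num)
  rcases hpp.dvd_mul.1 hpn with hh | hh
  · have hh' : (p : ℤ) ∣ D := by exact_mod_cast hh
    have : (p : ℤ) ∣ m * y ^ 2 := (Int.dvd_add_right ht2).1 (h ▸ hh'.mul_right _)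
    rcases hpZ.dvd_or_dvd this with h1 | h1
    · have : p ∣ m := by exact_mod_cast h1
      exact Nat.not_coprime_of_dvd_of_dvd hpp.one_lt hh this hc
    · exact A4 p hpp hh (hpZ.dvd_of_dvd_pow h1)
  · have hh' : (p : ℤ) ∣ m := by exact_mod_cast hh
    have : (p : ℤ) ∣ D * z ^ 2 := h ▸ dvd_add ht2 (hh'.mul_right _)
    rcases hpZ.dvd_or_dvd this with h1 | h1
    · have : p ∣ D := by exact_mod_cast h1
      exact Nat.not_coprime_of_dvd_of_dvd hpp.one_lt this hh hc
    · exact A3 p hpp hh (hpZ.dvd_of_dvd_pow h1)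

lemma int_cop_of {a b : ℤ} (h : ∀ p : ℕ, p.Prime → ¬ ((p : ℤ) ∣ a ∧ (p : ℤ) ∣ b)) : IsCoprime a b := by
  rw [Int.isCoprime_iff_gcd_eq_one]
  by_contra h1
  obtain ⟨p, hp, hpd⟩ := Nat.exists_prime_and_dvd h1
  refine h p hp ⟨?_, ?_⟩
  · exact (Int.natCast_dvd_natCast.2 hpd).trans (Int.gcd_dvd_left _ _)
  · exact (Int.natCast_dvd_natCast.2 hpd).trans (Int.gcd_dvd_right _ _)

section
variable {K : Type*} [Field K] [NumberField K] {n : ℕ} {s : K}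

lemma norm_TSol (h : QF K n s) {D m : ℕ} (hDm : D * m = n) {x : K} (hx : Algebra.norm ℚ x = D) :
    TSol D m := by
  obtain ⟨a, b, rfl⟩ := h.rep x
  rw [h.norm_eq] at hx
  have hDm' := h.sqf
  rw [← hDm] at hDm'
  obtain ⟨hc, hD, hm⟩ := Nat.squarefree_mul_iff.1 hDm'
  set q : ℤ := a.den * b.den with hq
  have hq0 : q ≠ 0 := by simp [hq]
  set A : ℤ := a.num * b.den with hA
  set B : ℤ := b.num * a.den with hB
  have ha : a * q = A := by
    rw [hq, hA]; push_cast; rw [← mul_assoc, Rat.mul_den_eq_num]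
  have hb : b * q = B := by
    rw [hq, hB]; push_cast; rw [mul_comm (a.den : ℚ), ← mul_assoc, Rat.mul_den_eq_num]
  have h1 : A ^ 2 - n * B ^ 2 = D * q ^ 2 := by
    have : ((A ^ 2 - n * B ^ 2 : ℤ) : ℚ) = ((D * q ^ 2 : ℤ) : ℚ) := by
      push_cast; rw [← ha, ← hb, ← hx]; ring
    exact_mod_cast this
  have hDA : (D : ℤ) ∣ A := by
    have : (D : ℤ) ∣ A ^ 2 := ⟨q ^ 2 + m * B ^ 2, by
      rw [← hDm] at h1; push_cast at h1; linear_combination h1⟩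
    have hD' : Squarefree (D : ℤ) := Int.squarefree_natCast.2 hD
    exact (hD'.dvd_pow_iff_dvd (by norm_num)).1 this
  obtain ⟨z, hz⟩ := hDA
  refine ⟨z, B, q, Or.inr (Or.inr hq0), ?_⟩
  have hD0 : (D : ℤ) ≠ 0 := by exact_mod_cast hD.ne_zero
  apply mul_left_cancel₀ hD0
  rw [hz, ← hDm] at h1
  push_cast at h1
  linear_combination -h1

lemma TSol_sq (h : QF K n s) {D m : ℕ} (hDm : D * m = n) (hS : TSol D m) :
    ∃ b : (FractionalIdeal (𝓞 K)⁰ K)ˣ, ∃ x : K, ∃ hx : x ≠ 0, (∀ φ : K →+* ℝ, 0 < φ x) ∧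
      dU s D * b ^ 2 = pr x hx := by
  obtain ⟨z, y, t, h1, hp⟩ := hS.prim
  obtain ⟨A1, A2, A3, A4⟩ := TSol.prim' h.sqf hDm h1 hp
  have hDm' := h.sqf
  rw [← hDm] at hDm'
  obtain ⟨hc, hD, hm⟩ := Nat.squarefree_mul_iff.1 hDm'
  have ht0 : t ≠ 0 := by
    rintro rfl
    have := h.n4
    exact A2 2 Nat.prime_two (by omega) (by simp)
  have cop1 : IsCoprime (D : ℤ) (y * m) := by
    apply int_cop_of
    rintro p hpp ⟨ha, hb⟩
    have hpZ : Prime (p : ℤ) := Nat.prime_iff_prime_int.1 hpp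
    have ha' : p ∣ D := by exact_mod_cast ha
    rcases hpZ.dvd_or_dvd hb with hh | hh
    · exact A4 p hpp ha' hh
    · have : p ∣ m := by exact_mod_cast hh
      exact Nat.not_coprime_of_dvd_of_dvd hpp.one_lt ha' this hc
  have cop2 : IsCoprime t (2 * y * n) := by
    apply int_cop_of
    rintro p hpp ⟨ha, hb⟩
    have hpZ : Prime (p : ℤ) := Nat.prime_iff_prime_int.1 hpp
    rcases hpZ.dvd_or_dvd hb with hh | hh
    · rcases hpZ.dvd_or_dvd hh with hh | hh
      · refine A2 p hpp ?_ ha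
        have h2 : p ∣ 2 := by exact_mod_cast hh
        refine h2.trans ?_
        have := h.n4; omega
      · exact A1 p hpp ⟨ha, hh⟩
    · exact A2 p hpp (by exact_mod_cast hh) ha
  have hD0 : (D : K) ≠ 0 := ncast_ne (h.Dpos hDm)
  have hn : (D : K) * m = n := by exact_mod_cast congrArg (Nat.cast (R := K)) hDm
  have hss : s * s = n := by rw [← sq, h.sq]
  have h1K : (t : K) ^ 2 + m * y ^ 2 = D * z ^ 2 := by exact_mod_cast congrArg (Int.cast (R := K)) h1
  set x : K := D * z + y * s with hx
  have hxN : Algebra.norm ℚ x = D * t ^ 2 := by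
    have e : x = ((D * z : ℚ) : K) + (y : ℚ) * s := by rw [hx]; push_cast; ring
    rw [e, h.norm_eq]
    have : ((t ^ 2 + m * y ^ 2 : ℤ) : ℚ) = ((D * z ^ 2 : ℤ) : ℚ) := by rw [h1]
    push_cast at this
    rw [← hDm]; push_cast
    linear_combination (D : ℚ) * (-this)
  have hNpos : 0 < Algebra.norm ℚ x := by
    rw [hxN]
    have : 0 < D := h.Dpos hDm
    positivity
  have hx0 : x ≠ 0 := by
    rintro h0; rw [h0] at hNpos; simp at hNpos
  -- the ideal b
  set bI : FractionalIdeal (𝓞 K)⁰ K := FractionalIdeal.spanSingleton (𝓞 K)⁰ (t : K) +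
    FractionalIdeal.spanSingleton (𝓞 K)⁰ x with hbI
  have mt : (t : K) ∈ bI := (le_sup_left : FractionalIdeal.spanSingleton (𝓞 K)⁰ (t : K) ≤ FractionalIdeal.spanSingleton (𝓞 K)⁰ (t : K) ⊔ FractionalIdeal.spanSingleton (𝓞 K)⁰ x) (FractionalIdeal.mem_spanSingleton_self _ _)
  have mx : x ∈ bI := (le_sup_right : FractionalIdeal.spanSingleton (𝓞 K)⁰ x ≤ FractionalIdeal.spanSingleton (𝓞 K)⁰ (t : K) ⊔ FractionalIdeal.spanSingleton (𝓞 K)⁰ x) (FractionalIdeal.mem_spanSingleton_self _ _)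
  obtain ⟨mD, ms⟩ := mem_dI s D
  have hb0 : bI ≠ 0 := by
    intro h0
    rw [h0] at mt
    have := FractionalIdeal.mem_zero_iff (S := (𝓞 K)⁰) (P := K) |>.1 mt
    exact ht0 (by exact_mod_cast this)
  have hxi : IsIntegral ℤ x := ((int_natCast D).mul (int_intCast z)).add ((int_intCast y).mul h.s_int)
  set xb : K := D * z - y * s with hxb
  set w : K := z * s - y * m with hw
  have hxbi : IsIntegral ℤ xb := ((int_natCast D).mul (int_intCast z)).sub ((int_intCast y).mul h.s_int)
  have hwi : IsIntegral ℤ w := ((int_intCast z).mul h.s_int).sub ((int_intCast y).mul (int_natCast m))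
  have e1 : (D : K) * (t * t) = xb * x := by
    rw [hxb, hx]; linear_combination (D : K) * h1K + (y : K) ^ 2 * hss - (y : K) ^ 2 * hn
  have e2 : s * (t * t : K) = w * x := by
    rw [hw, hx]; linear_combination s * h1K - z * y * hss + z * y * hn
  have key : dI s D * bI ^ 2 = FractionalIdeal.spanSingleton (𝓞 K)⁰ x := by
    apply le_antisymm
    · rw [sq, hbI, dI]
      simp only [add_mul, mul_add, FractionalIdeal.spanSingleton_mul_spanSingleton]
      have L : ∀ v : K, (∃ z : K, IsIntegral ℤ z ∧ v = z * x) →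
          FractionalIdeal.spanSingleton (𝓞 K)⁰ v ≤ FractionalIdeal.spanSingleton (𝓞 K)⁰ x := by
        intro v hv
        rw [FractionalIdeal.spanSingleton_le_iff_mem, mem_sp_iff]; exact hv
      have iD := int_natCast (K := K) D
      have it := int_intCast (K := K) t
      have L1 := L _ ⟨xb, hxbi, e1⟩
      have L2 := L _ ⟨w, hwi, e2⟩
      have L3 := L (D * (t * x)) ⟨D * t, iD.mul it, by ring⟩
      have L3' := L (D * (x * t)) ⟨D * t, iD.mul it, by ring⟩
      have L4 := L (D * (x * x)) ⟨D * x, iD.mul hxi, by ring⟩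
      have L5 := L (s * (t * x)) ⟨s * t, h.s_int.mul it, by ring⟩
      have L5' := L (s * (x * t)) ⟨s * t, h.s_int.mul it, by ring⟩
      have L6 := L (s * (x * x)) ⟨s * x, h.s_int.mul hxi, by ring⟩
      repeat first | assumption | apply add_le_fi
    · rw [FractionalIdeal.spanSingleton_le_iff_mem, sq]
      set J := dI s D * (bI * bI) with hJ
      have M : ∀ u v w' : K, u ∈ dI s D → v ∈ bI → w' ∈ bI → u * (v * w') ∈ J :=
        fun u v w' hu hv hw' => FractionalIdeal.mul_mem_mul hu (FractionalIdeal.mul_mem_mul hv hw')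
      have m1 : xb * x ∈ J := e1 ▸ M _ _ _ mD mt mt
      have m2 : w * x ∈ J := e2 ▸ M _ _ _ ms mt mt
      have m3 : (D : K) * (t * x) ∈ J := M _ _ _ mD mt mx
      have m4 : s * (t * x) ∈ J := M _ _ _ ms mt mx
      have m5 : s * (x * x) ∈ J := M _ _ _ ms mx mx
      obtain ⟨α, β, hαβ⟩ := cop1
      obtain ⟨α', β', hαβ'⟩ := cop2
      have c1 : (α : K) * D + β * (y * m) = 1 := by exact_mod_cast congrArg (Int.cast (R := K)) hαβ
      have c2 : (α' : K) * t + β' * (2 * y * n) = 1 := by exact_mod_cast congrArg (Int.cast (R := K)) hαβ'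
      have m6 : (t : K) * x ∈ J := by
        have : (t : K) * x = α * (D * (t * x)) + β * (z * (s * (t * x)) - t * (w * x)) := by
          rw [hw]; linear_combination (-(t : K) * x) * c1
        rw [this]
        exact fi_mem_add (fi_mem_smul (int_intCast _) m3) (fi_mem_smul (int_intCast _)
          (fi_mem_sub (fi_mem_smul (int_intCast _) m4) (fi_mem_smul (int_intCast _) m2)))
      have : x = α' * (t * x) + β' * (s * (x * x) - s * (xb * x)) := by
        have e3 : x - xb = 2 * y * s := by rw [hx, hxb]; ring
        linear_combination (-x) * c2 - β' * s * x * e3 - β' * 2 * y * x * hss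
      rw [this]
      exact fi_mem_add (fi_mem_smul (int_intCast _) m6) (fi_mem_smul (int_intCast _)
          (fi_mem_sub m5 (fi_mem_smul h.s_int m1)))
  have key' : dU s D * (Units.mk0 bI hb0) ^ 2 = pr x hx0 := by
    apply Units.ext
    rw [Units.val_mul, Units.val_pow_eq_pow_val, dU_val s (h.Dpos hDm), pr_val, ← key]
    rfl
  rcases h.tp_of_norm_pos hNpos with H | H
  · exact ⟨_, x, hx0, H, key'⟩
  · exact ⟨_, -x, neg_ne_zero.2 hx0, H, by rw [pr_neg, key']⟩

end

lemma fourRankPow_eq (G : Type*) [CommGroup G] [Finite G] :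
    fourRankPow G = Nat.card {h : G // h ^ 2 = 1 ∧ ∃ g : G, h = g ^ 2} := by
  unfold fourRankPow
  set R := (powMonoidHom 2 : G →* G).range
  let f : R →* R := powMonoidHom 2
  have hr : (powMonoidHom 4 : G →* G).range.subgroupOf R = f.range := by
    ext ⟨x, hx⟩
    rw [Subgroup.mem_subgroupOf]
    constructor
    · rintro ⟨g, hg⟩
      refine ⟨⟨g ^ 2, ⟨g, rfl⟩⟩, ?_⟩
      apply Subtype.ext
      simp only [powMonoidHom_apply] at hg
      simp [f, ← hg, ← pow_mul]
    · rintro ⟨⟨y, ⟨g, rfl⟩⟩, hy⟩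
      have := congrArg Subtype.val hy
      simp [f] at this
      refine ⟨g, ?_⟩
      simp only [powMonoidHom_apply]
      rw [← this, ← pow_mul]
  rw [hr]
  have h1 : Nat.card R = Nat.card (R ⧸ f.range) * Nat.card f.range :=
    Subgroup.card_eq_card_quotient_mul_card_subgroup _
  have h2 : Nat.card R = Nat.card (R ⧸ f.ker) * Nat.card f.ker :=
    Subgroup.card_eq_card_quotient_mul_card_subgroup _
  have h3 : Nat.card (R ⧸ f.ker) = Nat.card f.range :=
    Nat.card_congr (QuotientGroup.quotientKerEquivRange f).toEquiv
  have h4 : 0 < Nat.card f.range := Nat.card_pos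
  have h5 : Nat.card (R ⧸ f.range) = Nat.card f.ker := by
    rw [h3] at h2
    have : Nat.card f.range * Nat.card (R ⧸ f.range) = Nat.card f.range * Nat.card f.ker := by
      rw [← h2, h1, mul_comm]
    exact Nat.eq_of_mul_eq_mul_left h4 this
  rw [h5]
  refine Nat.card_congr ⟨fun x => ⟨x.1.1, ?_, ?_⟩, fun x => ⟨⟨x.1, ?_⟩, ?_⟩, ?_, ?_⟩
  · have := congrArg Subtype.val (f.mem_ker.1 x.2)
    simpa [f] using this
  · obtain ⟨g, hg⟩ := x.1.2
    exact ⟨g, hg.symm⟩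
  · obtain ⟨g, hg⟩ := x.2.2
    exact ⟨g, hg.symm⟩
  · rw [f.mem_ker]
    apply Subtype.ext
    simpa [f] using x.2.1
  · intro x; rfl
  · intro x; rfl

section
variable {K : Type*} [Field K] [NumberField K] {n : ℕ} {s : K}
  {G : Type*} [CommGroup G] {f : (FractionalIdeal (𝓞 K)⁰ K)ˣ →* G}

/-- `f` presents `G` as the narrow class group -/
structure NCG (f : (FractionalIdeal (𝓞 K)⁰ K)ˣ →* G) : Prop where
  surj : Function.Surjective f
  ker : ∀ c, f c = 1 ↔ c ∈ narrowPrincipals K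

lemma mk_pr_eq_one (hf : NCG f) {x : K} (hx : x ≠ 0) (ht : ∀ φ : K →+* ℝ, 0 < φ x) :
    f (pr x hx) = 1 :=
  (hf.ker _).2 ((narrow_mem _).2 ⟨x, hx, ht, rfl⟩)

lemma narrow_finite (h : QF K n s) (hf : NCG f) : Finite G := by
  let R := (toPrincipalIdeal (𝓞 K) K).range
  have hfin : Finite ((FractionalIdeal (𝓞 K)⁰ K)ˣ ⧸ R) :=
    Finite.of_equiv _ (ClassGroup.equiv (R := 𝓞 K) K).toEquiv
  let F : ((FractionalIdeal (𝓞 K)⁰ K)ˣ ⧸ R) × Bool → G :=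
    fun q => f (Quotient.out q.1 * (if q.2 then (pr s h.s_ne)⁻¹ else 1))
  apply Finite.of_surjective F
  intro g
  obtain ⟨a, rfl⟩ := hf.surj g
  have h1 : (Quotient.out (QuotientGroup.mk a : (FractionalIdeal (𝓞 K)⁰ K)ˣ ⧸ R))⁻¹ * a ∈ R := by
    rw [← QuotientGroup.eq]
    exact Quotient.out_eq _
  obtain ⟨x, hx⟩ := h1
  set b := Quotient.out (QuotientGroup.mk a : (FractionalIdeal (𝓞 K)⁰ K)ˣ ⧸ R)
  have hx' : b⁻¹ * a = pr (x : K) x.ne_zero := by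
    rw [← hx]; apply Units.ext; rw [coe_toPrincipalIdeal, pr_val]
  have ha : a = b * pr (x : K) x.ne_zero := by rw [← hx', mul_inv_cancel_left]
  have P : ∀ y : K, ∀ hy : y ≠ 0, 0 < Algebra.norm ℚ y → f (pr y hy) = 1 := by
    intro y hy hN
    rcases h.tp_of_norm_pos hN with H | H
    · exact mk_pr_eq_one hf hy H
    · rw [← pr_neg]; exact mk_pr_eq_one hf _ H
  have hN0 : Algebra.norm ℚ (x : K) ≠ 0 := by
    rw [Ne, Algebra.norm_eq_zero_iff]; exact x.ne_zero
  rcases lt_or_gt_of_ne hN0 with hN | hN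
  · refine ⟨(QuotientGroup.mk a, true), ?_⟩
    show f (b * (if true then (pr s h.s_ne)⁻¹ else 1)) = f a
    have hs : Algebra.norm ℚ s = -n := by
      have := h.norm_eq 0 1
      simpa using this
    have := P (x * s) (mul_ne_zero x.ne_zero h.s_ne) (by
      rw [map_mul, hs]
      have := h.npos
      have : (0 : ℚ) < n := by exact_mod_cast this
      nlinarith)
    rw [← pr_mul _ _ x.ne_zero h.s_ne, map_mul] at this
    rw [ha, if_pos rfl, map_mul, map_mul, map_inv]
    rw [eq_inv_of_mul_eq_one_left this]
  · refine ⟨(QuotientGroup.mk a, false), ?_⟩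
    show f (b * (if false then (pr s h.s_ne)⁻¹ else 1)) = f a
    rw [ha, map_mul, map_mul, P _ _ hN]
    simp

/-- class of `(D,s)` -/
noncomputable def dC (f : (FractionalIdeal (𝓞 K)⁰ K)ˣ →* G) (s : K) (D : ℕ) : G := f (dU s D)

lemma dC_sq (h : QF K n s) (hf : NCG f) {D m : ℕ} (hDm : D * m = n) : dC f s D ^ 2 = 1 := by
  rw [dC, ← map_pow, dU_sq h hDm]
  apply mk_pr_eq_one hf
  have := h.tp_rat (r := D) (by exact_mod_cast h.Dpos hDm)
  simpa using this

lemma absNorm_pr (x : K) (hx : x ≠ 0) :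
    FractionalIdeal.absNorm ((pr x hx : (FractionalIdeal (𝓞 K)⁰ K)ˣ) : FractionalIdeal (𝓞 K)⁰ K) = |Algebra.norm ℚ x| := by
  rw [pr_val]; exact FractionalIdeal.absNorm_span_singleton (R := 𝓞 K) x

lemma absNorm_pos (c : (FractionalIdeal (𝓞 K)⁰ K)ˣ) :
    0 < FractionalIdeal.absNorm (c : FractionalIdeal (𝓞 K)⁰ K) := by
  apply lt_of_le_of_ne (FractionalIdeal.absNorm_nonneg _)
  intro h0
  exact c.ne_zero (FractionalIdeal.absNorm_eq_zero_iff.1 h0.symm)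

lemma QF.norm_rat (h : QF K n s) (r : ℚ) : Algebra.norm ℚ (r : K) = r ^ 2 := by
  have := h.norm_eq r 0
  simpa using this

lemma dC_square_iff (h : QF K n s) (hf : NCG f) {D m : ℕ} (hDm : D * m = n) :
    (∃ g : G, dC f s D = g ^ 2) ↔ TSol D m := by
  constructor
  · rintro ⟨g, hg⟩
    obtain ⟨c, rfl⟩ := hf.surj g
    rw [dC, ← map_pow, ← inv_mul_eq_one, ← map_inv, ← map_mul, hf.ker, ← inv_mem_iff, narrow_mem] at hg
    obtain ⟨x, hx, ht, he⟩ := hg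
    have h1 : dU s D = c ^ 2 * pr x hx := by rw [← he]; simp [mul_comm]
    set A := fun c : (FractionalIdeal (𝓞 K)⁰ K)ˣ => FractionalIdeal.absNorm (c : FractionalIdeal (𝓞 K)⁰ K)
    have hmul : ∀ a b, A (a * b) = A a * A b := by intro a b; simp [A]
    have h2 : A (dU s D) = D := by
      have h3 : A (dU s D) ^ 2 = (D : ℚ) ^ 2 := by
        rw [sq, ← hmul, ← sq, dU_sq h hDm]
        simp only [A]
        rw [absNorm_pr]
        have := h.norm_rat D
        simp at this ⊢
        rw [this]; simp
      have h4 : 0 < A (dU s D) := absNorm_pos _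
      exact (pow_left_inj₀ h4.le (by positivity) (by norm_num)).1 h3
    have hNx := h.norm_pos_tp ht
    apply norm_TSol h hDm (x := (A c : K) * x)
    rw [map_mul, h.norm_rat, ← h2, h1, hmul, sq c, hmul]
    simp only [A]
    rw [absNorm_pr, abs_of_pos hNx]; ring
  · intro hS
    obtain ⟨b, x, hx, ht, he⟩ := TSol_sq h hDm hS
    refine ⟨f b⁻¹, ?_⟩
    have := mk_pr_eq_one hf hx ht
    rw [← he, map_mul] at this
    rw [dC, eq_inv_of_mul_eq_one_left this]
    simp

lemma QF.norm_one_trick (h : QF K n s) {β : K} (hβ : Algebra.norm ℚ β = 1) :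
    (1 + β) ^ 2 = β * (Algebra.norm ℚ (1 + β) : K) := by
  obtain ⟨a, b, rfl⟩ := h.rep β
  have e : 1 + ((a : K) + b * s) = ((1 + a : ℚ) : K) + b * s := by push_cast; ring
  rw [e, h.norm_eq]
  rw [h.norm_eq] at hβ
  have hbet : (a : K) ^ 2 - n * b ^ 2 = 1 := by exact_mod_cast congrArg (Rat.cast (K := K)) hβ
  have := h.sq
  push_cast
  linear_combination (b : K) ^ 2 * this - (1 + (a : K) + b * s) * hbet

/-- every 2-torsion class is one of the `dC` -/
lemma two_tors (h : QF K n s) (hf : NCG f) (g : G) (hg : g ^ 2 = 1) :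
    ∃ D m, D * m = n ∧ g = dC f s D := by
  obtain ⟨a, rfl⟩ := hf.surj g
  rw [← map_pow, hf.ker, narrow_mem] at hg
  obtain ⟨x, hx, ht, he⟩ := hg
  set m : ℚ := FractionalIdeal.absNorm (a : FractionalIdeal (𝓞 K)⁰ K) with hm
  have hm0 : 0 < m := absNorm_pos a
  have hNx : Algebra.norm ℚ x = m ^ 2 := by
    have := congrArg (fun c : (FractionalIdeal (𝓞 K)⁰ K)ˣ => FractionalIdeal.absNorm (c : FractionalIdeal (𝓞 K)⁰ K)) he
    simp only [absNorm_pr, abs_of_pos (h.norm_pos_tp ht)] at this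
    rw [← this]; simp [hm]
  set β : K := x * ((m⁻¹ : ℚ) : K) with hβ
  have hβ1 : Algebra.norm ℚ β = 1 := by
    rw [hβ, map_mul, h.norm_rat, hNx]; field_simp
  have hβt : ∀ φ : K →+* ℝ, 0 < φ β := tp_mul ht (h.tp_rat (by positivity))
  set γ : K := 1 + β with hγ
  have hγt : ∀ φ : K →+* ℝ, 0 < φ γ := by
    intro φ; rw [hγ, map_add, map_one]; linarith [hβt φ]
  have hγ0 := h.tp_ne hγt
  have hγ2 : γ ^ 2 = β * (Algebra.norm ℚ γ : K) := h.norm_one_trick hβ1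
  have hNγ := h.norm_pos_tp hγt
  obtain ⟨D, t, hD, ht0, hr⟩ := rat_sqfree (r := m / Algebra.norm ℚ γ) (by positivity)
  have htK : (t : K) ≠ 0 := by exact_mod_cast ht0.ne'
  have hmK : (m : K) ≠ 0 := by exact_mod_cast hm0.ne'
  have hNK : ((Algebra.norm ℚ γ : ℚ) : K) ≠ 0 := by exact_mod_cast hNγ.ne'
  have hγt0 : γ * t ≠ 0 := mul_ne_zero hγ0 htK
  set c := a * (pr (γ * t) hγt0)⁻¹ with hc
  have hc2 : c ^ 2 = pr (D : K) (ncast_ne (Nat.pos_of_ne_zero hD.ne_zero)) := by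
    rw [hc, mul_pow, inv_pow, he, mul_inv_eq_iff_eq_mul, pr_pow_two, pr_mul]
    apply pr_congr
    have hr' : (m : K) = D * t ^ 2 * (Algebra.norm ℚ γ : ℚ) := by
      have : m = D * t ^ 2 * Algebra.norm ℚ γ := by rw [← hr]; field_simp
      exact_mod_cast congrArg (Rat.cast (K := K)) this
    rw [mul_pow, hγ2, hβ]
    push_cast
    field_simp
    rw [hr']
    ring
  obtain ⟨m', hm'⟩ := F3 h hD c hc2
  refine ⟨D, m', hm'.symm, ?_⟩
  have : c = dU s D := tf _ _ (by rw [hc2, dU_sq h hm'.symm])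
  rw [dC, ← this, hc, map_mul, map_inv, mk_pr_eq_one hf hγt0 (tp_mul hγt (h.tp_rat ht0))]
  simp

end

lemma sqfree_eq_of_sq {D E : ℕ} (hD : Squarefree D) (hE : Squarefree E) (h : IsSquare (D * E)) : D = E := by
  obtain ⟨w, hw⟩ := h
  have hd : ∀ {D E : ℕ}, Squarefree D → D * E = w * w → D ∣ E := by
    intro D E hD hw
    have h1 : D ∣ w := (hD.dvd_pow_iff_dvd (n := 2) (by norm_num)).1 ⟨E, by rw [hw, sq]⟩
    obtain ⟨v, rfl⟩ := h1
    have : E = D * (v * v) := Nat.eq_of_mul_eq_mul_left (Nat.pos_of_ne_zero hD.ne_zero) (by rw [hw]; ring)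
    exact ⟨_, this⟩
  exact Nat.dvd_antisymm (hd hD hw) (hd hE (by rw [mul_comm, hw]))

section
variable {K : Type*} [Field K] [NumberField K] {n : ℕ} {s : K}
  {G : Type*} [CommGroup G] {f : (FractionalIdeal (𝓞 K)⁰ K)ˣ →* G}

lemma pr_unit {ε : K} (h0 : ε ≠ 0) (h1 : IsIntegral ℤ ε) (h2 : IsIntegral ℤ ε⁻¹) : pr ε h0 = 1 := by
  apply Units.ext
  rw [pr_val, Units.val_one]
  apply le_antisymm
  · rw [FractionalIdeal.spanSingleton_le_iff_mem, mem_one_iff']; exact h1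
  · rw [← FractionalIdeal.spanSingleton_one, FractionalIdeal.spanSingleton_le_iff_mem, mem_sp_iff]
    exact ⟨ε⁻¹, h2, by field_simp⟩

/-- evaluation of Pell solutions -/
noncomputable def pev (s : K) (e : Pell.Solution₁ (n : ℤ)) : K := (e.x : K) + (e.y : K) * s

lemma pev_mul (h : QF K n s) (e e' : Pell.Solution₁ (n : ℤ)) : pev s (e * e') = pev s e * pev s e' := by
  have := h.sq
  simp only [pev, Pell.Solution₁.x_mul, Pell.Solution₁.y_mul]
  push_cast
  linear_combination (-(e.y : K) * e'.y) * this

lemma pev_one : pev s (1 : Pell.Solution₁ (n : ℤ)) = 1 := by simp [pev]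

lemma pev_eq (e : Pell.Solution₁ (n : ℤ)) : pev s e = ((e.x : ℚ) : K) + ((e.y : ℚ) : K) * s := by simp [pev]

lemma pev_norm (h : QF K n s) (e : Pell.Solution₁ (n : ℤ)) : Algebra.norm ℚ (pev s e) = 1 := by
  rw [pev_eq, h.norm_eq]
  exact_mod_cast e.prop

lemma pev_ne (h : QF K n s) (e : Pell.Solution₁ (n : ℤ)) : pev s e ≠ 0 := by
  intro h0
  have := pev_norm h e
  rw [h0] at this; simp at this

lemma pev_int (h : QF K n s) (e : Pell.Solution₁ (n : ℤ)) : IsIntegral ℤ (pev s e) := by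
  rw [pev_eq]; exact (h.int_iff _ _).2 ⟨_, _, rfl, rfl⟩

lemma pev_inv (h : QF K n s) (e : Pell.Solution₁ (n : ℤ)) : (pev s e)⁻¹ = pev s e⁻¹ := by
  exact inv_eq_of_mul_eq_one_right (by rw [← pev_mul h, mul_inv_cancel, pev_one])

lemma pev_pr (h : QF K n s) (e : Pell.Solution₁ (n : ℤ)) : pr (pev s e) (pev_ne h e) = 1 :=
  pr_unit _ (pev_int h e) (by rw [pev_inv h]; exact pev_int h _)

lemma pev_inj (h : QF K n s) {e e' : Pell.Solution₁ (n : ℤ)} (he : pev s e = pev s e') : e = e' := by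
  rw [pev_eq, pev_eq] at he
  obtain ⟨h1, h2⟩ := h.ext' he
  exact Pell.Solution₁.ext (by exact_mod_cast h1) (by exact_mod_cast h2)

lemma pev_of (h : QF K n s) {ε : K} (hi : IsIntegral ℤ ε) (hN : Algebra.norm ℚ ε = 1) :
    ∃ e : Pell.Solution₁ (n : ℤ), ε = pev s e := by
  obtain ⟨a, b, rfl⟩ := h.rep ε
  obtain ⟨A, B, rfl, rfl⟩ := (h.int_iff a b).1 hi
  rw [h.norm_eq] at hN
  exact ⟨Pell.Solution₁.mk A B (by exact_mod_cast hN), by simp [pev]⟩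

lemma rat_of_sq (h : QF K n s) {r : K} {q : ℚ} (hr : r ^ 2 = q) (hN : 0 < Algebra.norm ℚ r) :
    ∃ a : ℚ, q = a ^ 2 := by
  obtain ⟨a, b, rfl⟩ := h.rep r
  rw [h.norm_eq] at hN
  have h1 := h.ext' (a := a ^ 2 + n * b ^ 2) (b := 2 * a * b) (c := q) (d := 0) (by
    have := h.sq
    push_cast
    linear_combination hr - (b : K) ^ 2 * this)
  have h2 : a = 0 ∨ b = 0 := by
    have := h1.2
    simpa using this
  rcases h2 with rfl | rfl
  · exfalso
    have : (0 : ℚ) ≤ n * b ^ 2 := by positivity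
    linarith
  · exact ⟨a, by rw [← h1.1]; ring⟩

lemma nat_isSquare_of_rat {N : ℕ} {a : ℚ} (h : (N : ℚ) = a ^ 2) : IsSquare N := by
  have : IsSquare (N : ℚ) := ⟨a, by rw [h]; ring⟩
  exact_mod_cast this

lemma unit_int_norm (h : QF K n s) {ε : K} (h1 : IsIntegral ℤ ε) (h0 : ε ≠ 0) (h2 : IsIntegral ℤ ε⁻¹)
    (hp : 0 < Algebra.norm ℚ ε) : Algebra.norm ℚ ε = 1 := by
  have hN : ∀ y : K, IsIntegral ℤ y → ∃ N : ℤ, Algebra.norm ℚ y = N := by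
    intro y hy
    have := Algebra.isIntegral_norm ℚ hy
    obtain ⟨N, hN⟩ := IsIntegrallyClosed.isIntegral_iff.1 this
    exact ⟨N, by simpa using hN.symm⟩
  obtain ⟨N, hN1⟩ := hN _ h1
  obtain ⟨N', hN2⟩ := hN _ h2
  have : Algebra.norm ℚ ε * Algebra.norm ℚ ε⁻¹ = 1 := by rw [← map_mul, mul_inv_cancel₀ h0, map_one]
  rw [hN1, hN2] at this
  have h3 : N * N' = 1 := by exact_mod_cast this
  rw [hN1] at hp
  have hp' : 0 < N := by exact_mod_cast hp
  have : N = 1 := by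
    rcases Int.eq_one_or_neg_one_of_mul_eq_one h3 with h | h
    · exact h
    · omega
  rw [hN1, this]; simp

lemma fiber_key (h : QF K n s) (hf : NCG f) : ∃ D₀ : ℕ, D₀ ∣ n ∧ D₀ ≠ 1 ∧
    ∀ D m E m' : ℕ, D * m = n → E * m' = n →
      (dC f s D = dC f s E ↔ IsSquare (D * E) ∨ IsSquare (D * E * D₀)) := by
  have hn0 : (0 : ℤ) < n := by exact_mod_cast h.npos
  have hns : ¬ IsSquare (n : ℤ) := by
    intro hh
    exact nat_not_sq_of h.n4 (by exact_mod_cast hh)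
  obtain ⟨e₀, he₀⟩ := Pell.IsFundamental.exists_of_not_isSquare hn0 hns
  set γ : K := 1 + pev s e₀ with hγ
  have hγ2 : γ ^ 2 = pev s e₀ * (Algebra.norm ℚ γ : ℚ) := h.norm_one_trick (pev_norm h e₀)
  have hpt : ∀ φ : K →+* ℝ, 0 < φ (pev s e₀) := by
    rw [pev_eq]
    refine (h.totpos_iff _ _).2 ⟨by exact_mod_cast he₀.x_pos, ?_⟩
    have := e₀.prop
    have h2 : (e₀.x : ℚ) ^ 2 - n * (e₀.y : ℚ) ^ 2 = 1 := by exact_mod_cast this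
    rw [h2]; norm_num
  have hγt : ∀ φ : K →+* ℝ, 0 < φ γ := by
    intro φ; rw [hγ, map_add, map_one]; linarith [hpt φ]
  have hγ0 := h.tp_ne hγt
  have hNγ := h.norm_pos_tp hγt
  obtain ⟨D₀, t, hD, ht0, hr⟩ := rat_sqfree hNγ
  have htK : (t : K) ≠ 0 := by exact_mod_cast ht0.ne'
  have hD₀ : 0 < D₀ := Nat.pos_of_ne_zero hD.ne_zero
  have hD₀K : (D₀ : K) ≠ 0 := ncast_ne hD₀
  rw [hr] at hγ2
  push_cast at hγ2
  have hdvd : D₀ ∣ n := by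
    refine F3 h hD (pr (γ * (t : K)⁻¹) (mul_ne_zero hγ0 (inv_ne_zero htK))) ?_
    rw [pr_pow_two]
    have : (γ * (t : K)⁻¹) ^ 2 = pev s e₀ * D₀ := by
      rw [mul_pow, hγ2]; field_simp
    rw [pr_congr _ this, ← pr_mul _ _ (pev_ne h e₀) hD₀K, pev_pr h, one_mul]
  have hne : D₀ ≠ 1 := by
    rintro rfl
    have h1 : (γ * (t : K)⁻¹) ^ 2 = pev s e₀ := by
      rw [mul_pow, hγ2]; field_simp; simp
    have h2 : IsIntegral ℤ (γ * (t : K)⁻¹) :=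
      IsIntegral.of_pow (n := 2) (by norm_num) (by rw [h1]; exact pev_int h _)
    have h3 : Algebra.norm ℚ (γ * (t : K)⁻¹) = 1 := by
      have : (t : K)⁻¹ = ((t⁻¹ : ℚ) : K) := by push_cast; rfl
      rw [map_mul, this, h.norm_rat, hr]
      field_simp; simp
    obtain ⟨e, he⟩ := pev_of h h2 h3
    rw [he, sq, ← pev_mul h] at h1
    have h4 := pev_inj h h1
    obtain ⟨j, hj⟩ := he₀.eq_zpow_or_neg_zpow e
    have h5 : e₀ ^ (2 * j) = e₀ := by
      rcases hj with hj | hj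
      · rw [hj] at h4; rw [two_mul, zpow_add]; exact h4
      · rw [hj] at h4; rw [two_mul, zpow_add]; simpa using h4
    have h6 : e₀ ^ (2 * j - 1) = 1 := by
      rw [zpow_sub, h5]; simp
    have := (he₀.zpow_eq_one_iff _).1 h6
    omega
  refine ⟨D₀, hdvd, hne, ?_⟩
  intro D m E m' hDm hEm
  have hDp := h.Dpos hDm
  have hEp := h.Dpos hEm
  have hDK : (D : K) ≠ 0 := ncast_ne hDp
  have hEK : (E : K) ≠ 0 := ncast_ne hEp
  constructor
  · intro hc
    rw [dC, dC, eq_comm, ← inv_mul_eq_one, ← map_inv, ← map_mul, hf.ker, narrow_mem] at hc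
    obtain ⟨y, hy0, hyt, hy⟩ := hc
    have h1 : dU s D = dU s E * pr y hy0 := by rw [← hy, mul_inv_cancel_left]
    have h2 : pr (D : K) hDK = pr (E * y ^ 2) (mul_ne_zero hEK (pow_ne_zero 2 hy0)) := by
      rw [← pr_mul _ _ hEK (pow_ne_zero 2 hy0), ← pr_pow_two, ← dU_sq h hDm, ← dU_sq h hEm, h1, mul_pow]
    obtain ⟨ε', hε'i, hε'⟩ := pr_eq_iff_mem _ _ h2
    obtain ⟨ε, hεi, hε⟩ := pr_eq_iff_mem _ _ h2.symm
    have hεε : ε' * ε = 1 := by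
      have : (ε' * ε - 1) * D = 0 := by rw [hε] at hε'; linear_combination -hε'
      rcases mul_eq_zero.1 this with hh | hh
      · linear_combination hh
      · exact absurd hh hDK
    have hε0 : ε ≠ 0 := right_ne_zero_of_mul_eq_one hεε
    have hinv : ε⁻¹ = ε' := inv_eq_of_mul_eq_one_left hεε
    have hNy := h.norm_pos_tp hyt
    have hNε : Algebra.norm ℚ ε = 1 := by
      apply unit_int_norm h hεi hε0 (by rw [hinv]; exact hε'i)
      have : Algebra.norm ℚ ε * D ^ 2 = E ^ 2 * Algebra.norm ℚ y ^ 2 := by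
        have := congrArg (Algebra.norm ℚ) hε
        rw [map_mul, map_mul, map_pow] at this
        have a1 := h.norm_rat D
        have a2 := h.norm_rat E
        simp only [Rat.cast_natCast] at a1 a2
        rw [a1, a2] at this
        exact this.symm
      have p1 : (0 : ℚ) < E ^ 2 * Algebra.norm ℚ y ^ 2 := by positivity
      rw [← this] at p1
      exact (mul_pos_iff_of_pos_right (by positivity)).1 p1
    have hεt : ∀ φ : K →+* ℝ, 0 < φ ε := by
      intro φ
      have h3 := congrArg φ hε
      simp only [map_mul, map_pow, map_natCast] at h3
      have p1 : (0 : ℝ) < E * φ y ^ 2 := by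
        have := hyt φ
        positivity
      rw [h3] at p1
      exact (mul_pos_iff_of_pos_right (by positivity)).1 p1
    obtain ⟨e, he⟩ := pev_of h hεi hNε
    have hex : 0 < e.x := by
      rw [he, pev_eq] at hεt
      have := ((h.totpos_iff _ _).1 hεt).1
      exact_mod_cast this
    obtain ⟨j, hj⟩ := he₀.eq_zpow_or_neg_zpow e
    have hj : e = e₀ ^ j := by
      rcases hj with hj | hj
      · exact hj
      · exfalso
        rw [hj, Pell.Solution₁.x_neg] at hex
        have := Pell.Solution₁.x_zpow_pos he₀.x_pos j
        omega
    rcases Int.even_or_odd' j with ⟨i, hi | hi⟩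
    · left
      set η := pev s (e₀ ^ i) with hη
      have hη0 : η ≠ 0 := pev_ne h _
      have h3 : ε = η ^ 2 := by
        rw [he, hj, hi, two_mul, zpow_add, pev_mul h, sq]
      have h4 : (y * η⁻¹) ^ 2 = ((D / E : ℚ) : K) := by
        push_cast
        rw [h3] at hε
        field_simp
        linear_combination hε
      obtain ⟨a, ha⟩ := rat_of_sq h h4 (by
        rw [map_mul, pev_inv h, pev_norm h, mul_one]; exact hNy)
      apply nat_isSquare_of_rat (a := a * E)
      push_cast
      have : (E : ℚ) ≠ 0 := by exact_mod_cast hEp.ne'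
      rw [mul_pow, ← ha]; field_simp
    · right
      set η := pev s (e₀ ^ i) with hη
      have hη0 : η ≠ 0 := pev_ne h _
      have h3 : ε = η ^ 2 * pev s e₀ := by
        rw [he, hj, hi, two_mul, zpow_add, zpow_add, zpow_one, pev_mul h, pev_mul h, sq]
      have h4 : (y * η⁻¹ * γ⁻¹) ^ 2 = ((D / (E * (D₀ * t ^ 2)) : ℚ) : K) := by
        push_cast
        rw [h3] at hε
        rw [mul_pow, inv_pow, hγ2]
        have := pev_ne h e₀
        field_simp
        linear_combination hε
      obtain ⟨a, ha⟩ := rat_of_sq h h4 (by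
        rw [map_mul, map_mul, pev_inv h, pev_norm h, mul_one]
        exact mul_pos hNy (h.norm_pos_tp (tp_inv hγt)))
      apply nat_isSquare_of_rat (a := a * E * D₀ * t)
      push_cast
      have : (E : ℚ) ≠ 0 := by exact_mod_cast hEp.ne'
      have : (D₀ : ℚ) ≠ 0 := by exact_mod_cast hD₀.ne'
      rw [mul_pow, mul_pow, mul_pow, ← ha]; field_simp
  · have fin : ∀ y : K, ∀ e : Pell.Solution₁ (n : ℤ), y ≠ 0 → (∀ φ : K →+* ℝ, 0 < φ y) →
        y ^ 2 * E = pev s e * D → dC f s D = dC f s E := by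
      intro y e hy0 hyt hy
      have : dU s D = dU s E * pr y hy0 := by
        apply tf
        rw [mul_pow, dU_sq h hDm, dU_sq h hEm, pr_pow_two, mul_comm, pr_mul, pr_congr _ hy,
          ← pr_mul _ _ (pev_ne h e) hDK, pev_pr h, one_mul]
      rw [dC, dC, this, map_mul, mk_pr_eq_one hf hy0 hyt, mul_one]
    rintro (⟨w, hw⟩ | ⟨w, hw⟩)
    · have hw0 : 0 < w := by
        rcases Nat.eq_zero_or_pos w with rfl | hh
        · simp at hw; omega
        · exact hh
      have hwK : (w : K) * w = D * E := by exact_mod_cast congrArg (Nat.cast (R := K)) hw.symm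
      have hyt := h.tp_rat (r := w / E) (by positivity)
      refine fin _ 1 (h.tp_ne hyt) hyt ?_
      rw [pev_one]
      push_cast
      field_simp
      linear_combination hwK
    · have hw0 : 0 < w := by
        rcases Nat.eq_zero_or_pos w with rfl | hh
        · simp at hw; omega
        · exact hh
      have hwK : (w : K) * w = D * E * D₀ := by exact_mod_cast congrArg (Nat.cast (R := K)) hw.symm
      have hyt := tp_mul hγt (h.tp_rat (r := w / (E * D₀ * t)) (by positivity))
      refine fin _ e₀ (h.tp_ne hyt) hyt ?_
      rw [mul_pow, hγ2]
      push_cast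
      field_simp
      linear_combination pev s e₀ * hwK

lemma four_rank_count (h : QF K n s) (hf : NCG f) :
    2 * fourRankPow G = (n.divisors.filter (fun D => TSol D (n / D))).card := by
  have hG : Finite G := narrow_finite h hf
  have : Fintype G := Fintype.ofFinite G
  rw [fourRankPow_eq]
  obtain ⟨D₀, hd0, hne, hkey⟩ := fiber_key h hf
  set S := n.divisors.filter (fun D => TSol D (n / D)) with hS
  set T : Finset G := Finset.univ.filter (fun g => g ^ 2 = 1 ∧ ∃ a : G, g = a ^ 2) with hT
  have hcT : Nat.card {g : G // g ^ 2 = 1 ∧ ∃ a : G, g = a ^ 2} = T.card := by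
    rw [Nat.card_eq_fintype_card, Fintype.card_subtype]
  rw [hcT]
  have hn0 := h.npos
  have hdiv : ∀ {D}, D ∈ n.divisors → D * (n / D) = n := fun hD =>
    Nat.mul_div_cancel' (Nat.dvd_of_mem_divisors hD)
  have hmaps : Set.MapsTo (dC f s) S T := by
    intro D hD
    simp only [hS, Finset.coe_filter, Set.mem_setOf_eq] at hD
    simp only [hT, Finset.coe_filter, Set.mem_setOf_eq, Finset.mem_univ, true_and]
    exact ⟨dC_sq h hf (hdiv hD.1), (dC_square_iff h hf (hdiv hD.1)).2 hD.2⟩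
  rw [Finset.card_eq_sum_card_fiberwise hmaps]
  rw [Finset.sum_const_nat (m := 2), mul_comm]
  intro g hg
  simp only [hT, Finset.mem_filter, Finset.mem_univ, true_and] at hg
  obtain ⟨D, m, hDm, rfl⟩ := two_tors h hf g hg.1
  have hDn : D ∣ n := ⟨m, hDm.symm⟩
  have hDsq : Squarefree D := h.sqf.squarefree_of_dvd hDn
  have hD0sq : Squarefree D₀ := h.sqf.squarefree_of_dvd hd0
  -- the other element
  obtain ⟨g, D', D₀', hg0, hcop, hD', hD₀'⟩ := Nat.exists_coprime' (m := D) (n := D₀)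
    (Nat.gcd_pos_of_pos_left _ (Nat.pos_of_ne_zero hDsq.ne_zero))
  set E₁ := D' * D₀' with hE₁
  have hE₁n : E₁ ∣ n := hcop.mul_dvd_of_dvd_of_dvd
    (dvd_trans ⟨g, hD'⟩ hDn) (dvd_trans ⟨g, hD₀'⟩ hd0)
  have hE₁sq : Squarefree E₁ := h.sqf.squarefree_of_dvd hE₁n
  have hsqE : IsSquare (D * E₁ * D₀) := ⟨g * D' * D₀', by rw [hD', hD₀', hE₁]; ring⟩
  have hneq : D ≠ E₁ := by
    intro hh
    rw [← hh] at hsqE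
    obtain ⟨w, hw⟩ := hsqE
    apply hne
    symm
    apply sqfree_eq_of_sq squarefree_one hD0sq
    rw [one_mul]
    have h1 : IsSquare ((D₀ : ℚ)) := ⟨w / D, by
      have h2 : (D : ℚ) * D * D₀ = w * w := by exact_mod_cast hw
      have : (D : ℚ) ≠ 0 := by exact_mod_cast hDsq.ne_zero
      field_simp
      linear_combination h2⟩
    exact_mod_cast h1
  have : S.filter (fun E => dC f s E = dC f s D) = {D, E₁} := by
    ext E
    simp only [hS, Finset.mem_filter, Finset.mem_insert, Finset.mem_singleton]
    constructor
    · rintro ⟨⟨hE, _⟩, hc⟩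
      have hEsq : Squarefree E := h.sqf.squarefree_of_dvd (Nat.dvd_of_mem_divisors hE)
      rcases (hkey _ _ _ _ hDm (hdiv hE)).1 hc.symm with hh | hh
      · left; exact (sqfree_eq_of_sq hDsq hEsq hh).symm
      · right
        apply sqfree_eq_of_sq hEsq hE₁sq
        obtain ⟨w, hw⟩ := hh
        obtain ⟨v, hv⟩ := hsqE
        have h1 : IsSquare ((E * E₁ : ℕ) : ℚ) := ⟨w * v / (D * D₀), by
          have h2 : (D : ℚ) * E * D₀ = w * w := by exact_mod_cast hw
          have h3 : (D : ℚ) * E₁ * D₀ = v * v := by exact_mod_cast hv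
          have : (D : ℚ) ≠ 0 := by exact_mod_cast hDsq.ne_zero
          have : (D₀ : ℚ) ≠ 0 := by exact_mod_cast hD0sq.ne_zero
          push_cast
          field_simp
          linear_combination (v : ℚ) ^ 2 * h2 + D * E * D₀ * h3⟩
        exact_mod_cast h1
    · have gen : ∀ E m', E * m' = n → dC f s E = dC f s D →
          (E ∈ n.divisors ∧ TSol E (n / E)) ∧ dC f s E = dC f s D := by
        intro E m' hE hc
        have hEd : E ∈ n.divisors := Nat.mem_divisors.2 ⟨⟨m', hE.symm⟩, hn0.ne'⟩
        refine ⟨⟨hEd, ?_⟩, hc⟩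
        rw [← dC_square_iff h hf (hdiv hEd), hc]
        exact hg.2
      rintro (rfl | rfl)
      · exact gen _ _ hDm rfl
      · obtain ⟨m', hm'⟩ := hE₁n
        exact gen _ m' hm'.symm ((hkey _ _ _ _ hDm hm'.symm).2 (Or.inr hsqE)).symm
  rw [this, Finset.card_pair hneq]

end

lemma four_rank_quad {n : ℕ} (hs : Squarefree n) (h4 : n % 4 = 2) :
    2 * fourRankPow (NarrowClassGroup (quadField n)) = (n.divisors.filter (fun D => TSol D (n / D))).card := by
  obtain ⟨_, s, h⟩ := quadField_QF hs h4
  exact four_rank_count (f := QuotientGroup.mk' (narrowPrincipals (quadField n))) h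
    ⟨QuotientGroup.mk'_surjective _, fun c => QuotientGroup.eq_one_iff c⟩

lemma sq_mod_of_primes : ∀ (D : ℕ), Squarefree D → ∀ c : ℤ,
    (∀ p : ℕ, p.Prime → p ∣ D → ∃ r : ℤ, (p : ℤ) ∣ r ^ 2 - c) → ∃ r : ℤ, (D : ℤ) ∣ r ^ 2 - c := by
  intro D
  induction D using Nat.recOnMul with
  | zero => intro h; simp at h
  | one => intro _ c _; exact ⟨0, by simp⟩
  | prime p hp => intro _ c h; exact h p hp dvd_rfl
  | mul a b iha ihb =>
    intro hs c h
    have hc : Nat.Coprime a b := Nat.coprime_of_squarefree_mul hs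
    obtain ⟨r1, h1⟩ := iha (hs.squarefree_of_dvd (dvd_mul_right a b)) c
      (fun p hp hd => h p hp (hd.mul_right b))
    obtain ⟨r2, h2⟩ := ihb (hs.squarefree_of_dvd (dvd_mul_left b a)) c
      (fun p hp hd => h p hp (hd.mul_left a))
    have hi : IsCoprime (a : ℤ) (b : ℤ) := Nat.isCoprime_iff_coprime.2 hc
    obtain ⟨u, v, huv⟩ := hi
    refine ⟨r1 * (v * b) + r2 * (u * a), ?_⟩
    push_cast
    refine IsCoprime.mul_dvd (Nat.isCoprime_iff_coprime.2 hc) ?_ ?_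
    · have : (r1 * (v * b) + r2 * (u * a)) ^ 2 - c = (r1 ^ 2 - c) +
          a * (u * (r2 - r1) * (2 * r1 + u * a * (r2 - r1))) := by
        have : v * (b : ℤ) = 1 - u * a := by linear_combination huv
        rw [this]; ring
      rw [this]
      exact dvd_add h1 (dvd_mul_right _ _)
    · have : (r1 * (v * b) + r2 * (u * a)) ^ 2 - c = (r2 ^ 2 - c) +
          b * (v * (r1 - r2) * (2 * r2 + v * b * (r1 - r2))) := by
        have : u * (a : ℤ) = 1 - v * b := by linear_combination huv
        rw [this]; ring
      rw [this]
      exact dvd_add h2 (dvd_mul_right _ _)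

lemma sqfree_nonsq {D : ℕ} (hs : Squarefree D) (h1 : 1 < D) (w : ℕ) : w ^ 2 ≠ D := by
  intro h
  have : IsUnit w := hs w ⟨1, by rw [← h]; ring⟩
  rw [Nat.isUnit_iff] at this
  subst this; omega

lemma legendre_pigeon {D m : ℕ} (hs : Squarefree (D * m)) (hD : 1 < D) (hm : 1 < m) {ρ τ : ℤ}
    (hρ : (D : ℤ) ∣ ρ ^ 2 - (-m)) (hτ : (m : ℤ) ∣ τ ^ 2 - D) : TSol D m := by
  have hc : Nat.Coprime D m := Nat.coprime_of_squarefree_mul hs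
  have hsD := hs.squarefree_of_dvd (dvd_mul_right D m)
  have hsm := hs.squarefree_of_dvd (dvd_mul_left m D)
  have hDm1 : 1 < D * m := by nlinarith
  have : NeZero D := ⟨by omega⟩
  have : NeZero m := ⟨by omega⟩
  let f : Fin (Nat.sqrt (D*m) + 1) × Fin (Nat.sqrt m + 1) × Fin (Nat.sqrt D + 1) → ZMod D × ZMod m :=
    fun q => (((q.1.1 : ℤ) - ρ * (q.2.2.1 : ℤ) : ℤ), ((q.1.1 : ℤ) - τ * (q.2.1.1 : ℤ) : ℤ))
  have hcard : Fintype.card (ZMod D × ZMod m) < Fintype.card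
      (Fin (Nat.sqrt (D*m) + 1) × Fin (Nat.sqrt m + 1) × Fin (Nat.sqrt D + 1)) := by
    simp only [Fintype.card_prod, ZMod.card, Fintype.card_fin]
    have e1 := Nat.lt_succ_sqrt (D*m)
    have e2 := Nat.lt_succ_sqrt m
    have e3 := Nat.lt_succ_sqrt D
    simp only [Nat.succ_eq_add_one] at e1 e2 e3
    by_contra hcon
    push Not at hcon
    set P := Nat.sqrt (D*m) + 1
    set R := Nat.sqrt m + 1
    set S := Nat.sqrt D + 1
    have h4 : m * D < (R * R) * (S * S) := Nat.mul_lt_mul'' e2 e3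
    have h5 : (D * m) * (m * D) < (P * P) * ((R * R) * (S * S)) := Nat.mul_lt_mul'' e1 h4
    have h6 : (P * (R * S)) * (P * (R * S)) ≤ (D * m) * (D * m) := Nat.mul_le_mul hcon hcon
    nlinarith
  obtain ⟨q, q', hne, hf⟩ := Fintype.exists_ne_map_eq_of_card_lt f hcard
  simp only [f, Prod.mk.injEq] at hf
  obtain ⟨hf1, hf2⟩ := hf
  rw [ZMod.intCast_eq_intCast_iff_dvd_sub] at hf1 hf2
  set z : ℤ := (q'.1.1 : ℤ) - q.1.1 with hz
  set x : ℤ := (q'.2.1.1 : ℤ) - q.2.1.1 with hx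
  set y : ℤ := (q'.2.2.1 : ℤ) - q.2.2.1 with hy
  have g1 : (D : ℤ) ∣ z - ρ * y := by
    have : z - ρ * y = (q'.1.1 : ℤ) - ρ * (q'.2.2.1 : ℤ) - ((q.1.1 : ℤ) - ρ * (q.2.2.1 : ℤ)) := by
      rw [hz, hy]; ring
    rw [this]; exact hf1
  have g2 : (m : ℤ) ∣ z - τ * x := by
    have : z - τ * x = (q'.1.1 : ℤ) - τ * (q'.2.1.1 : ℤ) - ((q.1.1 : ℤ) - τ * (q.2.1.1 : ℤ)) := by
      rw [hz, hx]; ring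
    rw [this]; exact hf2
  have key : ∀ (w : ℕ), Squarefree w → 1 < w → ∀ i j : Fin (Nat.sqrt w + 1),
      ((i.1 : ℤ) - j.1) ^ 2 < w := by
    intro w hw h1 i j
    have a1 : Nat.sqrt w ^ 2 < w := lt_of_le_of_ne (Nat.sqrt_le' w) (sqfree_nonsq hw h1 _)
    have a2 : ((i.1 : ℤ) - j.1) ^ 2 ≤ (Nat.sqrt w : ℤ) ^ 2 := by
      have := i.2; have := j.2
      apply sq_le_sq'
      · omega
      · omega
    have a3 : ((Nat.sqrt w : ℤ)) ^ 2 < w := by exact_mod_cast a1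
    omega
  have kz : z ^ 2 < (D * m : ℕ) := key _ hs hDm1 _ _
  have kx : x ^ 2 < m := key _ hsm hm _ _
  have ky : y ^ 2 < D := key _ hsD hD _ _
  have hnz : z ≠ 0 ∨ x ≠ 0 ∨ y ≠ 0 := by
    by_contra hcon
    push Not at hcon
    apply hne
    obtain ⟨c1, c2, c3⟩ := hcon
    refine Prod.ext (Fin.ext ?_) (Prod.ext (Fin.ext ?_) (Fin.ext ?_)) <;> omega
  have hQ1 : (D : ℤ) ∣ z ^ 2 + m * y ^ 2 - D * x ^ 2 := by
    have : z ^ 2 + m * y ^ 2 - D * x ^ 2 = (z - ρ * y) * (z + ρ * y) + (ρ ^ 2 - (-m)) * y ^ 2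
      - D * x ^ 2 := by ring
    rw [this]
    exact dvd_sub (dvd_add (g1.mul_right _) (hρ.mul_right _)) (dvd_mul_right _ _)
  have hQ2 : (m : ℤ) ∣ z ^ 2 + m * y ^ 2 - D * x ^ 2 := by
    have : z ^ 2 + m * y ^ 2 - D * x ^ 2 = (z - τ * x) * (z + τ * x) + (τ ^ 2 - D) * x ^ 2
      + m * y ^ 2 := by ring
    rw [this]
    exact dvd_add (dvd_add (g2.mul_right _) (hτ.mul_right _)) (dvd_mul_right _ _)
  obtain ⟨j, hj⟩ := IsCoprime.mul_dvd (Nat.isCoprime_iff_coprime.2 hc) hQ1 hQ2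
  push_cast at kz
  have hDp : (0 : ℤ) < D := by positivity
  have hmp : (0 : ℤ) < m := by positivity
  have hpos : (0 : ℤ) < D * m := by positivity
  have hub : z ^ 2 + m * y ^ 2 - D * x ^ 2 < D * m * 2 := by nlinarith [sq_nonneg x]
  have hlb : D * m * (-1) < z ^ 2 + m * y ^ 2 - D * x ^ 2 := by nlinarith [sq_nonneg z, sq_nonneg y]
  rw [hj] at hub hlb
  have j1 := lt_of_mul_lt_mul_left hub hpos.le
  have j2 := lt_of_mul_lt_mul_left hlb hpos.le
  have : j = 0 ∨ j = 1 := by omega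
  rcases this with rfl | rfl
  · exact ⟨x, y, z, by tauto, by linear_combination hj⟩
  · refine ⟨x ^ 2 + m, z + x * y, z * x - m * y, Or.inl (by positivity), ?_⟩
    linear_combination (x^2+m) * hj

lemma jac_one_of_sq {p : ℕ} (hp : p.Prime) (hp2 : p ≠ 2) {a b c : ℤ} (h : (p : ℤ) ∣ a ^ 2 - c * b ^ 2)
    (hb : ¬ (p : ℤ) ∣ b) (ha : ¬ (p : ℤ) ∣ a) : jacobiSym c p = 1 := by
  have := Fact.mk hp
  rw [← jacobiSym.legendreSym.to_jacobiSym]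
  have hb' : (b : ZMod p) ≠ 0 := by rwa [Ne, ZMod.intCast_zmod_eq_zero_iff_dvd]
  have ha' : (a : ZMod p) ≠ 0 := by rwa [Ne, ZMod.intCast_zmod_eq_zero_iff_dvd]
  have hzz : (a : ZMod p) ^ 2 - c * b ^ 2 = 0 := by
    have := (ZMod.intCast_zmod_eq_zero_iff_dvd _ p).2 h
    push_cast at this; exact this
  have hc : (c : ZMod p) ≠ 0 := by
    intro h0; rw [h0] at hzz; simp at hzz; exact ha' hzz
  rw [legendreSym.eq_one_iff p hc]
  exact ⟨a / b, by field_simp; linear_combination -hzz⟩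

/-- local conditions -/
def LC (D m : ℕ) : Prop := (∀ p : ℕ, p.Prime → p ≠ 2 → p ∣ m → jacobiSym D p = 1) ∧
  (∀ p : ℕ, p.Prime → p ≠ 2 → p ∣ D → jacobiSym (-m) p = 1)

lemma sq_of_jac {p : ℕ} (hp : p.Prime) {c : ℤ} (h : p ≠ 2 → jacobiSym c p = 1) :
    ∃ r : ℤ, (p : ℤ) ∣ r ^ 2 - c := by
  by_cases h2 : p = 2
  · subst h2
    refine ⟨c, ?_⟩
    have := Int.even_mul_succ_self (c - 1)
    rw [even_iff_two_dvd] at this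
    push_cast
    have e : c ^ 2 - c = (c - 1) * (c - 1 + 1) := by ring
    rw [e]; exact this
  · have := Fact.mk hp
    have h := h h2
    rw [← jacobiSym.legendreSym.to_jacobiSym] at h
    have hc : (c : ZMod p) ≠ 0 := by
      intro h0
      rw [(legendreSym.eq_zero_iff p c).2 h0] at h; simp at h
    rw [legendreSym.eq_one_iff p hc] at h
    obtain ⟨r, hr⟩ := h
    refine ⟨(r.val : ℤ), ?_⟩
    rw [← ZMod.intCast_zmod_eq_zero_iff_dvd]
    push_cast
    rw [ZMod.natCast_zmod_val, hr]; ring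

lemma tsol_of_lc {D m : ℕ} (hs : Squarefree (D * m)) (hm : 1 < m) (h : LC D m) : TSol D m := by
  have hD0 : 0 < D := by
    rcases Nat.eq_zero_or_pos D with rfl | h
    · simp at hs
    · exact h
  rcases Nat.lt_or_ge 1 D with hD | hD
  · have hsD := hs.squarefree_of_dvd (dvd_mul_right D m)
    have hsm := hs.squarefree_of_dvd (dvd_mul_left m D)
    obtain ⟨ρ, hρ⟩ := sq_mod_of_primes D hsD (-m) (fun p hp hd => sq_of_jac hp (fun h2 => h.2 p hp h2 hd))
    obtain ⟨τ, hτ⟩ := sq_mod_of_primes m hsm D (fun p hp hd => sq_of_jac hp (fun h2 => h.1 p hp h2 hd))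
    exact legendre_pigeon hs hD hm hρ hτ
  · have : D = 1 := by omega
    subst this
    exact ⟨1, 0, 1, by simp, by simp⟩


lemma lc_of_tsol {D m : ℕ} (hs : Squarefree (D * m)) (h : TSol D m) : LC D m := by
  obtain ⟨z, y, t, h1, h2⟩ := h.prim
  obtain ⟨-, q2, q3, q4⟩ := TSol.prim' hs rfl h1 h2
  constructor
  · intro p hp hp2 hd
    refine jac_one_of_sq hp hp2 (a := t) (b := z) ?_ (q3 p hp hd) (q2 p hp (hd.mul_left _))
    have : t ^ 2 - D * z ^ 2 = -(m * y ^ 2) := by linear_combination h1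
    rw [this, dvd_neg]
    exact (Int.natCast_dvd_natCast.2 hd).mul_right _
  · intro p hp hp2 hd
    refine jac_one_of_sq hp hp2 (a := t) (b := y) ?_ (q4 p hp hd) (q2 p hp (hd.mul_right _))
    have : t ^ 2 - -m * y ^ 2 = D * z ^ 2 := by linear_combination h1
    rw [this]
    exact (Int.natCast_dvd_natCast.2 hd).mul_right _

/-- the combinatorial 4-rank count -/
noncomputable def Tset (d : ℕ) : Finset ℕ := d.divisors.filter (fun a => LC a (d / a))

lemma LC_two_right {a b : ℕ} (h : ∀ p : ℕ, p.Prime → p ∣ a * b → jacobiSym 2 p = 1) :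
    LC a (2 * b) ↔ LC a b := by
  unfold LC
  refine and_congr ?_ ?_
  · refine forall_congr' fun p => forall_congr' fun hp => forall_congr' fun hp2 => ?_
    have : p ∣ 2 * b ↔ p ∣ b := by
      rw [hp.dvd_mul, Nat.prime_dvd_prime_iff_eq hp Nat.prime_two]
      tauto
    rw [this]
  · refine forall_congr' fun p => forall_congr' fun hp => forall_congr' fun hp2 => forall_congr' fun hd => ?_
    have : (-((2 * b : ℕ) : ℤ)) = 2 * (-b) := by push_cast; ring
    rw [this, jacobiSym.mul_left, h p hp (hd.mul_right b), one_mul]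

lemma LC_two_left {a b : ℕ} (h : ∀ p : ℕ, p.Prime → p ∣ a * b → jacobiSym 2 p = 1) :
    LC (2 * a) b ↔ LC a b := by
  unfold LC
  refine and_congr ?_ ?_
  · refine forall_congr' fun p => forall_congr' fun hp => forall_congr' fun hp2 => forall_congr' fun hd => ?_
    have : (((2 * a : ℕ) : ℤ)) = 2 * a := by push_cast; ring
    rw [this, jacobiSym.mul_left, h p hp (hd.mul_left a), one_mul]
  · refine forall_congr' fun p => forall_congr' fun hp => forall_congr' fun hp2 => ?_
    have : p ∣ 2 * a ↔ p ∣ a := by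
      rw [hp.dvd_mul, Nat.prime_dvd_prime_iff_eq hp Nat.prime_two]
      tauto
    rw [this]

lemma mod4_of_jac : ∀ a : ℕ, a % 2 = 1 → (∀ p : ℕ, p.Prime → p ≠ 2 → p ∣ a → jacobiSym (-1) p = 1) →
    a % 4 = 1 := by
  intro a
  induction a using Nat.recOnMul with
  | zero => intro h; simp at h
  | one => intro _ _; rfl
  | prime p hp =>
    intro h1 h
    have hp2 : p ≠ 2 := by rintro rfl; simp at h1
    have := h p hp hp2 dvd_rfl
    rw [jacobiSym.at_neg_one (Nat.odd_iff.2 h1)] at this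
    by_contra hc
    have h3 : p % 4 = 3 := by omega
    rw [ZMod.χ₄_nat_three_mod_four h3] at this
    simp at this
  | mul a b iha ihb =>
    intro h1 h
    have : a % 2 = 1 ∧ b % 2 = 1 := by
      rw [← Nat.odd_iff, ← Nat.odd_iff, ← Nat.odd_mul, Nat.odd_iff]; exact h1
    have e1 := iha this.1 (fun p hp h2 hd => h p hp h2 (hd.mul_right b))
    have e2 := ihb this.2 (fun p hp h2 hd => h p hp h2 (hd.mul_left a))
    rw [Nat.mul_mod, e1, e2]

lemma four_rank_T {d : ℕ} (hs : Squarefree d) (h4 : d % 4 = 3)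
    (h : ∀ p : ℕ, p.Prime → p ∣ d → jacobiSym 2 p = 1) :
    fourRankPow (NarrowClassGroup (quadField (2 * d))) = (Tset d).card := by
  have hd0 : d ≠ 0 := hs.ne_zero
  have hcop : Nat.Coprime 2 d := by
    rw [Nat.coprime_two_left, Nat.odd_iff]; omega
  have hs2 : Squarefree (2 * d) := (Nat.squarefree_mul_iff).2 ⟨hcop, Nat.prime_two.squarefree, hs⟩
  have key := four_rank_quad hs2 (by omega)
  have e : (2 * d).divisors.filter (fun D => TSol D (2 * d / D)) =
      Tset d ∪ (Tset d).image (fun a => 2 * a) := by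
    ext D
    simp only [Tset, Finset.mem_filter, Finset.mem_union, Finset.mem_image, Nat.mem_divisors]
    have A : ∀ a b, a * b = d → (TSol a (2 * b) ↔ LC a b) := by
      intro a b hab
      have hsab : Squarefree (a * (2 * b)) := by rw [show a * (2 * b) = 2 * (a * b) by ring, hab]; exact hs2
      rw [← LC_two_right (a := a) (b := b) (by rw [hab]; exact h)]
      refine ⟨lc_of_tsol hsab, tsol_of_lc hsab ?_⟩
      have : b ≠ 0 := by rintro rfl; simp at hab; exact hd0 hab.symm
      omega
    have B : ∀ a b, a * b = d → (TSol (2 * a) b ↔ LC a b) := by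
      intro a b hab
      have hsab : Squarefree ((2 * a) * b) := by rw [mul_assoc, hab]; exact hs2
      rw [← LC_two_left (a := a) (b := b) (by rw [hab]; exact h)]
      refine ⟨lc_of_tsol hsab, fun hl => tsol_of_lc hsab ?_ hl⟩
      have hb0 : b ≠ 0 := by rintro rfl; simp at hab; exact hd0 hab.symm
      by_contra hb1
      have hb : b = 1 := by omega
      subst hb
      rw [mul_one] at hab
      subst hab
      have := mod4_of_jac a (by omega) (fun p hp h2 hd => by
        have := hl.2 p hp h2 (hd.mul_left 2)
        simpa using this)
      omega
    constructor
    · rintro ⟨⟨hD, -⟩, hT⟩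
      by_cases h2 : 2 ∣ D
      · obtain ⟨a, rfl⟩ := h2
        obtain ⟨b, hb⟩ := (Nat.mul_dvd_mul_iff_left (by norm_num : 0 < 2)).1 hD
        have ha : 0 < a := Nat.pos_of_ne_zero (by rintro rfl; simp at hb; exact hd0 hb)
        right
        refine ⟨a, ⟨⟨⟨b, hb⟩, hd0⟩, ?_⟩, rfl⟩
        rw [Nat.mul_div_mul_left _ _ (by norm_num)] at hT
        have e : d / a = b := by rw [hb]; exact Nat.mul_div_cancel_left b ha
        rw [e] at hT ⊢
        exact (B a b hb.symm).1 hT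
      · have hc : Nat.Coprime D 2 := by
          rw [Nat.coprime_comm]; exact (Nat.Prime.coprime_iff_not_dvd Nat.prime_two).2 h2
        obtain ⟨b, hb⟩ := hc.dvd_of_dvd_mul_left hD
        have ha : 0 < D := Nat.pos_of_ne_zero (by rintro rfl; simp at hb; exact hd0 hb)
        left
        refine ⟨⟨⟨b, hb⟩, hd0⟩, ?_⟩
        have e : d / D = b := by rw [hb]; exact Nat.mul_div_cancel_left b ha
        have e' : 2 * d / D = 2 * b := by
          rw [hb, show 2 * (D * b) = D * (2 * b) by ring]; exact Nat.mul_div_cancel_left _ ha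
        rw [e'] at hT
        rw [e]
        exact (A D b hb.symm).1 hT
    · rintro (⟨⟨⟨b, hb⟩, -⟩, hl⟩ | ⟨a, ⟨⟨⟨b, hb⟩, -⟩, hl⟩, rfl⟩)
      · have ha : 0 < D := Nat.pos_of_ne_zero (by rintro rfl; simp at hb; exact hd0 hb)
        have e : d / D = b := by rw [hb]; exact Nat.mul_div_cancel_left b ha
        have e' : 2 * d / D = 2 * b := by
          rw [hb, show 2 * (D * b) = D * (2 * b) by ring]; exact Nat.mul_div_cancel_left _ ha
        rw [e] at hl
        rw [e']
        exact ⟨⟨⟨2 * b, by rw [hb]; ring⟩, by omega⟩, (A D b hb.symm).2 hl⟩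
      · have ha : 0 < a := Nat.pos_of_ne_zero (by rintro rfl; simp at hb; exact hd0 hb)
        have e : d / a = b := by rw [hb]; exact Nat.mul_div_cancel_left b ha
        rw [e] at hl
        rw [Nat.mul_div_mul_left _ _ (by norm_num), e]
        exact ⟨⟨⟨b, by rw [hb]; ring⟩, by omega⟩, (B a b hb.symm).2 hl⟩
  rw [e, Finset.card_union_of_disjoint, Finset.card_image_of_injective] at key
  · omega
  · intro x y hxy; simpa using hxy
  · rw [Finset.disjoint_left]
    rintro x hx hx'
    simp only [Tset, Finset.mem_filter, Finset.mem_image, Nat.mem_divisors] at hx hx'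
    obtain ⟨a, -, rfl⟩ := hx'
    have : 2 ∣ d := (dvd_mul_right 2 a).trans hx.1.1
    omega

section tuples
variable {ι : Type*} [Fintype ι]

/-- tuple attached to a coloring of the primes of `n` -/
noncomputable def tup {n : ℕ} (g : n.primeFactors → ι) (u : ι) : ℕ :=
  ∏ p ∈ Finset.univ.filter (fun p => g p = u), (p : ℕ)

/-- tuples with entries in `[1,Y]` -/
noncomputable def box (ι : Type*) [Fintype ι] (Y : ℕ) : Finset (ι → ℕ) :=
  Fintype.piFinset (fun _ : ι => Finset.Icc 1 Y)

lemma mem_box {Y : ℕ} {D : ι → ℕ} : D ∈ box ι Y ↔ ∀ u, 1 ≤ D u ∧ D u ≤ Y := by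
  simp [box, Fintype.mem_piFinset]

lemma tup_prod {n : ℕ} (hn : Squarefree n) (g : n.primeFactors → ι) : ∏ u, tup g u = n := by
  unfold tup
  have h := Finset.prod_fiberwise (Finset.univ) g (fun p => (p : ℕ))
  have h2 : ∏ p : n.primeFactors, (p : ℕ) = n := by
    rw [Finset.prod_coe_sort n.primeFactors (fun p => p)]
    exact Nat.prod_primeFactors_of_squarefree hn
  rw [h2] at h
  exact h

lemma dvd_tup {n : ℕ} (g : n.primeFactors → ι) (p : n.primeFactors) (u : ι) :
    (p : ℕ) ∣ tup g u ↔ g p = u := by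
  have hp := Nat.prime_of_mem_primeFactors p.2
  unfold tup
  rw [hp.prime.dvd_finset_prod_iff]
  constructor
  · rintro ⟨q, hq, hd⟩
    have : p = q := Subtype.ext ((Nat.prime_dvd_prime_iff_eq hp (Nat.prime_of_mem_primeFactors q.2)).1 hd)
    rw [this]; exact (Finset.mem_filter.1 hq).2
  · intro h
    exact ⟨p, by simp [h], dvd_rfl⟩

lemma tuple_sum {n Y : ℕ} (hn : Squarefree n) (hY : n ≤ Y) (F : (ι → ℕ) → ℝ) :
    ∑ D ∈ (box ι Y).filter (fun D => ∏ u, D u = n), F D = ∑ g : n.primeFactors → ι, F (tup g) := by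
  symm
  have hn0 : n ≠ 0 := hn.ne_zero
  refine Finset.sum_bij (fun g _ => tup g) ?_ ?_ ?_ (fun _ _ => rfl)
  · intro g _
    have h1 := tup_prod hn g
    rw [Finset.mem_filter, mem_box]
    refine ⟨fun u => ?_, h1⟩
    have hd : tup g u ∣ n := by
      conv_rhs => rw [← h1]
      exact Finset.dvd_prod_of_mem _ (Finset.mem_univ u)
    exact ⟨Nat.pos_of_dvd_of_pos hd (Nat.pos_of_ne_zero hn0), (Nat.le_of_dvd (Nat.pos_of_ne_zero hn0) hd).trans hY⟩
  · intro g _ g' _ h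
    funext p
    have h1 : (p : ℕ) ∣ tup g (g p) := (dvd_tup g p _).2 rfl
    have h2 : tup g = tup g' := h
    rw [h2] at h1
    exact ((dvd_tup g' p _).1 h1).symm
  · intro D hD
    rw [Finset.mem_filter, mem_box] at hD
    obtain ⟨hD1, hD2⟩ := hD
    have hex : ∀ p : n.primeFactors, ∃ u, (p : ℕ) ∣ D u := by
      intro p
      have hp := Nat.prime_of_mem_primeFactors p.2
      have := (Nat.dvd_of_mem_primeFactors p.2).trans hD2.symm.dvd
      rw [hp.prime.dvd_finset_prod_iff] at this
      obtain ⟨u, -, hu⟩ := this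
      exact ⟨u, hu⟩
    choose g hg using hex
    refine ⟨g, Finset.mem_univ _, ?_⟩
    funext u
    have hdn : ∀ u, D u ∣ n := fun u => by
      rw [← hD2]; exact Finset.dvd_prod_of_mem _ (Finset.mem_univ u)
    -- uniqueness
    have huniq : ∀ (p : n.primeFactors) u, (p : ℕ) ∣ D u → g p = u := by
      intro p u hu
      by_contra hne
      have h3 : D (g p) * D u ∣ n := by
        rw [← hD2, ← Finset.prod_pair (f := D) hne]
        exact Finset.prod_dvd_prod_of_subset _ _ _ (Finset.subset_univ _)
      have h4 : (p : ℕ) * p ∣ n := (mul_dvd_mul (hg p) hu).trans h3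
      exact (Nat.prime_of_mem_primeFactors p.2).not_isUnit (hn _ h4)
    have hsq := hn.squarefree_of_dvd (hdn u)
    rw [← Nat.prod_primeFactors_of_squarefree hsq]
    unfold tup
    refine Finset.prod_bij (fun p _ => (p : ℕ)) ?_ ?_ ?_ (fun _ _ => rfl)
    · intro p hp
      have e : g p = u := (Finset.mem_filter.1 hp).2
      have := hg p
      rw [e] at this
      exact Nat.mem_primeFactors.2 ⟨Nat.prime_of_mem_primeFactors p.2, this, hsq.ne_zero⟩
    · intro p _ q _ h; exact Subtype.ext h
    · intro p hp
      have h5 := Nat.dvd_of_mem_primeFactors hp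
      have h6 : p ∈ n.primeFactors :=
        Nat.mem_primeFactors.2 ⟨Nat.prime_of_mem_primeFactors hp, h5.trans (hdn u), hn0⟩
      exact ⟨⟨p, h6⟩, by simp [huniq ⟨p, h6⟩ u h5], rfl⟩

/-- multiplicative tuple functions -/
lemma tuple_mul {n Y : ℕ} (hn : Squarefree n) (hY : n ≤ Y) (G : ι → ℕ → ℝ) (h1 : ∀ u, G u 1 = 1)
    (hm : ∀ u a b, G u (a * b) = G u a * G u b) :
    ∑ D ∈ (box ι Y).filter (fun D => ∏ u, D u = n), ∏ u, G u (D u) =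
      ∏ p ∈ n.primeFactors, ∑ u, G u p := by
  rw [tuple_sum hn hY (fun D => ∏ u, G u (D u))]
  have hprod : ∀ (u : ι) (s : Finset n.primeFactors), G u (∏ p ∈ s, (p : ℕ)) = ∏ p ∈ s, G u p := by
    intro u s
    induction s using Finset.induction_on with
    | empty => simp [h1]
    | insert a s ha ih => rw [Finset.prod_insert ha, Finset.prod_insert ha, hm, ih]
  have : ∀ g : n.primeFactors → ι, ∏ u, G u (tup g u) = ∏ p, G (g p) p := by
    intro g
    unfold tup
    simp only [hprod]
    rw [← Finset.prod_fiberwise (s := Finset.univ) (g := g) (f := fun p => G (g p) p)]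
    refine Finset.prod_congr rfl fun u _ => Finset.prod_congr rfl fun p hp => ?_
    rw [(Finset.mem_filter.1 hp).2]
  simp only [this]
  rw [← Finset.prod_coe_sort n.primeFactors (fun p => ∑ u, G u p), Finset.prod_univ_sum]
  simp

end tuples

/-- sign power -/
def spow (x : ℤ) (c : ZMod 2) : ℤ := if c = 0 then 1 else x

lemma spow_zero (x : ℤ) : spow x 0 = 1 := by simp [spow]
lemma spow_one (x : ℤ) : spow x 1 = x := by simp [spow]

lemma spow_mul (x y : ℤ) (c : ZMod 2) : spow (x * y) c = spow x c * spow y c := by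
  unfold spow; split_ifs <;> simp

lemma spow_prod {α : Type*} (s : Finset α) (f : α → ℤ) (c : ZMod 2) :
    spow (∏ i ∈ s, f i) c = ∏ i ∈ s, spow (f i) c := by
  unfold spow; split_ifs <;> simp

lemma spow_add {x : ℤ} (hx : x * x = 1) (a b : ZMod 2) : spow x (a + b) = spow x a * spow x b := by
  have : ∀ a b : ZMod 2, (a = 0 ∨ a = 1) ∧ (b = 0 ∨ b = 1) := by decide
  obtain ⟨rfl | rfl, rfl | rfl⟩ := this a b
  · simp [spow]
  · simp [spow]
  · simp [spow]
  · rw [show (1 + 1 : ZMod 2) = 0 from rfl, spow_zero, spow_one, hx]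

lemma spow_sum {x : ℤ} (hx : x * x = 1) {α : Type*} (s : Finset α) (f : α → ZMod 2) :
    spow x (∑ i ∈ s, f i) = ∏ i ∈ s, spow x (f i) := by
  induction s using Finset.induction_on with
  | empty => simp [spow]
  | insert a s ha ih => rw [Finset.sum_insert ha, Finset.prod_insert ha, spow_add hx, ih]

lemma jac_prod_left {α : Type*} (s : Finset α) (f : α → ℕ) (m : ℕ) :
    jacobiSym ((∏ i ∈ s, f i : ℕ) : ℤ) m = ∏ i ∈ s, jacobiSym (f i) m := by
  induction s using Finset.induction_on with
  | empty => simp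
  | insert a s ha ih =>
    rw [Finset.prod_insert ha, Finset.prod_insert ha, ← ih]; push_cast; rw [jacobiSym.mul_left]

lemma jac_prod_right {α : Type*} (s : Finset α) (f : α → ℕ) (hf : ∀ i ∈ s, f i ≠ 0) (m : ℤ) :
    jacobiSym m (∏ i ∈ s, f i) = ∏ i ∈ s, jacobiSym m (f i) := by
  induction s using Finset.induction_on with
  | empty => simp
  | insert a s ha ih =>
    have h2 := fun i hi => hf i (Finset.mem_insert_of_mem hi)
    rw [Finset.prod_insert ha, Finset.prod_insert ha, ← ih h2, jacobiSym.mul_right']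
    · exact hf a (Finset.mem_insert_self _ _)
    · exact Finset.prod_ne_zero_iff.2 h2

lemma c4_prod {α : Type*} (s : Finset α) (f : α → ℕ) : c4 (∏ i ∈ s, f i) = ∏ i ∈ s, c4 (f i) := by
  induction s using Finset.induction_on with
  | empty => rfl
  | insert a s ha ih => rw [Finset.prod_insert ha, Finset.prod_insert ha, ← ih, c4_mul]

lemma z2 (a : ZMod 2) : a = 0 ∨ a = 1 := by revert a; decide

/-- local symbol -/
noncomputable def xs {n : ℕ} (g : n.primeFactors → ZMod 2) (p : n.primeFactors) : ℤ :=
  if g p = 1 then jacobiSym (-(tup g 0 : ℕ)) p else jacobiSym (tup g 1 : ℕ) p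

lemma xs_expand {n : ℕ} (ho : Odd n) (g e : n.primeFactors → ZMod 2) (p : n.primeFactors) :
    spow (xs g p) (1 + g p + e p) = spow (c4 p) (g p * e p) *
      ∏ q : n.primeFactors, spow (jacobiSym (q : ℕ) p) ((g q + g p) * (g q + e p)) := by
  have hp : Odd (p : ℕ) := ho.of_dvd_nat (Nat.dvd_of_mem_primeFactors p.2)
  have hpr : ∀ u : ZMod 2, jacobiSym (tup g u : ℕ) p = ∏ q : n.primeFactors, spow (jacobiSym (q : ℕ) p) (g q + u + 1) := by
    intro u
    unfold tup
    rw [jac_prod_left, Finset.prod_filter]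
    refine Finset.prod_congr rfl fun q _ => ?_
    have key : ∀ a u : ZMod 2, (a = u ↔ a + u + 1 ≠ 0) := by decide
    unfold spow
    by_cases h : g q = u
    · rw [if_pos h, if_neg ((key _ _).1 h)]
    · rw [if_neg h, if_pos]
      by_contra hc; exact h ((key _ _).2 hc)
  unfold xs
  have e01 : (1 : ZMod 2) + 0 = 1 := rfl
  rcases z2 (g p) with h | h <;> rcases z2 (e p) with h' | h' <;> rw [h, h']
  · rw [if_neg (by decide), show (1 + 0 + 0 : ZMod 2) = 1 from rfl, spow_one, hpr, mul_zero, spow_zero, one_mul]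
    refine Finset.prod_congr rfl fun q _ => ?_
    congr 1
    generalize g q = a; revert a; decide
  · rw [show (1 + 0 + 1 : ZMod 2) = 0 from rfl, spow_zero, zero_mul, spow_zero, one_mul]
    symm; apply Finset.prod_eq_one; intro q _
    have : (g q + 0) * (g q + 1) = 0 := by generalize g q = a; revert a; decide
    rw [this, spow_zero]
  · rw [show (1 + 1 + 0 : ZMod 2) = 0 from rfl, spow_zero, mul_zero, spow_zero, one_mul]
    symm; apply Finset.prod_eq_one; intro q _
    have : (g q + 1) * (g q + 0) = 0 := by generalize g q = a; revert a; decide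
    rw [this, spow_zero]
  · rw [if_pos rfl, show (1 + 1 + 1 : ZMod 2) = 1 from rfl, spow_one, mul_one, spow_one,
      neg_eq_neg_one_mul, jacobiSym.mul_left, jacobiSym.at_neg_one hp, hpr]
    congr 1
    refine Finset.prod_congr rfl fun q _ => ?_
    congr 1
    generalize g q = a; revert a; decide

lemma prime_jac_ne {p a : ℕ} (hp : p.Prime) (h : ¬ p ∣ a) : jacobiSym (a : ℤ) p = 1 ∨ jacobiSym (a : ℤ) p = -1 := by
  apply jacobiSym.eq_one_or_neg_one
  rw [Int.gcd_natCast_natCast, Nat.gcd_comm]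
  exact (Nat.Prime.coprime_iff_not_dvd hp).2 h

lemma xs_pm {n : ℕ} (g : n.primeFactors → ZMod 2) (p : n.primeFactors) : xs g p = 1 ∨ xs g p = -1 := by
  have hp := Nat.prime_of_mem_primeFactors p.2
  unfold xs
  split_ifs with h
  · apply jacobiSym.eq_one_or_neg_one
    rw [Int.neg_gcd, Int.gcd_natCast_natCast, Nat.gcd_comm]
    refine (Nat.Prime.coprime_iff_not_dvd hp).2 ?_
    rw [dvd_tup, h]; decide
  · exact prime_jac_ne hp (by rw [dvd_tup]; exact h)

lemma LC_iff_xs {n : ℕ} (ho : Odd n) (g : n.primeFactors → ZMod 2) :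
    LC (tup g 1) (tup g 0) ↔ ∀ p, xs g p = 1 := by
  have key : ∀ (p : ℕ) (u : ZMod 2), p.Prime → p ∣ tup g u → p ∈ n.primeFactors := by
    intro p u hp hd
    unfold tup at hd
    rw [hp.prime.dvd_finset_prod_iff] at hd
    obtain ⟨q, -, hq⟩ := hd
    rw [(Nat.prime_dvd_prime_iff_eq hp (Nat.prime_of_mem_primeFactors q.2)).1 hq]
    exact q.2
  have hp2 : ∀ p : n.primeFactors, (p : ℕ) ≠ 2 := by
    intro p h
    have : Odd (p : ℕ) := ho.of_dvd_nat (Nat.dvd_of_mem_primeFactors p.2)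
    rw [h] at this; exact absurd this (by decide)
  constructor
  · rintro ⟨h1, h2⟩ p
    have hp := Nat.prime_of_mem_primeFactors p.2
    unfold xs
    split_ifs with h
    · exact h2 p hp (hp2 p) ((dvd_tup g p 1).2 h)
    · refine h1 p hp (hp2 p) ((dvd_tup g p 0).2 ?_)
      rcases z2 (g p) with h' | h'
      · exact h'
      · exact absurd h' h
  · intro h
    constructor
    · intro p hp h2 hd
      have hm := key p 0 hp hd
      have := h ⟨p, hm⟩
      have e : g ⟨p, hm⟩ = 0 := (dvd_tup g ⟨p, hm⟩ 0).1 hd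
      unfold xs at this
      rw [if_neg (by rw [e]; decide)] at this
      exact this
    · intro p hp h2 hd
      have hm := key p 1 hp hd
      have := h ⟨p, hm⟩
      have e : g ⟨p, hm⟩ = 1 := (dvd_tup g ⟨p, hm⟩ 1).1 hd
      unfold xs at this
      rw [if_pos e] at this
      exact this

lemma prod_z2 (D : ZMod 2 → ℕ) : ∏ u, D u = D 0 * D 1 := Fin.prod_univ_two D

lemma Tset_card {n : ℕ} (hn : Squarefree n) :
    (((Tset n).card : ℤ) : ℝ) = ∑ g : n.primeFactors → ZMod 2, if LC (tup g 1) (tup g 0) then (1 : ℝ) else 0 := by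
  rw [← tuple_sum hn le_rfl (fun D : ZMod 2 → ℕ => if LC (D 1) (D 0) then (1 : ℝ) else 0),
    ← Finset.sum_filter, Finset.sum_const, nsmul_eq_mul, mul_one]
  push_cast
  congr 1
  have hn0 := Nat.pos_of_ne_zero hn.ne_zero
  refine Finset.card_bij' (fun a _ => fun u : ZMod 2 => if u = 1 then a else n / a) (fun D _ => D 1) ?_ ?_ ?_ ?_
  · intro a ha
    simp only [Tset, Finset.mem_filter, Nat.mem_divisors] at ha
    have e : a * (n / a) = n := Nat.mul_div_cancel' ha.1.1
    have ha0 := Nat.pos_of_dvd_of_pos ha.1.1 hn0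
    have hb0 : 0 < n / a := Nat.pos_of_ne_zero (by intro h0; rw [h0] at e; omega)
    simp only [Finset.mem_filter, mem_box, prod_z2]
    refine ⟨⟨fun u => ?_, ?_⟩, ?_⟩
    · split_ifs
      · exact ⟨ha0, Nat.le_of_dvd hn0 ha.1.1⟩
      · exact ⟨hb0, Nat.div_le_self _ _⟩
    · rw [if_neg (by decide), if_pos trivial, mul_comm]; exact e
    · rw [if_pos trivial, if_neg (by decide)]; exact ha.2
  · intro D hD
    simp only [Finset.mem_filter, mem_box, prod_z2] at hD
    obtain ⟨⟨h1, h2⟩, h3⟩ := hD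
    simp only [Tset, Finset.mem_filter, Nat.mem_divisors]
    have e : n / D 1 = D 0 := by rw [← h2]; exact Nat.mul_div_cancel _ (h1 1).1
    rw [e]
    exact ⟨⟨⟨D 0, by rw [← h2]; ring⟩, hn.ne_zero⟩, h3⟩
  · intro a _; simp
  · intro D hD
    simp only [Finset.mem_filter, mem_box, prod_z2] at hD
    obtain ⟨⟨h1, h2⟩, h3⟩ := hD
    funext u
    have e : n / D 1 = D 0 := by rw [← h2]; exact Nat.mul_div_cancel _ (h1 1).1
    rcases z2 u with rfl | rfl
    · rw [if_neg (by decide), e]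
    · rw [if_pos rfl]

/-- the weight for `k = 1` -/
noncomputable def W1 {n : ℕ} (G : n.primeFactors → ZMod 2 × ZMod 2) : ℤ :=
  (∏ p : n.primeFactors, spow (c4 p) ((G p).1 * (G p).2)) *
    ∏ p : n.primeFactors, ∏ q : n.primeFactors, spow (jacobiSym (q : ℕ) p) (((G q).1 + (G p).1) * ((G q).1 + (G p).2))

lemma T_W1 {n : ℕ} (hn : Squarefree n) (ho : Odd n) :
    ((Tset n).card : ℤ) * 2 ^ n.primeFactors.card = ∑ G : n.primeFactors → ZMod 2 × ZMod 2, W1 G := by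
  have h1 : ((Tset n).card : ℤ) = ∑ g : n.primeFactors → ZMod 2, if LC (tup g 1) (tup g 0) then (1 : ℤ) else 0 := by
    have := Tset_card hn
    exact_mod_cast this
  rw [h1, Finset.sum_mul, ← (Equiv.arrowProdEquivProdArrow n.primeFactors (fun _ => ZMod 2) (fun _ => ZMod 2)).symm.sum_comp,
    Fintype.sum_prod_type]
  refine Finset.sum_congr rfl fun g _ => ?_
  have h2 : (if LC (tup g 1) (tup g 0) then (1 : ℤ) else 0) * 2 ^ n.primeFactors.card = ∏ p, (1 + xs g p) := by
    rw [LC_iff_xs ho]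
    split_ifs with h
    · simp only [h]
      simp
    · push Not at h
      obtain ⟨p, hp⟩ := h
      rw [zero_mul]
      symm
      apply Finset.prod_eq_zero (Finset.mem_univ p)
      rcases xs_pm g p with h' | h'
      · exact absurd h' hp
      · rw [h']; rfl
  rw [h2]
  have h3 : ∀ p, 1 + xs g p = ∑ e : ZMod 2, spow (xs g p) (1 + g p + e) := by
    intro p
    have : ∑ e : ZMod 2, spow (xs g p) (1 + g p + e) = spow (xs g p) (1 + g p + 0) + spow (xs g p) (1 + g p + 1) :=
      Fin.sum_univ_two _
    rw [this]
    rcases z2 (g p) with h | h <;> rw [h]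
    · rw [show (1 + 0 + 0 : ZMod 2) = 1 from rfl, show (1 + 0 + 1 : ZMod 2) = 0 from rfl, spow_zero, spow_one]; ring
    · rw [show (1 + 1 + 0 : ZMod 2) = 0 from rfl, show (1 + 1 + 1 : ZMod 2) = 1 from rfl, spow_zero, spow_one]
  simp only [h3]
  rw [Finset.prod_univ_sum]
  rw [Fintype.piFinset_univ]
  refine Finset.sum_congr rfl fun e _ => ?_
  unfold W1
  rw [← Finset.prod_mul_distrib]
  refine Finset.prod_congr rfl fun p _ => ?_
  exact xs_expand ho g e p

/-- the weight of a tuple -/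
noncomputable def wt {k : ℕ} (D : (Fin (2 * k) → ZMod 2) → ℕ) : ℤ :=
  (∏ u, spow (c4 (D u)) (lambdaK u)) * ∏ u, ∏ v, spow (jacobiSym (D u) (D v)) (phiK u v)

lemma phi_self {k : ℕ} (u : Fin (2 * k) → ZMod 2) : phiK u u = 0 := by
  unfold phiK
  apply Finset.sum_eq_zero
  intro j _
  generalize u _ = a; generalize u _ = b
  revert a b; decide

lemma wt_tup {k n : ℕ} (g : n.primeFactors → (Fin (2 * k) → ZMod 2)) :
    wt (tup g) = (∏ p : n.primeFactors, spow (c4 p) (lambdaK (g p))) *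
      ∏ p : n.primeFactors, ∏ q : n.primeFactors, spow (jacobiSym (q : ℕ) p) (phiK (g q) (g p)) := by
  unfold wt
  congr 1
  · rw [← Finset.prod_fiberwise (s := Finset.univ) (g := g) (f := fun p => spow (c4 p) (lambdaK (g p)))]
    refine Finset.prod_congr rfl fun u _ => ?_
    unfold tup
    rw [c4_prod, spow_prod]
    refine Finset.prod_congr (by congr) fun p hp => ?_
    rw [(Finset.mem_filter.1 hp).2]
  · rw [Finset.prod_comm]
    rw [← Finset.prod_fiberwise (s := Finset.univ) (g := g) (f := fun p => ∏ q : n.primeFactors, spow (jacobiSym (q : ℕ) p) (phiK (g q) (g p)))]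
    refine Finset.prod_congr rfl fun v _ => ?_
    rw [Finset.prod_comm]
    rw [← Finset.prod_fiberwise (s := Finset.univ) (g := g) (f := fun q => ∏ p ∈ Finset.univ.filter (fun p => g p = v), spow (jacobiSym (q : ℕ) p) (phiK (g q) (g p)))]
    refine Finset.prod_congr rfl fun u _ => ?_
    unfold tup
    rw [jac_prod_left, spow_prod]
    refine Finset.prod_congr (by congr) fun q hq => ?_
    rw [jac_prod_right _ _ (fun p _ => (Nat.prime_of_mem_primeFactors p.2).ne_zero), spow_prod]
    refine Finset.prod_congr (by congr) fun p hp => ?_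
    rw [(Finset.mem_filter.1 hp).2, (Finset.mem_filter.1 hq).2]

lemma T_pow {k n : ℕ} (hn : Squarefree n) (ho : Odd n) :
    ((Tset n).card : ℤ) ^ k * (2 ^ k) ^ n.primeFactors.card =
      ∑ g : n.primeFactors → (Fin (2 * k) → ZMod 2), wt (tup g) := by
  rw [← pow_mul, mul_comm k, pow_mul, ← mul_pow, T_W1 hn ho, Fintype.sum_pow]
  let E : (n.primeFactors → (Fin (2 * k) → ZMod 2)) ≃ (Fin k → n.primeFactors → ZMod 2 × ZMod 2) :=
    (Equiv.arrowCongr (Equiv.refl _) (pairEquiv k)).trans (Equiv.piComm _)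
  rw [← E.sum_comp]
  refine Finset.sum_congr rfl fun g _ => ?_
  rw [wt_tup]
  unfold W1
  rw [Finset.prod_mul_distrib]
  have hE : ∀ j p, E g j p = pairEquiv k (g p) j := fun j p => rfl
  simp only [hE]
  congr 1
  · rw [Finset.prod_comm]
    refine Finset.prod_congr rfl fun p _ => ?_
    have hp : Odd (p : ℕ) := ho.of_dvd_nat (Nat.dvd_of_mem_primeFactors p.2)
    rw [← spow_sum]
    · rfl
    · rw [c4_eq]; rw [Nat.odd_iff] at hp; split_ifs <;> first | omega | simp
  · rw [Finset.prod_comm]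
    refine Finset.prod_congr rfl fun p _ => ?_
    rw [Finset.prod_comm]
    refine Finset.prod_congr rfl fun q _ => ?_
    by_cases hpq : q = p
    · subst hpq
      rw [phi_self, spow_zero]
      apply Finset.prod_eq_one
      intro j _
      have : ∀ a b : ZMod 2, (a + a) * (a + b) = 0 := by decide
      rw [this, spow_zero]
    · rw [← spow_sum]
      · rfl
      · have : ¬ (p : ℕ) ∣ q := by
          rw [Nat.prime_dvd_prime_iff_eq (Nat.prime_of_mem_primeFactors p.2) (Nat.prime_of_mem_primeFactors q.2)]
          intro h; exact hpq (Subtype.ext h.symm)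
        rcases prime_jac_ne (Nat.prime_of_mem_primeFactors p.2) this with h | h <;> rw [h] <;> rfl

lemma T_tuple {k n Y : ℕ} (hn : Squarefree n) (ho : Odd n) (hY : n ≤ Y) :
    ((Tset n).card : ℝ) ^ k * (2 ^ k) ^ n.primeFactors.card =
      ∑ D ∈ (box (Fin (2 * k) → ZMod 2) Y).filter (fun D => ∏ u, D u = n), (wt D : ℝ) := by
  rw [tuple_sum hn hY (fun D => (wt D : ℝ))]
  exact_mod_cast T_pow hn ho

section tup3
variable {ι : Type*} [Fintype ι]

/-- tuples with product at most `Y` -/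
noncomputable def TB (ι : Type*) [Fintype ι] (Y : ℕ) : Finset (ι → ℕ) :=
  (box ι Y).filter (fun D => ∏ u, D u ≤ Y)

lemma mem_TB {Y : ℕ} {D : ι → ℕ} : D ∈ TB ι Y ↔ (∀ u, 1 ≤ D u) ∧ ∏ u, D u ≤ Y := by
  unfold TB
  rw [Finset.mem_filter, mem_box]
  constructor
  · rintro ⟨h1, h2⟩; exact ⟨fun u => (h1 u).1, h2⟩
  · rintro ⟨h1, h2⟩
    refine ⟨fun u => ⟨h1 u, ?_⟩, h2⟩
    refine le_trans (Nat.le_of_dvd ?_ (Finset.dvd_prod_of_mem D (Finset.mem_univ u))) h2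
    exact Finset.prod_pos fun v _ => h1 v

lemma sum_TB (Y : ℕ) (F : (ι → ℕ) → ℝ) :
    ∑ D ∈ TB ι Y, F D =
      ∑ n ∈ Finset.Icc 1 Y, ∑ D ∈ (box ι Y).filter (fun D => ∏ u, D u = n), F D := by
  rw [← Finset.sum_fiberwise_of_maps_to (s := TB ι Y) (t := Finset.Icc 1 Y) (g := fun D => ∏ u, D u)]
  · refine Finset.sum_congr rfl fun n hn => Finset.sum_congr ?_ fun _ _ => rfl
    ext D
    simp only [TB, Finset.mem_filter]
    rw [Finset.mem_Icc] at hn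
    constructor
    · rintro ⟨⟨a, b⟩, c⟩; exact ⟨a, c⟩
    · rintro ⟨a, c⟩; exact ⟨⟨a, c ▸ hn.2⟩, c⟩
  · intro D hD
    rw [mem_TB] at hD
    exact Finset.mem_Icc.2 ⟨Nat.succ_le_of_lt (Finset.prod_pos fun v _ => hD.1 v), hD.2⟩

lemma sum_TB' (Y : ℕ) (a : ℕ → ℝ) (F : (ι → ℕ) → ℝ) :
    ∑ D ∈ TB ι Y, a (∏ u, D u) * F D =
      ∑ n ∈ Finset.Icc 1 Y, a n * ∑ D ∈ (box ι Y).filter (fun D => ∏ u, D u = n), F D := by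
  rw [sum_TB]
  refine Finset.sum_congr rfl fun n _ => ?_
  rw [Finset.mul_sum]
  refine Finset.sum_congr rfl fun D hD => ?_
  rw [(Finset.mem_filter.1 hD).2]

lemma TB_gm (Y : ℕ) (h : ℕ → ℝ) (G : ι → ℕ → ℝ) (h1 : ∀ u, G u 1 = 1)
    (hm : ∀ u a b, G u (a * b) = G u a * G u b) :
    ∑ D ∈ TB ι Y, gm h (∏ u, D u) * ∏ u, G u (D u) =
      ∑ n ∈ Finset.Icc 1 Y, gm (fun p => h p * ∑ u, G u p) n := by
  rw [sum_TB' Y (gm h) (fun D => ∏ u, G u (D u))]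
  refine Finset.sum_congr rfl fun n hn => ?_
  by_cases hs : Squarefree n
  · rw [tuple_mul hs (Finset.mem_Icc.1 hn).2 G h1 hm]
    simp only [gm, hs, if_true]
    rw [Finset.prod_mul_distrib]
  · simp [gm, hs]

lemma gm_abs (h : ℕ → ℝ) (n : ℕ) : |gm h n| = gm (fun p => |h p|) n := by
  unfold gm
  split_ifs
  · rw [Finset.abs_prod]
  · simp

lemma gm_mono {f g : ℕ → ℝ} {n : ℕ} (h0 : ∀ p, p.Prime → 0 ≤ f p) (h : ∀ p, p.Prime → f p ≤ g p) :
    gm f n ≤ gm g n := by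
  unfold gm
  split_ifs
  · exact Finset.prod_le_prod (fun p hp => h0 p (Nat.prime_of_mem_primeFactors hp))
      (fun p hp => h p (Nat.prime_of_mem_primeFactors hp))
  · exact le_rfl

lemma gm_le_one {f : ℕ → ℝ} {n : ℕ} (h0 : ∀ p, 0 ≤ f p) (h : ∀ p, f p ≤ 1) :
    gm f n ≤ 1 := by
  unfold gm
  split_ifs
  · exact Finset.prod_le_one (fun p _ => h0 p) (fun p _ => h p)
  · exact zero_le_one

lemma gm_mul (h : ℕ → ℝ) {a b : ℕ} (ha : a ≠ 0) (hb : b ≠ 0) :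
    gm h (a * b) = gm h a * gm (fun p => if p ∣ a then 0 else h p) b := by
  by_cases hc : Nat.Coprime a b
  · unfold gm
    by_cases h1 : Squarefree a
    · by_cases h2 : Squarefree b
      · rw [if_pos (Nat.squarefree_mul_iff.2 ⟨hc, h1, h2⟩), if_pos h1, if_pos h2]
        rw [Nat.Coprime.primeFactors_mul hc, Finset.prod_union hc.disjoint_primeFactors]
        congr 1
        refine Finset.prod_congr rfl fun p hp => ?_
        beta_reduce
        rw [if_neg]
        intro hd
        exact Nat.Prime.not_coprime_iff_dvd.2 ⟨p, Nat.prime_of_mem_primeFactors hp, hd, Nat.dvd_of_mem_primeFactors hp⟩ hc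
      · rw [if_neg (fun h => h2 (Nat.squarefree_mul_iff.1 h).2.2), if_neg h2, mul_zero]
    · rw [if_neg (fun h => h1 (Nat.squarefree_mul_iff.1 h).2.1), if_neg h1, zero_mul]
  · obtain ⟨p, hp, h1, h2⟩ := Nat.Prime.not_coprime_iff_dvd.1 hc
    have : gm (fun p => if p ∣ a then 0 else h p) b = 0 := by
      unfold gm
      split_ifs
      · exact Finset.prod_eq_zero (Nat.mem_primeFactors.2 ⟨hp, h2, hb⟩) (by simp [h1])
      · rfl
    rw [this, mul_zero]
    unfold gm
    rw [if_neg]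
    rw [Nat.squarefree_mul_iff]; tauto

lemma harm_box (B : ℕ) : ∑ s ∈ box ι B, ∏ u, (1 / (s u : ℝ)) = harm B ^ Fintype.card ι := by
  have := Finset.prod_univ_sum (fun _ : ι => Finset.Icc 1 B) (fun _ n => 1 / (n : ℝ))
  unfold box
  rw [← this]
  simp [harm]

/-- glue two partial tuples -/
noncomputable def glue (p : ι → Prop) (D : {u // p u} → ℕ) (s : {u // ¬ p u} → ℕ) (u : ι) : ℕ :=
  if h : p u then D ⟨u, h⟩ else s ⟨u, h⟩

lemma glue_pos {p : ι → Prop} {D : {u // p u} → ℕ} {s : {u // ¬ p u} → ℕ} (u : {u // p u}) :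
    glue p D s u = D u := by
  unfold glue; rw [dif_pos u.2]

lemma glue_neg {p : ι → Prop} {D : {u // p u} → ℕ} {s : {u // ¬ p u} → ℕ} (u : {u // ¬ p u}) :
    glue p D s u = s u := by
  unfold glue; rw [dif_neg u.2]

lemma prod_glue {R : Type*} [CommMonoid R] (p : ι → Prop) (f : ι → R) :
    ∏ u, f u = (∏ u : {u // p u}, f u) * ∏ u : {u // ¬ p u}, f u :=
  (Fintype.prod_subtype_mul_prod_subtype p f).symm

lemma TB_split (p : ι → Prop) (Y : ℕ) (F : (ι → ℕ) → ℝ) :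
    ∑ D ∈ TB ι Y, F D = ∑ s ∈ box {u // ¬ p u} Y, ∑ D ∈ TB {u // p u} (Y / ∏ u, s u), F (glue p D s) := by
  rw [Finset.sum_sigma']
  refine Finset.sum_bij' (fun D _ => ⟨fun u => D u, fun u => D u⟩) (fun q _ => glue p q.2 q.1) ?_ ?_ ?_ ?_ ?_
  · intro D hD
    have hD' := mem_TB.1 hD
    have hD'' := mem_box.1 (Finset.mem_filter.1 hD).1
    rw [Finset.mem_sigma, mem_box, mem_TB]
    refine ⟨fun u => hD'' u, fun u => hD'.1 u, ?_⟩
    have h2 := hD'.2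
    rw [prod_glue p] at h2
    refine (Nat.le_div_iff_mul_le (Finset.prod_pos fun u _ => hD'.1 _)).2 ?_
    exact h2
  · rintro ⟨s, D⟩ h
    rw [Finset.mem_sigma, mem_box, mem_TB] at h
    obtain ⟨h1, h2, h3⟩ := h
    rw [mem_TB]
    constructor
    · intro u
      by_cases hu : p u
      · simp only [glue, dif_pos hu]; exact h2 _
      · simp only [glue, dif_neg hu]; exact (h1 _).1
    · rw [prod_glue p]
      simp only [glue_pos, glue_neg]
      rw [Nat.le_div_iff_mul_le (Finset.prod_pos fun u _ => (h1 u).1)] at h3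
      exact h3
  · intro D _
    funext u
    unfold glue
    split_ifs <;> rfl
  · rintro ⟨s, D⟩ _
    simp only [glue_pos, glue_neg]
  · intro D _
    congr 1
    funext u
    unfold glue
    split_ifs <;> rfl

/-- Fourier coefficient on the cube -/
noncomputable def fc (H : Finset ι → ℝ) (E : Finset ι) : ℝ :=
  (1 / 2) ^ Fintype.card ι * ∑ S : Finset ι, H S * ∏ u ∈ E, (if u ∈ S then (-1 : ℝ) else 1)

lemma cube_fourier (H : Finset ι → ℝ) (σ : ι → ℝ) (hσ : ∀ u, σ u = 1 ∨ σ u = -1) :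
    H (Finset.univ.filter (fun u => σ u = -1)) = ∑ E : Finset ι, fc H E * ∏ u ∈ E, σ u := by
  unfold fc
  simp only [mul_assoc, ← Finset.mul_sum, Finset.sum_mul]
  rw [Finset.sum_comm]
  simp only [← Finset.prod_mul_distrib, ← Finset.mul_sum]
  have key : ∀ S : Finset ι, ∑ E : Finset ι, ∏ u ∈ E, ((if u ∈ S then (-1 : ℝ) else 1) * σ u) =
      if S = Finset.univ.filter (fun u => σ u = -1) then 2 ^ Fintype.card ι else 0 := by
    intro S
    have h1 := Finset.prod_one_add (s := Finset.univ) (f := fun u => (if u ∈ S then (-1 : ℝ) else 1) * σ u)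
    rw [Finset.powerset_univ] at h1
    rw [← h1]
    split_ifs with h
    · have : ∀ u, 1 + (if u ∈ S then (-1 : ℝ) else 1) * σ u = 2 := by
        intro u
        rcases hσ u with h' | h'
        · have : u ∉ S := by rw [h]; simp [h']; norm_num
          rw [if_neg this, h']; norm_num
        · have : u ∈ S := by rw [h]; simp [h']
          rw [if_pos this, h']; norm_num
      rw [Finset.prod_congr rfl fun u _ => this u]
      simp
    · have : ∃ u, ¬ (u ∈ S ↔ σ u = -1) := by
        by_contra hc
        push Not at hc
        apply h
        ext u
        simp [hc u]
      obtain ⟨u, hu⟩ := this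
      apply Finset.prod_eq_zero (Finset.mem_univ u)
      rcases hσ u with h' | h'
      · have : u ∈ S := by
          by_contra hc
          exact hu ⟨fun h => absurd h hc, fun h => by rw [h'] at h; norm_num at h⟩
        rw [if_pos this, h']; norm_num
      · have : u ∉ S := fun hc => hu ⟨fun _ => h', fun _ => hc⟩
        rw [if_neg this, h']; norm_num
  simp only [key]
  simp only [mul_ite, mul_zero, Finset.sum_ite_eq', Finset.mem_univ, if_true]
  rw [one_div, mul_comm (H _), ← mul_assoc, ← mul_pow, inv_mul_cancel₀ (by norm_num), one_pow, one_mul]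

lemma fc_abs (H : Finset ι → ℝ) (hH : ∀ S, |H S| ≤ 1) (E : Finset ι) : |fc H E| ≤ 1 := by
  unfold fc
  rw [abs_mul, abs_of_nonneg (by positivity)]
  have : |∑ S : Finset ι, H S * ∏ u ∈ E, (if u ∈ S then (-1 : ℝ) else 1)| ≤ 2 ^ Fintype.card ι := by
    refine (Finset.abs_sum_le_sum_abs _ _).trans ?_
    have : ∀ S ∈ (Finset.univ : Finset (Finset ι)), |H S * ∏ u ∈ E, (if u ∈ S then (-1 : ℝ) else 1)| ≤ 1 := by
      intro S _
      rw [abs_mul, Finset.abs_prod]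
      have : ∏ u ∈ E, |(if u ∈ S then (-1 : ℝ) else 1)| = 1 := by
        apply Finset.prod_eq_one; intro u _; split_ifs <;> simp
      rw [this, mul_one]; exact hH S
    refine (Finset.sum_le_sum this).trans ?_
    simp
  calc _ ≤ (1 / 2 : ℝ) ^ Fintype.card ι * 2 ^ Fintype.card ι := by gcongr
    _ = 1 := by rw [← mul_pow]; norm_num

end tup3

/-- indicator of `χ₈ = 1` -/
noncomputable def hb (p : ℕ) : ℝ := if c8 p = 1 then 1 else 0

lemma hb_nonneg (p : ℕ) : 0 ≤ hb p := by unfold hb; split_ifs <;> norm_num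
lemma hb_le_one (p : ℕ) : hb p ≤ 1 := by unfold hb; split_ifs <;> norm_num
lemma hb_two : hb 2 = 0 := by
  have : c8 2 = 0 := by decide
  simp [hb, this]

lemma hb_le (p : ℕ) (hp : p.Prime) : hb p ≤ 1 / 2 * (1 + c8 p) := by
  unfold hb
  split_ifs with h
  · rw [h]; norm_num
  · have h1 := c8_abs p
    rw [abs_le] at h1
    have : (-1 : ℝ) ≤ c8 p := by exact_mod_cast h1.1
    linarith

lemma c8_iff {p : ℕ} (hp : p.Prime) : c8 p = 1 ↔ jacobiSym 2 p = 1 := by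
  rcases hp.eq_two_or_odd' with rfl | ho
  · have : c8 2 = 0 := by decide
    have h2 : jacobiSym 2 2 = 0 := by
      rw [jacobiSym.eq_zero_iff_not_coprime]; decide
    simp [this, h2]
  · rw [jacobiSym.at_two ho]; rfl

lemma gm_odd {N : ℝ} {n : ℕ} (h : gm (fun p => hb p / N) n ≠ 0) : Squarefree n ∧ Odd n := by
  unfold gm at h
  split_ifs at h with hs
  · refine ⟨hs, ?_⟩
    by_contra ho
    rw [Nat.not_odd_iff_even, even_iff_two_dvd] at ho
    apply h
    exact Finset.prod_eq_zero (Nat.mem_primeFactors.2 ⟨Nat.prime_two, ho, hs.ne_zero⟩) (by simp [hb_two])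
  · exact absurd rfl h

lemma gm_hb_eq (n : ℕ) : gm hb n = if Squarefree n ∧ ∀ p : ℕ, p.Prime → p ∣ n → jacobiSym 2 p = 1 then 1 else 0 := by
  unfold gm
  by_cases hs : Squarefree n
  · rw [if_pos hs]
    split_ifs with h
    · apply Finset.prod_eq_one
      intro p hp
      have hpp := Nat.prime_of_mem_primeFactors hp
      unfold hb
      rw [if_pos ((c8_iff hpp).2 (h.2 p hpp (Nat.dvd_of_mem_primeFactors hp)))]
    · have : ∃ p : ℕ, p.Prime ∧ p ∣ n ∧ jacobiSym 2 p ≠ 1 := by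
        by_contra hc
        push Not at hc
        exact h ⟨hs, hc⟩
      obtain ⟨p, hp, hd, hj⟩ := this
      apply Finset.prod_eq_zero (Nat.mem_primeFactors.2 ⟨hp, hd, hs.ne_zero⟩)
      unfold hb
      rw [if_neg (fun h => hj ((c8_iff hp).1 h))]
  · rw [if_neg hs, if_neg (fun h => hs h.1)]

lemma dcond_sum (X : ℝ) (f : ℕ → ℝ) :
    (∑ d ∈ Finset.range (⌊X⌋₊ + 1), if dCond X d then f d else 0) =
      ∑ n ∈ Finset.Icc 1 ⌊X / 2⌋₊, gm hb n * ((1 - c4 n) / 2) * f n := by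
  have hle : ∀ d : ℕ, d ≠ 0 → ((2 * d : ℝ) ≤ X ↔ d ≤ ⌊X / 2⌋₊) := by
    intro d hd
    rw [Nat.le_floor_iff' hd, le_div_iff₀ (by norm_num), mul_comm]
  have hpt : ∀ n ∈ Finset.Icc 1 ⌊X / 2⌋₊, gm hb n * ((1 - c4 n) / 2) * f n = if dCond X n then f n else 0 := by
    intro n hn
    rw [Finset.mem_Icc] at hn
    have h2 := (hle n (by omega)).2 hn.2
    by_cases h : dCond X n
    · rw [if_pos h, gm_hb_eq, if_pos ⟨h.1, h.2.2.2.2⟩, c4_eq, if_neg (by have := h.2.1; omega),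
        if_neg (by have := h.2.1; omega)]
      push_cast; ring
    · rw [if_neg h]
      by_cases hg : gm hb n = 0
      · rw [hg]; ring
      · have ho := gm_odd (N := 1) (n := n) (by simpa using hg)
        rw [gm_hb_eq] at hg
        have hg' : Squarefree n ∧ ∀ p : ℕ, p.Prime → p ∣ n → jacobiSym 2 p = 1 := by
          by_contra hc; exact hg (if_neg hc)
        have : n % 4 = 1 := by
          have := Nat.odd_iff.1 ho.2
          by_contra hc
          exact h ⟨hg'.1, by omega, by omega, h2, hg'.2⟩
        have hc : c4 n = 1 := by rw [c4_eq, if_neg (by omega), if_pos this]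
        rw [hc]; push_cast; ring
  rw [Finset.sum_congr rfl hpt]
  symm
  apply Finset.sum_subset
  · intro n hn
    rw [Finset.mem_Icc] at hn
    have h2 := (hle n (by omega)).2 hn.2
    rw [Finset.mem_range, Nat.lt_succ_iff]
    apply Nat.le_floor
    have : (0 : ℝ) ≤ n := Nat.cast_nonneg n
    linarith
  · intro n _ hn
    rw [if_neg]
    intro h
    apply hn
    have h0 : n ≠ 0 := by rintro rfl; have := h.2.1; simp at this
    rw [Finset.mem_Icc]
    exact ⟨by omega, (hle n h0).1 h.2.2.2.1⟩

/-- summand attached to a tuple -/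
noncomputable def vval (k : ℕ) (D : (Fin (2 * k) → ZMod 2) → ℕ) : ℝ :=
  gm (fun p => hb p / 2 ^ k) (∏ u, D u) * ((1 - c4 (∏ u, D u)) / 2) * wt D

lemma gm_div (h : ℕ → ℝ) {N : ℝ} (hN : N ≠ 0) (n : ℕ) :
    gm (fun p => h p / N) n * N ^ n.primeFactors.card = gm h n := by
  unfold gm
  split_ifs
  · rw [Finset.prod_div_distrib, Finset.prod_const]
    field_simp
  · simp

lemma Scount_eq (k : ℕ) (X : ℝ) :
    Scount k X = ∑ D ∈ TB (Fin (2 * k) → ZMod 2) ⌊X / 2⌋₊, vval k D := by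
  have h1 : Scount k X = ∑ d ∈ Finset.range (⌊X⌋₊ + 1), if dCond X d then ((Tset d).card : ℝ) ^ k else 0 := by
    unfold Scount
    refine Finset.sum_congr rfl fun d _ => ?_
    by_cases h : dCond X d
    · rw [if_pos h, if_pos h, four_rank_T h.1 h.2.1 h.2.2.2.2]
    · rw [if_neg h, if_neg h]
  rw [h1, dcond_sum]
  unfold vval
  rw [sum_TB' _ (fun n => gm (fun p => hb p / 2 ^ k) n * ((1 - c4 n) / 2)) (fun D => (wt D : ℝ))]
  refine Finset.sum_congr rfl fun n hn => ?_
  by_cases hg : gm (fun p => hb p / 2 ^ k) n = 0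
  · rw [← gm_div hb (N := 2 ^ k) (by positivity), hg]; ring
  · obtain ⟨h1, h2⟩ := gm_odd hg
    rw [← T_tuple h1 h2 (Finset.mem_Icc.1 hn).2, ← gm_div hb (N := 2 ^ k) (by positivity) n]
    ring

lemma Acount_eq (X : ℝ) :
    Acount34 X = ∑ n ∈ Finset.Icc 1 ⌊X / 2⌋₊, gm hb n * ((1 - c4 n) / 2) := by
  unfold Acount34
  rw [dcond_sum X (fun _ => 1)]
  simp

/-- `Y` is large compared to `B` -/
def Big (k Y B : ℕ) : Prop := 2 ≤ B ∧ ∀ t, 1 ≤ t → t ≤ B ^ (4 ^ k) → 3 ≤ Y / t ∧ Y ≤ (Y / t) ^ 2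

/-- the saving -/
noncomputable def sav (k Y : ℕ) : ℝ := Real.log Y ^ (-(1 / 2) - 1 / (2 * (2 ^ k : ℝ)) : ℝ)

lemma Big.three {k Y B : ℕ} (h : Big k Y B) : 3 ≤ Y := by
  have := (h.2 1 le_rfl (Nat.one_le_pow _ _ (by have := h.1; omega))).1
  simpa using this

lemma Big.logpos {k Y B : ℕ} (h : Big k Y B) : 0 < Real.log Y :=
  Real.log_pos (by have := h.three; exact_mod_cast (by omega : 1 < Y))

lemma sav_nonneg (k Y : ℕ) : 0 ≤ sav k Y := Real.rpow_nonneg (Real.log_natCast_nonneg Y) _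

lemma IL {k Y B t q : ℕ} (hb' : Big k Y B) (ht : 1 ≤ t) (htB : t ≤ B ^ (4 ^ k)) (hq : 8 ≤ q) {h : ℕ → ℝ}
    (h0 : ∀ p, 0 ≤ h p) (h1 : ∀ p, h p ≤ 1) {ψ : ℕ → ℤ}
    (hψ : (ψ = fun _ => 0) ∨ (NPC q ψ ∧ NPC q (fun n => ψ n * c8 n)))
    (hh : ∀ p : ℕ, p.Prime → h p ≤ 1 / 2 * (1 + c8 p) * (1 - 1 / (2 ^ k : ℝ) + ψ p / (2 ^ k : ℝ))) :
    ∑ n ∈ Finset.Icc 1 (Y / t), gm h n ≤ 54 * (sav k Y * (1 + harm q)) * (Y / t) := by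
  obtain ⟨hy3, hy2⟩ := hb'.2 t ht htB
  have hub := UB (N := 2 ^ k) (Nat.one_le_two_pow) hq h0 h1 hψ
    (by intro p hp; have := hh p hp; push_cast; exact this) hy3
  push_cast at hub
  refine hub.trans ?_
  set y := Y / t with hy
  have hyle : (y : ℝ) ≤ Y / t := Nat.cast_div_le
  have hY3 := hb'.three
  have hlY := hb'.logpos
  have hly : Real.log Y / 2 ≤ Real.log y := by
    have h2 : (Y : ℝ) ≤ (y : ℝ) ^ 2 := by exact_mod_cast hy2
    have h3 := Real.log_le_log (by positivity) h2
    rw [Real.log_pow] at h3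
    push_cast at h3
    linarith
  have hN1 : (1 : ℝ) ≤ 2 ^ k := one_le_pow₀ (by norm_num)
  have he : -(1 : ℝ) ≤ -(1 / 2) - 1 / (2 * 2 ^ k) := by
    have : (1 : ℝ) / (2 * 2 ^ k) ≤ 1 / 2 := by
      apply one_div_le_one_div_of_le (by norm_num); linarith
    linarith
  have he0 : -(1 / 2) - 1 / (2 * (2 : ℝ) ^ k) ≤ 0 := by
    have : (0 : ℝ) ≤ 1 / (2 * 2 ^ k) := by positivity
    linarith
  have hpow : Real.log y ^ (-(1 / 2) - 1 / (2 * (2 ^ k : ℝ)) : ℝ) ≤ 2 * sav k Y := by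
    calc Real.log y ^ (-(1 / 2) - 1 / (2 * (2 ^ k : ℝ)) : ℝ)
        ≤ (Real.log Y / 2) ^ (-(1 / 2) - 1 / (2 * (2 ^ k : ℝ)) : ℝ) :=
          Real.rpow_le_rpow_of_nonpos (by positivity) hly he0
      _ = sav k Y * (1 / 2) ^ (-(1 / 2) - 1 / (2 * (2 ^ k : ℝ)) : ℝ) := by
          rw [div_eq_mul_one_div, Real.mul_rpow hlY.le (by norm_num)]; rfl
      _ ≤ sav k Y * (1 / 2) ^ (-1 : ℝ) := by
          apply mul_le_mul_of_nonneg_left _ (sav_nonneg k Y)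
          exact Real.rpow_le_rpow_of_exponent_ge (by norm_num) (by norm_num) he
      _ = 2 * sav k Y := by rw [Real.rpow_neg_one]; ring
  have hh0 := harm_nonneg q
  have hs0 := sav_nonneg k Y
  calc 27 * (y * Real.log y ^ (-(1 / 2) - 1 / (2 * (2 ^ k : ℝ)) : ℝ) * (1 + harm q))
      ≤ 27 * ((Y / t) * (2 * sav k Y) * (1 + harm q)) := by
        gcongr
    _ = _ := by ring

abbrev VV (k : ℕ) := Fin (2 * k) → ZMod 2

lemma card_VV (k : ℕ) : Fintype.card (VV k) = 4 ^ k := by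
  simp [VV, Fintype.card_fun, ZMod.card, pow_mul]

lemma card_sub_le {k : ℕ} (p : VV k → Prop) : Fintype.card {u // p u} ≤ 4 ^ k := by
  rw [← card_VV]; exact Fintype.card_subtype_le p

lemma harm_ge_one {B : ℕ} (hB : 1 ≤ B) : 1 ≤ harm B := by
  have := harm_mono hB
  have h1 : harm 1 = 1 := by simp [harm]
  rw [h1] at this; exact this

lemma prod_lt_bound {k B : ℕ} (hB : 1 ≤ B) {ι : Type*} [Fintype ι] (hι : Fintype.card ι ≤ 4 ^ k) {s : ι → ℕ} (hs : ∀ u, s u < B) :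
    ∏ u, s u ≤ B ^ (4 ^ k) := by
  calc ∏ u, s u ≤ ∏ _u : ι, B := Finset.prod_le_prod' fun u _ => (hs u).le
    _ = B ^ Fintype.card ι := by simp
    _ ≤ B ^ 4 ^ k := Nat.pow_le_pow_right hB hι

lemma off_bound {k Y B : ℕ} (hB : 1 ≤ B) {ι : Type*} [Fintype ι] (hι : Fintype.card ι ≤ 4 ^ k) {C : ℝ} (hC : 0 ≤ C) (I : (ι → ℕ) → ℝ)
    (hI : ∀ s : ι → ℕ, (∀ u, 1 ≤ s u) → (∀ u, s u < B) → |I s| ≤ C * (Y / (∏ u, s u : ℕ))) :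
    |∑ s ∈ (box ι Y).filter (fun s => ∀ u, s u < B), I s| ≤ C * Y * harm B ^ (4 ^ k) := by
  refine (Finset.abs_sum_le_sum_abs _ _).trans ?_
  calc ∑ s ∈ (box ι Y).filter (fun s => ∀ u, s u < B), |I s|
      ≤ ∑ s ∈ (box ι Y).filter (fun s => ∀ u, s u < B), C * Y * ∏ u, (1 / (s u : ℝ)) := by
        refine Finset.sum_le_sum fun s hs => ?_
        rw [Finset.mem_filter, mem_box] at hs
        refine (hI s (fun u => (hs.1 u).1) hs.2).trans (le_of_eq ?_)
        rw [Finset.prod_div_distrib]; push_cast; simp; ring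
    _ ≤ ∑ s ∈ box ι B, C * Y * ∏ u, (1 / (s u : ℝ)) := by
        apply Finset.sum_le_sum_of_subset_of_nonneg
        · intro s hs
          rw [Finset.mem_filter, mem_box] at hs
          rw [mem_box]
          exact fun u => ⟨(hs.1 u).1, (hs.2 u).le⟩
        · intro s _ _; positivity
    _ = C * Y * harm B ^ Fintype.card ι := by rw [← Finset.mul_sum, harm_box]
    _ ≤ _ := by
        gcongr
        · exact harm_ge_one hB

lemma TB_split_lt {k Y B : ℕ} (p : VV k → Prop) (F : (VV k → ℕ) → ℝ) :
    ∑ D ∈ (TB (VV k) Y).filter (fun D => ∀ u, ¬ p u → D u < B), F D =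
      ∑ s ∈ (box {u // ¬ p u} Y).filter (fun s => ∀ u, s u < B),
        ∑ D ∈ TB {u // p u} (Y / ∏ u, s u), F (glue p D s) := by
  rw [Finset.sum_filter, TB_split p, Finset.sum_filter]
  refine Finset.sum_congr rfl fun s _ => ?_
  have : ∀ D, (∀ u, ¬ p u → glue p D s u < B) ↔ ∀ u, s u < B := by
    intro D
    constructor
    · intro h u
      have := h u u.2
      rwa [glue_neg] at this
    · intro h u hu
      have := h ⟨u, hu⟩
      rwa [← glue_neg (D := D) (s := s) ⟨u, hu⟩] at this
  simp only [this]
  split_ifs <;> simp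

/-- the majorant over tuples small off `M` -/
noncomputable def TM (k Y B : ℕ) (P : VV k → Prop) : ℝ :=
  ∑ D ∈ (TB (VV k) Y).filter (fun D => ∀ u, ¬ P u → D u < B), gm (fun p => hb p / 2 ^ k) (∏ u, D u)

lemma hbN_nonneg (k p : ℕ) : 0 ≤ hb p / 2 ^ k := div_nonneg (hb_nonneg p) (by positivity)
lemma hbN_le_one (k p : ℕ) : hb p / 2 ^ k ≤ 1 := by
  have := hb_le_one p
  have h1 : (1 : ℝ) ≤ 2 ^ k := one_le_pow₀ (by norm_num)
  rw [div_le_one (by positivity)]; linarith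

lemma TM_bound {k Y B : ℕ} (hb' : Big k Y B) {P : VV k → Prop} (hM : Fintype.card {u // P u} < 2 ^ k) :
    TM k Y B P ≤ 54 * (sav k Y * (1 + harm 8)) * Y * harm B ^ (4 ^ k) := by
  unfold TM
  rw [TB_split_lt P]
  refine (le_abs_self _).trans (off_bound (by have := hb'.1; omega) ?_ ?_ _ ?_)
  · rw [← card_VV]; exact Fintype.card_subtype_le _
  · have := harm_nonneg 8; have := sav_nonneg k Y; positivity
  · intro s hs1 hs2
    have hsp : 0 < ∏ u, s u := Finset.prod_pos fun u _ => hs1 u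
    rw [abs_of_nonneg (Finset.sum_nonneg fun D _ => gm_nonneg (hbN_nonneg k) _)]
    have hle : ∀ D ∈ TB {u // P u} (Y / ∏ u, s u),
        gm (fun p => hb p / 2 ^ k) (∏ u, glue P D s u) ≤
          gm (fun p => hb p / 2 ^ k) (∏ u, D u) * ∏ u : {u // P u}, (1 : ℝ) := by
      intro D hD
      rw [mem_TB] at hD
      rw [prod_glue P]
      simp only [glue_pos, glue_neg]
      rw [gm_mul _ (Finset.prod_pos fun u _ => hD.1 u).ne' hsp.ne', Finset.prod_const_one]
      apply mul_le_mul_of_nonneg_left _ (gm_nonneg (hbN_nonneg k) _)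
      apply gm_le_one
      · intro p; split_ifs
        · exact le_rfl
        · exact hbN_nonneg k p
      · intro p; split_ifs
        · exact zero_le_one
        · exact hbN_le_one k p
    refine (Finset.sum_le_sum hle).trans ?_
    rw [TB_gm _ _ (fun _ _ => 1) (fun _ => rfl) (fun _ _ _ => by norm_num)]
    obtain ⟨c, hcd⟩ : ∃ c, c = Fintype.card {u // P u} := ⟨_, rfl⟩
    rw [← hcd] at hM
    have hc : (∑ _u : {u // P u}, (1 : ℝ)) = c := by simp [hcd]
    simp only [hc]
    have hN : (0 : ℝ) < 2 ^ k := by positivity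
    have hM' : (c : ℝ) ≤ 2 ^ k - 1 := by
      have : c + 1 ≤ 2 ^ k := hM
      have : ((c + 1 : ℕ) : ℝ) ≤ ((2 ^ k : ℕ) : ℝ) := by exact_mod_cast this
      push_cast at this; linarith
    refine IL hb' hsp (prod_lt_bound (by have := hb'.1; omega) (by rw [← card_VV]; exact Fintype.card_subtype_le _) hs2) le_rfl ?_ ?_ (Or.inl rfl) ?_
    · intro p; have := hbN_nonneg k p; positivity
    · intro p
      have := hb_le_one p
      have := hb_nonneg p
      rw [div_mul_eq_mul_div, div_le_one hN]
      have h0 : (0 : ℝ) ≤ c := Nat.cast_nonneg _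
      nlinarith
    · intro p hp
      have h1 := hb_le p hp
      have h2 := hb_nonneg p
      have e : hb p / 2 ^ k * c = hb p * (c / 2 ^ k) := by ring
      have e2 : (c : ℝ) / 2 ^ k ≤ 1 - 1 / 2 ^ k + ((0 : ℤ) : ℝ) / 2 ^ k := by
        rw [div_le_iff₀ hN]; push_cast; field_simp; linarith
      rw [e]
      refine mul_le_mul h1 e2 (by positivity) ?_
      linarith

/-- separable bounded functions of two variables -/
def Sepa (f : ℕ → ℕ → ℤ) : Prop :=
  ∃ a b : ℕ → ℤ, (∀ m, |a m| ≤ 1) ∧ (∀ n, |b n| ≤ 1) ∧ ∀ m n, f m n = a m * b n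

lemma Sepa.left {a : ℕ → ℤ} (ha : ∀ m, |a m| ≤ 1) : Sepa (fun m _ => a m) :=
  ⟨a, fun _ => 1, ha, fun _ => by norm_num, fun _ _ => by ring⟩
lemma Sepa.right {a : ℕ → ℤ} (ha : ∀ m, |a m| ≤ 1) : Sepa (fun _ n => a n) :=
  ⟨fun _ => 1, a, fun _ => by norm_num, ha, fun _ _ => by ring⟩
lemma Sepa.mul {f g : ℕ → ℕ → ℤ} (hf : Sepa f) (hg : Sepa g) : Sepa (fun m n => f m n * g m n) := by
  obtain ⟨a, b, ha, hb, h⟩ := hf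
  obtain ⟨a', b', ha', hb', h'⟩ := hg
  refine ⟨fun m => a m * a' m, fun n => b n * b' n, ?_, ?_, ?_⟩
  · intro m; rw [abs_mul]; exact mul_le_one₀ (ha m) (abs_nonneg _) (ha' m)
  · intro m; rw [abs_mul]; exact mul_le_one₀ (hb m) (abs_nonneg _) (hb' m)
  · intro m n; beta_reduce; rw [h, h']; ring
lemma Sepa.prod {α : Type*} (s : Finset α) {f : α → ℕ → ℕ → ℤ} (hf : ∀ i, Sepa (f i)) :
    Sepa (fun m n => ∏ i ∈ s, f i m n) := by
  induction s using Finset.induction_on with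
  | empty => exact ⟨fun _ => 1, fun _ => 1, fun _ => by norm_num, fun _ => by norm_num, fun _ _ => by simp⟩
  | insert a s ha ih =>
    have := (hf a).mul ih
    simpa only [Finset.prod_insert ha] using this

lemma spow_abs {x : ℤ} (hx : |x| ≤ 1) (c : ZMod 2) : |spow x c| ≤ 1 := by
  unfold spow; split_ifs
  · norm_num
  · exact hx

lemma jac_abs (a : ℤ) (b : ℕ) : |jacobiSym a b| ≤ 1 := by
  rcases jacobiSym.trichotomy a b with h | h | h <;> rw [h] <;> norm_num

/-- replace two entries -/
noncomputable def ext2 {k : ℕ} (u0 v0 : VV k) (r : VV k → ℕ) (m n : ℕ) : VV k → ℕ :=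
  Function.update (Function.update r v0 n) u0 m

lemma ext2_u {k : ℕ} {u0 v0 : VV k} (r : VV k → ℕ) (m n : ℕ) : ext2 u0 v0 r m n u0 = m := by simp [ext2]
lemma ext2_v {k : ℕ} {u0 v0 : VV k} (h : u0 ≠ v0) (r : VV k → ℕ) (m n : ℕ) : ext2 u0 v0 r m n v0 = n := by
  simp [ext2, Function.update_of_ne h.symm]
lemma ext2_o {k : ℕ} {u0 v0 u : VV k} (h1 : u ≠ u0) (h2 : u ≠ v0) (r : VV k → ℕ) (m n : ℕ) :
    ext2 u0 v0 r m n u = r u := by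
  simp [ext2, Function.update_of_ne h1, Function.update_of_ne h2]

lemma prod_upd {k : ℕ} (r : VV k → ℕ) (u : VV k) (hu : r u = 1) (b : ℕ) :
    ∏ v, Function.update r u b v = b * ∏ v, r v := by
  rw [Finset.prod_update_of_mem (Finset.mem_univ u)]
  congr 1
  rw [← Finset.mul_prod_erase Finset.univ r (Finset.mem_univ u), hu, one_mul, Finset.sdiff_singleton_eq_erase]

lemma prod_ext2 {k : ℕ} {u0 v0 : VV k} (h : u0 ≠ v0) {r : VV k → ℕ} (hu : r u0 = 1) (hv : r v0 = 1) (m n : ℕ) :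
    ∏ u, ext2 u0 v0 r m n u = m * (n * ∏ u, r u) := by
  unfold ext2
  rw [prod_upd _ _ (by rw [Function.update_of_ne h, hu]), prod_upd _ _ hv]

lemma sep_wt {k : ℕ} {u0 v0 : VV k} (h : u0 ≠ v0) (h1 : phiK u0 v0 = 1) (h0 : phiK v0 u0 = 0) (r : VV k → ℕ) :
    ∃ f, Sepa f ∧ ∀ m n, wt (ext2 u0 v0 r m n) = f m n * jacobiSym m n := by
  have hA : ∀ u : VV k, Sepa (fun m n => spow (c4 (ext2 u0 v0 r m n u)) (lambdaK u)) := by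
    intro u
    by_cases hu : u = u0
    · subst hu; simp only [ext2_u]; exact Sepa.left fun m => spow_abs (c4_abs m) _
    by_cases hv : u = v0
    · subst hv; simp only [ext2_v h]; exact Sepa.right fun m => spow_abs (c4_abs m) _
    simp only [ext2_o hu hv]; exact Sepa.left (a := fun _ => _) fun m => spow_abs (c4_abs _) _
  have hB : ∀ u v : VV k, Sepa (fun m n => if u = u0 ∧ v = v0 then 1 else
      spow (jacobiSym (ext2 u0 v0 r m n u) (ext2 u0 v0 r m n v)) (phiK u v)) := by
    intro u v
    by_cases hc : u = u0 ∧ v = v0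
    · simp only [hc, and_self, if_true]; exact Sepa.left (a := fun _ => 1) fun _ => by norm_num
    simp only [hc, if_false]
    by_cases hz : phiK u v = 0
    · simp only [hz, spow_zero]; exact Sepa.left (a := fun _ => 1) fun _ => by norm_num
    have huv : u ≠ v := by rintro rfl; exact hz (phi_self u)
    by_cases hu : u = u0
    · subst hu
      have hv : v ≠ v0 := fun e => hc ⟨rfl, e⟩
      simp only [ext2_u, ext2_o huv.symm hv]
      exact Sepa.left fun m => spow_abs (jac_abs _ _) _
    by_cases hu' : u = v0
    · subst hu'
      have hv : v ≠ u0 := by rintro rfl; exact hz h0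
      simp only [ext2_v h, ext2_o hv huv.symm]
      exact Sepa.right fun m => spow_abs (jac_abs _ _) _
    by_cases hv : v = u0
    · subst hv
      simp only [ext2_u, ext2_o hu hu']
      exact Sepa.left fun m => spow_abs (jac_abs _ _) _
    by_cases hv' : v = v0
    · subst hv'
      simp only [ext2_v h, ext2_o hu hu']
      exact Sepa.right fun m => spow_abs (jac_abs _ _) _
    simp only [ext2_o hu hu', ext2_o hv hv']
    exact Sepa.left (a := fun _ => _) fun m => spow_abs (jac_abs _ _) _
  refine ⟨_, (Sepa.prod Finset.univ hA).mul (Sepa.prod Finset.univ fun u => Sepa.prod Finset.univ (hB u)), ?_⟩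
  intro m n
  unfold wt
  rw [mul_assoc]
  congr 1
  have hJ : jacobiSym m n = ∏ u : VV k, ∏ v : VV k, if u = u0 ∧ v = v0 then jacobiSym m n else 1 := by
    rw [Finset.prod_eq_single u0, Finset.prod_eq_single v0]
    · simp
    · intro b _ hb; simp [hb]
    · simp
    · intro b _ hb; simp [hb]
    · simp
  rw [hJ, ← Finset.prod_mul_distrib]
  refine Finset.prod_congr rfl fun u _ => ?_
  rw [← Finset.prod_mul_distrib]
  refine Finset.prod_congr rfl fun v _ => ?_
  by_cases hc : u = u0 ∧ v = v0
  · obtain ⟨rfl, rfl⟩ := hc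
    simp only [and_self, if_true, ext2_u, ext2_v h, h1, spow_one, one_mul]
  · rw [if_neg hc, if_neg hc, mul_one]

lemma gm_mul_jac (h : ℕ → ℝ) {m n : ℕ} (hn : n ≠ 0) :
    gm h (m * n) * jacobiSym m n = gm h m * gm h n * jacobiSym m n := by
  by_cases hc : Nat.Coprime m n
  · congr 1
    unfold gm
    by_cases h1 : Squarefree m
    · by_cases h2 : Squarefree n
      · rw [if_pos (Nat.squarefree_mul_iff.2 ⟨hc, h1, h2⟩), if_pos h1, if_pos h2,
          Nat.Coprime.primeFactors_mul hc, Finset.prod_union hc.disjoint_primeFactors]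
      · rw [if_neg (fun h => h2 (Nat.squarefree_mul_iff.1 h).2.2), if_neg h2, mul_zero]
    · rw [if_neg (fun h => h1 (Nat.squarefree_mul_iff.1 h).2.1), if_neg h1, zero_mul]
  · have : jacobiSym m n = 0 := by
      haveI : NeZero n := ⟨hn⟩
      rw [jacobiSym.eq_zero_iff_not_coprime, Int.gcd_natCast_natCast]; exact hc
    rw [this]; simp

lemma gm_osb {h : ℕ → ℝ} (h0 : ∀ p, 0 ≤ h p) (h1 : ∀ p, h p ≤ 1) (h2 : h 2 = 0) : OSB (gm h) := by
  refine ⟨fun m => ?_, fun m hm => ?_⟩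
  · rw [abs_of_nonneg (gm_nonneg h0 m)]; exact gm_le_one h0 h1
  · unfold gm
    split_ifs with hs
    · have ho : ¬ Odd m := fun ho => hm ⟨ho, hs⟩
      rw [Nat.not_odd_iff_even, even_iff_two_dvd] at ho
      exact Finset.prod_eq_zero (Nat.mem_primeFactors.2 ⟨Nat.prime_two, ho, hs.ne_zero⟩) h2
    · rfl

lemma vval_ext2 {k : ℕ} {u0 v0 : VV k} (h : u0 ≠ v0) (h1 : phiK u0 v0 = 1) (h0 : phiK v0 u0 = 0) {r : VV k → ℕ}
    (hr : ∀ u, 1 ≤ r u) (hu : r u0 = 1) (hv : r v0 = 1) :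
    ∃ α β α' β' : ℕ → ℝ, OSB α ∧ OSB β ∧ OSB α' ∧ OSB β' ∧ ∀ m n, m ≠ 0 → n ≠ 0 →
      vval k (ext2 u0 v0 r m n) = 1 / 2 * (α m * β n * jacobiSym m n) + 1 / 2 * (α' m * β' n * jacobiSym m n) := by
  obtain ⟨f, ⟨a, b, ha, hb', hf⟩, hw⟩ := sep_wt h h1 h0 r
  set R := ∏ u, r u with hR
  have hR0 : R ≠ 0 := (Finset.prod_pos fun u _ => hr u).ne'
  set hh : ℕ → ℝ := fun p => if p ∣ R then 0 else hb p / 2 ^ k with hhh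
  have hh0 : ∀ p, 0 ≤ hh p := by
    intro p; simp only [hhh]; split_ifs
    · exact le_rfl
    · exact hbN_nonneg k p
  have hh1 : ∀ p, hh p ≤ 1 := by
    intro p; simp only [hhh]; split_ifs
    · exact zero_le_one
    · exact hbN_le_one k p
  have hh2 : hh 2 = 0 := by simp [hhh, hb_two]
  have ho := gm_osb hh0 hh1 hh2
  have hg0 := gm_nonneg (hbN_nonneg k) R
  have hg1 : gm (fun p => hb p / 2 ^ k) R ≤ 1 := gm_le_one (hbN_nonneg k) (hbN_le_one k)
  have ha' : ∀ m, |(a m : ℝ)| ≤ 1 := fun m => by exact_mod_cast ha m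
  have hb'' : ∀ m, |(b m : ℝ)| ≤ 1 := fun m => by exact_mod_cast hb' m
  have hc' : ∀ m, |(c4 m : ℝ)| ≤ 1 := fun m => by exact_mod_cast c4_abs m
  have hg : ∀ m : ℕ, |gm (fun p => hb p / 2 ^ k) R| ≤ 1 := fun m => by rw [abs_of_nonneg hg0]; exact hg1
  have hα := (ho.mul ha').mul hg
  have hβ := ho.mul hb''
  refine ⟨_, _, _, _, hα, hβ, (hα.mul hc').mul (θ := fun _ => - (c4 R : ℝ)) (fun _ => by rw [abs_neg]; exact hc' R), hβ.mul hc', ?_⟩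
  intro m n hm hn
  unfold vval
  rw [hw, hf, prod_ext2 h hu hv, show m * (n * R) = R * (m * n) by ring, gm_mul _ hR0 (mul_ne_zero hm hn), c4_mul, c4_mul]
  have key := gm_mul_jac hh (m := m) hn
  push_cast
  linear_combination (gm (fun p => hb p / 2 ^ k) R * ((1 - c4 R * (c4 m * c4 n)) / 2) * (a m * b n)) * key

lemma inner_linked {k Y B : ℕ} (hY : 1 ≤ Y) (hB : 1 ≤ B) {u0 v0 : VV k} (h : u0 ≠ v0) (h1 : phiK u0 v0 = 1) (h0 : phiK v0 u0 = 0)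
    {r : VV k → ℕ} (hr : ∀ u, 1 ≤ r u) (hu : r u0 = 1) (hv : r v0 = 1) :
    |∑ p ∈ hyp (Y / ∏ u, r u) B, vval k (ext2 u0 v0 r p.1 p.2)| ≤
      2000000 * (B : ℝ) ^ (-(1 / 32) : ℝ) * (1 + Real.log Y) ^ 10 * Y * ∏ u, (1 / (r u : ℝ)) := by
  have hlY : 0 ≤ Real.log Y := Real.log_natCast_nonneg Y
  have hB0 : (0 : ℝ) ≤ (B : ℝ) ^ (-(1 / 32) : ℝ) := by positivity
  obtain ⟨α, β, α', β', hα, hβ, hα', hβ', he⟩ := vval_ext2 h h1 h0 hr hu hv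
  set Z := Y / ∏ u, r u with hZ
  by_cases hZ0 : Z = 0
  · have : hyp Z B = ∅ := by
      rw [Finset.eq_empty_iff_forall_notMem]
      intro p hp
      have := mem_hyp.1 hp
      omega
    rw [this]; simp only [Finset.sum_empty, abs_zero]; positivity
  have hZ1 : 1 ≤ Z := Nat.one_le_iff_ne_zero.2 hZ0
  have hs : ∑ p ∈ hyp Z B, vval k (ext2 u0 v0 r p.1 p.2) =
      1 / 2 * (∑ p ∈ hyp Z B, α p.1 * β p.2 * jacobiSym p.1 p.2) +
      1 / 2 * (∑ p ∈ hyp Z B, α' p.1 * β' p.2 * jacobiSym p.1 p.2) := by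
    rw [Finset.mul_sum, Finset.mul_sum, ← Finset.sum_add_distrib]
    refine Finset.sum_congr rfl fun p hp => ?_
    have := mem_hyp.1 hp
    exact he _ _ (by omega) (by omega)
  have e1 := hyp_bilinear Z B hZ1 hB α β hα hβ
  have e2 := hyp_bilinear Z B hZ1 hB α' β' hα' hβ'
  rw [hs]
  have e3 := abs_add_le (1 / 2 * (∑ p ∈ hyp Z B, α p.1 * β p.2 * jacobiSym p.1 p.2)) (1 / 2 * (∑ p ∈ hyp Z B, α' p.1 * β' p.2 * jacobiSym p.1 p.2))
  rw [abs_mul, abs_mul, abs_of_pos (by norm_num : (0 : ℝ) < 1 / 2)] at e3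
  have hZle : (Z : ℝ) ≤ Y * ∏ u, (1 / (r u : ℝ)) := by
    refine (Nat.cast_div_le).trans (le_of_eq ?_)
    rw [Finset.prod_div_distrib]; push_cast; simp; ring
  have hlZ : Real.log Z ≤ Real.log Y := Real.log_le_log (by positivity) (by exact_mod_cast Nat.div_le_self _ _)
  have hlZ0 : 0 ≤ Real.log Z := Real.log_natCast_nonneg Z
  calc _ ≤ 2000000*(Z*(B:ℝ)^(-(1/32):ℝ)*(1+Real.log Z)^10) := by linarith
    _ ≤ 2000000*((Y * ∏ u, (1 / (r u : ℝ)))*(B:ℝ)^(-(1/32):ℝ)*(1+Real.log Y)^10) := by gcongr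
    _ = _ := by ring

/-- the set of large indices -/
noncomputable def Lg {k : ℕ} (B : ℕ) (D : VV k → ℕ) : Finset (VV k) := Finset.univ.filter fun u => B ≤ D u

lemma linked_bound {k Y B : ℕ} (hY : 1 ≤ Y) (hB : 2 ≤ B) {M : Finset (VV k)} {u0 v0 : VV k} (hu : u0 ∈ M) (hv : v0 ∈ M)
    (h1 : phiK u0 v0 = 1) (h0 : phiK v0 u0 = 0) :
    |∑ D ∈ (TB (VV k) Y).filter (fun D => Lg B D = M), vval k D| ≤
      2000000 * (B : ℝ) ^ (-(1 / 32) : ℝ) * (1 + Real.log Y) ^ 10 * Y * harm Y ^ (4 ^ k) := by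
  have hne : u0 ≠ v0 := by rintro rfl; rw [h1] at h0; exact one_ne_zero h0
  have hlY : 0 ≤ Real.log Y := Real.log_natCast_nonneg Y
  have hB0 : (0 : ℝ) ≤ (B : ℝ) ^ (-(1 / 32) : ℝ) := by positivity
  have hLg : ∀ D : VV k → ℕ, Lg B D = M ↔ ∀ u, B ≤ D u ↔ u ∈ M := by
    intro D; unfold Lg; rw [Finset.ext_iff]; simp
  set Rs := (box (VV k) Y).filter (fun r => r u0 = 1 ∧ r v0 = 1 ∧ ∀ u, u ≠ u0 → u ≠ v0 → (B ≤ r u ↔ u ∈ M)) with hRs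
  have hsum : ∑ D ∈ (TB (VV k) Y).filter (fun D => Lg B D = M), vval k D =
      ∑ r ∈ Rs, ∑ p ∈ hyp (Y / ∏ u, r u) B, vval k (ext2 u0 v0 r p.1 p.2) := by
    rw [Finset.sum_sigma']
    refine Finset.sum_bij' (fun D _ => ⟨ext2 u0 v0 D 1 1, (D u0, D v0)⟩) (fun q _ => ext2 u0 v0 q.1 q.2.1 q.2.2) ?_ ?_ ?_ ?_ ?_
    · intro D hD
      rw [Finset.mem_filter, mem_TB, hLg] at hD
      obtain ⟨⟨hD1, hD2⟩, hD3⟩ := hD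
      have hDe : D = ext2 u0 v0 (ext2 u0 v0 D 1 1) (D u0) (D v0) := by
        funext u
        by_cases hu : u = u0
        · subst hu; rw [ext2_u]
        by_cases hv : u = v0
        · subst hv; rw [ext2_v hne]
        rw [ext2_o hu hv, ext2_o hu hv]
      have hpr : ∏ u, D u = D u0 * (D v0 * ∏ u, ext2 u0 v0 D 1 1 u) := by
        conv_lhs => rw [hDe]
        rw [prod_ext2 hne (ext2_u _ _ _) (ext2_v hne _ _ _)]
      have hge : ∀ u, 1 ≤ ext2 u0 v0 D 1 1 u := by
        intro u
        by_cases hu : u = u0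
        · subst hu; rw [ext2_u]
        by_cases hv : u = v0
        · subst hv; rw [ext2_v hne]
        rw [ext2_o hu hv]; exact hD1 u
      have hpos : 0 < ∏ u, ext2 u0 v0 D 1 1 u := Finset.prod_pos fun u _ => hge u
      have hY' : D u0 * D v0 * ∏ u, ext2 u0 v0 D 1 1 u ≤ Y := by rw [mul_assoc, ← hpr]; exact hD2
      have hle := (Nat.le_div_iff_mul_le hpos).2 hY'
      rw [Finset.mem_sigma, hRs, Finset.mem_filter, mem_box, mem_hyp]
      refine ⟨⟨?_, ext2_u _ _ _, ext2_v hne _ _ _, ?_⟩, ?_⟩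
      · intro u
        refine ⟨hge u, ?_⟩
        change ext2 u0 v0 D 1 1 u ≤ Y
        by_cases hu : u = u0
        · subst hu; rw [ext2_u]; exact hY
        by_cases hv : u = v0
        · subst hv; rw [ext2_v hne]; exact hY
        rw [ext2_o hu hv]
        refine le_trans ?_ hD2
        exact Finset.single_le_prod' (f := D) (fun u _ => hD1 u) (Finset.mem_univ u)
      · intro u hu hv; change B ≤ ext2 u0 v0 D 1 1 u ↔ _; rw [ext2_o hu hv]; exact hD3 u
      · have hd1 := hD1 u0; have hd2 := hD1 v0
        refine ⟨⟨hd1, ?_⟩, ⟨hd2, ?_⟩, (hD3 u0).2 hu, (hD3 v0).2 hv, hle⟩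
        · exact (Nat.le_mul_of_pos_right _ hd2).trans hle
        · exact (Nat.le_mul_of_pos_left _ hd1).trans hle
    · rintro ⟨r, m, n⟩ hq
      rw [Finset.mem_sigma, hRs, Finset.mem_filter, mem_box, mem_hyp] at hq
      obtain ⟨⟨hr, hr1, hr2, hr3⟩, hm, hn, hBm, hBn, hmn⟩ := hq
      rw [Finset.mem_filter, mem_TB, hLg]
      have hpos : 0 < ∏ u, r u := Finset.prod_pos fun u _ => (hr u).1
      refine ⟨⟨?_, ?_⟩, ?_⟩
      · intro u
        by_cases hu : u = u0
        · subst hu; rw [ext2_u]; exact hm.1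
        by_cases hv : u = v0
        · subst hv; rw [ext2_v hne]; exact hn.1
        rw [ext2_o hu hv]; exact (hr u).1
      · rw [prod_ext2 hne hr1 hr2, ← mul_assoc]
        exact (Nat.le_div_iff_mul_le hpos).1 hmn
      · intro u
        by_cases hu' : u = u0
        · subst hu'; rw [ext2_u]; exact ⟨fun _ => hu, fun _ => hBm⟩
        by_cases hv' : u = v0
        · subst hv'; rw [ext2_v hne]; exact ⟨fun _ => hv, fun _ => hBn⟩
        rw [ext2_o hu' hv']; exact hr3 u hu' hv'
    · intro D hD
      funext u
      by_cases hu : u = u0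
      · subst hu; simp only [ext2_u]
      by_cases hv : u = v0
      · subst hv; simp only [ext2_v hne]
      simp only [ext2_o hu hv]
    · rintro ⟨r, m, n⟩ hq
      rw [Finset.mem_sigma, hRs, Finset.mem_filter] at hq
      obtain ⟨⟨_, hr1, hr2, _⟩, _⟩ := hq
      change r u0 = 1 at hr1
      change r v0 = 1 at hr2
      have : ext2 u0 v0 (ext2 u0 v0 r m n) 1 1 = r := by
        funext u
        by_cases hu : u = u0
        · subst hu; rw [ext2_u, hr1]
        by_cases hv : u = v0
        · subst hv; rw [ext2_v hne, hr2]
        rw [ext2_o hu hv, ext2_o hu hv]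
      simp only [this, ext2_u, ext2_v hne]
    · intro D hD
      simp only
      congr 1
      funext u
      by_cases hu : u = u0
      · subst hu; simp only [ext2_u]
      by_cases hv : u = v0
      · subst hv; simp only [ext2_v hne]
      simp only [ext2_o hu hv]
  rw [hsum]
  refine (Finset.abs_sum_le_sum_abs _ _).trans ?_
  calc _ ≤ ∑ r ∈ Rs, 2000000 * (B : ℝ) ^ (-(1 / 32) : ℝ) * (1 + Real.log Y) ^ 10 * Y * ∏ u, (1 / (r u : ℝ)) := by
        refine Finset.sum_le_sum fun r hr => ?_
        rw [hRs, Finset.mem_filter, mem_box] at hr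
        exact inner_linked hY (by omega) hne h1 h0 (fun u => (hr.1 u).1) hr.2.1 hr.2.2.1
    _ ≤ ∑ r ∈ box (VV k) Y, 2000000 * (B : ℝ) ^ (-(1 / 32) : ℝ) * (1 + Real.log Y) ^ 10 * Y * ∏ u, (1 / (r u : ℝ)) := by
        apply Finset.sum_le_sum_of_subset_of_nonneg (Finset.filter_subset _ _)
        intro r _ _; positivity
    _ = _ := by rw [← Finset.mul_sum, harm_box, card_VV]

lemma encV_inj {k : ℕ} : Function.Injective (encV (k := k)) := by
  have h : ∀ v : VV k, encV v = ∑ i ∈ (Finset.univ.filter (fun i => v i = 1)).map Fin.valEmbedding, 2 ^ i := by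
    intro v
    unfold encV
    rw [Finset.sum_map, Finset.sum_filter]
    refine Finset.sum_congr rfl fun i _ => ?_
    rcases z2 (v i) with h | h <;> simp [h]
    rfl
  intro v w hvw
  rw [h, h] at hvw
  have := Finset.map_injective _ (Finset.geomSum_injective (le_refl 2) hvw)
  funext i
  rw [Finset.ext_iff] at this
  have hi := this i
  simp only [Finset.mem_filter, Finset.mem_univ, true_and] at hi
  rcases z2 (v i) with h1 | h1 <;> rcases z2 (w i) with h2 | h2 <;> simp_all

/-- reciprocity sign -/
def rsg (a b : ℤ) : ℤ := if a = -1 ∧ b = -1 then -1 else 1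

lemma rsg_sq (a b : ℤ) : rsg a b * rsg a b = 1 := by unfold rsg; split_ifs <;> norm_num
lemma rsg_abs (a b : ℤ) : |rsg a b| ≤ 1 := by unfold rsg; split_ifs <;> norm_num
lemma rsg_one_right (a : ℤ) : rsg a 1 = 1 := by unfold rsg; rw [if_neg]; rintro ⟨_, h⟩; norm_num at h

lemma c4_pm {n : ℕ} (h : Odd n) : c4 n = 1 ∨ c4 n = -1 := by
  have := Nat.odd_iff.1 h
  rw [c4_eq, if_neg (by omega)]; split_ifs <;> simp

lemma jac_sq {a b : ℕ} (h : Nat.Coprime a b) : jacobiSym (a : ℤ) b * jacobiSym (a : ℤ) b = 1 := by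
  rcases jacobiSym.eq_one_or_neg_one (a := (a : ℤ)) (b := b) (by simpa using h) with h | h <;> rw [h] <;> norm_num

lemma jac_flip {a b : ℕ} (ha : Odd a) (hb : Odd b) :
    jacobiSym b a = rsg (c4 a) (c4 b) * jacobiSym a b := by
  have h := qr_flip hb ha
  unfold rsg
  rcases c4_pm ha with h1 | h1 <;> rcases c4_pm hb with h2 | h2 <;> rw [h1, h2] at h ⊢ <;> norm_num at h ⊢ <;> linarith

lemma pair_flip {a b : ℕ} (ha : Odd a) (hb : Odd b) (h : Nat.Coprime a b) (x y : ZMod 2) :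
    spow (jacobiSym a b) x * spow (jacobiSym b a) y =
      spow (rsg (c4 a) (c4 b)) y * spow (jacobiSym a b) (x + y) := by
  rw [jac_flip ha hb, spow_mul, spow_add (jac_sq h)]; ring

lemma prod_pairs {ι : Type*} [Fintype ι] (e : ι → ℕ) (he : Function.Injective e) (f : ι → ι → ℤ) (hf : ∀ u, f u u = 1) :
    ∏ u, ∏ v, f u v = ∏ q ∈ (Finset.univ : Finset (ι × ι)).filter (fun q => e q.1 < e q.2), f q.1 q.2 * f q.2 q.1 := by
  rw [← Fintype.prod_prod_type' f, ← Finset.prod_filter_mul_prod_filter_not Finset.univ (fun q : ι × ι => e q.1 < e q.2),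
    Finset.prod_mul_distrib]
  congr 1
  rw [← Finset.prod_filter_mul_prod_filter_not (Finset.univ.filter fun q : ι × ι => ¬ e q.1 < e q.2) (fun q : ι × ι => e q.2 < e q.1)]
  rw [Finset.prod_eq_one (s := Finset.filter (fun q : ι × ι => ¬ e q.2 < e q.1) _), mul_one]
  · refine Finset.prod_bij' (fun q _ => q.swap) (fun q _ => q.swap) ?_ ?_ ?_ ?_ ?_
    · intro q hq; simp only [Finset.mem_filter, Finset.mem_univ, true_and] at hq ⊢; exact hq.2
    · intro q hq; simp only [Finset.mem_filter, Finset.mem_univ, true_and] at hq ⊢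
      simp only [Prod.fst_swap, Prod.snd_swap]; omega
    · intro q _; simp
    · intro q _; simp
    · intro q _; simp
  · intro q hq
    simp only [Finset.mem_filter, Finset.mem_univ, true_and] at hq
    have : q.1 = q.2 := he (by omega)
    rw [this]; exact hf _

section
variable {k : ℕ} (P : VV k → Prop)

/-- contribution of the small part -/
noncomputable def Ks (s : {u // ¬ P u} → ℕ) : ℤ :=
  (∏ u : {u // ¬ P u}, spow (c4 (s u)) (lambdaK u.1)) *
    ∏ u : {u // ¬ P u}, ∏ v : {u // ¬ P u}, spow (jacobiSym (s u) (s v)) (phiK u.1 v.1)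

/-- character attached to the small part -/
noncomputable def Lf (s : {u // ¬ P u} → ℕ) (u : {u // P u}) (n : ℕ) : ℤ :=
  ∏ v : {u // ¬ P u}, spow (jacobiSym n (s v)) (phiK u.1 v.1 + phiK v.1 u.1)

/-- sign contribution -/
noncomputable def Hp (s : {u // ¬ P u} → ℕ) (σ : {u // P u} → ℤ) : ℤ :=
  (∏ u : {u // P u}, spow (σ u) (lambdaK u.1)) *
    (∏ u : {u // P u}, ∏ v : {u // ¬ P u}, spow (rsg (σ u) (c4 (s v))) (phiK v.1 u.1)) *
    ∏ q ∈ (Finset.univ : Finset ({u // P u} × {u // P u})).filter (fun q => encV q.1.1 < encV q.2.1),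
      spow (rsg (σ q.1) (σ q.2)) (phiK q.1.1 q.2.1)

lemma wt_glue (hun : ∀ u v, P u → P v → Unlinked u v) {D : {u // P u} → ℕ} {s : {u // ¬ P u} → ℕ}
    (ho : ∀ u, Odd (glue P D s u)) (hc : ∀ u v, u ≠ v → Nat.Coprime (glue P D s u) (glue P D s v)) :
    wt (glue P D s) = Ks P s * Hp P s (fun u => c4 (D u)) * ∏ u, Lf P s u (D u) := by
  have e1 : ∏ u, spow (c4 (glue P D s u)) (lambdaK u) =
      (∏ u : {u // P u}, spow (c4 (D u)) (lambdaK u.1)) * ∏ u : {u // ¬ P u}, spow (c4 (s u)) (lambdaK u.1) := by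
    rw [prod_glue P]; simp only [glue_pos, glue_neg]
  have hoD : ∀ u, Odd (D u) := fun u => by have := ho u; rwa [glue_pos] at this
  have hos : ∀ u, Odd (s u) := fun u => by have := ho u; rwa [glue_neg] at this
  have hcDs : ∀ u v, Nat.Coprime (D u) (s v) := by
    intro u v
    have := hc u v (by intro e; exact v.2 (e ▸ u.2))
    rwa [glue_pos, glue_neg] at this
  have hcD : ∀ u v, u ≠ v → Nat.Coprime (D u) (D v) := by
    intro u v huv
    have := hc u v (fun e => huv (Subtype.ext e))
    rwa [glue_pos, glue_pos] at this
  have e2 : ∏ u, ∏ v, spow (jacobiSym (glue P D s u) (glue P D s v)) (phiK u v) =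
      (∏ u : {u // P u}, ∏ v : {u // P u}, spow (jacobiSym (D u) (D v)) (phiK u.1 v.1)) *
      (∏ u : {u // P u}, ∏ v : {u // ¬ P u}, spow (jacobiSym (D u) (s v)) (phiK u.1 v.1)) *
      ((∏ u : {u // ¬ P u}, ∏ v : {u // P u}, spow (jacobiSym (s u) (D v)) (phiK u.1 v.1)) *
      (∏ u : {u // ¬ P u}, ∏ v : {u // ¬ P u}, spow (jacobiSym (s u) (s v)) (phiK u.1 v.1))) := by
    rw [prod_glue P]
    congr 1
    · rw [← Finset.prod_mul_distrib]
      refine Finset.prod_congr rfl fun u _ => ?_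
      rw [prod_glue P]; simp only [glue_pos, glue_neg]
    · rw [← Finset.prod_mul_distrib]
      refine Finset.prod_congr rfl fun u _ => ?_
      rw [prod_glue P]; simp only [glue_pos, glue_neg]
  have e3 : (∏ u : {u // P u}, ∏ v : {u // P u}, spow (jacobiSym (D u) (D v)) (phiK u.1 v.1)) =
      ∏ q ∈ (Finset.univ : Finset ({u // P u} × {u // P u})).filter (fun q => encV q.1.1 < encV q.2.1),
      spow (rsg (c4 (D q.1)) (c4 (D q.2))) (phiK q.1.1 q.2.1) := by
    rw [prod_pairs (fun u : {u // P u} => encV u.1) (encV_inj.comp Subtype.val_injective)]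
    · refine Finset.prod_congr rfl fun q hq => ?_
      have hne : q.1 ≠ q.2 := by
        intro e
        simp only [Finset.mem_filter, e] at hq
        exact lt_irrefl _ hq.2
      have hu : phiK q.1.1 q.2.1 = phiK q.2.1 q.1.1 := hun _ _ q.1.2 q.2.2
      rw [pair_flip (hoD _) (hoD _) (hcD _ _ hne), ← hu]
      have : ∀ x : ZMod 2, x + x = 0 := by decide
      rw [this, spow_zero, mul_one]
    · intro u; rw [phi_self, spow_zero]
  have e4 : (∏ u : {u // P u}, ∏ v : {u // ¬ P u}, spow (jacobiSym (D u) (s v)) (phiK u.1 v.1)) *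
      (∏ u : {u // ¬ P u}, ∏ v : {u // P u}, spow (jacobiSym (s u) (D v)) (phiK u.1 v.1)) =
      (∏ u : {u // P u}, ∏ v : {u // ¬ P u}, spow (rsg (c4 (D u)) (c4 (s v))) (phiK v.1 u.1)) *
      ∏ u, Lf P s u (D u) := by
    rw [Finset.prod_comm (s := (Finset.univ : Finset {u // ¬ P u})), ← Finset.prod_mul_distrib, ← Finset.prod_mul_distrib]
    refine Finset.prod_congr rfl fun u _ => ?_
    unfold Lf
    rw [← Finset.prod_mul_distrib, ← Finset.prod_mul_distrib]
    refine Finset.prod_congr rfl fun v _ => ?_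
    rw [pair_flip (hoD _) (hos _) (hcDs _ _)]
  unfold wt
  rw [e1, e2, e3]
  unfold Hp Ks
  linear_combination (∏ u : {u // P u}, spow (c4 (D u)) (lambdaK u.1)) * (∏ u : {u // ¬ P u}, spow (c4 (s u)) (lambdaK u.1)) *
    (∏ q ∈ (Finset.univ : Finset ({u // P u} × {u // P u})).filter (fun q => encV q.1.1 < encV q.2.1),
      spow (rsg (c4 (D q.1)) (c4 (D q.2))) (phiK q.1.1 q.2.1)) *
    (∏ u : {u // ¬ P u}, ∏ v : {u // ¬ P u}, spow (jacobiSym (s u) (s v)) (phiK u.1 v.1)) * e4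

lemma prod_abs_le {α : Type*} (s : Finset α) {f : α → ℤ} (h : ∀ i, |f i| ≤ 1) : |∏ i ∈ s, f i| ≤ 1 := by
  rw [Finset.abs_prod]
  exact Finset.prod_le_one (fun i _ => abs_nonneg _) (fun i _ => h i)

lemma Ks_abs (s : {u // ¬ P u} → ℕ) : |Ks P s| ≤ 1 := by
  unfold Ks
  rw [abs_mul]
  exact mul_le_one₀ (prod_abs_le _ fun u => spow_abs (c4_abs _) _) (abs_nonneg _)
    (prod_abs_le _ fun u => prod_abs_le _ fun v => spow_abs (jac_abs _ _) _)

lemma Hp_abs (s : {u // ¬ P u} → ℕ) (σ : {u // P u} → ℤ) (hσ : ∀ u, |σ u| ≤ 1) : |Hp P s σ| ≤ 1 := by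
  unfold Hp
  rw [abs_mul, abs_mul]
  refine mul_le_one₀ (mul_le_one₀ (prod_abs_le _ fun u => spow_abs (hσ _) _) (abs_nonneg _)
    (prod_abs_le _ fun u => prod_abs_le _ fun v => spow_abs (rsg_abs _ _) _)) (abs_nonneg _)
    (prod_abs_le _ fun q => spow_abs (rsg_abs _ _) _)

lemma Lf_abs (s : {u // ¬ P u} → ℕ) (u : {u // P u}) (n : ℕ) : |Lf P s u n| ≤ 1 :=
  prod_abs_le _ fun v => spow_abs (jac_abs _ _) _

lemma Lf_one (s : {u // ¬ P u} → ℕ) (u : {u // P u}) : Lf P s u 1 = 1 := by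
  unfold Lf
  refine Finset.prod_eq_one fun v _ => ?_
  rw [Nat.cast_one, jacobiSym.one_left]; unfold spow; split_ifs <;> rfl

lemma Lf_mul (s : {u // ¬ P u} → ℕ) (u : {u // P u}) (a b : ℕ) : Lf P s u (a * b) = Lf P s u a * Lf P s u b := by
  unfold Lf
  rw [← Finset.prod_mul_distrib]
  refine Finset.prod_congr rfl fun v _ => ?_
  rw [Nat.cast_mul, jacobiSym.mul_left, spow_mul]

/-- sign vector of a set -/
noncomputable def sgv {ι : Type*} (S : Finset ι) (u : ι) : ℤ := if u ∈ S then -1 else 1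

/-- function on the cube -/
noncomputable def Hs (s : {u // ¬ P u} → ℕ) (S : Finset {u // P u}) : ℝ :=
  ((1 - (c4 (∏ v, s v)) * ∏ u, sgv S u) / 2) * (Ks P s * Hp P s (sgv S))

lemma sgv_abs {ι : Type*} (S : Finset ι) (u : ι) : |sgv S u| ≤ 1 := by unfold sgv; split_ifs <;> norm_num

lemma Hs_abs (s : {u // ¬ P u} → ℕ) (S : Finset {u // P u}) : |Hs P s S| ≤ 1 := by
  unfold Hs
  rw [abs_mul, abs_mul]
  have h1 : |(c4 (∏ v, s v) : ℝ) * ∏ u, (sgv S u : ℝ)| ≤ 1 := by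
    rw [abs_mul]
    refine mul_le_one₀ (by exact_mod_cast c4_abs _) (abs_nonneg _) ?_
    have := prod_abs_le Finset.univ (sgv_abs S)
    exact_mod_cast this
  refine mul_le_one₀ ?_ (by positivity) (mul_le_one₀ ?_ (abs_nonneg _) ?_)
  · push_cast; rw [abs_le] at h1 ⊢; constructor <;> linarith
  · exact_mod_cast Ks_abs P s
  · exact_mod_cast Hp_abs P s _ (sgv_abs S)

/-- twisted characters -/
noncomputable def Gf (s : {u // ¬ P u} → ℕ) (E : Finset {u // P u}) (u : {u // P u}) (n : ℕ) : ℤ :=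
  (if u ∈ E then c4 n else 1) * Lf P s u n

lemma Gf_one (s : {u // ¬ P u} → ℕ) (E : Finset {u // P u}) (u : {u // P u}) : Gf P s E u 1 = 1 := by
  unfold Gf; rw [Lf_one, show c4 1 = 1 from rfl]; simp

lemma Gf_mul (s : {u // ¬ P u} → ℕ) (E : Finset {u // P u}) (u : {u // P u}) (a b : ℕ) :
    Gf P s E u (a * b) = Gf P s E u a * Gf P s E u b := by
  unfold Gf; rw [Lf_mul, c4_mul]; split_ifs <;> ring

lemma Gf_abs (s : {u // ¬ P u} → ℕ) (E : Finset {u // P u}) (u : {u // P u}) (n : ℕ) : |Gf P s E u n| ≤ 1 := by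
  unfold Gf; rw [abs_mul]
  refine mul_le_one₀ ?_ (abs_nonneg _) (Lf_abs P s u n)
  split_ifs
  · exact c4_abs n
  · norm_num

/-- the local density with the primes of the small part removed -/
noncomputable def hs (s : {u // ¬ P u} → ℕ) (p : ℕ) : ℝ := if p ∣ ∏ v, s v then 0 else hb p / 2 ^ k

lemma vval_glue (hun : ∀ u v, P u → P v → Unlinked u v) {D : {u // P u} → ℕ} {s : {u // ¬ P u} → ℕ}
    (hD : ∀ u, 1 ≤ D u) (hs1 : ∀ u, 1 ≤ s u) :
    vval k (glue P D s) = gm (fun p => hb p / 2 ^ k) (∏ v, s v) *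
      ∑ E : Finset {u // P u}, fc (Hs P s) E * (gm (hs P s) (∏ u, D u) * ∏ u, (Gf P s E u (D u) : ℝ)) := by
  have hs0 : ∏ v, s v ≠ 0 := (Finset.prod_pos fun u _ => hs1 u).ne'
  have hD0 : ∏ v, D v ≠ 0 := (Finset.prod_pos fun u _ => hD u).ne'
  have hpr : ∏ u, glue P D s u = (∏ v, s v) * ∏ u, D u := by
    rw [prod_glue P]; simp only [glue_pos, glue_neg]; rw [mul_comm]
  have hgm : gm (fun p => hb p / 2 ^ k) (∏ u, glue P D s u) =
      gm (fun p => hb p / 2 ^ k) (∏ v, s v) * gm (hs P s) (∏ u, D u) := by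
    rw [hpr, gm_mul _ hs0 hD0]; rfl
  by_cases hg : gm (fun p => hb p / 2 ^ k) (∏ u, glue P D s u) = 0
  · unfold vval
    rw [hg]
    rw [hgm] at hg
    rcases mul_eq_zero.1 hg with h | h <;> rw [h] <;> simp
  obtain ⟨hsq, hodd⟩ := gm_odd hg
  have ho : ∀ u, Odd (glue P D s u) := fun u => hodd.of_dvd_nat (Finset.dvd_prod_of_mem _ (Finset.mem_univ u))
  have hc : ∀ u v, u ≠ v → Nat.Coprime (glue P D s u) (glue P D s v) := by
    intro u v huv
    have : glue P D s u * glue P D s v ∣ ∏ u, glue P D s u := by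
      rw [← Finset.mul_prod_erase Finset.univ _ (Finset.mem_univ u)]
      exact mul_dvd_mul_left _ (Finset.dvd_prod_of_mem _ (Finset.mem_erase.2 ⟨huv.symm, Finset.mem_univ v⟩))
    exact (Nat.squarefree_mul_iff.1 (hsq.squarefree_of_dvd this)).1
  have hoD : ∀ u, Odd (D u) := fun u => by have := ho u; rwa [glue_pos] at this
  have hσ : ∀ u, (c4 (D u) : ℝ) = 1 ∨ (c4 (D u) : ℝ) = -1 := by
    intro u
    rcases c4_pm (hoD u) with h | h <;> rw [h] <;> simp
  have hcf := cube_fourier (Hs P s) (fun u => (c4 (D u) : ℝ)) hσ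
  have hsg : sgv (Finset.univ.filter fun u => (c4 (D u) : ℝ) = -1) = fun u => c4 (D u) := by
    funext u
    unfold sgv
    rcases c4_pm (hoD u) with h | h
    · rw [if_neg, h]; simp [h]; norm_num
    · rw [if_pos, h]; simp [h]
  unfold vval
  rw [hgm, wt_glue P hun ho hc, hpr, c4_mul, c4_prod Finset.univ D]
  have hG : ∀ E : Finset {u // P u}, ∏ u, (Gf P s E u (D u) : ℝ) = (∏ u ∈ E, (c4 (D u) : ℝ)) * ∏ u, (Lf P s u (D u) : ℝ) := by
    intro E
    unfold Gf
    push_cast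
    rw [Finset.prod_mul_distrib]
    congr 1
    simp [Finset.prod_ite_mem]
  simp only [hG]
  have hr : ∑ E : Finset {u // P u}, fc (Hs P s) E * (gm (hs P s) (∏ u, D u) * ((∏ u ∈ E, (c4 (D u) : ℝ)) * ∏ u, (Lf P s u (D u) : ℝ))) =
      gm (hs P s) (∏ u, D u) * (∏ u, (Lf P s u (D u) : ℝ)) * ∑ E : Finset {u // P u}, fc (Hs P s) E * ∏ u ∈ E, (c4 (D u) : ℝ) := by
    rw [Finset.mul_sum]
    exact Finset.sum_congr rfl fun E _ => by ring
  rw [hr, ← hcf]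
  unfold Hs
  rw [hsg]
  push_cast
  ring
end

lemma sgn8_c4 : Sgn8 c4 := ⟨npc_c4.per, npc_c4.mul, npc_c4.one, npc_c4.bd⟩
lemma sgn8_c8 : Sgn8 c8 := ⟨npc_c8.per, npc_c8.mul, npc_c8.one, npc_c8.bd⟩
lemma Sgn8.times {θ η : ℕ → ℤ} (h : Sgn8 θ) (h' : Sgn8 η) : Sgn8 (fun n => θ n * η n) where
  per := fun n => by rw [h.per, h'.per]
  mul := fun m n => by rw [h.mul, h'.mul]; ring
  one := by rw [h.one, h'.one]; rfl
  bd := fun n => by rw [abs_mul]; exact mul_le_one₀ (h.bd n) (abs_nonneg _) (h'.bd n)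
lemma sgn8_ite (c : Prop) [Decidable c] : Sgn8 (fun n => if c then c4 n else 1) := by
  by_cases h : c
  · simp only [h, if_true]; exact sgn8_c4
  · simp only [h, if_false]; exact Sgn8.const

section
variable {k : ℕ} (P : VV k → Prop)

lemma hs_nonneg (s : {u // ¬ P u} → ℕ) (p : ℕ) : 0 ≤ hs P s p := by
  unfold hs; split_ifs
  · exact le_rfl
  · exact hbN_nonneg k p
lemma hs_le (s : {u // ¬ P u} → ℕ) (p : ℕ) : hs P s p ≤ hb p / 2 ^ k := by
  unfold hs; split_ifs
  · exact hbN_nonneg k p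
  · exact le_rfl

lemma Gsum_le (hP : Fintype.card {u // P u} = 2 ^ k) (s : {u // ¬ P u} → ℕ) (E : Finset {u // P u}) (p : ℕ) :
    |∑ u, (Gf P s E u p : ℝ)| ≤ 2 ^ k := by
  refine (Finset.abs_sum_le_sum_abs _ _).trans ?_
  calc ∑ u, |(Gf P s E u p : ℝ)| ≤ ∑ _u : {u // P u}, (1 : ℝ) :=
        Finset.sum_le_sum fun u _ => by exact_mod_cast Gf_abs P s E u p
    _ = 2 ^ k := by rw [Finset.sum_const, Finset.card_univ, hP]; simp

lemma Gsum_le' (hP : Fintype.card {u // P u} = 2 ^ k) (s : {u // ¬ P u} → ℕ) (E : Finset {u // P u}) (p : ℕ)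
    {u u' : {u // P u}} (huu : u ≠ u') :
    |∑ u, (Gf P s E u p : ℝ)| ≤ 2 ^ k - 1 + ((Gf P s E u p * Gf P s E u' p : ℤ) : ℝ) := by
  have hu' : u' ∈ Finset.univ.erase u := Finset.mem_erase.2 ⟨huu.symm, Finset.mem_univ _⟩
  rw [← Finset.add_sum_erase Finset.univ _ (Finset.mem_univ u), ← Finset.add_sum_erase _ _ hu', ← add_assoc]
  have hN : ((Finset.univ.erase u).erase u').card + 2 = 2 ^ k := by
    rw [Finset.card_erase_of_mem hu', Finset.card_erase_of_mem (Finset.mem_univ u), Finset.card_univ, hP]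
    have : 2 ≤ Fintype.card {u // P u} := by
      have := Finset.card_le_univ ({u, u'} : Finset {u // P u})
      rwa [Finset.card_pair huu] at this
    rw [hP] at this
    omega
  have h3 : |∑ v ∈ (Finset.univ.erase u).erase u', (Gf P s E v p : ℝ)| ≤ 2 ^ k - 2 := by
    refine (Finset.abs_sum_le_sum_abs _ _).trans ?_
    calc ∑ v ∈ (Finset.univ.erase u).erase u', |(Gf P s E v p : ℝ)| ≤ ∑ v ∈ (Finset.univ.erase u).erase u', (1 : ℝ) :=
          Finset.sum_le_sum fun u _ => by exact_mod_cast Gf_abs P s E u p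
      _ = 2 ^ k - 2 := by
        rw [Finset.sum_const]
        have : (((Finset.univ.erase u).erase u').card : ℝ) + 2 = 2 ^ k := by exact_mod_cast hN
        simp only [nsmul_eq_mul, mul_one]; linarith
  have h1 : |(Gf P s E u p : ℝ)| ≤ 1 := by exact_mod_cast Gf_abs P s E u p
  have h2 : |(Gf P s E u' p : ℝ)| ≤ 1 := by exact_mod_cast Gf_abs P s E u' p
  push_cast
  rw [abs_le] at *
  constructor <;> nlinarith

lemma E_bound {Y B q : ℕ} (hb' : Big k Y B) (hP : Fintype.card {u // P u} = 2 ^ k)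
    {s : {u // ¬ P u} → ℕ} (hs1 : ∀ u, 1 ≤ s u) (hs2 : ∀ u, s u < B) (E : Finset {u // P u})
    {u u' : {u // P u}} (huu : u ≠ u') (hq : 8 ≤ q) (h1 : NPC q (fun n => Gf P s E u n * Gf P s E u' n))
    (h2 : NPC q (fun n => Gf P s E u n * Gf P s E u' n * c8 n)) :
    |∑ D ∈ TB {u // P u} (Y / ∏ u, s u), gm (hs P s) (∏ u, D u) * ∏ u, (Gf P s E u (D u) : ℝ)| ≤
      54 * (sav k Y * (1 + harm q)) * (Y / (∏ u, s u : ℕ)) := by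
  have hsp : 0 < ∏ u, s u := Finset.prod_pos fun u _ => hs1 u
  rw [TB_gm _ _ (fun u n => (Gf P s E u n : ℝ)) (fun u => by rw [Gf_one]; norm_num)
    (fun u a b => by rw [Gf_mul]; push_cast; ring)]
  refine (Finset.abs_sum_le_sum_abs _ _).trans ?_
  simp only [gm_abs]
  have hN : (0 : ℝ) < 2 ^ k := by positivity
  refine IL hb' hsp (prod_lt_bound (by have := hb'.1; omega) (by rw [← card_VV]; exact Fintype.card_subtype_le _) hs2) hq
    (fun p => abs_nonneg _) ?_ (Or.inr ⟨h1, h2⟩) ?_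
  · intro p
    rw [abs_mul, abs_of_nonneg (hs_nonneg P s p)]
    have e1 := hs_le P s p
    have e2 := hb_le_one p
    have e3 := Gsum_le P hP s E p
    calc hs P s p * |∑ u, (Gf P s E u p : ℝ)| ≤ (1 / 2 ^ k) * 2 ^ k := by
          refine mul_le_mul (e1.trans ?_) e3 (abs_nonneg _) (by positivity)
          gcongr
      _ = 1 := by field_simp
  · intro p hp
    rw [abs_mul, abs_of_nonneg (hs_nonneg P s p)]
    have e1 := hs_le P s p
    have e2 := hb_le p hp
    have e3 := Gsum_le' P hP s E p huu
    have e0 := hb_nonneg p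
    calc hs P s p * |∑ u, (Gf P s E u p : ℝ)|
        ≤ (hb p / 2 ^ k) * (2 ^ k - 1 + ((Gf P s E u p * Gf P s E u' p : ℤ) : ℝ)) :=
          mul_le_mul e1 e3 (abs_nonneg _) (hbN_nonneg k p)
      _ = hb p * (1 - 1 / (2 ^ k : ℝ) + ((Gf P s E u p * Gf P s E u' p : ℤ) : ℝ) / (2 ^ k : ℝ)) := by
          field_simp; try ring
      _ ≤ _ := by
          apply mul_le_mul_of_nonneg_right e2
          have := (abs_nonneg _).trans e3
          have : 0 ≤ (2 ^ k - 1 + ((Gf P s E u p * Gf P s E u' p : ℤ) : ℝ)) / 2 ^ k := by positivity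
          refine this.trans (le_of_eq ?_)
          field_simp; try ring

/-- modulus attached to an index -/
noncomputable def mu (s : {u // ¬ P u} → ℕ) (u : {u // P u}) : ℕ :=
  ∏ v : {u // ¬ P u}, if phiK u.1 v.1 + phiK v.1 u.1 = 0 then 1 else s v

lemma Lf_eq {s : {u // ¬ P u} → ℕ} (hs1 : ∀ u, 1 ≤ s u) (u : {u // P u}) (n : ℕ) :
    Lf P s u n = jacobiSym n (mu P s u) := by
  unfold Lf mu
  rw [jac_prod_right _ _ (fun v _ => by split_ifs <;> [exact one_ne_zero; exact (by have := hs1 v; omega)])]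
  refine Finset.prod_congr rfl fun v _ => ?_
  unfold spow
  split_ifs
  · rw [jacobiSym.one_right]
  · rfl

lemma mu_dvd (s : {u // ¬ P u} → ℕ) (u : {u // P u}) : mu P s u ∣ ∏ v, s v := by
  unfold mu
  refine Finset.prod_dvd_prod_of_dvd _ _ fun v _ => ?_
  split_ifs
  · exact one_dvd _
  · exact dvd_rfl

lemma unl_zero {u v : VV k} : Unlinked u v ↔ phiK u v + phiK v u = 0 := by
  unfold Unlinked
  generalize phiK u v = a; generalize phiK v u = b
  revert a b; decide

lemma npc_G {s : {u // ¬ P u} → ℕ} (hsq : Squarefree (∏ v, s v)) (hodd : Odd (∏ v, s v)) (hs1 : ∀ u, 1 ≤ s u)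
    (E : Finset {u // P u}) {v0 : {u // ¬ P u}} (hv0 : s v0 ≠ 1) {u u' : {u // P u}} (hu : ¬ Unlinked u.1 v0.1)
    (hu' : Unlinked u'.1 v0.1) :
    NPC (8 * (mu P s u * mu P s u')) (fun n => Gf P s E u n * Gf P s E u' n) ∧
    NPC (8 * (mu P s u * mu P s u')) (fun n => Gf P s E u n * Gf P s E u' n * c8 n) := by
  obtain ⟨p, hp, hpd⟩ := Nat.exists_prime_and_dvd hv0
  have hdv : ∀ v, s v ∣ ∏ v, s v := fun v => Finset.dvd_prod_of_mem _ (Finset.mem_univ v)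
  have hp2 : p ≠ 2 := by
    rintro rfl
    have := hodd.of_dvd_nat (hpd.trans (hdv v0))
    exact absurd this (by decide)
  have hpu : p ∣ mu P s u := by
    refine hpd.trans ?_
    unfold mu
    have : s v0 = if phiK u.1 v0.1 + phiK v0.1 u.1 = 0 then 1 else s v0 := by
      rw [if_neg (fun h => hu (unl_zero.2 h))]
    conv_lhs => rw [this]
    exact Finset.dvd_prod_of_mem (fun v : {u // ¬ P u} => if phiK u.1 v.1 + phiK v.1 u.1 = 0 then 1 else s v) (Finset.mem_univ v0)
  have hpu' : ¬ p ∣ mu P s u' := by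
    intro h
    unfold mu at h
    rw [Prime.dvd_finset_prod_iff hp.prime] at h
    obtain ⟨v, _, hv⟩ := h
    split_ifs at hv with hz
    · exact hp.one_lt.ne' (Nat.dvd_one.1 hv)
    · have hne : v ≠ v0 := by rintro rfl; exact hz (unl_zero.1 hu')
      have : s v0 * s v ∣ ∏ u, s u := by
        rw [← Finset.mul_prod_erase Finset.univ _ (Finset.mem_univ v0)]
        exact mul_dvd_mul_left _ (Finset.dvd_prod_of_mem _ (Finset.mem_erase.2 ⟨hne, Finset.mem_univ v⟩))
      have hc := (Nat.squarefree_mul_iff.1 (hsq.squarefree_of_dvd this)).1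
      exact Nat.Prime.not_coprime_iff_dvd.2 ⟨p, hp, hpd, hv⟩ hc
  obtain ⟨c, hc⟩ := hpu
  have hsu := hsq.squarefree_of_dvd (mu_dvd P s u)
  have hou := hodd.of_dvd_nat (mu_dvd P s u)
  have hou' := hodd.of_dvd_nat (mu_dvd P s u')
  have hpc : ¬ p ∣ c := by
    rintro ⟨e, rfl⟩
    rw [hc, ← mul_assoc] at hsu
    exact hp.prime.not_unit (hsu p ⟨e, rfl⟩)
  have hoc : Odd (c * mu P s u') := by
    rw [hc] at hou
    exact (Nat.odd_mul.1 hou).2.mul hou'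
  have hpm : ¬ p ∣ c * mu P s u' := fun h => (hp.dvd_mul.1 h).elim hpc hpu'
  have hG : ∀ n : ℕ, Gf P s E u n * Gf P s E u' n =
      jacobiSym n (p * (c * mu P s u')) * ((if u ∈ E then c4 n else 1) * (if u' ∈ E then c4 n else 1)) := by
    intro n
    have h1 : mu P s u ≠ 0 := hsu.ne_zero
    have h2 : mu P s u' ≠ 0 := (hsq.squarefree_of_dvd (mu_dvd P s u')).ne_zero
    haveI : NeZero (mu P s u) := ⟨h1⟩
    haveI : NeZero (mu P s u') := ⟨h2⟩
    rw [← mul_assoc p, ← hc, jacobiSym.mul_right]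
    unfold Gf
    rw [Lf_eq P hs1, Lf_eq P hs1]; ring
  have hθ := (sgn8_ite (u ∈ E)).times (sgn8_ite (u' ∈ E))
  rw [hc, mul_assoc p]
  constructor
  · simp only [hG]
    exact npc_jac hp hp2 hoc hpm hθ
  · simp only [hG, mul_assoc]
    have := npc_jac hp hp2 hoc hpm (hθ.times sgn8_c8)
    simpa only [mul_assoc] using this

end

lemma spow_neg_one (x : ZMod 2) : spow (-1) x = sg x := by revert x; decide
lemma spow_one_left (x : ZMod 2) : spow 1 x = 1 := by revert x; decide

lemma gm_congr {f g : ℕ → ℝ} {n : ℕ} (h : ∀ p, p.Prime → f p = g p) : gm f n = gm g n := by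
  unfold gm
  split_ifs
  · exact Finset.prod_congr rfl fun p hp => h p (Nat.prime_of_mem_primeFactors hp)
  · rfl

lemma gm_c4 (h : ℕ → ℝ) (n : ℕ) : gm (fun p => h p * c4 p) n = gm h n * c4 n := by
  unfold gm
  split_ifs with hs
  · rw [Finset.prod_mul_distrib]
    congr 1
    conv_rhs => rw [← Nat.prod_primeFactors_of_squarefree hs]
    rw [c4_prod]; push_cast; rfl
  · simp

section
variable {k : ℕ} (P : VV k → Prop)

lemma Ks_one : Ks P (fun _ => 1) = 1 := by
  unfold Ks
  simp [show c4 1 = 1 from rfl, spow_one_left]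

lemma Lf_one_s (u : {u // P u}) (n : ℕ) : Lf P (fun _ => 1) u n = 1 := by
  unfold Lf
  simp [spow_one_left]

lemma Hp_one (S : Finset {u // P u}) :
    Hp P (fun _ => 1) (sgv S) = sg (ePlus (S.map (Function.Embedding.subtype P))) := by
  unfold Hp ePlus
  rw [sg_add, Finset.sum_map, sg_sum]
  have h2 : (∏ u : {u // P u}, ∏ v : {u // ¬ P u}, spow (rsg (sgv S u) (c4 1)) (phiK v.1 u.1)) = 1 := by
    simp [show c4 1 = 1 from rfl, rsg_one_right, spow_one_left]
  rw [h2, mul_one]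
  congr 1
  · have : ∀ u : {u // P u}, spow (sgv S u) (lambdaK u.1) = if u ∈ S then sg (lambdaK u.1) else 1 := by
      intro u; unfold sgv; split_ifs
      · exact spow_neg_one _
      · exact spow_one_left _
    simp only [this]
    rw [Finset.prod_ite_mem, Finset.univ_inter]
    rfl
  · rw [Finset.sum_filter, Finset.sum_product, Finset.sum_map, sg_sum, Finset.prod_filter, ← Finset.univ_product_univ,
      Finset.prod_product]
    simp only [Finset.sum_map, sg_sum, Function.Embedding.subtype_apply]
    have key : ∀ u v : {u // P u}, (if encV u.1 < encV v.1 then spow (rsg (sgv S u) (sgv S v)) (phiK u.1 v.1) else 1) =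
        if u ∈ S then (if v ∈ S then sg (if encV u.1 < encV v.1 then phiK u.1 v.1 else 0) else 1) else 1 := by
      intro u v
      unfold sgv rsg
      by_cases h1 : u ∈ S <;> by_cases h2 : v ∈ S <;> by_cases h3 : encV u.1 < encV v.1 <;>
        simp [h1, h2, h3, spow_one_left, spow_neg_one, sg_zero] <;> norm_num [spow_one_left]
    simp only [key]
    rw [← Finset.prod_subset (Finset.subset_univ S)]
    · refine Finset.prod_congr rfl fun u hu => ?_
      simp only [hu, if_true]
      rw [Finset.prod_ite_mem, Finset.univ_inter]
      refine Finset.prod_congr rfl fun i _ => ?_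
      congr
    · intro u _ hu; simp [hu]

lemma sgv_prod {ι : Type*} [Fintype ι] (S : Finset ι) : ∏ u, sgv S u = (-1) ^ S.card := by
  unfold sgv
  rw [Finset.prod_ite_mem, Finset.univ_inter, Finset.prod_const]

lemma Hs_one (S : Finset {u // P u}) :
    Hs P (fun _ => 1) S = if Odd S.card then ((sg (ePlus (S.map (Function.Embedding.subtype P))) : ℤ) : ℝ) else 0 := by
  unfold Hs
  rw [Ks_one, Hp_one]
  have : ∏ u, (sgv S u : ℝ) = (-1) ^ S.card := by exact_mod_cast sgv_prod S
  push_cast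
  rw [this, Finset.prod_const_one, show c4 1 = 1 from rfl]
  split_ifs with h
  · rw [h.neg_one_pow]; push_cast; ring
  · rw [(Nat.not_odd_iff_even.1 h).neg_one_pow]; simp

lemma gamma_eq {U : Finset (VV k)} (hU : ∀ u, u ∈ U ↔ P u) :
    (gammaPlus U : ℝ) = ∑ S : Finset {u // P u}, Hs P (fun _ => 1) S := by
  simp only [Hs_one]
  rw [← Finset.sum_filter]
  unfold gammaPlus
  push_cast
  symm
  refine Finset.sum_bij' (fun S _ => S.map (Function.Embedding.subtype P)) (fun T _ => T.subtype P) ?_ ?_ ?_ ?_ ?_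
  · intro S hS
    simp only [Finset.mem_filter, Finset.mem_univ, true_and] at hS
    simp only [Finset.mem_filter, Finset.mem_powerset, Finset.card_map]
    refine ⟨?_, hS⟩
    intro u hu
    simp only [Finset.mem_map, Function.Embedding.subtype_apply] at hu
    obtain ⟨a, _, rfl⟩ := hu
    exact (hU _).2 a.2
  · intro T hT
    simp only [Finset.mem_filter, Finset.mem_powerset] at hT
    simp only [Finset.mem_filter, Finset.mem_univ, true_and]
    rw [Finset.card_subtype, Finset.filter_true_of_mem]
    · exact hT.2
    · intro x hx; exact (hU x).1 (hT.1 hx)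
  · intro S hS
    ext x; simp
    exact fun _ => x.2
  · intro T hT
    simp only [Finset.mem_filter, Finset.mem_powerset] at hT
    rw [Finset.subtype_map, Finset.filter_true_of_mem]
    intro x hx; exact (hU x).1 (hT.1 hx)
  · intro S hS
    unfold sg; split_ifs <;> simp

lemma fc_empty {U : Finset (VV k)} (hU : ∀ u, u ∈ U ↔ P u) (hP : Fintype.card {u // P u} = 2 ^ k) :
    fc (Hs P (fun _ => 1)) ∅ = (1 / 2) ^ (2 ^ k) * gammaPlus U := by
  unfold fc
  rw [gamma_eq P hU, hP]; simp

lemma fc_univ {U : Finset (VV k)} (hU : ∀ u, u ∈ U ↔ P u) (hP : Fintype.card {u // P u} = 2 ^ k) :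
    fc (Hs P (fun _ => 1)) Finset.univ = - ((1 / 2) ^ (2 ^ k) * gammaPlus U) := by
  unfold fc
  rw [gamma_eq P hU, hP, ← mul_neg, ← Finset.sum_neg_distrib]
  congr 1
  refine Finset.sum_congr rfl fun S _ => ?_
  have hp : ∏ u, (sgv S u : ℝ) = (-1) ^ S.card := by exact_mod_cast sgv_prod S
  have hq : ∀ u : {u // P u}, (if u ∈ S then (-1 : ℝ) else 1) = sgv S u := by
    intro u; unfold sgv; split_ifs <;> simp
  have hr := Finset.prod_congr (rfl : (Finset.univ : Finset {u // P u}) = Finset.univ) fun u _ => hq u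
  rw [hp] at hr
  refine (congrArg (Hs P (fun _ => 1) S * ·) (Eq.trans ?_ hr)).trans ?_
  · refine Finset.prod_congr rfl fun i _ => ?_
    congr
  rw [Hs_one]
  split_ifs with h
  · rw [h.neg_one_pow]; ring
  · simp

/-- sum attached to a character set -/
noncomputable def SE (Y : ℕ) (s : {u // ¬ P u} → ℕ) (E : Finset {u // P u}) : ℝ :=
  ∑ D ∈ TB {u // P u} (Y / ∏ u, s u), gm (hs P s) (∏ u, D u) * ∏ u, (Gf P s E u (D u) : ℝ)

lemma SE_one (Y : ℕ) (E : Finset {u // P u}) : SE P Y (fun _ => 1) E =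
    ∑ n ∈ Finset.Icc 1 Y, gm (fun p => hb p / 2 ^ k * ∑ u : {u // P u}, (if u ∈ E then (c4 p : ℝ) else 1)) n := by
  unfold SE
  rw [TB_gm _ _ (fun u n => (Gf P _ E u n : ℝ)) (fun u => by rw [Gf_one]; norm_num)
    (fun u a b => by rw [Gf_mul]; push_cast; ring)]
  rw [Finset.prod_const_one, Nat.div_one]
  refine Finset.sum_congr rfl fun n _ => gm_congr fun p hp => ?_
  congr 1
  · unfold hs; rw [Finset.prod_const_one, if_neg]; exact hp.one_lt.ne' ∘ Nat.dvd_one.1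
  · refine Finset.sum_congr rfl fun u _ => ?_
    unfold Gf; rw [Lf_one_s, mul_one]; split_ifs <;> simp

lemma SE_empty (Y : ℕ) (hP : Fintype.card {u // P u} = 2 ^ k) :
    SE P Y (fun _ => 1) ∅ = ∑ n ∈ Finset.Icc 1 Y, gm hb n := by
  rw [SE_one]
  refine Finset.sum_congr rfl fun n _ => gm_congr fun p hp => ?_
  simp only [Finset.notMem_empty, if_false, Finset.sum_const, Finset.card_univ, hP]
  simp

lemma SE_univ (Y : ℕ) (hP : Fintype.card {u // P u} = 2 ^ k) :
    SE P Y (fun _ => 1) Finset.univ = ∑ n ∈ Finset.Icc 1 Y, gm hb n * c4 n := by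
  rw [SE_one]
  refine Finset.sum_congr rfl fun n _ => ?_
  rw [← gm_c4]
  refine gm_congr fun p hp => ?_
  simp only [Finset.mem_univ, if_true, Finset.sum_const, Finset.card_univ, hP]
  simp; field_simp

/-- main sum -/
noncomputable def Aq (Y : ℕ) : ℝ := ∑ n ∈ Finset.Icc 1 Y, gm hb n * ((1 - c4 n) / 2)

lemma main_pair {U : Finset (VV k)} (hU : ∀ u, u ∈ U ↔ P u) (hP : Fintype.card {u // P u} = 2 ^ k) (Y : ℕ) :
    fc (Hs P (fun _ => 1)) ∅ * SE P Y (fun _ => 1) ∅ + fc (Hs P (fun _ => 1)) Finset.univ * SE P Y (fun _ => 1) Finset.univ =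
      Aq Y * (2 : ℝ) ^ ((1 : ℤ) - 2 ^ k) * gammaPlus U := by
  rw [fc_empty P hU hP, fc_univ P hU hP, SE_empty P Y hP, SE_univ P Y hP]
  have e : (2 : ℝ) ^ ((1 : ℤ) - 2 ^ k) = 2 * (1 / 2) ^ (2 ^ k) := by
    rw [zpow_sub₀ (by norm_num)]
    have : ((2 : ℤ) ^ k) = ((2 ^ k : ℕ) : ℤ) := by push_cast; rfl
    rw [this, zpow_natCast, one_div, inv_pow]
    simp [div_eq_mul_inv]
  have e2 : Aq Y = ((∑ n ∈ Finset.Icc 1 Y, gm hb n) - ∑ n ∈ Finset.Icc 1 Y, gm hb n * c4 n) / 2 := by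
    unfold Aq
    rw [← Finset.sum_sub_distrib, Finset.sum_div]
    refine Finset.sum_congr rfl fun n _ => by ring
  rw [e, e2]; ring
end

section
variable {k : ℕ} (P : VV k → Prop)

lemma inner_eq (hun : ∀ u v, P u → P v → Unlinked u v) (Y : ℕ) {s : {u // ¬ P u} → ℕ} (hs1 : ∀ u, 1 ≤ s u) :
    ∑ D ∈ TB {u // P u} (Y / ∏ u, s u), vval k (glue P D s) =
      gm (fun p => hb p / 2 ^ k) (∏ v, s v) * ∑ E : Finset {u // P u}, fc (Hs P s) E * SE P Y s E := by
  rw [Finset.sum_congr rfl fun D hD => vval_glue P hun (mem_TB.1 hD).1 hs1, ← Finset.mul_sum, Finset.sum_comm]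
  congr 1
  refine Finset.sum_congr rfl fun E _ => ?_
  rw [← Finset.mul_sum]; rfl

lemma sub_abs_le {α : Type*} (s : Finset α) (f : α → ℝ) {T : ℝ} (hT : 0 ≤ T) {N : ℕ} (hN : s.card ≤ N) (h : ∀ i ∈ s, |f i| ≤ T) :
    |∑ i ∈ s, f i| ≤ N * T := by
  refine (Finset.abs_sum_le_sum_abs _ _).trans ((Finset.sum_le_card_nsmul _ _ _ h).trans ?_)
  rw [nsmul_eq_mul]
  gcongr

set_option maxHeartbeats 1000000 in
lemma max_est {U : Finset (VV k)} (hU : ∀ u, u ∈ U ↔ P u) (hmax : IsMaxUnlinked U) {Y B : ℕ} (hb' : Big k Y B) :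
    |∑ D ∈ (TB (VV k) Y).filter (fun D => ∀ u, ¬ P u → D u < B), vval k D -
      Aq Y * (2 : ℝ) ^ ((1 : ℤ) - 2 ^ k) * gammaPlus U| ≤
      (2 ^ (2 ^ k) : ℕ) * (54 * (sav k Y * (1 + harm (8 * (B ^ (4 ^ k) * B ^ (4 ^ k)))))) * Y * harm B ^ (4 ^ k) := by
  set Q := 8 * (B ^ (4 ^ k) * B ^ (4 ^ k)) with hQ
  have hB1 : 1 ≤ B := by have := hb'.1; omega
  have hP : Fintype.card {u // P u} = 2 ^ k := by
    rw [← max_card hmax]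
    exact Fintype.card_of_subtype U hU
  have hun : ∀ u v, P u → P v → Unlinked u v := fun u v hu hv => hmax.1 u ((hU u).2 hu) v ((hU v).2 hv)
  have hι : Fintype.card {u // ¬ P u} ≤ 4 ^ k := by rw [← card_VV]; exact Fintype.card_subtype_le _
  have hQ8 : 8 ≤ Q := by
    have : 1 ≤ B ^ (4 ^ k) * B ^ (4 ^ k) := Nat.mul_pos (Nat.pow_pos hB1) (Nat.pow_pos hB1)
    omega
  have hsav := sav_nonneg k Y
  have hhQ := harm_nonneg Q
  have hT0 : 0 ≤ 54 * (sav k Y * (1 + harm Q)) := by positivity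
  set mn := Aq Y * (2 : ℝ) ^ ((1 : ℤ) - 2 ^ k) * gammaPlus U with hmn
  rw [TB_split_lt P]
  have hone : (fun _ => 1 : {u // ¬ P u} → ℕ) ∈ (box {u // ¬ P u} Y).filter (fun s => ∀ u, s u < B) := by
    rw [Finset.mem_filter, mem_box]
    have := hb'.three
    have := hb'.1
    exact ⟨fun u => ⟨le_rfl, by omega⟩, fun u => by show 1 < B; omega⟩
  have hsub : mn = ∑ s ∈ (box {u // ¬ P u} Y).filter (fun s => ∀ u, s u < B), if s = (fun _ => 1) then mn else 0 := by
    rw [Finset.sum_ite_eq', if_pos hone]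
  rw [hsub, ← Finset.sum_sub_distrib]
  refine off_bound hB1 hι (mul_nonneg (Nat.cast_nonneg _) hT0) _ ?_
  intro s hs1 hs2
  have hTs : 0 ≤ 54 * (sav k Y * (1 + harm Q)) * ((Y : ℝ) / (∏ u, s u : ℕ)) := by positivity
  rw [inner_eq P hun Y hs1, mul_assoc ((2 ^ 2 ^ k : ℕ) : ℝ)]
  have hcardE : (Finset.univ : Finset (Finset {u // P u})).card = 2 ^ 2 ^ k := by
    rw [Finset.card_univ, Fintype.card_finset, hP]
  have hmono : ∀ q, q ≤ Q → 54 * (sav k Y * (1 + harm q)) * ((Y : ℝ) / (∏ u, s u : ℕ)) ≤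
      54 * (sav k Y * (1 + harm Q)) * ((Y : ℝ) / (∏ u, s u : ℕ)) := by
    intro q hq
    have := harm_mono hq
    gcongr
  have hterm : ∀ E, |SE P Y s E| ≤ 54 * (sav k Y * (1 + harm Q)) * ((Y : ℝ) / (∏ u, s u : ℕ)) →
      |fc (Hs P s) E * SE P Y s E| ≤ 54 * (sav k Y * (1 + harm Q)) * ((Y : ℝ) / (∏ u, s u : ℕ)) := by
    intro E h
    rw [abs_mul]
    exact (mul_le_of_le_one_left (abs_nonneg _) (fc_abs _ (Hs_abs P s) E)).trans h
  by_cases hs : s = fun _ => 1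
  · rw [if_pos hs]
    have hg1 : gm (fun p => hb p / 2 ^ k) (∏ v, s v) = 1 := by
      rw [hs, Finset.prod_const_one]; simp [gm]
    rw [hg1, one_mul]
    have hne : (∅ : Finset {u // P u}) ≠ Finset.univ := by
      intro h
      have h2 := congrArg Finset.card h
      rw [Finset.card_empty, Finset.card_univ, hP] at h2
      have : 0 < 2 ^ k := by positivity
      omega
    rw [← Finset.add_sum_erase Finset.univ _ (Finset.mem_univ (∅ : Finset {u // P u})),
      ← Finset.add_sum_erase _ _ (Finset.mem_erase.2 ⟨hne.symm, Finset.mem_univ (Finset.univ : Finset {u // P u})⟩), ← add_assoc]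
    have hmp := main_pair P hU hP Y
    rw [← hs] at hmp
    rw [hmp, ← hmn, add_sub_cancel_left]
    refine sub_abs_le _ _ hTs ?_ ?_
    · rw [← hcardE]; exact Finset.card_le_card (Finset.subset_univ _)
    · intro E hE
      refine hterm E ?_
      have hE1 : E ≠ Finset.univ := (Finset.mem_erase.1 hE).1
      have hE2 : E ≠ ∅ := (Finset.mem_erase.1 (Finset.mem_erase.1 hE).2).1
      obtain ⟨u, hu⟩ := Finset.nonempty_iff_ne_empty.2 hE2
      obtain ⟨u', hu'⟩ : ∃ u', u' ∉ E := by
        by_contra hc; push Not at hc; exact hE1 (Finset.eq_univ_iff_forall.2 hc)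
      have huu : u ≠ u' := by rintro rfl; exact hu' hu
      have hG : ∀ n : ℕ, Gf P s E u n * Gf P s E u' n = c4 n := by
        intro n
        unfold Gf
        rw [hs, Lf_one_s, Lf_one_s, if_pos hu, if_neg hu']; ring
      exact (E_bound P hb' hP hs1 hs2 E huu le_rfl (by simp only [hG]; exact npc_c4) (by simp only [hG]; exact npc_c48)).trans
        (hmono 8 hQ8)
  · rw [if_neg hs, sub_zero]
    by_cases hg : gm (fun p => hb p / 2 ^ k) (∏ v, s v) = 0
    · rw [hg, zero_mul, abs_zero]; exact mul_nonneg (Nat.cast_nonneg _) hTs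
    obtain ⟨hsq, hodd⟩ := gm_odd hg
    rw [abs_mul]
    have hg1 : |gm (fun p => hb p / 2 ^ k) (∏ v, s v)| ≤ 1 := by
      rw [abs_of_nonneg (gm_nonneg (hbN_nonneg k) _)]
      exact gm_le_one (hbN_nonneg k) (hbN_le_one k)
    refine (mul_le_of_le_one_left (abs_nonneg _) hg1).trans ?_
    refine sub_abs_le _ _ hTs hcardE.le ?_
    intro E _
    refine hterm E ?_
    obtain ⟨v0, hv0⟩ : ∃ v0, s v0 ≠ 1 := by
      by_contra hc; push Not at hc; exact hs (funext hc)
    obtain ⟨⟨u, hu, hu1⟩, u', hu', hu2⟩ := max_mixed hmax (fun h => v0.2 ((hU v0.1).1 h))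
    have hN := npc_G P hsq hodd hs1 E hv0 (u := ⟨u, (hU u).1 hu⟩) (u' := ⟨u', (hU u').1 hu'⟩) hu1 hu2
    have huu : (⟨u, (hU u).1 hu⟩ : {u // P u}) ≠ ⟨u', (hU u').1 hu'⟩ := by
      intro h
      have : u = u' := congrArg Subtype.val h
      subst this; exact hu1 hu2
    have hsp := prod_lt_bound hB1 hι hs2
    have hsp0 : 0 < ∏ u, s u := Finset.prod_pos fun u _ => hs1 u
    have hm : ∀ w, mu P s w ≤ B ^ 4 ^ k := fun w => (Nat.le_of_dvd hsp0 (mu_dvd P s w)).trans hsp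
    have hm0 : ∀ w, 1 ≤ mu P s w := fun w => Nat.pos_of_dvd_of_pos (mu_dvd P s w) hsp0
    refine (E_bound P hb' hP hs1 hs2 E huu ?_ hN.1 hN.2).trans (hmono _ ?_)
    · have := Nat.mul_pos (hm0 ⟨u, (hU u).1 hu⟩) (hm0 ⟨u', (hU u').1 hu'⟩)
      omega
    · exact Nat.mul_le_mul_left _ (Nat.mul_le_mul (hm _) (hm _))
end

section
variable {k : ℕ}

lemma vval_abs_le (D : VV k → ℕ) : |vval k D| ≤ gm (fun p => hb p / 2 ^ k) (∏ u, D u) := by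
  unfold vval
  have h0 := gm_nonneg (hbN_nonneg k) (∏ u, D u)
  have h1 : |((1 - c4 (∏ u, D u)) / 2 : ℝ)| ≤ 1 := by
    have : |(c4 (∏ u, D u) : ℝ)| ≤ 1 := by exact_mod_cast c4_abs _
    rw [abs_le] at this ⊢; constructor <;> linarith
  have h2 : |(wt D : ℝ)| ≤ 1 := by
    have : |wt D| ≤ 1 := by
      unfold wt
      rw [abs_mul]
      exact mul_le_one₀ (prod_abs_le _ fun u => spow_abs (c4_abs _) _) (abs_nonneg _)
        (prod_abs_le _ fun u => prod_abs_le _ fun v => spow_abs (jac_abs _ _) _)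
    exact_mod_cast this
  rw [abs_mul, abs_mul, abs_of_nonneg h0]
  calc _ ≤ gm (fun p => hb p / 2 ^ k) (∏ u, D u) * 1 * 1 := by gcongr
    _ = _ := by ring

lemma sum_le_TM {Y B : ℕ} (P : VV k → Prop) {A : Finset (VV k → ℕ)} (hA : A ⊆ TB (VV k) Y)
    (hP : ∀ D ∈ A, ∀ u, ¬ P u → D u < B) : ∑ D ∈ A, |vval k D| ≤ TM k Y B P := by
  unfold TM
  refine (Finset.sum_le_sum fun D _ => vval_abs_le D).trans ?_
  refine Finset.sum_le_sum_of_subset_of_nonneg ?_ fun D _ _ => gm_nonneg (hbN_nonneg k) _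
  intro D hD
  exact Finset.mem_filter.2 ⟨hA hD, hP D hD⟩

lemma mem_Lg {B : ℕ} {D : VV k → ℕ} {u : VV k} : u ∈ Lg B D ↔ B ≤ D u := by
  unfold Lg; simp

/-- errors -/
noncomputable def er1 (k Y B : ℕ) : ℝ := 2000000*(B:ℝ)^(-(1/32):ℝ)*(1+Real.log Y)^10*Y*harm Y^(4^k)
/-- errors -/
noncomputable def er2 (k Y B : ℕ) : ℝ := 54 * (sav k Y * (1 + harm 8)) * Y * harm B ^ (4 ^ k)
/-- errors -/
noncomputable def er3 (k Y B : ℕ) : ℝ :=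
  (2 ^ (2 ^ k) : ℕ) * (54 * (sav k Y * (1 + harm (8 * (B ^ (4 ^ k) * B ^ (4 ^ k)))))) * Y * harm B ^ (4 ^ k)

lemma er2_nonneg (k Y B : ℕ) : 0 ≤ er2 k Y B := by
  have := sav_nonneg k Y; have := harm_nonneg 8; have := harm_nonneg B
  unfold er2; positivity
lemma er3_nonneg (k Y B : ℕ) : 0 ≤ er3 k Y B := by
  have := sav_nonneg k Y; have := harm_nonneg (8 * (B ^ (4 ^ k) * B ^ (4 ^ k))); have := harm_nonneg B
  have h : 0 ≤ (54 * (sav k Y * (1 + harm (8 * (B ^ (4 ^ k) * B ^ (4 ^ k)))))) := by positivity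
  exact mul_nonneg (mul_nonneg (mul_nonneg (Nat.cast_nonneg _) h) (Nat.cast_nonneg _)) (pow_nonneg this _)
lemma er1_nonneg {k Y B : ℕ} (hY : 1 ≤ Y) : 0 ≤ er1 k Y B := by
  have := Real.log_nonneg (show (1 : ℝ) ≤ Y by exact_mod_cast hY); have := harm_nonneg Y
  unfold er1; positivity

/-- main term of a set -/
noncomputable def mnt (k Y : ℕ) (M : Finset (VV k)) : ℝ :=
  if IsMaxUnlinked M then Aq Y * (2 : ℝ) ^ ((1 : ℤ) - 2 ^ k) * gammaPlus M else 0

lemma part_est {Y B : ℕ} (hb' : Big k Y B) (M : Finset (VV k)) :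
    |∑ D ∈ (TB (VV k) Y).filter (fun D => Lg B D = M), vval k D - mnt k Y M| ≤
      er1 k Y B + (4 ^ k + 1) * er2 k Y B + er3 k Y B := by
  have hY : 1 ≤ Y := by have := hb'.three; omega
  have h1 := er1_nonneg (k := k) (B := B) hY
  have h2 := er2_nonneg k Y B
  have h3 := er3_nonneg k Y B
  have h4 : (0 : ℝ) ≤ 4 ^ k := by positivity
  obtain ⟨P, hPM⟩ : ∃ P : VV k → Prop, ∀ u, u ∈ M ↔ P u := ⟨(· ∈ M), fun _ => Iff.rfl⟩
  by_cases hun : ∀ u ∈ M, ∀ v ∈ M, Unlinked u v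
  · have hcl := unl_card_le hun
    rcases hcl.lt_or_eq with hlt | heq
    · have hnm : ¬ IsMaxUnlinked M := fun h => hlt.ne (max_card h)
      unfold mnt
      rw [if_neg hnm, sub_zero]
      have hb2 : TM k Y B P ≤ er2 k Y B := by
        refine TM_bound hb' ?_
        rw [Fintype.card_of_subtype M hPM]; exact hlt
      have := (Finset.abs_sum_le_sum_abs (vval k) _).trans (sum_le_TM (k := k) (Y := Y) (B := B) P
        (A := (TB (VV k) Y).filter (fun D => Lg B D = M)) (Finset.filter_subset _ _) ?_)
      · nlinarith
      · intro D hD u hu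
        have := (Finset.mem_filter.1 hD).2
        rw [← hPM, ← this, mem_Lg] at hu; omega
    · have hmax := max_of_card hun heq
      unfold mnt
      rw [if_pos hmax]
      have hm := max_est P hPM hmax hb'
      rw [← Finset.sum_filter_add_sum_filter_not ((TB (VV k) Y).filter (fun D => ∀ u, ¬ P u → D u < B)) (fun D => Lg B D = M)] at hm
      have hA : ((TB (VV k) Y).filter (fun D => ∀ u, ¬ P u → D u < B)).filter (fun D => Lg B D = M) =
          (TB (VV k) Y).filter (fun D => Lg B D = M) := by
        ext D
        simp only [Finset.mem_filter]
        constructor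
        · rintro ⟨⟨a, b⟩, c⟩; exact ⟨a, c⟩
        · rintro ⟨a, c⟩
          refine ⟨⟨a, fun u hu => ?_⟩, c⟩
          rw [← hPM, ← c, mem_Lg] at hu; omega
      rw [hA] at hm
      set R := ((TB (VV k) Y).filter (fun D => ∀ u, ¬ P u → D u < B)).filter (fun D => ¬ Lg B D = M) with hR
      have hRb : |∑ D ∈ R, vval k D| ≤ 4 ^ k * er2 k Y B := by
        refine (Finset.abs_sum_le_sum_abs _ _).trans ?_
        calc ∑ D ∈ R, |vval k D| ≤ ∑ D ∈ R, ∑ u0 ∈ M, if D u0 < B then |vval k D| else 0 := by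
              refine Finset.sum_le_sum fun D hD => ?_
              rw [hR, Finset.mem_filter, Finset.mem_filter] at hD
              obtain ⟨⟨hD1, hD2⟩, hD3⟩ := hD
              obtain ⟨u0, hu0, hlt⟩ : ∃ u0 ∈ M, D u0 < B := by
                by_contra hc; push Not at hc
                refine hD3 ?_
                ext u
                rw [mem_Lg]
                constructor
                · intro h; by_contra hu; have := hD2 u (fun h => hu ((hPM u).2 h)); omega
                · exact hc u
              refine le_trans ?_ (Finset.single_le_sum (f := fun u0 => if D u0 < B then |vval k D| else 0) ?_ hu0)
              · simp [hlt]
              · intro u _; split_ifs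
                · exact abs_nonneg _
                · exact le_rfl
          _ = ∑ u0 ∈ M, ∑ D ∈ R.filter (fun D => D u0 < B), |vval k D| := by
              rw [Finset.sum_comm]
              refine Finset.sum_congr rfl fun u0 _ => ?_
              exact (Finset.sum_filter _ _).symm
          _ ≤ ∑ u0 ∈ M, er2 k Y B := by
              refine Finset.sum_le_sum fun u0 hu0 => ?_
              obtain ⟨P', hPM'⟩ : ∃ P' : VV k → Prop, ∀ u, u ∈ M.erase u0 ↔ P' u := ⟨(· ∈ M.erase u0), fun _ => Iff.rfl⟩
              refine (sum_le_TM (Y := Y) (B := B) P' ?_ ?_).trans (TM_bound hb' ?_)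
              · exact (Finset.filter_subset _ _).trans ((Finset.filter_subset _ _).trans (Finset.filter_subset _ _))
              · intro D hD u hu
                rw [Finset.mem_filter, hR, Finset.mem_filter, Finset.mem_filter] at hD
                by_cases he : u = u0
                · rw [he]; exact hD.2
                · exact hD.1.1.2 u (fun h => hu ((hPM' u).1 (Finset.mem_erase.2 ⟨he, (hPM u).2 h⟩)))
              · rw [Fintype.card_of_subtype (M.erase u0) hPM', Finset.card_erase_of_mem hu0, heq]
                have : 0 < 2 ^ k := by positivity
                omega
          _ = M.card * er2 k Y B := by rw [Finset.sum_const, nsmul_eq_mul]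
          _ ≤ 4 ^ k * er2 k Y B := by
              gcongr
              have := Finset.card_le_univ M
              rw [card_VV] at this
              exact_mod_cast this
      have hm' : |_| ≤ er3 k Y B := hm
      rw [abs_le] at hm' hRb ⊢
      constructor <;> linarith [hm'.1, hm'.2, hRb.1, hRb.2]
  · have hnm : ¬ IsMaxUnlinked M := fun h => hun h.1
    unfold mnt
    rw [if_neg hnm, sub_zero]
    push Not at hun
    obtain ⟨u, hu, v, hv, hl⟩ := hun
    have key : ∃ u0 ∈ M, ∃ v0 ∈ M, phiK u0 v0 = 1 ∧ phiK v0 u0 = 0 := by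
      unfold Unlinked at hl
      rcases z2 (phiK u v) with a | a <;> rcases z2 (phiK v u) with b | b
      · rw [a, b] at hl; exact absurd rfl hl
      · exact ⟨v, hv, u, hu, b, a⟩
      · exact ⟨u, hu, v, hv, a, b⟩
      · rw [a, b] at hl; exact absurd rfl hl
    obtain ⟨u0, hu0, v0, hv0, e1, e0⟩ := key
    have := linked_bound hY hb'.1 hu0 hv0 e1 e0
    have this' : |_| ≤ er1 k Y B := this
    nlinarith

lemma total_est {Y B : ℕ} (hb' : Big k Y B) :
    |∑ D ∈ TB (VV k) Y, vval k D - Aq Y * (2 : ℝ) ^ ((1 : ℤ) - 2 ^ k) *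
      ((∑ U ∈ Finset.univ.filter (fun U : Finset (VV k) => IsMaxUnlinked U), gammaPlus U : ℤ) : ℝ)| ≤
      (2 ^ (4 ^ k) : ℕ) * (er1 k Y B + (4 ^ k + 1) * er2 k Y B + er3 k Y B) := by
  have hY : 1 ≤ Y := by have := hb'.three; omega
  have h1 := er1_nonneg (k := k) (B := B) hY
  have h2 := er2_nonneg k Y B
  have h3 := er3_nonneg k Y B
  have h4 : (0 : ℝ) ≤ 4 ^ k := by positivity
  have e : Aq Y * (2 : ℝ) ^ ((1 : ℤ) - 2 ^ k) *
      ((∑ U ∈ Finset.univ.filter (fun U : Finset (VV k) => IsMaxUnlinked U), gammaPlus U : ℤ) : ℝ) =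
      ∑ M : Finset (VV k), mnt k Y M := by
    unfold mnt
    rw [Int.cast_sum, Finset.mul_sum, Finset.sum_filter]
  rw [e, ← Finset.sum_fiberwise (TB (VV k) Y) (Lg B) (vval k), ← Finset.sum_sub_distrib]
  refine sub_abs_le _ _ (by positivity) ?_ fun M _ => part_est hb' M
  rw [Finset.card_univ, Fintype.card_finset, card_VV]
end

lemma big_of {k Y B : ℕ} (hB : 2 ≤ B) (h : 4 * (B ^ (4 ^ k)) ^ 2 ≤ Y) : Big k Y B := by
  refine ⟨hB, fun t ht1 ht2 => ?_⟩
  set T := B ^ (4 ^ k)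
  have hw4 : 4 ≤ Y / t := by
    rw [Nat.le_div_iff_mul_le (by omega)]
    nlinarith
  refine ⟨by omega, ?_⟩
  set w := Y / t
  have hlt : Y < (w + 1) * T := by
    have := Nat.lt_div_mul_add (a := Y) (b := t) (by omega)
    calc Y < (w + 1) * t := by rw [add_mul, one_mul]; exact this
      _ ≤ (w + 1) * T := Nat.mul_le_mul_left _ ht2
  by_contra hc
  push Not at hc
  have h1 : (w + 1) * T ≤ 2 * w * T := Nat.mul_le_mul_right _ (by omega)
  have h2 : Y * Y < (2 * w * T) * (2 * w * T) := Nat.mul_self_lt_mul_self (hlt.trans_le h1)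
  have h3 : (2 * w * T) * (2 * w * T) = w ^ 2 * (4 * T ^ 2) := by ring
  rw [h3] at h2
  have h4 : w ^ 2 * (4 * T ^ 2) ≤ Y * Y := Nat.mul_le_mul hc.le h
  omega

/-- exponent for the cutoff -/
def Aex (k : ℕ) : ℕ := 32 * (12 + 4 ^ k)

/-- cutoff -/
noncomputable def Bc (k Y : ℕ) : ℕ := ⌊Real.log Y ^ Aex k⌋₊ + 2

lemma log_nat_tendsto : Filter.Tendsto (fun Y : ℕ => Real.log Y) Filter.atTop Filter.atTop :=
  Real.tendsto_log_atTop.comp tendsto_natCast_atTop_atTop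

lemma Bc_le {k Y : ℕ} (hL : 1 ≤ Real.log Y) : (Bc k Y : ℝ) ≤ 3 * Real.log Y ^ Aex k := by
  have h1 : (1 : ℝ) ≤ Real.log Y ^ Aex k := one_le_pow₀ hL
  have h2 := Nat.floor_le (show (0 : ℝ) ≤ Real.log Y ^ Aex k by positivity)
  unfold Bc; push_cast; linarith

lemma Bc_ge (k Y : ℕ) : Real.log Y ^ Aex k ≤ (Bc k Y : ℝ) := by
  have := (Nat.lt_floor_add_one (Real.log Y ^ Aex k)).le
  unfold Bc; push_cast; linarith

lemma ev_big (k : ℕ) : ∀ᶠ Y : ℕ in Filter.atTop, Big k Y (Bc k Y) := by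
  have hlo := (Real.isLittleO_pow_log_id_atTop (n := Aex k * 4 ^ k * 2)).comp_tendsto (tendsto_natCast_atTop_atTop (R := ℝ))
  have hc : (0 : ℝ) < 1 / (4 * (3 ^ 4 ^ k) ^ 2) := by positivity
  filter_upwards [hlo.bound hc, log_nat_tendsto.eventually_ge_atTop 1] with Y h1 hL
  refine big_of (by unfold Bc; omega) ?_
  have hB := Bc_le (k := k) hL
  simp only [Function.comp, id, Real.norm_eq_abs] at h1
  rw [abs_of_nonneg (by positivity), abs_of_nonneg (by positivity)] at h1
  have : (4 * ((Bc k Y : ℝ) ^ (4 ^ k)) ^ 2) ≤ Y := by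
    calc (4 * ((Bc k Y : ℝ) ^ (4 ^ k)) ^ 2) ≤ 4 * ((3 * Real.log Y ^ Aex k) ^ (4 ^ k)) ^ 2 := by gcongr
      _ = (4 * (3 ^ 4 ^ k) ^ 2) * Real.log Y ^ (Aex k * 4 ^ k * 2) := by
        rw [mul_pow, mul_pow, ← pow_mul (Real.log Y), ← pow_mul (Real.log Y)]; ring
      _ ≤ (4 * (3 ^ 4 ^ k) ^ 2) * (1 / (4 * (3 ^ 4 ^ k) ^ 2) * Y) := by gcongr
      _ = Y := by field_simp
  exact_mod_cast this

lemma harmQ_le {k Y : ℕ} (hL : 1 ≤ Real.log Y) :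
    1 + harm (8 * (Bc k Y ^ (4 ^ k) * Bc k Y ^ (4 ^ k))) ≤
      (2 + Real.log 8 + 2 * 4 ^ k * (Real.log 3 + Aex k)) * (1 + Real.log (Real.log Y)) := by
  have hB0 : (0 : ℝ) < Bc k Y := by unfold Bc; positivity
  have hLL : 0 ≤ Real.log (Real.log Y) := Real.log_nonneg hL
  have hL0 : 0 < Real.log Y := by linarith
  have h1 : Real.log (Bc k Y) ≤ Real.log 3 + Aex k * Real.log (Real.log Y) := by
    rw [← Real.log_pow, ← Real.log_mul (by norm_num) (by positivity)]
    exact Real.log_le_log hB0 (Bc_le hL)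
  have h2 := harm_le_log (n := 8 * (Bc k Y ^ (4 ^ k) * Bc k Y ^ (4 ^ k)))
  push_cast at h2
  rw [Real.log_mul (by norm_num) (by positivity), Real.log_mul (by positivity) (by positivity), Real.log_pow] at h2
  push_cast at h2
  have h4 : (0 : ℝ) ≤ 4 ^ k := by positivity
  have h5 := mul_le_mul_of_nonneg_left h1 h4
  have h8 : 0 ≤ Real.log 8 := Real.log_nonneg (by norm_num)
  have h3 : 0 ≤ Real.log 3 := Real.log_nonneg (by norm_num)
  have h6 : (0 : ℝ) ≤ Aex k := by positivity
  have e1 := mul_nonneg h8 hLL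
  have e2 := mul_nonneg (mul_nonneg h4 h3) hLL
  have e3 := mul_nonneg h4 h6
  nlinarith

lemma ev_err (k : ℕ) (ε : ℝ) (hε : 0 < ε) : ∃ C : ℝ, ∀ᶠ Y : ℕ in Filter.atTop, Big k Y (Bc k Y) ∧
    (2 ^ (4 ^ k) : ℕ) * (er1 k Y (Bc k Y) + (4 ^ k + 1) * er2 k Y (Bc k Y) + er3 k Y (Bc k Y)) ≤
      C * (Y * Real.log Y ^ (-(1 / 2) - 1 / (2 * (2 ^ k : ℝ)) + ε : ℝ)) := by
  set C0 : ℝ := 2 + Real.log 8 + 2 * 4 ^ k * (Real.log 3 + Aex k) with hC0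
  have hC00 : 0 ≤ C0 := by
    have h8 : 0 ≤ Real.log 8 := Real.log_nonneg (by norm_num)
    have h3 : 0 ≤ Real.log 3 := Real.log_nonneg (by norm_num)
    positivity
  have hm0 : (0 : ℝ) < ((4 ^ k + 1 : ℕ) : ℝ) := by positivity
  have hδ : 0 < ε / ((4 ^ k + 1 : ℕ) : ℝ) := by positivity
  have hlo := (isLittleO_log_rpow_atTop hδ).comp_tendsto log_nat_tendsto
  set K : ℝ := (C0 * 2) ^ (4 ^ k + 1) with hK
  refine ⟨(2 ^ (4 ^ k) : ℕ) * (2000000 * 2 ^ (10 + 4 ^ k) + (4 ^ k + 1) * (54 * K) + (2 ^ (2 ^ k) : ℕ) * (54 * K)), ?_⟩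
  filter_upwards [ev_big k, hlo.bound one_pos, log_nat_tendsto.eventually_ge_atTop 1] with Y hbig hll hL
  refine ⟨hbig, ?_⟩
  set L := Real.log Y with hLdef
  set B := Bc k Y with hB
  have hL0 : 0 < L := by linarith
  have hLL : 0 ≤ Real.log L := Real.log_nonneg hL
  set e : ℝ := -(1 / 2) - 1 / (2 * (2 ^ k : ℝ)) with he
  have hY0 : (0 : ℝ) ≤ Y := by positivity
  have hB1 : 1 ≤ B := by have := hbig.1; omega
  set Q := 8 * (B ^ (4 ^ k) * B ^ (4 ^ k)) with hQ
  set G := 1 + harm Q with hG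
  have hGle : G ≤ C0 * 2 * L ^ (ε / ((4 ^ k + 1 : ℕ) : ℝ)) := by
    have h1 : G ≤ C0 * (1 + Real.log L) := harmQ_le hL
    simp only [Function.comp, Real.norm_eq_abs, one_mul] at hll
    rw [abs_of_nonneg hLL, abs_of_nonneg (by positivity)] at hll
    have h2 : 1 ≤ L ^ (ε / ((4 ^ k + 1 : ℕ) : ℝ)) := Real.one_le_rpow hL hδ.le
    calc G ≤ C0 * (1 + Real.log L) := h1
      _ ≤ C0 * (2 * L ^ (ε / ((4 ^ k + 1 : ℕ) : ℝ))) := by gcongr; linarith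
      _ = _ := by ring
  have hG0 : 0 ≤ G := by have := harm_nonneg Q; positivity
  have hGm : G ^ (4 ^ k + 1) ≤ K * L ^ ε := by
    calc G ^ (4 ^ k + 1) ≤ (C0 * 2 * L ^ (ε / ((4 ^ k + 1 : ℕ) : ℝ))) ^ (4 ^ k + 1) := by gcongr
      _ = K * L ^ ε := by
        rw [mul_pow, ← Real.rpow_natCast (L ^ _), ← Real.rpow_mul hL0.le, div_mul_cancel₀ _ hm0.ne']
  have hBQ : B ^ (4 ^ k) ≥ B := Nat.le_self_pow (by positivity) B
  have hBp : 1 ≤ B ^ (4 ^ k) := by omega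
  have hBQ' : B ≤ Q := by rw [hQ]; nlinarith
  have h8Q : 8 ≤ Q := by rw [hQ]; nlinarith
  have hhB : harm B ≤ G := by have := harm_mono hBQ'; linarith
  have hh8 : 1 + harm 8 ≤ G := by have := harm_mono h8Q; linarith
  have hsav : sav k Y = L ^ e := rfl
  have hsav0 := sav_nonneg k Y
  have hexp : sav k Y * (K * L ^ ε) = K * L ^ (e + ε) := by
    rw [hsav, Real.rpow_add hL0]; ring
  have hhB0 := harm_nonneg B
  have hh80 := harm_nonneg 8
  have base : ∀ g, 0 ≤ g → g ≤ G → 54 * (sav k Y * g) * Y * harm B ^ (4 ^ k) ≤ 54 * K * (Y * L ^ (e + ε)) := by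
    intro g hg0 hg
    calc 54 * (sav k Y * g) * Y * harm B ^ (4 ^ k) ≤ 54 * (sav k Y * G) * Y * G ^ (4 ^ k) := by gcongr
      _ = 54 * Y * (sav k Y * G ^ (4 ^ k + 1)) := by rw [pow_succ]; ring
      _ ≤ 54 * Y * (sav k Y * (K * L ^ ε)) := by gcongr
      _ = _ := by rw [hexp]; ring
  have b2 : er2 k Y B ≤ 54 * K * (Y * L ^ (e + ε)) := base _ (by positivity) hh8
  have b3 : er3 k Y B ≤ (2 ^ (2 ^ k) : ℕ) * (54 * K * (Y * L ^ (e + ε))) := by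
    have := mul_le_mul_of_nonneg_left (base G hG0 le_rfl) (Nat.cast_nonneg (α := ℝ) (2 ^ 2 ^ k))
    refine le_trans (le_of_eq ?_) this
    unfold er3
    rw [← hQ, ← hG]
    generalize ((2 ^ 2 ^ k : ℕ) : ℝ) = z
    generalize harm B ^ 4 ^ k = w
    ring
  have b1 : er1 k Y B ≤ 2000000 * 2 ^ (10 + 4 ^ k) * (Y * L ^ (e + ε)) := by
    have hY1 : 1 + L ≤ 2 * L := by linarith
    have hhY : harm Y ≤ 2 * L := (harm_le_log (n := Y)).trans hY1
    have hhY0 := harm_nonneg Y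
    have hBr : (B : ℝ) ^ (-(1 / 32) : ℝ) ≤ L ^ (-((12 + 4 ^ k : ℕ) : ℝ)) := by
      have h1 : L ^ Aex k ≤ (B : ℝ) := Bc_ge k Y
      calc (B : ℝ) ^ (-(1 / 32) : ℝ) ≤ (L ^ Aex k) ^ (-(1 / 32) : ℝ) :=
            Real.rpow_le_rpow_of_nonpos (by positivity) h1 (by norm_num)
        _ = L ^ (-((12 + 4 ^ k : ℕ) : ℝ)) := by
            rw [← Real.rpow_natCast, ← Real.rpow_mul hL0.le]
            congr 1
            unfold Aex; push_cast; ring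
    have hex : L ^ (-((12 + 4 ^ k : ℕ) : ℝ)) * L ^ (10 + 4 ^ k) ≤ L ^ (e + ε) := by
      rw [← Real.rpow_natCast L (10 + 4 ^ k), ← Real.rpow_add hL0]
      refine Real.rpow_le_rpow_of_exponent_le hL ?_
      have : 1 / (2 * (2 ^ k : ℝ)) ≤ 1 / 2 := by
        have h1 : (1 : ℝ) ≤ 2 ^ k := one_le_pow₀ (by norm_num)
        apply one_div_le_one_div_of_le <;> linarith
      rw [he]; push_cast; linarith
    unfold er1
    calc 2000000*(B:ℝ)^(-(1/32):ℝ)*(1+Real.log Y)^10*Y*harm Y^(4^k)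
        ≤ 2000000 * L ^ (-((12 + 4 ^ k : ℕ) : ℝ)) * (2 * L) ^ 10 * Y * (2 * L) ^ (4 ^ k) := by gcongr
      _ = 2000000 * 2 ^ (10 + 4 ^ k) * (Y * (L ^ (-((12 + 4 ^ k : ℕ) : ℝ)) * L ^ (10 + 4 ^ k))) := by
        rw [mul_pow, mul_pow, pow_add, pow_add]; ring
      _ ≤ _ := by gcongr
  have h4 : (0 : ℝ) ≤ 4 ^ k + 1 := by positivity
  have b2' := mul_le_mul_of_nonneg_left b2 h4
  calc ((2 ^ (4 ^ k) : ℕ) : ℝ) * (er1 k Y B + (4 ^ k + 1) * er2 k Y B + er3 k Y B)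
      ≤ ((2 ^ (4 ^ k) : ℕ) : ℝ) * (2000000 * 2 ^ (10 + 4 ^ k) * (Y * L ^ (e + ε)) +
        (4 ^ k + 1) * (54 * K * (Y * L ^ (e + ε))) + (2 ^ (2 ^ k) : ℕ) * (54 * K * (Y * L ^ (e + ε)))) :=
        mul_le_mul_of_nonneg_left (by linarith) (Nat.cast_nonneg _)
    _ = _ := by ring

lemma half_tendsto : Filter.Tendsto (fun X : ℝ => ⌊X / 2⌋₊) Filter.atTop Filter.atTop :=
  tendsto_nat_floor_atTop.comp (Filter.tendsto_id.atTop_div_const (by norm_num))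

lemma log_compare (a : ℝ) {X : ℝ} (hX : 16 ≤ X) :
    ((⌊X / 2⌋₊ : ℕ) : ℝ) * Real.log (⌊X / 2⌋₊ : ℕ) ^ a ≤ (1 + (1 / 2 : ℝ) ^ a) * (X * Real.log X ^ a) := by
  set Y := ⌊X / 2⌋₊
  have hY1 : (Y : ℝ) ≤ X / 2 := Nat.floor_le (by linarith)
  have hY2 : X / 2 < Y + 1 := Nat.lt_floor_add_one _
  have hYX : (Y : ℝ) ≤ X := by linarith
  have hY0 : (1 : ℝ) < Y := by linarith
  have hX0 : 0 < X := by linarith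
  have hlX : 0 < Real.log X := Real.log_pos (by linarith)
  have hlY : 0 < Real.log Y := Real.log_pos hY0
  have hle : Real.log Y ≤ Real.log X := Real.log_le_log (by linarith) hYX
  have hge : 1 / 2 * Real.log X ≤ Real.log Y := by
    have : Real.log X ≤ Real.log ((Y : ℝ) ^ 2) := Real.log_le_log hX0 (by nlinarith)
    rw [Real.log_pow] at this; push_cast at this; linarith
  have hpos : 0 ≤ Real.log X ^ a := by positivity
  have hpos2 : 0 ≤ (1 / 2 : ℝ) ^ a := by positivity
  have key : Real.log Y ^ a ≤ (1 + (1 / 2 : ℝ) ^ a) * Real.log X ^ a := by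
    rcases le_total 0 a with ha | ha
    · have := Real.rpow_le_rpow hlY.le hle ha
      nlinarith
    · have := Real.rpow_le_rpow_of_nonpos (by positivity) hge ha
      rw [Real.mul_rpow (by norm_num) hlX.le] at this
      nlinarith
  calc (Y : ℝ) * Real.log Y ^ a ≤ X * ((1 + (1 / 2 : ℝ) ^ a) * Real.log X ^ a) := by gcongr
    _ = _ := by ring

theorem stmt15 (k : ℕ) (hk : 1 ≤ k) (ε : ℝ) (hε : 0 < ε) :
    (fun X : ℝ => Scount k X -
        Acount34 X * (2 : ℝ) ^ ((1 : ℤ) - 2 ^ k) *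
          ((∑ U ∈ Finset.univ.filter
              (fun U : Finset (Fin (2 * k) → ZMod 2) => IsMaxUnlinked U),
            gammaPlus U : ℤ) : ℝ))
      =O[Filter.atTop] fun X : ℝ =>
        X * Real.log X ^ (-(1 : ℝ) / 2 - 1 / 2 ^ (k + 1) + ε) := by
  obtain ⟨C, hC⟩ := ev_err k ε hε
  have ha : (-(1 : ℝ) / 2 - 1 / 2 ^ (k + 1) + ε) = -(1 / 2) - 1 / (2 * (2 ^ k : ℝ)) + ε := by
    rw [pow_succ']; ring
  rw [ha]
  set a : ℝ := -(1 / 2) - 1 / (2 * (2 ^ k : ℝ)) + ε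
  refine Asymptotics.IsBigO.of_bound (|C| * (1 + (1 / 2 : ℝ) ^ a)) ?_
  filter_upwards [half_tendsto.eventually hC, Filter.eventually_ge_atTop (16 : ℝ)] with X hX h16
  obtain ⟨hbig, herr⟩ := hX
  have ht := total_est hbig
  rw [Scount_eq, Acount_eq]
  have hlX : 0 < Real.log X := Real.log_pos (by linarith)
  have hX0 : 0 < X := by linarith
  rw [Real.norm_eq_abs, Real.norm_eq_abs, abs_of_nonneg (show 0 ≤ X * Real.log X ^ a by positivity)]
  refine (show _ ≤ _ from ht).trans (herr.trans ?_)
  have h0 : 0 ≤ ((⌊X / 2⌋₊ : ℕ) : ℝ) * Real.log (⌊X / 2⌋₊ : ℕ) ^ a := by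
    have := hbig.logpos
    positivity
  calc C * (((⌊X / 2⌋₊ : ℕ) : ℝ) * Real.log (⌊X / 2⌋₊ : ℕ) ^ a)
      ≤ |C| * (((⌊X / 2⌋₊ : ℕ) : ℝ) * Real.log (⌊X / 2⌋₊ : ℕ) ^ a) := by gcongr; exact le_abs_self C
    _ ≤ |C| * ((1 + (1 / 2 : ℝ) ^ a) * (X * Real.log X ^ a)) :=
      mul_le_mul_of_nonneg_left (log_compare a h16) (abs_nonneg C)
    _ = _ := by ring
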